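/- Let ξ = (ξ₁,ξ₂,ξ₃,ξ₄) ∈ ℝ⁴ satisfy ξ₂ξ₃ξ₄ + ξ₁ξ₃ξ₄ + ξ₁ξ₂ξ₄ + ξ₁ξ₂ξ₃ = 0, ξ₁ξ₂ξ₃ξ₄ ≠ 0, and ξᵢ + ξⱼ ≠ 0 for all i ≠ j. Then there exist constants C > 0, c > 0 and B₀ (depending only on ξ) such that for all B ≥ B₀, the number of quadruples x = (x₁,x₂,x₃,x₄) ∈ ℤ⁴ with gcd(x₁,x₂,x₃,x₄) = 1, x₂x₃x₄ + x₁x₃x₄ + x₁x₂x₄ + x₁x₂x₃ = 0, x₁x₂x₃x₄ ≠ 0, xᵢ + xⱼ ≠ 0 for all i ≠ j, |xᵢ/B − ξᵢ| ≤ C/log B for i = 1,…,4, and such that |x₁x₂x₃x₄| has at most 12 prime factors counted with multiplicity, is at least c·B(log B)^{−7}. -/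

import Mathlib

namespace Cay
open Finset

/-- additive character -/
noncomputable def ee (x : ℝ) : ℂ := Complex.exp (2 * Real.pi * x * Complex.I)

lemma ee_add (x y : ℝ) : ee (x + y) = ee x * ee y := by
  unfold ee; rw [← Complex.exp_add]; congr 1; push_cast; ring

lemma ee_zero : ee 0 = 1 := by simp [ee]

lemma norm_ee (x : ℝ) : ‖ee x‖ = 1 := by
  unfold ee
  have : (2 * Real.pi * x * Complex.I : ℂ) = ((2 * Real.pi * x : ℝ) : ℂ) * Complex.I := by
    push_cast; ring
  rw [this, Complex.norm_exp_ofReal_mul_I]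

lemma ee_int (n : ℤ) : ee n = 1 := by
  unfold ee
  rw [Complex.exp_eq_one_iff]
  exact ⟨n, by push_cast; ring⟩

lemma ee_nat (n : ℕ) : ee n = 1 := by
  have := ee_int n
  simpa using this

lemma ee_add_int (x : ℝ) (n : ℤ) : ee (x + n) = ee x := by
  rw [ee_add, ee_int, mul_one]

lemma ee_neg (x : ℝ) : ee (-x) = (starRingEnd ℂ) (ee x) := by
  unfold ee
  rw [← Complex.exp_conj]; congr 1
  simp only [map_mul, Complex.conj_ofReal, Complex.conj_I, map_ofNat]
  push_cast; ring

lemma ee_mul_nat (x : ℝ) (n : ℕ) : ee (n * x) = ee x ^ n := by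
  unfold ee
  rw [← Complex.exp_nat_mul]; congr 1; push_cast; ring

/-- distance to nearest integer -/
noncomputable def nn (x : ℝ) : ℝ := |x - round x|

lemma nn_nonneg (x : ℝ) : 0 ≤ nn x := abs_nonneg _

lemma nn_le (x : ℝ) (n : ℤ) : nn x ≤ |x - n| := round_le x n

lemma nn_neg (x : ℝ) : nn (-x) = nn x := by
  apply le_antisymm
  · have := nn_le (-x) (-(round x))
    rw [nn, nn] at *
    refine this.trans (le_of_eq ?_)
    rw [← abs_neg]; push_cast; congr 1; ring
  · have := nn_le x (-(round (-x)))
    rw [nn, nn] at *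
    refine this.trans (le_of_eq ?_)
    rw [← abs_neg]; push_cast; congr 1; ring

lemma norm_ee_sub_one (x : ℝ) : 4 * nn x ≤ ‖ee x - 1‖ := by
  have h1 : ee x = ee (x - round x) := by
    have := ee_add_int (x - round x) (round x)
    rw [← this]; congr 1; ring
  rw [h1]
  set y := x - round x with hy
  have hyb : |y| ≤ 1/2 := abs_sub_round x
  have : ee y = Complex.exp (Complex.I * ((2 * Real.pi * y : ℝ) : ℂ)) := by
    unfold ee; congr 1; push_cast; ring
  rw [this, Complex.norm_exp_I_mul_ofReal_sub_one, nn, ← hy]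
  have h2 : 2 * Real.pi * y / 2 = Real.pi * y := by ring
  rw [h2, norm_mul]
  have h3 : |Real.pi * y| ≤ Real.pi / 2 := by
    rw [abs_mul, abs_of_pos Real.pi_pos]; nlinarith [Real.pi_pos]
  have h4 := Real.mul_abs_le_abs_sin h3
  rw [abs_mul, abs_of_pos Real.pi_pos] at h4
  have h5 : 2 / Real.pi * (Real.pi * |y|) = 2 * |y| := by
    field_simp
  rw [h5] at h4
  simp only [Real.norm_eq_abs]
  norm_num
  linarith

/-- smooth substitute for min(Y, 1/‖x‖) -/
noncomputable def mn (Y x : ℝ) : ℝ := Y / (1 + Y * nn x)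

lemma mn_nonneg {Y : ℝ} (hY : 0 ≤ Y) (x : ℝ) : 0 ≤ mn Y x := by
  have := nn_nonneg x
  unfold mn; positivity

lemma mn_le {Y : ℝ} (hY : 0 ≤ Y) (x : ℝ) : mn Y x ≤ Y := by
  have := nn_nonneg x
  unfold mn
  apply div_le_self hY
  nlinarith [mul_nonneg hY this]

lemma mn_mono {Y Z : ℝ} (hY : 0 ≤ Y) (h : Y ≤ Z) (x : ℝ) : mn Y x ≤ mn Z x := by
  have := nn_nonneg x
  unfold mn
  rw [div_le_div_iff₀ (by nlinarith [mul_nonneg hY this]) (by nlinarith [mul_nonneg (hY.trans h) this])]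
  nlinarith

lemma mn_neg (Y x : ℝ) : mn Y (-x) = mn Y x := by simp [mn, nn_neg]

lemma le_mn {S Y x : ℝ} (hY : 0 ≤ Y) (h1 : S ≤ Y) (h2 : S * nn x ≤ 1/2) : S ≤ 3/2 * mn Y x := by
  have := nn_nonneg x
  unfold mn
  rw [← mul_div_assoc, le_div_iff₀ (by nlinarith [mul_nonneg hY this])]
  nlinarith

lemma geom_bound (a b : ℕ) (x : ℝ) :
    ‖∑ n ∈ Ioc a b, ee (n * x)‖ ≤ 3/2 * mn ((b - a : ℕ) : ℝ) x := by
  apply le_mn (by positivity)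
  · refine (norm_sum_le _ _).trans ?_
    simp [norm_ee]
  · have key : (∑ n ∈ Ioc a b, ee (n * x)) * (ee x - 1) = 
        if a ≤ b then ee ((b+1:ℕ) * x) - ee ((a+1 : ℕ) * x) else 0 := by
      split_ifs with h
      · induction b, h using Nat.le_induction with
        | base => simp
        | succ n hn ih =>
          rw [Finset.sum_Ioc_succ_top (by omega), add_mul, ih]
          simp only [ee_mul_nat]; ring
      · rw [Ioc_eq_empty (by omega)]; simp
    have h2 : ‖(∑ n ∈ Ioc a b, ee (n * x)) * (ee x - 1)‖ ≤ 2 := by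
      rw [key]; split_ifs
      · refine (norm_sub_le _ _).trans ?_
        rw [norm_ee, norm_ee]; norm_num
      · simp
    rw [norm_mul] at h2
    nlinarith [norm_ee_sub_one x, norm_nonneg (∑ n ∈ Ioc a b, ee (n * x))]

/-- separation of multiples of α -/
lemma sep {α : ℝ} {a : ℤ} {q : ℕ} (hq : 0 < q) (hc : IsCoprime a (q:ℤ)) (h : |α - a / q| ≤ 1 / (q:ℝ)^2)
    {d : ℤ} (hd : d ≠ 0) (hd2 : 2 * |d| ≤ q) : 1 / (2 * (q:ℝ)) ≤ nn (d * α) := by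
  have hq' : (0:ℝ) < q := by exact_mod_cast hq
  unfold nn
  set r := round (d * α)
  have hne : d * a - r * q ≠ 0 := by
    intro h0
    have h1 : (q:ℤ) ∣ d * a := ⟨r, by linarith⟩
    have h2 : (q:ℤ) ∣ d := hc.symm.dvd_of_dvd_mul_right h1
    have h3 := Int.le_of_dvd (abs_pos.mpr hd) ((dvd_abs _ _).mpr h2)
    have := abs_pos.mpr hd
    omega
  have h1 : (1:ℝ) ≤ |(d * a - r * q : ℝ)| := by
    have : (1:ℤ) ≤ |d * a - r * q| := Int.one_le_abs hne
    exact_mod_cast this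
  have h2 : |(d * a - r * q : ℝ)| = q * |(d * (a / q) - r : ℝ)| := by
    rw [← abs_of_pos hq', ← abs_mul, abs_of_pos hq']; congr 1; field_simp
  have h3 : |(d * (a/q) - r : ℝ)| ≤ |d * α - r| + |(d:ℝ)| * |α - a/q| := by
    rw [← abs_mul, ← abs_neg ((d:ℝ) * (α - a/q))]
    refine le_trans (le_of_eq ?_) (abs_add_le _ _)
    congr 1; ring
  have h4 : |(d:ℝ)| ≤ q / 2 := by
    have : ((2 * |d| : ℤ):ℝ) ≤ (q:ℤ) := by exact_mod_cast hd2
    push_cast at this; linarith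
  have h5 : |(d:ℝ)| * |α - a/q| ≤ q/2 * (1/(q:ℝ)^2) := by gcongr
  have h6 : q/2 * (1/(q:ℝ)^2) = 1/(2*q) := by field_simp
  have h7 : 1/(q:ℝ) ≤ |(d * (a/q) - r : ℝ)| := by
    rw [div_le_iff₀ hq', mul_comm, ← h2]; exact h1
  have h8 : 1/(q:ℝ) = 1/(2*q) + 1/(2*q) := by field_simp; norm_num
  linarith

end Cay

namespace Cay
open Finset

lemma sum_G {q : ℕ} (hq : 0 < q) {Y : ℝ} (hY : 0 ≤ Y) :
    ∑ k ∈ range (q+1), Y / (1 + Y * (k / (2 * q))) ≤ Y + 2 * q * (1 + Real.log q) := by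
  have hq' : (0:ℝ) < q := by exact_mod_cast hq
  rw [sum_range_succ']
  have h0 : Y / (1 + Y * (((0:ℕ):ℝ) / (2 * q))) = Y := by simp
  rw [h0]
  have h1 : ∑ k ∈ range q, Y / (1 + Y * (((k+1:ℕ):ℝ) / (2 * q))) ≤ ∑ k ∈ range q, 2 * q * ((k+1:ℕ):ℝ)⁻¹ := by
    apply sum_le_sum
    intro k _
    have hk : (0:ℝ) < ((k+1:ℕ):ℝ) := by positivity
    rw [← div_eq_mul_inv, div_le_div_iff₀ (by positivity) hk]
    have : 2 * q * (1 + Y * (((k+1:ℕ):ℝ) / (2 * q))) = 2 * q + Y * ((k+1:ℕ):ℝ) := by field_simp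
    rw [this]; linarith
  have h2 := harmonic_le_one_add_log q
  rw [harmonic] at h2
  rw [← mul_sum] at h1
  push_cast at h1 h2 ⊢
  nlinarith

lemma block_half {α : ℝ} {q : ℕ} (hq : 0 < q) (D : Finset ℕ)
    (hsep : ∀ d ∈ D, ∀ d' ∈ D, d ≠ d' → 1 / (2 * (q:ℝ)) ≤ nn (((d:ℤ) - d' : ℤ) * α))
    (s : ℝ) (hs : s = 1 ∨ s = -1)
    (hsign : ∀ d ∈ D, |d * α - round (d * α)| = s * (d * α - round (d * α))) {Y : ℝ} (hY : 0 ≤ Y) :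
    ∑ d ∈ D, mn Y (d * α) ≤ Y + 2 * q * (1 + Real.log q) := by
  have hq' : (0:ℝ) < q := by exact_mod_cast hq
  refine le_trans ?_ (sum_G hq hY)
  let k : ℕ → ℕ := fun d => ⌊2 * q * nn (d * α)⌋₊
  have hk : ∀ d : ℕ, (k d : ℝ) ≤ 2 * q * nn (d * α) := fun d => Nat.floor_le (mul_nonneg (by positivity) (nn_nonneg _))
  have hk2 : ∀ d : ℕ, 2 * q * nn (d * α) < k d + 1 := fun d => Nat.lt_floor_add_one _
  have hinj : Set.InjOn k D := by
    intro d hd d' hd' hkk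
    by_contra hne
    have h1 := hsep d hd d' hd' hne
    have h2 := nn_le (((d:ℤ) - d' : ℤ) * α) (round (d * α) - round (d' * α))
    have h3 : |((((d:ℤ) - d' : ℤ):ℝ) * α) - ((round (d * α) - round (d' * α) : ℤ):ℝ)| = |nn (d * α) - nn (d' * α)| := by
      unfold nn
      rw [hsign d hd, hsign d' hd', ← mul_sub, abs_mul]
      have : |s| = 1 := by rcases hs with h | h <;> simp [h]
      rw [this, one_mul]; congr 1; push_cast; ring
    rw [h3] at h2
    have h4 : |nn (d * α) - nn (d' * α)| < 1 / (2 * q) := by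
      have a1 := hk d; have a2 := hk2 d; have a3 := hk d'; have a4 := hk2 d'
      rw [hkk] at a1 a2
      rw [abs_lt]
      have e1 : 2 * q * (1 / (2 * (q:ℝ))) = 1 := by field_simp
      constructor <;> nlinarith
    linarith
  calc ∑ d ∈ D, mn Y (d * α) ≤ ∑ d ∈ D, Y / (1 + Y * ((k d : ℝ) / (2 * q))) := by
        apply sum_le_sum
        intro d _
        unfold mn
        have : (k d : ℝ) / (2 * q) ≤ nn (d * α) := by
          rw [div_le_iff₀ (by positivity)]; linarith [hk d]
        gcongr
    _ = ∑ j ∈ D.image k, Y / (1 + Y * ((j : ℝ) / (2 * q))) := by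
        rw [sum_image hinj]
    _ ≤ _ := by
        apply sum_le_sum_of_subset_of_nonneg
        · intro j hj
          rw [mem_image] at hj
          obtain ⟨d, _, rfl⟩ := hj
          rw [mem_range]
          have h1 : nn (d * α) ≤ 1/2 := abs_sub_round _
          have h2 := hk d
          have : (k d : ℝ) ≤ q := by nlinarith
          have : k d ≤ q := by exact_mod_cast this
          omega
        · intros; positivity

lemma block {α : ℝ} {a : ℤ} {q : ℕ} (hq : 0 < q) (hc : IsCoprime a (q:ℤ)) (h : |α - a / q| ≤ 1 / (q:ℝ)^2)
    (D : Finset ℕ) (hD : ∀ d ∈ D, ∀ d' ∈ D, 2 * |(d:ℤ) - d'| ≤ q) {Y : ℝ} (hY : 0 ≤ Y) :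
    ∑ d ∈ D, mn Y (d * α) ≤ 2 * Y + 4 * q * (1 + Real.log q) := by
  have hsep : ∀ d ∈ D, ∀ d' ∈ D, d ≠ d' → 1 / (2 * (q:ℝ)) ≤ nn (((d:ℤ) - d' : ℤ) * α) := by
    intro d hd d' hd' hne
    exact sep hq hc h (by intro h0; apply hne; omega) (hD d hd d' hd')
  rw [← sum_filter_add_sum_filter_not D (fun d => 0 ≤ d * α - round (d * α))]
  have h1 := block_half hq (D.filter (fun d => 0 ≤ d * α - round (d * α)))
    (fun d hd d' hd' => hsep d (mem_filter.1 hd).1 d' (mem_filter.1 hd').1) 1 (Or.inl rfl)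
    (by intro d hd; rw [abs_of_nonneg (mem_filter.1 hd).2, one_mul]) hY
  have h2 := block_half hq (D.filter (fun d => ¬ 0 ≤ d * α - round (d * α)))
    (fun d hd d' hd' => hsep d (mem_filter.1 hd).1 d' (mem_filter.1 hd').1) (-1) (Or.inr rfl)
    (by intro d hd; rw [abs_of_neg (not_le.1 (mem_filter.1 hd).2), neg_one_mul]) hY
  linarith

/-- split an initial range into blocks of length L -/
lemma sum_blocks (f : ℕ → ℝ) (L D : ℕ) (hL : 0 < L) (g : ℕ → ℝ) (hf : ∀ n, 0 ≤ f n)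
    (hg : ∀ j ≤ D / L, ∑ n ∈ Ico (j * L) ((j+1) * L) with n ≤ D, f n ≤ g j) :
    ∑ n ∈ range (D+1), f n ≤ ∑ j ∈ range (D / L + 1), g j := by
  rw [← sum_fiberwise_of_maps_to (s := range (D+1)) (t := range (D / L + 1)) (g := fun n => n / L)]
  · apply sum_le_sum
    intro j hj
    refine le_trans ?_ (hg j (by rw [mem_range] at hj; omega))
    apply sum_le_sum_of_subset_of_nonneg
    · intro n hn
      simp only [mem_filter, mem_range, mem_Ico] at hn ⊢
      obtain ⟨h1, h2⟩ := hn
      have h3 := Nat.div_add_mod n L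
      have h4 := Nat.mod_lt n hL
      rw [h2] at h3
      rw [mul_comm] at h3
      have e : (j+1) * L = j * L + L := by ring
      refine ⟨⟨by omega, by omega⟩, by omega⟩
    · intros; exact hf _
  · intro n hn
    simp only [mem_range] at hn ⊢
    have := Nat.div_le_div_right (c := L) (show n ≤ D by omega)
    omega

lemma block_sum {α : ℝ} {a : ℤ} {q : ℕ} (hq : 0 < q) (hc : IsCoprime a (q:ℤ)) (h : |α - a / q| ≤ 1 / (q:ℝ)^2)
    (D : ℕ) {Y : ℝ} (hY : 0 ≤ Y) :
    ∑ d ∈ range (D+1), mn Y (d * α) ≤ (2 * D / q + 1) * (2 * Y + 4 * q * (1 + Real.log q)) := by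
  have hq' : (0:ℝ) < q := by exact_mod_cast hq
  have hlog : 0 ≤ Real.log q := Real.log_natCast_nonneg q
  have := sum_blocks (fun d => mn Y (d * α)) (q / 2 + 1) D (by omega)
    (fun _ => 2 * Y + 4 * q * (1 + Real.log q)) (fun n => mn_nonneg hY _) (by
      intro j _
      apply block hq hc h _ _ hY
      intro d hd d' hd'
      simp only [mem_filter, mem_Ico] at hd hd'
      have e : (j+1) * (q/2+1) = j * (q/2+1) + (q/2+1) := by ring
      rw [e] at hd hd'
      have : |(d:ℤ) - d'| ≤ q/2 := by rw [abs_le]; constructor <;> omega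
      omega)
  refine this.trans ?_
  rw [sum_const, card_range, nsmul_eq_mul]
  apply mul_le_mul_of_nonneg_right _ (by positivity)
  push_cast
  have h1 : ((D / (q/2+1) : ℕ):ℝ) ≤ (D:ℝ) / ((q/2+1 : ℕ):ℝ) := Nat.cast_div_le
  have h2 : (q:ℝ)/2 ≤ ((q/2+1 : ℕ):ℝ) := by
    have : q ≤ 2 * (q/2+1) := by omega
    have : (q:ℝ) ≤ 2 * ((q/2+1 : ℕ):ℝ) := by exact_mod_cast this
    linarith
  have h3 : (D:ℝ) / ((q/2+1 : ℕ):ℝ) ≤ D / (q/2) := by gcongr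
  have h4 : (D:ℝ)/(q/2) = 2 * D / q := by field_simp
  linarith

lemma type_one {α : ℝ} {a : ℤ} {q : ℕ} (hq : 0 < q) (hc : IsCoprime a (q:ℤ)) (h : |α - a / q| ≤ 1 / (q:ℝ)^2)
    (D : ℕ) {N : ℝ} (hN : 0 ≤ N) :
    ∑ d ∈ Ioc 0 D, mn (N / d) (d * α) ≤
      (4 * N / q + 8 * D + 16 * q) * ((1 + Real.log q) + (1 + Real.log D)) := by
  have hq' : (0:ℝ) < q := by exact_mod_cast hq
  have hlog : 0 ≤ Real.log q := Real.log_natCast_nonneg q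
  have hlogD : 0 ≤ Real.log D := Real.log_natCast_nonneg D
  set L := q / 2 + 1 with hL
  have h2 : (q:ℝ)/2 ≤ (L:ℝ) := by
    have : q ≤ 2 * L := by omega
    have : (q:ℝ) ≤ 2 * (L:ℝ) := by exact_mod_cast this
    linarith
  have hLpos : (0:ℝ) < L := by linarith
  let f : ℕ → ℝ := fun d => if d = 0 then 0 else mn (N / d) (d * α)
  have hfsum : ∑ d ∈ Ioc 0 D, mn (N / d) (d * α) ≤ ∑ d ∈ range (D+1), f d := by
    have : Ioc 0 D ⊆ range (D+1) := by
      intro d hd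
      rw [mem_Ioc] at hd; rw [mem_range]; omega
    rw [← sum_subset this]
    · apply le_of_eq
      apply sum_congr rfl
      intro d hd
      rw [mem_Ioc] at hd
      simp only [f]; rw [if_neg (by omega)]
    · intro d h1 h2
      rw [mem_Ioc] at h2; rw [mem_range] at h1
      simp only [f]; rw [if_pos (by omega)]
  let g : ℕ → ℝ := fun j => if j = 0 then 2 * (2 * (2 * q) + 4 * q * (1 + Real.log q)) else
    2 * (N / (j * L)) + 4 * q * (1 + Real.log q)
  have hblk : ∀ j, ∀ d ∈ (Ico (j * L) ((j+1) * L)).filter (fun n => n ≤ D),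
      ∀ d' ∈ (Ico (j * L) ((j+1) * L)).filter (fun n => n ≤ D), 2 * |(d:ℤ) - d'| ≤ q := by
    intro j d hd d' hd'
    simp only [mem_filter, mem_Ico] at hd hd'
    have e : (j+1) * L = j * L + L := by ring
    rw [e] at hd hd'
    have : |(d:ℤ) - d'| ≤ q/2 := by rw [abs_le]; constructor <;> omega
    omega
  have := sum_blocks f L D (by omega) g (by
      intro n; simp only [f]; split_ifs
      · exact le_rfl
      · exact mn_nonneg (by positivity) _) (by
      intro j _
      simp only [g]
      split_ifs with hj
      · subst hj
        refine le_trans ?_ (mul_le_mul_of_nonneg_left (block hq hc h _ (hblk 0) (Y := 2 * q) (by positivity)) (by norm_num))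
        rw [mul_sum]
        apply sum_le_sum
        intro d hd
        have hd' := hd
        simp only [mem_filter, mem_Ico] at hd
        simp only [f]; split_ifs with hd0
        · have := mn_nonneg (Y := 2 * (q:ℝ)) (by positivity) (d * α); linarith
        · have hs := sep hq hc h (d := d) (by omega) (by rw [abs_of_nonneg (by omega)]; omega)
          push_cast at hs
          have hnn : 0 < nn (d * α) := lt_of_lt_of_le (by positivity) hs
          unfold mn
          rw [← mul_div_assoc, div_le_div_iff₀ (by positivity) (by positivity)]
          have h5 : 1 ≤ 2 * q * nn (d * α) := by
            rw [div_le_iff₀ (by positivity)] at hs; linarith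
          have h6 : 0 ≤ N / d := by positivity
          nlinarith [mul_nonneg h6 hq'.le]
      · refine le_trans ?_ (block hq hc h _ (hblk j) (Y := N / (j * L)) (by positivity))
        apply sum_le_sum
        intro d hd
        simp only [mem_filter, mem_Ico] at hd
        have hjL : 0 < j * L := Nat.mul_pos (by omega) (by omega)
        simp only [f]; rw [if_neg (by omega)]
        apply mn_mono (by positivity)
        apply div_le_div_of_nonneg_left hN (by exact_mod_cast hjL)
        exact_mod_cast hd.1.1)
  refine hfsum.trans (this.trans ?_)
  rw [sum_range_succ']
  simp only [g, Nat.add_eq_zero_iff, one_ne_zero, and_false, if_false, if_true]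
  rw [sum_add_distrib, sum_const, card_range, nsmul_eq_mul]
  have e1 : ∑ j ∈ range (D / L), 2 * (N / (((j+1:ℕ):ℝ) * L)) ≤ (4 * N / q) * (1 + Real.log D) := by
    have h7 : ∀ j ∈ range (D / L), 2 * (N / (((j+1:ℕ):ℝ) * L)) ≤ (4 * N / q) * ((j+1:ℕ):ℝ)⁻¹ := by
      intro j _
      have : (4 * N / q) * ((j+1:ℕ):ℝ)⁻¹ = 2 * (N / (((j+1:ℕ):ℝ) * (q/2))) := by field_simp; ring
      rw [this]; gcongr
    refine (sum_le_sum h7).trans ?_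
    rw [← mul_sum]
    apply mul_le_mul_of_nonneg_left _ (by positivity)
    have h8 := harmonic_le_one_add_log (D / L)
    rw [harmonic] at h8
    push_cast at h8 ⊢
    refine h8.trans ?_
    rcases Nat.eq_zero_or_pos (D / L) with h0 | h0
    · rw [h0]; simp [hlogD]
    · have : Real.log ((D / L : ℕ):ℝ) ≤ Real.log D := by
        apply Real.log_le_log (by exact_mod_cast h0)
        exact_mod_cast Nat.div_le_self _ _
      linarith
  have e2 : ((D / L : ℕ):ℝ) * (4 * q * (1 + Real.log q)) ≤ 8 * D * (1 + Real.log q) := by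
    have h1 : ((D / L : ℕ):ℝ) ≤ (D:ℝ) / (L:ℝ) := Nat.cast_div_le
    have h3 : (D:ℝ) / (L:ℝ) ≤ D / (q/2) := by gcongr
    have h4 : (D:ℝ)/(q/2) * (4 * q) = 8 * D := by field_simp; ring
    calc _ = ((D / L : ℕ):ℝ) * (4 * q) * (1 + Real.log q) := by ring
      _ ≤ (D:ℝ)/(q/2) * (4 * q) * (1 + Real.log q) := by gcongr; linarith
      _ = _ := by rw [h4]
  have p1 : 0 ≤ 4 * N / q := by positivity
  have p2 : (0:ℝ) ≤ D := by positivity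
  nlinarith [mul_nonneg p1 hlog, mul_nonneg p2 hlogD, mul_nonneg hq'.le hlog, mul_nonneg hq'.le hlogD]

end Cay

namespace Cay
open Finset ArithmeticFunction
open scoped ArithmeticFunction.Moebius ArithmeticFunction.zeta

lemma abel_id (g z : ℕ → ℂ) (a : ℕ) {b : ℕ} (hab : a ≤ b) :
    ∑ n ∈ Ioc a b, g n * z n = g (b+1) * (∑ n ∈ Ioc a b, z n) -
      ∑ n ∈ Ioc a b, (g (n+1) - g n) * ∑ m ∈ Ioc a n, z m := by
  induction b, hab using Nat.le_induction with
  | base => simp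
  | succ n hn ih =>
    rw [sum_Ioc_succ_top (by omega), sum_Ioc_succ_top (by omega) (fun n => (g (n+1) - g n) * ∑ m ∈ Ioc a n, z m), ih,
      sum_Ioc_succ_top (by omega)]
    ring

lemma abel_bound (g z : ℕ → ℂ) (a b : ℕ) (K : ℝ) (hK : 0 ≤ K)
    (hz : ∀ n, a < n → n ≤ b → ‖∑ m ∈ Ioc a n, z m‖ ≤ K) :
    ‖∑ n ∈ Ioc a b, g n * z n‖ ≤ K * (‖g (b+1)‖ + ∑ n ∈ Ioc a b, ‖g (n+1) - g n‖) := by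
  rcases Nat.lt_or_ge a b with hab | hab
  · rw [abel_id g z a hab.le]
    refine (norm_sub_le _ _).trans ?_
    rw [mul_add, mul_sum (Ioc a b) (fun n => ‖g (n+1) - g n‖) K]
    apply add_le_add
    · rw [norm_mul, mul_comm]
      exact mul_le_mul_of_nonneg_right (hz b hab le_rfl) (norm_nonneg _)
    · refine (norm_sum_le _ _).trans ?_
      apply sum_le_sum
      intro n hn
      rw [mem_Ioc] at hn
      rw [norm_mul, mul_comm]
      exact mul_le_mul_of_nonneg_right (hz n hn.1 hn.2) (norm_nonneg _)
  · rw [Ioc_eq_empty (by omega)]; simp; positivity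

lemma sum_tele (g : ℕ → ℝ) (a : ℕ) {b : ℕ} (hab : a ≤ b) :
    ∑ n ∈ Ioc a b, (g (n+1) - g n) = g (b+1) - g (a+1) := by
  induction b, hab using Nat.le_induction with
  | base => simp
  | succ n hn ih => rw [sum_Ioc_succ_top (by omega), ih]; ring

lemma abel_mono (g : ℕ → ℝ) (z : ℕ → ℂ) (a b : ℕ) (K : ℝ) (hK : 0 ≤ K)
    (hg0 : 0 ≤ g (a+1)) (hg : ∀ n, a < n → n ≤ b → g n ≤ g (n+1))
    (hz : ∀ n, a < n → n ≤ b → ‖∑ m ∈ Ioc a n, z m‖ ≤ K) :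
    ‖∑ n ∈ Ioc a b, (g n : ℂ) * z n‖ ≤ 2 * K * |g (b+1)| := by
  rcases Nat.lt_or_ge a b with hab | hab
  · refine (abel_bound (fun n => (g n : ℂ)) z a b K hK hz).trans ?_
    have h1 : ∑ n ∈ Ioc a b, ‖((g (n+1) : ℝ):ℂ) - (g n : ℂ)‖ = g (b+1) - g (a+1) := by
      rw [← sum_tele g a hab.le]
      apply sum_congr rfl
      intro n hn
      rw [mem_Ioc] at hn
      rw [← Complex.ofReal_sub, Complex.norm_real, Real.norm_eq_abs, abs_of_nonneg]
      linarith [hg n hn.1 hn.2]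
    rw [h1, Complex.norm_real, Real.norm_eq_abs]
    have := le_abs_self (g (b+1))
    nlinarith
  · rw [Ioc_eq_empty (by omega)]; simp; positivity

/-- weighted convolution sums -/
lemma conv_sum (f g : ArithmeticFunction ℝ) (w : ℕ → ℂ) (N : ℕ) :
    ∑ n ∈ Ioc 0 N, (((f * g) n : ℝ) : ℂ) * w n =
      ∑ d ∈ Ioc 0 N, ∑ m ∈ Ioc 0 (N / d), (f d : ℂ) * g m * w (d * m) := by
  have h1 : ∑ n ∈ Ioc 0 N, (((f * g) n : ℝ) : ℂ) * w n =
      ∑ x ∈ Ioc 0 N ×ˢ Ioc 0 N with x.1 * x.2 ≤ N, (f x.1 : ℂ) * g x.2 * w (x.1 * x.2) := by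
    simp only [mul_apply]
    trans ∑ n ∈ Ioc 0 N, ∑ x ∈ Ioc 0 N ×ˢ Ioc 0 N with x.1 * x.2 = n, (f x.1 : ℂ) * g x.2 * w (x.1 * x.2)
    · refine sum_congr rfl fun n hn ↦ ?_
      simp only [mem_Ioc] at hn
      rw [Nat.divisorsAntidiagonal_eq_prod_filter_of_le hn.1.ne' hn.2]
      push_cast
      rw [sum_mul]
      apply sum_congr rfl
      intro x hx
      rw [(mem_filter.1 hx).2]
    · simp_rw [sum_filter]
      rw [sum_comm]
      exact sum_congr rfl fun _ _ ↦ (by simp_all)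
  rw [h1, sum_filter, sum_product]
  refine sum_congr rfl fun n hn ↦ ?_
  rw [← sum_filter]
  apply sum_congr _ (fun _ _ => rfl)
  ext m
  simp only [mem_filter, mem_Ioc] at hn ⊢
  rw [Nat.le_div_iff_mul_le hn.1, mul_comm m n]
  constructor
  · rintro ⟨h1, h2⟩; exact ⟨h1.1, h2⟩
  · rintro ⟨h1, h2⟩; exact ⟨⟨h1, le_trans (Nat.le_mul_of_pos_left m hn.1) h2⟩, h2⟩

/-- truncation -/
noncomputable def tr (f : ArithmeticFunction ℝ) (U : ℕ) : ArithmeticFunction ℝ :=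
  ⟨fun n => if n ≤ U then f n else 0, by simp⟩

lemma tr_apply (f : ArithmeticFunction ℝ) (U n : ℕ) : tr f U n = if n ≤ U then f n else 0 := rfl

lemma vaughan_id (U : ℕ) : (Λ : ArithmeticFunction ℝ) = tr Λ U + tr (μ : ArithmeticFunction ℝ) U * log
    - (tr (μ : ArithmeticFunction ℝ) U * tr Λ U) * (ζ : ArithmeticFunction ℝ)
    + (Λ - tr Λ U) * ((ζ : ArithmeticFunction ℝ) * ((μ : ArithmeticFunction ℝ) - tr (μ : ArithmeticFunction ℝ) U)) := by
  have h1 : (Λ : ArithmeticFunction ℝ) * (ζ : ArithmeticFunction ℝ) = log := vonMangoldt_mul_zeta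
  have h2 : (ζ : ArithmeticFunction ℝ) * (μ : ArithmeticFunction ℝ) = 1 := coe_zeta_mul_coe_moebius
  rw [← h1]
  linear_combination (-Λ + tr Λ U) * h2

lemma card_divisors_mul_le (m n : ℕ) : (m * n).divisors.card ≤ m.divisors.card * n.divisors.card := by
  rw [Nat.divisors_mul]; exact card_mul_le

noncomputable def tau (n : ℕ) : ℝ := (n.divisors.card : ℝ)

lemma tau_nonneg (n : ℕ) : 0 ≤ tau n := by unfold tau; positivity

lemma tau_mul_le (m n : ℕ) : tau (m * n) ≤ tau m * tau n := by
  unfold tau; exact_mod_cast card_divisors_mul_le m n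

lemma tau_eq (n : ℕ) : tau n = ((ζ : ArithmeticFunction ℝ) * (ζ : ArithmeticFunction ℝ)) n := by
  rw [coe_zeta_mul_apply]
  unfold tau
  rw [sum_congr rfl (g := fun _ => (1:ℝ))]
  · simp
  · intro d hd
    have := Nat.pos_of_mem_divisors hd
    simp [natCoe_apply, zeta_apply]; omega

lemma sum_inv_le (N : ℕ) : ∑ n ∈ Ioc 0 N, (1:ℝ) / n ≤ 1 + Real.log N := by
  have h8 := harmonic_le_one_add_log N
  rw [harmonic] at h8
  push_cast at h8
  refine le_trans (le_of_eq ?_) h8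
  have : Ioc 0 N = Ico (0+1) (N+1) := by ext; simp; omega
  rw [this, ← sum_Ico_add' (fun n : ℕ => (1:ℝ)/n) 0 N 1, range_eq_Ico]; simp

/-- real version of conv_sum for divisor sums -/
lemma sum_tau_mul (F : ℕ → ℝ) (N : ℕ) :
    ∑ n ∈ Ioc 0 N, tau n * F n = ∑ d ∈ Ioc 0 N, ∑ m ∈ Ioc 0 (N / d), F (d * m) := by
  have := conv_sum (ζ : ArithmeticFunction ℝ) (ζ : ArithmeticFunction ℝ) (fun n => (F n : ℂ)) N
  simp_rw [← tau_eq] at this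
  have h2 : ∑ d ∈ Ioc 0 N, ∑ m ∈ Ioc 0 (N / d), (((ζ : ArithmeticFunction ℝ) d : ℝ):ℂ) * (((ζ : ArithmeticFunction ℝ) m : ℝ):ℂ) * ((F (d*m) : ℝ):ℂ) =
     ∑ d ∈ Ioc 0 N, ∑ m ∈ Ioc 0 (N / d), ((F (d * m) : ℝ):ℂ) := by
    apply sum_congr rfl; intro d hd
    apply sum_congr rfl; intro m hm
    rw [mem_Ioc] at hd hm
    simp [natCoe_apply, zeta_apply, show d ≠ 0 by omega, show m ≠ 0 by omega]
  rw [h2] at this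
  exact_mod_cast this

lemma sum_tau_le (N : ℕ) : ∑ n ∈ Ioc 0 N, tau n ≤ N * (1 + Real.log N) := by
  have := sum_tau_mul (fun _ => 1) N
  simp only [mul_one] at this
  rw [this]
  simp only [sum_const, Nat.card_Ioc, tsub_zero, nsmul_eq_mul, mul_one]
  calc ∑ d ∈ Ioc 0 N, ((N / d : ℕ):ℝ) ≤ ∑ d ∈ Ioc 0 N, (N:ℝ) * (1 / d) := by
        apply sum_le_sum; intro d _
        refine Nat.cast_div_le.trans (le_of_eq ?_); ring
    _ ≤ _ := by rw [← mul_sum]; exact mul_le_mul_of_nonneg_left (sum_inv_le N) (by positivity)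

lemma log_nat_mono {m n : ℕ} (h : m ≤ n) : Real.log m ≤ Real.log n := by
  rcases Nat.eq_zero_or_pos m with h0 | h0
  · subst h0; simp [Real.log_natCast_nonneg]
  · exact Real.log_le_log (by exact_mod_cast h0) (by exact_mod_cast h)

lemma sum_tau_div_le (N : ℕ) : ∑ n ∈ Ioc 0 N, tau n * (1 / n) ≤ (1 + Real.log N)^2 := by
  have := sum_tau_mul (fun n => 1 / n) N
  rw [this]
  have hl : 0 ≤ Real.log N := Real.log_natCast_nonneg N
  calc ∑ d ∈ Ioc 0 N, ∑ m ∈ Ioc 0 (N / d), (1:ℝ) / ((d * m : ℕ):ℝ) 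
      = ∑ d ∈ Ioc 0 N, (1:ℝ)/d * ∑ m ∈ Ioc 0 (N / d), (1:ℝ) / m := by
        apply sum_congr rfl; intro d _
        rw [mul_sum]; apply sum_congr rfl; intro m _
        push_cast; rw [div_mul_div_comm, one_mul]
    _ ≤ ∑ d ∈ Ioc 0 N, (1:ℝ)/d * (1 + Real.log N) := by
        apply sum_le_sum; intro d _
        apply mul_le_mul_of_nonneg_left _ (by positivity)
        refine (sum_inv_le _).trans ?_
        have := log_nat_mono (Nat.div_le_self N d)
        linarith
    _ ≤ _ := by
        rw [← sum_mul, sq]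
        exact mul_le_mul_of_nonneg_right (sum_inv_le N) (by positivity)

lemma sum_tau_sq_le (N : ℕ) : ∑ n ∈ Ioc 0 N, tau n ^ 2 ≤ N * (1 + Real.log N)^3 := by
  have := sum_tau_mul tau N
  simp only [← sq] at this
  rw [this]
  have hl : 0 ≤ Real.log N := Real.log_natCast_nonneg N
  calc ∑ d ∈ Ioc 0 N, ∑ m ∈ Ioc 0 (N / d), tau (d * m)
      ≤ ∑ d ∈ Ioc 0 N, tau d * ((N:ℝ) * (1/d) * (1 + Real.log N)) := by
        apply sum_le_sum; intro d _
        calc ∑ m ∈ Ioc 0 (N / d), tau (d * m) ≤ ∑ m ∈ Ioc 0 (N / d), tau d * tau m := 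
              sum_le_sum fun m _ => tau_mul_le _ _
          _ = tau d * ∑ m ∈ Ioc 0 (N / d), tau m := by rw [mul_sum]
          _ ≤ _ := by
            apply mul_le_mul_of_nonneg_left _ (tau_nonneg d)
            refine (sum_tau_le _).trans ?_
            have h1 := log_nat_mono (Nat.div_le_self N d)
            have h2 : ((N / d : ℕ):ℝ) ≤ N * (1/d) := by
              refine Nat.cast_div_le.trans (le_of_eq ?_); ring
            gcongr
    _ = (N:ℝ) * (1 + Real.log N) * ∑ d ∈ Ioc 0 N, tau d * (1/d) := by
        rw [mul_sum]; apply sum_congr rfl; intro d _; ring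
    _ ≤ (N:ℝ) * (1 + Real.log N) * (1 + Real.log N)^2 := 
        mul_le_mul_of_nonneg_left (sum_tau_div_le N) (by positivity)
    _ = _ := by ring

end Cay

namespace Cay
open Finset ArithmeticFunction
open scoped ArithmeticFunction.Moebius ArithmeticFunction.zeta

lemma cauchy_norm {ι : Type*} (s : Finset ι) (a : ι → ℝ) (z : ι → ℂ) :
    ‖∑ m ∈ s, (a m : ℂ) * z m‖ ^ 2 ≤ (∑ m ∈ s, a m ^ 2) * ∑ m ∈ s, ‖z m‖ ^ 2 := by
  have h1 : ‖∑ m ∈ s, (a m : ℂ) * z m‖ ≤ ∑ m ∈ s, |a m| * ‖z m‖ := by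
    refine (norm_sum_le _ _).trans (le_of_eq ?_)
    apply sum_congr rfl; intro m _; simp
  calc _ ≤ (∑ m ∈ s, |a m| * ‖z m‖)^2 := by gcongr
    _ ≤ (∑ m ∈ s, |a m| ^ 2) * ∑ m ∈ s, ‖z m‖ ^ 2 := sum_mul_sq_le_sq_mul_sq _ _ _
    _ = _ := by simp

lemma inner_geom (α : ℝ) (N M : ℕ) (hM : 0 < M) (k k' : ℕ) (hk : 0 < k) (hk' : 0 < k') :
    ‖∑ m ∈ (Ico M (2 * M)).filter (fun m => m * k ≤ N ∧ m * k' ≤ N), ee (m * (((k:ℝ) - k') * α))‖ ≤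
      3/2 * mn M (((k:ℝ) - k') * α) := by
  have : (Ico M (2 * M)).filter (fun m => m * k ≤ N ∧ m * k' ≤ N) =
      Ioc (M - 1) (min (2 * M - 1) (min (N / k) (N / k'))) := by
    ext m
    simp only [mem_filter, mem_Ico, mem_Ioc, le_min_iff, Nat.le_div_iff_mul_le hk, Nat.le_div_iff_mul_le hk']
    omega
  rw [this]
  refine (geom_bound _ _ _).trans ?_
  apply mul_le_mul_of_nonneg_left _ (by norm_num)
  apply mn_mono (by positivity)
  have : min (2 * M - 1) (min (N / k) (N / k')) ≤ 2 * M - 1 := min_le_left _ _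
  have : min (2 * M - 1) (min (N / k) (N / k')) - (M - 1) ≤ M := by omega
  exact_mod_cast this

lemma sum_diff_le (Y α : ℝ) (hY : 0 ≤ Y) (R k : ℕ) (hk : k ≤ R) :
    ∑ k' ∈ Ioc 0 R, mn Y (((k:ℝ) - k') * α) ≤ 2 * ∑ d ∈ range (R + 1), mn Y (d * α) := by
  rw [← sum_filter_add_sum_filter_not (Ioc 0 R) (fun k' => k' ≤ k), two_mul]
  apply add_le_add
  · have h1 : ∑ k' ∈ (Ioc 0 R).filter (fun k' => k' ≤ k), mn Y (((k:ℝ) - k') * α) =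
      ∑ d ∈ ((Ioc 0 R).filter (fun k' => k' ≤ k)).image (fun k' => k - k'), mn Y (d * α) := by
      rw [sum_image]
      · apply sum_congr rfl; intro k' hk'
        rw [mem_filter] at hk'
        rw [Nat.cast_sub hk'.2]
      · intro x hx y hy hxy
        simp only [coe_filter, mem_Ioc, Set.mem_ofPred_eq] at hx hy
        simp only at hxy
        omega
    rw [h1]
    apply sum_le_sum_of_subset_of_nonneg
    · intro d hd
      rw [mem_image] at hd
      obtain ⟨x, _, rfl⟩ := hd
      rw [mem_range]; omega
    · intros; exact mn_nonneg hY _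
  · have h1 : ∑ k' ∈ (Ioc 0 R).filter (fun k' => ¬ k' ≤ k), mn Y (((k:ℝ) - k') * α) =
      ∑ d ∈ ((Ioc 0 R).filter (fun k' => ¬ k' ≤ k)).image (fun k' => k' - k), mn Y (d * α) := by
      rw [sum_image]
      · apply sum_congr rfl; intro k' hk'
        rw [mem_filter] at hk'
        rw [Nat.cast_sub (by omega), ← mn_neg]; congr 1; ring
      · intro x hx y hy hxy
        simp only [coe_filter, mem_Ioc, Set.mem_ofPred_eq] at hx hy
        simp only at hxy
        omega
    rw [h1]
    apply sum_le_sum_of_subset_of_nonneg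
    · intro d hd
      rw [mem_image] at hd
      obtain ⟨x, hx, rfl⟩ := hd
      rw [mem_filter, mem_Ioc] at hx
      rw [mem_range]; omega
    · intros; exact mn_nonneg hY _

lemma type_two_block {α : ℝ} {a : ℤ} {q : ℕ} (hq : 0 < q) (hc : IsCoprime a (q:ℤ)) (h : |α - a / q| ≤ 1 / (q:ℝ)^2)
    (N M : ℕ) (hM : 0 < M) (b : ℕ → ℝ) :
    ∑ m ∈ Ico M (2 * M), ‖∑ k ∈ Ioc 0 (N / m), (b k : ℂ) * ee (((m * k : ℕ):ℝ) * α)‖ ^ 2 ≤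
      3 * (∑ k ∈ Ioc 0 (N / M), b k ^ 2) *
        ((2 * ((N / M : ℕ):ℝ) / q + 1) * (2 * M + 4 * q * (1 + Real.log q))) := by
  set R := N / M with hR
  let E : ℕ → ℕ → ℝ := fun k k' => mn M (((k:ℝ) - k') * α)
  have hE0 : ∀ k k', 0 ≤ E k k' := fun k k' => mn_nonneg (by positivity) _
  have hEs : ∀ k k', E k k' = E k' k := by
    intro k k'; simp only [E]; rw [← mn_neg]; congr 1; ring
  have step1 : ∀ m ∈ Ico M (2 * M), ∑ k ∈ Ioc 0 (N / m), (b k : ℂ) * ee (((m * k : ℕ):ℝ) * α) =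
      ∑ k ∈ Ioc 0 R, (if m * k ≤ N then (b k : ℂ) * ee (((m * k : ℕ):ℝ) * α) else 0) := by
    intro m hm
    rw [mem_Ico] at hm
    rw [← sum_filter]
    apply sum_congr _ (fun _ _ => rfl)
    ext k
    simp only [mem_filter, mem_Ioc]
    rw [Nat.le_div_iff_mul_le (by omega), hR, Nat.le_div_iff_mul_le hM, mul_comm k m]
    constructor
    · rintro ⟨h1, h2⟩; exact ⟨⟨h1, by nlinarith⟩, h2⟩
    · rintro ⟨h1, h2⟩; exact ⟨h1.1, h2⟩
  have step2 : ((∑ m ∈ Ico M (2 * M), ‖∑ k ∈ Ioc 0 (N / m), (b k : ℂ) * ee (((m * k : ℕ):ℝ) * α)‖ ^ 2 : ℝ) : ℂ) =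
      ∑ k ∈ Ioc 0 R, ∑ k' ∈ Ioc 0 R, (b k : ℂ) * (b k') *
        ∑ m ∈ (Ico M (2 * M)).filter (fun m => m * k ≤ N ∧ m * k' ≤ N), ee (m * (((k:ℝ) - k') * α)) := by
    push_cast
    have : ∀ m ∈ Ico M (2 * M), ((‖∑ k ∈ Ioc 0 (N / m), (b k : ℂ) * ee (((m * k : ℕ):ℝ) * α)‖ : ℝ):ℂ) ^ 2 =
        ∑ k ∈ Ioc 0 R, ∑ k' ∈ Ioc 0 R, (if m * k ≤ N ∧ m * k' ≤ N then
          (b k : ℂ) * (b k') * ee (m * (((k:ℝ) - k') * α)) else 0) := by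
      intro m hm
      rw [← Complex.mul_conj', step1 m hm, map_sum, sum_mul_sum]
      apply sum_congr rfl; intro k _
      apply sum_congr rfl; intro k' _
      by_cases h1 : m * k ≤ N <;> by_cases h2 : m * k' ≤ N <;> simp only [h1, h2, if_true, if_false, and_self, and_true, and_false, _root_.map_zero, mul_zero, zero_mul]
      have e1 : (m:ℝ) * (((k:ℝ) - k') * α) = ((m * k : ℕ):ℝ) * α + -(((m * k' : ℕ):ℝ) * α) := by push_cast; ring
      rw [e1, ee_add, ee_neg, map_mul, Complex.conj_ofReal]; ring
    push_cast at this
    rw [sum_congr rfl this, sum_comm]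
    apply sum_congr rfl; intro k _
    rw [sum_comm]
    apply sum_congr rfl; intro k' _
    rw [← sum_filter, mul_sum]
  have step3 : ∑ m ∈ Ico M (2 * M), ‖∑ k ∈ Ioc 0 (N / m), (b k : ℂ) * ee (((m * k : ℕ):ℝ) * α)‖ ^ 2 ≤
      ∑ k ∈ Ioc 0 R, ∑ k' ∈ Ioc 0 R, |b k| * |b k'| * (3/2 * E k k') := by
    refine (le_abs_self _).trans ?_
    rw [← Real.norm_eq_abs, ← Complex.norm_real, step2]
    refine (norm_sum_le _ _).trans ?_
    apply sum_le_sum; intro k hk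
    refine (norm_sum_le _ _).trans ?_
    apply sum_le_sum; intro k' hk'
    rw [mem_Ioc] at hk hk'
    rw [norm_mul, norm_mul, Complex.norm_real, Complex.norm_real, Real.norm_eq_abs, Real.norm_eq_abs]
    exact mul_le_mul_of_nonneg_left (inner_geom α N M hM k k' hk.1 hk'.1) (by positivity)
  have step4 : ∑ k ∈ Ioc 0 R, ∑ k' ∈ Ioc 0 R, |b k| * |b k'| * (3/2 * E k k') ≤
      3/2 * ∑ k ∈ Ioc 0 R, b k ^ 2 * ∑ k' ∈ Ioc 0 R, E k k' := by
    have h1 : ∀ k k', |b k| * |b k'| * (3/2 * E k k') ≤ 3/4 * (b k ^2 * E k k') + 3/4 * (b k' ^2 * E k' k) := by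
      intro k k'
      have := two_mul_le_add_sq (|b k|) (|b k'|)
      rw [sq_abs, sq_abs] at this
      rw [hEs k' k]
      nlinarith [hE0 k k']
    refine (sum_le_sum fun k _ => sum_le_sum fun k' _ => h1 k k').trans (le_of_eq ?_)
    simp_rw [sum_add_distrib]
    rw [sum_comm (f := fun k k' => 3/4 * (b k' ^2 * E k' k))]
    simp_rw [← mul_sum]
    ring
  refine step3.trans (step4.trans ?_)
  have step5 : ∀ k ∈ Ioc 0 R, b k ^ 2 * ∑ k' ∈ Ioc 0 R, E k k' ≤ b k ^ 2 * (2 * ((2 * (R:ℝ) / q + 1) * (2 * M + 4 * q * (1 + Real.log q)))) := by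
    intro k hk
    rw [mem_Ioc] at hk
    apply mul_le_mul_of_nonneg_left _ (sq_nonneg _)
    refine (sum_diff_le M α (by positivity) R k hk.2).trans ?_
    exact mul_le_mul_of_nonneg_left (block_sum hq hc h R (by positivity)) (by norm_num)
  refine (mul_le_mul_of_nonneg_left (sum_le_sum step5) (by norm_num)).trans (le_of_eq ?_)
  rw [← sum_mul]; ring

end Cay

namespace Cay
open Finset ArithmeticFunction
open scoped ArithmeticFunction.Moebius ArithmeticFunction.zeta

lemma aux_sq {x y z : ℝ} (p1 : 0 ≤ x) (p2 : 0 ≤ y) (p3 : 0 ≤ z) :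
    12 * x^2 + 54 * y^2 + 12 * z^2 ≤ 8^2 * (x + y + z)^2 := by
  nlinarith [mul_nonneg p1 p2, mul_nonneg p1 p3, mul_nonneg p2 p3, sq_nonneg x, sq_nonneg y, sq_nonneg z]

/-- the dyadic piece of the bilinear sum -/
lemma type_two_dyadic {α : ℝ} {a : ℤ} {q : ℕ} (hq : 0 < q) (hc : IsCoprime a (q:ℤ)) (h : |α - a / q| ≤ 1 / (q:ℝ)^2)
    (N M U : ℕ) (X L : ℝ) (hM : 0 < M) (hU : 0 < U) (hNX : (N:ℝ) ≤ X) (hX : 1 ≤ X) (hL : L = 1 + Real.log X)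
    (hqX : (q:ℝ) ≤ X) (hMU : U ≤ 2 * M) (hMU2 : M * U ≤ N)
    (A b : ℕ → ℝ) (hA : ∀ m, m ≤ N → |A m| ≤ L) (hb : ∀ k, |b k| ≤ tau k) (s : Finset ℕ) (hs : s ⊆ Ico M (2*M))
    (hsN : ∀ m ∈ s, m ≤ N) :
    ‖∑ m ∈ s, (A m : ℂ) * ∑ k ∈ Ioc 0 (N / m), (b k : ℂ) * ee (((m * k : ℕ):ℝ) * α)‖ ≤
      8 * L^3 * (X / √q + X / √U + √(X * q)) := by
  have hq' : (0:ℝ) < q := by exact_mod_cast hq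
  have hM' : (0:ℝ) < M := by exact_mod_cast hM
  have hU' : (0:ℝ) < U := by exact_mod_cast hU
  have hX0 : 0 < X := by linarith
  have hlX : 0 ≤ Real.log X := Real.log_nonneg hX
  have hL1 : 1 ≤ L := by linarith
  have h1 := cauchy_norm s A (fun m => ∑ k ∈ Ioc 0 (N / m), (b k : ℂ) * ee (((m * k : ℕ):ℝ) * α))
  have h2 : ∑ m ∈ s, A m ^ 2 ≤ M * L^2 := by
    calc ∑ m ∈ s, A m ^ 2 ≤ ∑ m ∈ s, L^2 := by
          apply sum_le_sum; intro m hm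
          rw [← sq_abs]; have := hA m (hsN m hm); gcongr
      _ = s.card * L^2 := by simp
      _ ≤ _ := by
          have := card_le_card hs
          rw [Nat.card_Ico] at this
          have : s.card ≤ M := by omega
          have : (s.card:ℝ) ≤ M := by exact_mod_cast this
          gcongr
  have h3 : ∑ m ∈ s, ‖∑ k ∈ Ioc 0 (N / m), (b k : ℂ) * ee (((m * k : ℕ):ℝ) * α)‖^2 ≤
      3 * (∑ k ∈ Ioc 0 (N / M), b k ^ 2) *
        ((2 * ((N / M : ℕ):ℝ) / q + 1) * (2 * M + 4 * q * (1 + Real.log q))) :=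
    (sum_le_sum_of_subset_of_nonneg hs (fun _ _ _ => sq_nonneg _)).trans (type_two_block hq hc h N M hM b)
  have hR : ((N / M : ℕ):ℝ) ≤ X / M := Nat.cast_div_le.trans (by gcongr)
  have hR0 : (0:ℝ) ≤ ((N / M : ℕ):ℝ) := by positivity
  have hlR : 1 + Real.log ((N / M : ℕ):ℝ) ≤ L := by
    rw [hL]
    rcases Nat.eq_zero_or_pos (N / M) with h0 | h0
    · rw [h0]; simp [hlX]
    · have : ((N / M : ℕ):ℝ) ≤ X := (by exact_mod_cast Nat.div_le_self N M : ((N / M : ℕ):ℝ) ≤ N).trans hNX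
      have := Real.log_le_log (by exact_mod_cast h0) this
      linarith
  have hlq : 1 + Real.log q ≤ L := by
    have := Real.log_le_log hq' hqX; linarith
  have hlq0 : 0 ≤ Real.log q := Real.log_natCast_nonneg q
  have hlR0 : 0 ≤ Real.log ((N / M : ℕ):ℝ) := Real.log_natCast_nonneg _
  have h4 : ∑ k ∈ Ioc 0 (N / M), b k ^ 2 ≤ (X / M) * L^3 := by
    calc ∑ k ∈ Ioc 0 (N / M), b k ^ 2 ≤ ∑ k ∈ Ioc 0 (N / M), tau k ^ 2 := by
          apply sum_le_sum; intro k _; rw [← sq_abs]; have := hb k; gcongr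
      _ ≤ _ := sum_tau_sq_le _
      _ ≤ _ := by gcongr
  have h5 : (2 * ((N / M : ℕ):ℝ) / q + 1) * (2 * M + 4 * q * (1 + Real.log q)) ≤
      (2 * (X / M) / q + 1) * (2 * M + 4 * q * L) := by gcongr
  have h6 : (2 * (X / M) / q + 1) * (2 * M + 4 * q * L) = 4 * X / q + 8 * (X / M) * L + 2 * M + 4 * q * L := by
    field_simp; ring
  have h7 : X / M ≤ 2 * (X / U) := by
    rw [← mul_div_assoc, div_le_div_iff₀ hM' hU']
    have : (U:ℝ) ≤ 2 * M := by exact_mod_cast hMU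
    nlinarith
  have h8 : (M:ℝ) ≤ X / U := by
    rw [le_div_iff₀ hU']
    have : ((M * U : ℕ):ℝ) ≤ N := by exact_mod_cast hMU2
    push_cast at this; linarith
  have hXq : 0 ≤ X / q := by positivity
  have hXU : 0 ≤ X / U := by positivity
  have h9 : (2 * ((N / M : ℕ):ℝ) / q + 1) * (2 * M + 4 * q * (1 + Real.log q)) ≤ L * (4 * (X / q) + 18 * (X / U) + 4 * q) := by
    refine h5.trans ?_
    rw [h6, mul_div_assoc]
    nlinarith
  have hP : 0 ≤ L * (4 * (X / q) + 18 * (X / U) + 4 * q) := by positivity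
  have h10 : ‖∑ m ∈ s, (A m : ℂ) * ∑ k ∈ Ioc 0 (N / m), (b k : ℂ) * ee (((m * k : ℕ):ℝ) * α)‖^2 ≤
      (M * L^2) * (3 * ((X / M) * L^3) * (L * (4 * (X / q) + 18 * (X / U) + 4 * q))) := by
    refine h1.trans ?_
    apply mul_le_mul h2 _ (sum_nonneg fun _ _ => sq_nonneg _) (by positivity)
    refine h3.trans ?_
    apply mul_le_mul _ h9 _ (by positivity)
    · gcongr
    · positivity
  have h11 : (M * L^2) * (3 * ((X / M) * L^3) * (L * (4 * (X / q) + 18 * (X / U) + 4 * q))) =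
      L^6 * (12 * (X^2 / q) + 54 * (X^2 / U) + 12 * (X * q)) := by
    field_simp; ring
  rw [h11] at h10
  apply (pow_le_pow_iff_left₀ (norm_nonneg _) (by positivity) two_ne_zero).1
  refine h10.trans ?_
  have e1 : (X / √q)^2 = X^2 / q := by rw [div_pow, Real.sq_sqrt hq'.le]
  have e2 : (X / √U)^2 = X^2 / U := by rw [div_pow, Real.sq_sqrt hU'.le]
  have e3 : (√(X * q))^2 = X * q := Real.sq_sqrt (by positivity)
  have p1 : 0 ≤ X / √q := by positivity
  have p2 : 0 ≤ X / √U := by positivity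
  have p3 : 0 ≤ √(X * q) := by positivity
  have h12 := aux_sq p1 p2 p3
  rw [e1, e2, e3] at h12
  have hL6 : 0 ≤ L^6 := by positivity
  calc _ ≤ L^6 * (8^2 * (X / √q + X / √U + √(X * q))^2) := mul_le_mul_of_nonneg_left h12 hL6
    _ = _ := by ring

lemma type_two {α : ℝ} {a : ℤ} {q : ℕ} (hq : 0 < q) (hc : IsCoprime a (q:ℤ)) (h : |α - a / q| ≤ 1 / (q:ℝ)^2)
    (N U : ℕ) (X L : ℝ) (hU : 0 < U) (hNX : (N:ℝ) ≤ X) (hX : 1 ≤ X) (hL : L = 1 + Real.log X)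
    (hqX : (q:ℝ) ≤ X) 
    (A b : ℕ → ℝ) (hA : ∀ m, m ≤ N → |A m| ≤ L) (hb : ∀ k, |b k| ≤ tau k) (hA0 : ∀ m ≤ U, A m = 0)
    (hb0 : ∀ k ≤ U, b k = 0) :
    ‖∑ m ∈ Ioc 0 N, (A m : ℂ) * ∑ k ∈ Ioc 0 (N / m), (b k : ℂ) * ee (((m * k : ℕ):ℝ) * α)‖ ≤
      16 * L^4 * (X / √q + X / √U + √(X * q)) := by
  have hX0 : 0 < X := by linarith
  have hlX : 0 ≤ Real.log X := Real.log_nonneg hX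
  have hL1 : 1 ≤ L := by linarith
  rw [← sum_fiberwise_of_maps_to (s := Ioc 0 N) (t := range (Nat.log 2 N + 1)) (g := fun n => Nat.log 2 n)]
  swap
  · intro n hn
    rw [mem_Ioc] at hn
    rw [mem_range]
    have := Nat.log_mono_right (b := 2) hn.2
    omega
  have hW : 0 ≤ 8 * L^3 * (X / √q + X / √U + √(X * q)) := by positivity
  have key : ∀ j ∈ range (Nat.log 2 N + 1), ‖∑ m ∈ (Ioc 0 N).filter (fun n => Nat.log 2 n = j), (A m : ℂ) * ∑ k ∈ Ioc 0 (N / m), (b k : ℂ) * ee (((m * k : ℕ):ℝ) * α)‖ ≤ 8 * L^3 * (X / √q + X / √U + √(X * q)) := by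
    intro j _
    have hsub : ∀ m ∈ (Ioc 0 N).filter (fun n => Nat.log 2 n = j), 2^j ≤ m ∧ m < 2 * 2^j ∧ m ≤ N := by
      intro m hm
      rw [mem_filter, mem_Ioc] at hm
      refine ⟨?_, ?_, hm.1.2⟩
      · rw [← hm.2]; exact Nat.pow_log_le_self 2 (by omega)
      · have := Nat.lt_pow_succ_log_self (b := 2) (by norm_num) m
        rw [hm.2, pow_succ] at this; omega
    by_cases c1 : U ≤ 2 * 2^j
    · by_cases c2 : 2^j * U ≤ N
      · apply type_two_dyadic hq hc h N (2^j) U X L (by positivity) hU hNX hX hL hqX c1 c2 A b hA hb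
        · intro m hm
          have := hsub m hm
          rw [mem_Ico]; omega
        · intro m hm; exact (hsub m hm).2.2
      · rw [sum_eq_zero]
        · simpa using hW
        · intro m hm
          have h1 := hsub m hm
          rw [sum_eq_zero, mul_zero]
          intro k hk
          rw [mem_Ioc, Nat.le_div_iff_mul_le (by have : 0 < 2^j := by positivity
                                                 omega)] at hk
          rw [hb0 k]
          · simp
          · by_contra hkU
            push Not at hkU c2
            have : 2^j * U ≤ m * k := Nat.mul_le_mul h1.1 hkU.le
            nlinarith
    · rw [sum_eq_zero]
      · simpa using hW
      · intro m hm
        have h1 := hsub m hm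
        rw [hA0 m (by omega)]; simp
  refine (norm_sum_le _ _).trans ((sum_le_sum key).trans ?_)
  rw [sum_const, card_range, nsmul_eq_mul]
  have hj : ((Nat.log 2 N + 1 : ℕ):ℝ) ≤ 2 * L := by
    push_cast
    rcases Nat.eq_zero_or_pos N with h0 | h0
    · subst h0; simp; linarith
    · have h1 : 2 ^ Nat.log 2 N ≤ N := Nat.pow_log_le_self 2 (by omega)
      have h2 : ((2:ℝ) ^ Nat.log 2 N) ≤ X := le_trans (by exact_mod_cast h1) hNX
      have h3 := Real.log_le_log (by positivity) h2
      rw [Real.log_pow] at h3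
      have := Real.log_two_gt_d9
      have h4 : (0:ℝ) ≤ Nat.log 2 N := by positivity
      nlinarith
  calc _ ≤ 2 * L * (8 * L^3 * (X / √q + X / √U + √(X * q))) := by gcongr
    _ = _ := by ring

end Cay

namespace Cay
open Finset ArithmeticFunction
open scoped ArithmeticFunction.Moebius ArithmeticFunction.zeta

lemma abs_moebius_real (n : ℕ) : |((μ : ArithmeticFunction ℝ) n)| ≤ 1 := by
  have : ((μ : ArithmeticFunction ℝ) n) = ((μ n : ℤ) : ℝ) := rfl
  rw [this]
  exact_mod_cast abs_moebius_le_one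

lemma vaughan_aux {α : ℝ} {a : ℤ} {q : ℕ} (hq : 0 < q) (hc : IsCoprime a (q:ℤ)) (h : |α - a / q| ≤ 1 / (q:ℝ)^2)
    (N U : ℕ) (X L : ℝ) (hU : 0 < U) (hNX : (N:ℝ) ≤ X) (hX : 1 ≤ X) (hL : L = 1 + Real.log X)
    (hqX : (q:ℝ) ≤ X) (hUX : (U:ℝ)^2 ≤ X) :
    ‖∑ n ∈ Ioc 0 N, (Λ n : ℂ) * ee (n * α)‖ ≤ U * L + 300 * L^2 * (X / q + U^2 + q) +
      16 * L^4 * (X / √q + X / √U + √(X * q)) := by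
  have hX0 : 0 < X := by linarith
  have hlX : 0 ≤ Real.log X := Real.log_nonneg hX
  have hL1 : 1 ≤ L := by linarith
  have hq' : (0:ℝ) < q := by exact_mod_cast hq
  have hU' : (1:ℝ) ≤ U := by exact_mod_cast hU
  set w : ℕ → ℂ := fun n => ee (n * α) with hw
  have hlog : ∀ n : ℕ, n ≤ N → Real.log n ≤ Real.log X := by
    intro n hn
    rcases Nat.eq_zero_or_pos n with h0 | h0
    · subst h0; simpa using hlX
    · apply Real.log_le_log (by exact_mod_cast h0)
      exact le_trans (by exact_mod_cast hn) hNX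
  have hΛ : ∀ n, n ≤ N → |Λ n| ≤ L := by
    intro n hn
    rw [abs_of_nonneg vonMangoldt_nonneg]
    have := vonMangoldt_le_log (n := n)
    linarith [hlog n hn]
  -- type I sums
  have hlq : 1 + Real.log q ≤ L := by
    have := Real.log_le_log hq' hqX; linarith
  have hI : ∀ D : ℕ, D ≤ U^2 → ∑ d ∈ Ioc 0 D, mn (N / d) (d * α) ≤ 32 * L * (X / q + U^2 + q) := by
    intro D hD
    refine (type_one hq hc h D (N := N) (by positivity)).trans ?_
    have hD' : (D:ℝ) ≤ U^2 := by exact_mod_cast hD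
    have hlD : 1 + Real.log D ≤ L := by
      rcases Nat.eq_zero_or_pos D with h0 | h0
      · subst h0; simpa using hL1
      · have := Real.log_le_log (by exact_mod_cast h0) (hD'.trans hUX); linarith
    have hlq0 : 0 ≤ Real.log q := Real.log_natCast_nonneg q
    have hlD0 : 0 ≤ Real.log D := Real.log_natCast_nonneg D
    have e1 : 4 * (N:ℝ) / q ≤ 4 * (X / q) := by rw [← mul_div_assoc]; gcongr
    have e2 : 0 ≤ X / q := by positivity
    calc (4 * (N:ℝ) / q + 8 * D + 16 * q) * ((1 + Real.log q) + (1 + Real.log D))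
        ≤ (4 * (X / q) + 8 * U^2 + 16 * q) * (L + L) := by gcongr
      _ ≤ _ := by nlinarith
  have hgeo : ∀ d M : ℕ, 0 < d → M ≤ N / d → ‖∑ m ∈ Ioc 0 M, w (d * m)‖ ≤ 3/2 * mn (N / d) (d * α) := by
    intro d M hd hM
    have e : ∑ m ∈ Ioc 0 M, w (d * m) = ∑ m ∈ Ioc 0 M, ee (m * (d * α)) := by
      apply sum_congr rfl; intro m _; simp only [hw]; congr 1; push_cast; ring
    rw [e]
    refine (geom_bound 0 M _).trans ?_
    apply mul_le_mul_of_nonneg_left _ (by norm_num)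
    apply mn_mono (by positivity)
    rw [Nat.sub_zero]
    exact le_trans (by exact_mod_cast hM) Nat.cast_div_le
  -- pieces
  have hS1 : ‖∑ n ∈ Ioc 0 N, ((tr Λ U n : ℝ) : ℂ) * w n‖ ≤ U * L := by
    refine (norm_sum_le _ _).trans ?_
    calc ∑ n ∈ Ioc 0 N, ‖((tr Λ U n : ℝ) : ℂ) * w n‖ ≤ ∑ n ∈ Ioc 0 N, if n ≤ U then L else 0 := by
          apply sum_le_sum; intro n hn
          rw [mem_Ioc] at hn
          rw [norm_mul, norm_ee, mul_one, Complex.norm_real, Real.norm_eq_abs, tr_apply]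
          split_ifs
          · exact hΛ n hn.2
          · simp
      _ ≤ ∑ n ∈ Ioc 0 U, L := by
          rw [← sum_filter]
          apply sum_le_sum_of_subset_of_nonneg
          · intro n hn
            rw [mem_filter, mem_Ioc] at hn
            rw [mem_Ioc]; omega
          · intros; linarith
      _ = _ := by simp
  have hS2 : ‖∑ n ∈ Ioc 0 N, (((tr (μ : ArithmeticFunction ℝ) U * log) n : ℝ) : ℂ) * w n‖ ≤ 6 * L * (32 * L * (X / q + U^2 + q)) := by
    rw [conv_sum]
    refine (norm_sum_le _ _).trans ?_
    calc _ ≤ ∑ d ∈ Ioc 0 N, (if d ≤ U then 6 * L * mn (N / d) (d * α) else 0) := by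
          apply sum_le_sum; intro d hd
          rw [mem_Ioc] at hd
          simp_rw [mul_assoc]
          rw [← mul_sum, norm_mul, Complex.norm_real, Real.norm_eq_abs, tr_apply]
          split_ifs with hdU
          · have h1 := abel_mono (fun n => Real.log n) (fun m => w (d * m)) 0 (N / d) (3/2 * mn (N / d) (d * α))
              (by have := mn_nonneg (Y := (N:ℝ)/d) (by positivity) (d * α); positivity)
              (by simp) (fun n hn _ => log_nat_mono (by omega)) (fun n _ hn => hgeo d n hd.1 hn)
            have h2 : |Real.log ((N / d + 1 : ℕ):ℝ)| ≤ 2 * L := by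
              rw [abs_of_nonneg (Real.log_natCast_nonneg _)]
              have h3 : ((N / d + 1 : ℕ):ℝ) ≤ 2 * X := by
                have : ((N / d : ℕ):ℝ) ≤ N := by exact_mod_cast Nat.div_le_self N d
                push_cast; linarith
              have := Real.log_le_log (by positivity) h3
              rw [Real.log_mul (by norm_num) (by positivity)] at this
              have := Real.log_two_lt_d9
              linarith
            have h4 := mn_nonneg (Y := (N:ℝ)/d) (by positivity) (d * α)
            calc _ ≤ 1 * (2 * (3/2 * mn (N / d) (d * α)) * (2 * L)) := by
                  apply mul_le_mul (abs_moebius_real d) (h1.trans _) (norm_nonneg _) (by norm_num)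
                  gcongr
              _ = _ := by ring
          · simp
      _ ≤ ∑ d ∈ Ioc 0 U, 6 * L * mn (N / d) (d * α) := by
          rw [← sum_filter]
          apply sum_le_sum_of_subset_of_nonneg
          · intro n hn
            rw [mem_filter, mem_Ioc] at hn
            rw [mem_Ioc]; omega
          · intro d _ _
            have h4 := mn_nonneg (Y := (N:ℝ)/d) (by positivity) (d * α)
            positivity
      _ ≤ _ := by
          rw [← mul_sum]
          exact mul_le_mul_of_nonneg_left (hI U (by nlinarith)) (by positivity)
  have hS3 : ‖∑ n ∈ Ioc 0 N, ((((tr (μ : ArithmeticFunction ℝ) U * tr Λ U) * (ζ : ArithmeticFunction ℝ)) n : ℝ) : ℂ) * w n‖ ≤ 3/2 * L * (32 * L * (X / q + U^2 + q)) := by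
    rw [conv_sum]
    refine (norm_sum_le _ _).trans ?_
    calc _ ≤ ∑ d ∈ Ioc 0 N, (if d ≤ U^2 then 3/2 * L * mn (N / d) (d * α) else 0) := by
          apply sum_le_sum; intro d hd
          rw [mem_Ioc] at hd
          have h0 := mn_nonneg (Y := (N:ℝ)/d) (by positivity) (d * α)
          simp_rw [mul_assoc]
          rw [← mul_sum, norm_mul, Complex.norm_real, Real.norm_eq_abs]
          have e : ∑ m ∈ Ioc 0 (N / d), (((ζ : ArithmeticFunction ℝ) m : ℝ):ℂ) * w (d * m) = ∑ m ∈ Ioc 0 (N / d), w (d * m) := by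
            apply sum_congr rfl; intro m hm
            rw [mem_Ioc] at hm
            simp [natCoe_apply, zeta_apply, show m ≠ 0 by omega]
          rw [e]
          have hco : |(tr (μ : ArithmeticFunction ℝ) U * tr Λ U) d| ≤ if d ≤ U^2 then L else 0 := by
            rw [mul_apply]
            split_ifs with hdU
            · calc _ ≤ ∑ x ∈ d.divisorsAntidiagonal, Λ x.2 := by
                    refine (abs_sum_le_sum_abs _ _).trans ?_
                    apply sum_le_sum; intro x _
                    rw [abs_mul, ← one_mul (Λ x.2)]
                    apply mul_le_mul _ _ (abs_nonneg _) (by norm_num)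
                    · rw [tr_apply]; split_ifs
                      · exact abs_moebius_real _
                      · simp
                    · rw [tr_apply]; split_ifs
                      · rw [abs_of_nonneg vonMangoldt_nonneg]
                      · simpa using vonMangoldt_nonneg
                _ = ∑ i ∈ d.divisors, Λ i := by
                    rw [Nat.sum_divisorsAntidiagonal' (fun _ y => Λ y)]
                _ = Real.log d := vonMangoldt_sum
                _ ≤ L := by linarith [hlog d hd.2]
            · rw [sum_eq_zero]; · simp
              intro x hx
              rw [Nat.mem_divisorsAntidiagonal] at hx
              rw [tr_apply, tr_apply]
              split_ifs with g1 g2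
              · exfalso; apply hdU; rw [← hx.1, sq]; exact Nat.mul_le_mul g1 g2
              · simp
              · simp
              · simp
          have hg := hgeo d (N / d) hd.1 le_rfl
          split_ifs at hco ⊢ with hdU
          · calc _ ≤ L * (3/2 * mn (N / d) (d * α)) := mul_le_mul hco hg (norm_nonneg _) (by linarith)
              _ = _ := by ring
          · have : |(tr (μ : ArithmeticFunction ℝ) U * tr Λ U) d| = 0 := le_antisymm hco (abs_nonneg _)
            rw [this]; simp
      _ ≤ ∑ d ∈ Ioc 0 (U^2), 3/2 * L * mn (N / d) (d * α) := by
          rw [← sum_filter]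
          apply sum_le_sum_of_subset_of_nonneg
          · intro n hn
            rw [mem_filter, mem_Ioc] at hn
            rw [mem_Ioc]; omega
          · intro d _ _
            have h4 := mn_nonneg (Y := (N:ℝ)/d) (by positivity) (d * α)
            positivity
      _ ≤ _ := by
          rw [← mul_sum]
          exact mul_le_mul_of_nonneg_left (hI (U^2) le_rfl) (by positivity)
  have hS4 : ‖∑ n ∈ Ioc 0 N, ((((Λ - tr Λ U) * ((ζ : ArithmeticFunction ℝ) * ((μ : ArithmeticFunction ℝ) - tr (μ : ArithmeticFunction ℝ) U))) n : ℝ) : ℂ) * w n‖ ≤ 16 * L^4 * (X / √q + X / √U + √(X * q)) := by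
    rw [conv_sum]
    have hsub : ∀ (f : ArithmeticFunction ℝ) n, (f - tr f U) n = if n ≤ U then 0 else f n := by
      intro f n
      have : (f - tr f U) n = f n - tr f U n := rfl
      rw [this, tr_apply]; split_ifs <;> simp
    have := type_two hq hc h N U X L hU hNX hX hL hqX (fun m => (Λ - tr Λ U) m)
      (fun k => ((ζ : ArithmeticFunction ℝ) * ((μ : ArithmeticFunction ℝ) - tr (μ : ArithmeticFunction ℝ) U)) k)
      (by
        intro m hm
        simp only [hsub]; split_ifs
        · simp; linarith
        · exact hΛ m hm)
      (by
        intro k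
        simp only [coe_zeta_mul_apply]
        refine (abs_sum_le_sum_abs _ _).trans ?_
        unfold tau
        rw [← nsmul_one, ← sum_const]
        apply sum_le_sum; intro i _
        rw [hsub]; split_ifs
        · simp
        · exact abs_moebius_real i)
      (by intro m hm; simp only [hsub]; rw [if_pos hm])
      (by
        intro k hk
        simp only [coe_zeta_mul_apply]
        apply sum_eq_zero; intro i hi
        have := Nat.divisor_le hi
        rw [hsub, if_pos (by omega)])
    refine le_trans (le_of_eq ?_) this
    congr 1
    apply sum_congr rfl; intro m _
    rw [mul_sum]; apply sum_congr rfl; intro k _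
    rw [mul_assoc]
  have hid : ∑ n ∈ Ioc 0 N, (Λ n : ℂ) * w n = ∑ n ∈ Ioc 0 N, ((tr Λ U n : ℝ) : ℂ) * w n
      + ∑ n ∈ Ioc 0 N, (((tr (μ : ArithmeticFunction ℝ) U * log) n : ℝ) : ℂ) * w n
      - ∑ n ∈ Ioc 0 N, ((((tr (μ : ArithmeticFunction ℝ) U * tr Λ U) * (ζ : ArithmeticFunction ℝ)) n : ℝ) : ℂ) * w n
      + ∑ n ∈ Ioc 0 N, ((((Λ - tr Λ U) * ((ζ : ArithmeticFunction ℝ) * ((μ : ArithmeticFunction ℝ) - tr (μ : ArithmeticFunction ℝ) U))) n : ℝ) : ℂ) * w n := by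
    rw [← sum_add_distrib, ← sum_sub_distrib, ← sum_add_distrib]
    apply sum_congr rfl; intro n _
    have : Λ n = tr Λ U n + (tr (μ : ArithmeticFunction ℝ) U * log) n - ((tr (μ : ArithmeticFunction ℝ) U * tr Λ U) * (ζ : ArithmeticFunction ℝ)) n + ((Λ - tr Λ U) * ((ζ : ArithmeticFunction ℝ) * ((μ : ArithmeticFunction ℝ) - tr (μ : ArithmeticFunction ℝ) U))) n :=
      congrArg (fun f : ArithmeticFunction ℝ => f n) (vaughan_id U)
    rw [this]; push_cast; ring
  rw [hid]
  refine (norm_add_le _ _).trans ?_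
  refine (add_le_add ((norm_sub_le _ _).trans (add_le_add ((norm_add_le _ _).trans (add_le_add hS1 hS2)) hS3)) hS4).trans ?_
  have p : 0 ≤ L^2 * (X / q + U^2 + q) := by positivity
  nlinarith

/-- Vinogradov's bound for exponential sums over primes -/
theorem vinogradov {α : ℝ} {a : ℤ} {q : ℕ} (hq : 0 < q) (hc : IsCoprime a (q:ℤ)) (h : |α - a / q| ≤ 1 / (q:ℝ)^2)
    (N : ℕ) (X : ℝ) (hNX : (N:ℝ) ≤ X) (hX : 1 ≤ X) :
    ‖∑ n ∈ Ioc 0 N, (Λ n : ℂ) * ee (n * α)‖ ≤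
      1000 * (1 + Real.log X)^4 * (X / √q + X ^ (5/6 : ℝ) + √(X * q)) := by
  have hX0 : 0 < X := by linarith
  have hlX : 0 ≤ Real.log X := Real.log_nonneg hX
  have hq' : (0:ℝ) < q := by exact_mod_cast hq
  have hq1 : (1:ℝ) ≤ q := by exact_mod_cast hq
  set L := 1 + Real.log X with hL
  have hL1 : 1 ≤ L := by linarith
  by_cases hqX : (q:ℝ) ≤ X
  · set u : ℝ := X ^ (1/3 : ℝ) with hu
    have hu1 : 1 ≤ u := Real.one_le_rpow hX (by norm_num)
    set U := ⌊u⌋₊ with hUdef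
    have hU : 0 < U := Nat.floor_pos.2 hu1
    have hUu : (U:ℝ) ≤ u := Nat.floor_le (by linarith)
    have hUu2 : u ≤ 2 * U := by
      have h1 := Nat.lt_floor_add_one u
      have : (1:ℝ) ≤ U := by exact_mod_cast hU
      linarith
    have hu2 : u^2 = X ^ (2/3 : ℝ) := by
      rw [hu, ← Real.rpow_natCast, ← Real.rpow_mul hX0.le]; norm_num
    have h23 : X ^ (2/3 : ℝ) ≤ X ^ (5/6 : ℝ) := Real.rpow_le_rpow_of_exponent_le hX (by norm_num)
    have h56 : X ^ (5/6 : ℝ) ≤ X := by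
      conv_rhs => rw [← Real.rpow_one X]
      exact Real.rpow_le_rpow_of_exponent_le hX (by norm_num)
    have hUsq : (U:ℝ)^2 ≤ X ^ (5/6 : ℝ) := by
      calc (U:ℝ)^2 ≤ u^2 := by gcongr
        _ ≤ _ := by rw [hu2]; exact h23
    have := vaughan_aux hq hc h N U X L hU hNX hX hL hqX (hUsq.trans h56)
    refine this.trans ?_
    have hU' : (0:ℝ) < U := by exact_mod_cast hU
    have e1 : X / √U ≤ 2 * X ^ (5/6 : ℝ) := by
      rw [div_le_iff₀ (by positivity)]
      have h1 : √u ≤ 2 * √U := by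
        rw [Real.sqrt_le_left (by positivity), mul_pow, Real.sq_sqrt hU'.le]; linarith
      have h2 : X = X ^ (5/6 : ℝ) * √u := by
        rw [hu, Real.sqrt_eq_rpow, ← Real.rpow_mul hX0.le, ← Real.rpow_add hX0]; norm_num
      have : 0 ≤ X ^ (5/6 : ℝ) := by positivity
      nlinarith
    have e2 : X / q ≤ X / √q := by
      apply div_le_div_of_nonneg_left hX0.le (by positivity)
      rw [Real.sqrt_le_left hq'.le]; nlinarith
    have e3 : (q:ℝ) ≤ √(X * q) := by
      apply Real.le_sqrt_of_sq_le; nlinarith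
    have e4 : (U:ℝ) ≤ X ^ (5/6 : ℝ) := by
      have : (1:ℝ) ≤ U := by exact_mod_cast hU
      nlinarith
    have a1 : 0 ≤ X / √q := by positivity
    have a2 : 0 ≤ X ^ (5/6 : ℝ) := by positivity
    have a3 : 0 ≤ √(X * q) := by positivity
    have l1 : L ≤ L^4 := by calc L = L^1 := by ring
                              _ ≤ _ := pow_le_pow_right₀ hL1 (by norm_num)
    have l2 : L^2 ≤ L^4 := pow_le_pow_right₀ hL1 (by norm_num)
    set W := X / √q + X ^ (5/6 : ℝ) + √(X * q) with hW
    have f1 : (U:ℝ) * L ≤ W * L^4 := by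
      apply mul_le_mul _ l1 (by linarith) (by positivity); linarith
    have f2 : 300 * L^2 * (X / q + U^2 + q) ≤ 300 * L^4 * W := by
      apply mul_le_mul (by linarith) (by linarith) (by positivity) (by positivity)
    have f3 : 16 * L^4 * (X / √q + X / √U + √(X * q)) ≤ 16 * L^4 * (2 * W) := by
      apply mul_le_mul_of_nonneg_left _ (by positivity); linarith
    have hLW : 0 ≤ L^4 * W := by positivity
    clear_value W L u U
    clear * - f1 f2 f3 hLW
    linarith
  · push Not at hqX
    have h1 : ‖∑ n ∈ Ioc 0 N, (Λ n : ℂ) * ee (n * α)‖ ≤ N * L := by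
      refine (norm_sum_le _ _).trans ?_
      calc _ ≤ ∑ n ∈ Ioc 0 N, L := by
            apply sum_le_sum; intro n hn
            rw [mem_Ioc] at hn
            rw [norm_mul, norm_ee, mul_one, Complex.norm_real, Real.norm_eq_abs, abs_of_nonneg vonMangoldt_nonneg]
            refine vonMangoldt_le_log.trans ?_
            have := Real.log_le_log (show (0:ℝ) < n by exact_mod_cast hn.1) (le_trans (by exact_mod_cast hn.2) hNX : (n:ℝ) ≤ X)
            linarith
        _ = _ := by simp
    have h2 : X ≤ √(X * q) := by apply Real.le_sqrt_of_sq_le; nlinarith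
    have a1 : 0 ≤ X / √q := by positivity
    have a2 : 0 ≤ X ^ (5/6 : ℝ) := by positivity
    have l1 : L ≤ L^4 := by calc L = L^1 := by ring
                              _ ≤ _ := pow_le_pow_right₀ hL1 (by norm_num)
    calc _ ≤ N * L := h1
      _ ≤ √(X * q) * L^4 := by
          apply mul_le_mul (hNX.trans h2) l1 (by linarith) (by positivity)
      _ ≤ _ := by
        clear * - a1 a2
        nlinarith [mul_nonneg a1 (show 0 ≤ L^4 by positivity), mul_nonneg a2 (show 0 ≤ L^4 by positivity), mul_nonneg (show 0 ≤ √(X*q) by positivity) (show 0 ≤ L^4 by positivity)]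

end Cay

namespace Cay
open Finset

/-- sums of nonprincipal characters -/
lemma char_sum_le {q : ℕ} [NeZero q] {χ : DirichletCharacter ℂ q} (hχ : χ ≠ 1) (n : ℕ) :
    ‖∑ m ∈ range n, χ (m : ZMod q)‖ ≤ q := by
  have h0 : ∑ m ∈ range q, χ (m : ZMod q) = 0 := by
    rw [← χ.sum_eq_zero_of_ne_one hχ]
    refine Finset.sum_nbij' (fun n => (n : ZMod q)) ZMod.val ?_ ?_ ?_ ?_ ?_
    · simp
    · intro a _; simpa using ZMod.val_lt a
    · intro a ha; exact ZMod.val_cast_of_lt (by simpa using ha)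
    · intro a _; simp
    · simp
  induction n using Nat.strong_induction_on with
  | _ n ih =>
    by_cases hn : n < q
    · calc _ ≤ ∑ m ∈ range n, ‖χ (m : ZMod q)‖ := norm_sum_le _ _
        _ ≤ ∑ m ∈ range n, (1:ℝ) := sum_le_sum fun _ _ => χ.norm_le_one _
        _ = n := by simp
        _ ≤ q := by exact_mod_cast hn.le
    · obtain ⟨m, rfl⟩ := Nat.exists_eq_add_of_le (not_lt.1 hn)
      rw [sum_range_add, h0, zero_add]
      have := ih m (by have := NeZero.pos q; omega)
      simpa using this

lemma cpow_diff_le {s : ℂ} (hs : 0 < s.re) {n : ℝ} (hn : 1 ≤ n) {x y : ℝ} (hx : x ∈ Set.Icc n (n+1)) (hy : y ∈ Set.Icc n (n+1)) :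
    ‖(y:ℂ)^(-s) - (x:ℂ)^(-s)‖ ≤ ‖s‖ * n ^ (-s.re - 1) := by
  have h1 : ∀ x ∈ Set.Icc n (n+1), HasDerivWithinAt (fun x : ℝ => (x:ℂ)^(-s)) (-s * (x:ℂ)^(-s-1)) (Set.Icc n (n+1)) x := by
    intro x hx
    apply HasDerivAt.hasDerivWithinAt
    have hx0 : 0 < x := by linarith [hx.1]
    exact hasDerivAt_ofReal_cpow_const hx0.ne' (by intro h; have := congrArg Complex.re h; simp at this; linarith)
  have h2 : ∀ x ∈ Set.Icc n (n+1), ‖-s * (x:ℂ)^(-s-1)‖ ≤ ‖s‖ * n ^ (-s.re - 1) := by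
    intro x hx
    have hx0 : 0 < x := by linarith [hx.1]
    rw [norm_mul, norm_neg, Complex.norm_cpow_eq_rpow_re_of_pos hx0]
    gcongr
    simp only [Complex.sub_re, Complex.neg_re, Complex.one_re]
    exact Real.rpow_le_rpow_of_nonpos (by linarith) hx.1 (by linarith)
  have h3 := (convex_Icc n (n+1)).norm_image_sub_le_of_norm_hasDerivWithin_le h1 h2 hx hy
  refine h3.trans ?_
  have : ‖y - x‖ ≤ 1 := by rw [Real.norm_eq_abs, abs_le]; constructor <;> linarith [hx.1, hx.2, hy.1, hy.2]
  exact mul_le_of_le_one_right (by positivity) this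

lemma cpow_diff2_le {s : ℂ} (hs : 0 < s.re) {n : ℝ} (hn : 1 ≤ n) :
    ‖(s - 1) * (n:ℂ)^(-s) - ((n:ℂ)^(1-s) - ((n+1 : ℝ):ℂ)^(1-s))‖ ≤ ‖1 - s‖ * (‖s‖ * n ^ (-s.re - 1)) := by
  have h1 : ∀ x ∈ Set.Icc n (n+1), HasDerivWithinAt (fun x : ℝ => (x:ℂ)^(1-s) + (s-1) * (n:ℂ)^(-s) * x) ((1-s) * ((x:ℂ)^(-s) - (n:ℂ)^(-s))) (Set.Icc n (n+1)) x := by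
    intro x hx
    apply HasDerivAt.hasDerivWithinAt
    have hx0 : 0 < x := by linarith [hx.1]
    by_cases h1 : s = 1
    · subst h1; simp; exact hasDerivAt_const x (1:ℂ)
    have h := (hasDerivAt_ofReal_cpow_const' hx0.ne' (r := -s) (by intro h; apply h1; linear_combination -h)).const_mul (1-s)
    have h2 : HasDerivAt (fun x : ℝ => (s-1) * (n:ℂ)^(-s) * x) ((s-1) * (n:ℂ)^(-s) * 1) x :=
      (Complex.ofRealCLM.hasDerivAt (x := x)).const_mul _ |>.congr_deriv (by simp)
    refine ((h.add h2).congr_deriv (by ring)).congr_of_eventuallyEq (Filter.Eventually.of_forall fun y => ?_)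
    have : 1 - s ≠ 0 := sub_ne_zero.2 (Ne.symm h1)
    simp only [Pi.add_apply]
    congr 1
    rw [neg_add_eq_sub]
    field_simp
  have h2 : ∀ x ∈ Set.Icc n (n+1), ‖(1-s) * ((x:ℂ)^(-s) - (n:ℂ)^(-s))‖ ≤ ‖1 - s‖ * (‖s‖ * n ^ (-s.re - 1)) := by
    intro x hx
    rw [norm_mul]
    gcongr
    exact cpow_diff_le hs hn (by constructor <;> linarith) hx
  have h3 := (convex_Icc n (n+1)).norm_image_sub_le_of_norm_hasDerivWithin_le h1 h2 (x := n) (y := n+1) (by constructor <;> linarith) (by constructor <;> linarith)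
  simp only [add_sub_cancel_left, norm_one, mul_one] at h3
  refine le_trans (le_of_eq ?_) h3
  congr 1; push_cast; ring

lemma summable_shift {r : ℝ} (hr : 1 < r) : Summable fun n : ℕ => ((n:ℝ)+1) ^ (-r) := by
  have := (summable_nat_add_iff 1).2 (Real.summable_nat_rpow.2 (show -r < -1 by linarith))
  simpa using this

/-- analytic continuation of a series representation -/
lemma continue_series {g : ℕ → ℂ → ℂ} {G : ℂ → ℂ} {K : ℝ} (hG : Differentiable ℂ G)
    (hg : ∀ n, Differentiable ℂ (g n))
    (hb : ∀ n s, 0 < s.re → ‖g n s‖ ≤ K * (‖s‖ + 1)^2 * ((n:ℝ)+1) ^ (-s.re - 1))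
    (hs : ∀ s : ℂ, 1 < s.re → G s = ∑' n, g n s) {s : ℂ} (hs0 : 0 < s.re) : HasSum (fun n => g n s) (G s) := by
  have hK : 0 ≤ K := by
    have h := hb 0 1 (by simp)
    norm_num at h
    have : 0 ≤ ‖g 0 1‖ := norm_nonneg _
    linarith
  have hsm : ∀ s : ℂ, 0 < s.re → Summable fun n => g n s := by
    intro s hs
    apply Summable.of_norm_bounded _ (fun n => hb n s hs)
    apply Summable.mul_left
    have := summable_shift (r := s.re + 1) (by linarith)
    refine this.congr fun n => ?_
    congr 1; ring
  set δ := s.re / 2 with hδ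
  set R := ‖s‖ + 3 with hR
  set U : Set ℂ := {z | δ < z.re} ∩ Metric.ball 0 R with hU
  have hUo : IsOpen U := (isOpen_lt continuous_const Complex.continuous_re).inter Metric.isOpen_ball
  have hUc : Convex ℝ U := by
    apply Convex.inter
    · exact convex_halfSpace_re_gt δ
    · exact convex_ball _ _
  have hdT : DifferentiableOn ℂ (fun z => ∑' n, g n z) U := by
    refine Complex.differentiableOn_tsum_of_summable_norm (u := fun n => K * (R + 1)^2 * ((n:ℝ)+1) ^ (-(δ + 1))) ?_ ?_ hUo ?_
    · exact (summable_shift (by simp [hδ]; linarith)).mul_left _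
    · intro n; exact (hg n).differentiableOn
    · intro n w hw
      have hw1 : δ < w.re := hw.1
      have hw2 : ‖w‖ < R := by simpa using hw.2
      refine (hb n w (by simp only [hδ] at hw1; linarith)).trans ?_
      gcongr
      · have : (0:ℝ) ≤ n := by positivity
        linarith
      · linarith
  have hpt : (s + 2 : ℂ) ∈ U := by
    constructor
    · simp [hδ]; linarith
    · simp [hR]; refine (norm_add_le _ _).trans_lt ?_; simp; linarith
  have hsU : s ∈ U := by
    constructor
    · simp [hδ]; linarith
    · simp [hR]
  have heq : Set.EqOn G (fun z => ∑' n, g n z) U := by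
    apply (hG.differentiableOn.analyticOnNhd hUo).eqOn_of_preconnected_of_eventuallyEq (hdT.analyticOnNhd hUo) hUc.isPreconnected hpt
    have : {z : ℂ | 1 < z.re} ∈ nhds (s + 2 : ℂ) := (isOpen_lt continuous_const Complex.continuous_re).mem_nhds (by simp; linarith)
    filter_upwards [this] with z hz
    exact hs z hz
  have := heq hsU
  rw [this]
  exact (hsm s hs0).hasSum

lemma tail_bound {g : ℕ → ℂ} {G : ℂ} {σ K δ : ℝ} (hδ : 0 < δ) (hσ : δ ≤ σ) (hb : ∀ n, ‖g n‖ ≤ K * ((n:ℝ)+1) ^ (-σ - 1))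
    (hs : HasSum g G) (N : ℕ) : ‖G - ∑ n ∈ range N, g n‖ ≤ K * ((N:ℝ)+1) ^ (-σ + δ) * ∑' n : ℕ, ((n:ℝ)+1) ^ (-(1 + δ)) := by
  have hK : 0 ≤ K := by have := (norm_nonneg _).trans (hb 0); simpa using this
  have hsum := (summable_shift (r := 1 + δ) (by linarith)).mul_left (K * ((N:ℝ)+1) ^ (-σ + δ))
  have h1 : ∀ n, ‖g (n + N)‖ ≤ (K * ((N:ℝ)+1) ^ (-σ + δ)) * ((n:ℝ)+1) ^ (-(1 + δ)) := by
    intro n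
    refine (hb _).trans ?_
    rw [mul_assoc]
    gcongr
    have e : -σ - 1 = (-σ + δ) + (-(1+δ)) := by ring
    rw [e, Real.rpow_add (by positivity)]
    have a1 : (((n + N : ℕ) : ℝ) + 1)^(-σ + δ) ≤ ((N:ℝ)+1)^(-σ+δ) := by
      apply Real.rpow_le_rpow_of_nonpos (by positivity) _ (by linarith)
      push_cast; have : (0:ℝ) ≤ n := by positivity
      linarith
    have a2 : (((n + N : ℕ) : ℝ) + 1)^(-(1+δ)) ≤ ((n:ℝ)+1)^(-(1+δ)) := by
      apply Real.rpow_le_rpow_of_nonpos (by positivity) _ (by linarith)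
      push_cast; have : (0:ℝ) ≤ N := by positivity
      linarith
    gcongr
  have h2 : G - ∑ n ∈ range N, g n = ∑' n, g (n + N) := by
    rw [← hs.tsum_eq, ← hs.summable.sum_add_tsum_nat_add N]; ring
  rw [h2]
  refine (tsum_of_norm_bounded hsum.hasSum h1).trans ?_
  rw [tsum_mul_left]

lemma fin_sum_bound {σ ε : ℝ} (hε : 0 < ε) (hσ : 1 - ε ≤ σ) (N : ℕ) :
    ∑ n ∈ range N, ((n:ℝ)+1) ^ (-σ) ≤ ((N:ℝ)+1) ^ (2*ε) * ∑' n : ℕ, ((n:ℝ)+1) ^ (-(1 + ε)) := by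
  have hsm := summable_shift (r := 1 + ε) (by linarith)
  calc _ ≤ ∑ n ∈ range N, ((N:ℝ)+1) ^ (2*ε) * ((n:ℝ)+1) ^ (-(1 + ε)) := by
        apply sum_le_sum; intro n hn
        have hn' : (n:ℝ) ≤ N := by exact_mod_cast (mem_range.1 hn).le
        have : ((n:ℝ)+1)^(-σ) ≤ ((n:ℝ)+1)^((2*ε) + (-(1+ε))) := by
          apply Real.rpow_le_rpow_of_exponent_le (by linarith [(Nat.cast_nonneg n : (0:ℝ) ≤ n)]) (by linarith)
        rw [Real.rpow_add (by positivity)] at this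
        refine this.trans ?_
        gcongr
    _ = ((N:ℝ)+1) ^ (2*ε) * ∑ n ∈ range N, ((n:ℝ)+1) ^ (-(1 + ε)) := by rw [mul_sum]
    _ ≤ _ := by
        gcongr
        exact hsm.sum_le_tsum _ (fun _ _ => by positivity)

end Cay

namespace Cay
open Finset

lemma differentiable_ncpow (n : ℝ) (hn : 0 < n) : Differentiable ℂ fun s : ℂ => (n:ℂ)^(-s) := by
  have : (n:ℂ) ≠ 0 := by exact_mod_cast hn.ne'
  intro s
  exact (differentiableAt_id.neg).const_cpow (Or.inl this)

lemma differentiable_ncpow' (n : ℝ) (hn : 0 < n) : Differentiable ℂ fun s : ℂ => (n:ℂ)^(1-s) := by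
  have : (n:ℂ) ≠ 0 := by exact_mod_cast hn.ne'
  intro s
  exact (differentiableAt_id.const_sub 1).const_cpow (Or.inl this)

lemma L_partial {q : ℕ} (χ : DirichletCharacter ℂ q) (h0 : χ 0 = 0) (s : ℂ) (N : ℕ) :
    ∑ n ∈ range N, (∑ m ∈ range (n+2), χ (m : ZMod q)) * ((((n:ℝ)+1 : ℝ) : ℂ)^(-s) - (((n:ℝ)+1+1 : ℝ):ℂ)^(-s)) =
    ∑ n ∈ range N, χ ((n+1 : ℕ) : ZMod q) * (((n:ℝ)+1 : ℝ) : ℂ)^(-s) - (∑ m ∈ range (N+1), χ (m : ZMod q)) * (((N:ℝ)+1 : ℝ):ℂ)^(-s) := by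
  induction N with
  | zero => simp [h0]
  | succ N ih =>
    rw [sum_range_succ, ih, sum_range_succ (fun n => χ ((n+1 : ℕ) : ZMod q) * (((n:ℝ)+1 : ℝ) : ℂ)^(-s)) N, sum_range_succ (fun m : ℕ => χ (m : ZMod q)) (N+1)]
    push_cast
    ring

lemma norm_ncpow {n : ℝ} (hn : 0 < n) (s : ℂ) : ‖(n:ℂ)^(-s)‖ = n ^ (-s.re) := by
  rw [Complex.norm_cpow_eq_rpow_re_of_pos hn]; simp

lemma chi_zero {q : ℕ} [NeZero q] {χ : DirichletCharacter ℂ q} (hχ : χ ≠ 1) : χ 0 = 0 := by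
  apply χ.map_zero'
  rintro rfl
  exact hχ (DirichletCharacter.level_one χ)

lemma L_term_bound {q : ℕ} [NeZero q] {χ : DirichletCharacter ℂ q} (hχ : χ ≠ 1) (s : ℂ) (hs : 0 < s.re) (n : ℕ) :
    ‖(∑ m ∈ range (n+2), χ (m : ZMod q)) * ((((n:ℝ)+1 : ℝ) : ℂ)^(-s) - (((n:ℝ)+1+1 : ℝ):ℂ)^(-s))‖ ≤
      q * ‖s‖ * ((n:ℝ)+1) ^ (-s.re - 1) := by
  rw [norm_mul, mul_assoc]
  have := cpow_diff_le hs (n := (n:ℝ)+1) (by linarith [(Nat.cast_nonneg n : (0:ℝ) ≤ n)]) (x := (n:ℝ)+1+1) (y := (n:ℝ)+1)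
    (by constructor <;> linarith) (by constructor <;> linarith)
  gcongr
  exact char_sum_le hχ _

lemma L_hasSum {q : ℕ} [NeZero q] {χ : DirichletCharacter ℂ q} (hχ : χ ≠ 1) {s : ℂ} (hs : 0 < s.re) :
    HasSum (fun n : ℕ => (∑ m ∈ range (n+2), χ (m : ZMod q)) * ((((n:ℝ)+1 : ℝ) : ℂ)^(-s) - (((n:ℝ)+1+1 : ℝ):ℂ)^(-s)))
      (χ.LFunction s) := by
  refine continue_series (K := q) (g := fun (n : ℕ) (s : ℂ) => (∑ m ∈ range (n+2), χ (m : ZMod q)) * ((((n:ℝ)+1 : ℝ) : ℂ)^(-s) - (((n:ℝ)+1+1 : ℝ):ℂ)^(-s)))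
    (DirichletCharacter.differentiable_LFunction hχ) ?_ ?_ ?_ hs
  · intro n
    exact ((differentiable_ncpow _ (by positivity)).sub (differentiable_ncpow _ (by positivity))).const_mul _
  · intro n s hs
    refine (L_term_bound hχ s hs n).trans ?_
    gcongr
    nlinarith [norm_nonneg s]
  · intro s hs
    have hsm : Summable (fun n : ℕ => (∑ m ∈ range (n+2), χ (m : ZMod q)) * ((((n:ℝ)+1 : ℝ) : ℂ)^(-s) - (((n:ℝ)+1+1 : ℝ):ℂ)^(-s))) := by
      apply Summable.of_norm_bounded _ (fun n => L_term_bound hχ s (by linarith) n)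
      apply Summable.mul_left
      have := summable_shift (r := s.re + 1) (by linarith)
      refine this.congr fun n => ?_
      congr 1; ring
    have h1 := hsm.hasSum.tendsto_sum_nat
    simp_rw [L_partial χ (chi_zero hχ)] at h1
    rw [χ.LFunction_eq_LSeries hs]
    refine tendsto_nhds_unique ?_ h1
    rw [← sub_zero (LSeries _ s)]
    apply Filter.Tendsto.sub
    · have := (χ.LSeriesSummable_of_one_lt_re hs).hasSum.tendsto_sum_nat
      have h2 := (Filter.tendsto_add_atTop_iff_nat 1).2 this
      refine h2.congr fun N => ?_
      rw [sum_range_succ', LSeries.term_zero, add_zero]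
      apply sum_congr rfl
      intro n _
      rw [LSeries.term_of_ne_zero (by omega), Complex.cpow_neg, div_eq_mul_inv]
      push_cast; rfl
    · apply squeeze_zero_norm (a := fun N : ℕ => (q:ℝ) * ((N:ℝ)+1)^(-s.re))
      · intro N
        rw [norm_mul, norm_ncpow (by positivity)]
        gcongr
        exact char_sum_le hχ _
      · rw [← mul_zero (q:ℝ)]
        apply Filter.Tendsto.const_mul
        have := (tendsto_rpow_neg_atTop (show 0 < s.re by linarith)).comp (Filter.tendsto_atTop_add_const_right _ (1:ℝ) tendsto_natCast_atTop_atTop)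
        exact this

lemma V_aux {q : ℝ} (hq : 1 ≤ q) {s : ℂ} {ε : ℝ} (hε : 0 < ε) (hε2 : ε < 1/2) (h1 : 1 - ε ≤ s.re) (h2 : s.re ≤ 3)
    {N : ℕ} (hN : N = ⌊q * (|s.im| + 2)⌋₊) :
    q * ‖s‖ * ((N:ℝ)+1)^(-s.re + ε) ≤ 2 * (q * (|s.im| + 2))^(2*ε) ∧
    ((N:ℝ)+1)^(2*ε) ≤ 2 * (q * (|s.im| + 2))^(2*ε) ∧
    q * ((N:ℝ)+1)^(-s.re) ≤ (q * (|s.im| + 2))^(2*ε) := by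
  set V := q * (|s.im| + 2) with hV
  have hV1 : 1 ≤ V := by nlinarith [abs_nonneg s.im]
  have hVq : q ≤ V := by nlinarith [abs_nonneg s.im]
  have hN1 : V ≤ N + 1 := by rw [hN]; exact (Nat.lt_floor_add_one V).le
  have hN2 : (N:ℝ) + 1 ≤ 2 * V := by
    have : (N:ℝ) ≤ V := by rw [hN]; exact Nat.floor_le (by linarith)
    linarith
  have hsn : ‖s‖ ≤ 2 * (|s.im| + 2) := by
    have := Complex.norm_le_abs_re_add_abs_im s
    rw [abs_of_nonneg (by linarith : 0 ≤ s.re)] at this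
    linarith [abs_nonneg s.im]
  refine ⟨?_, ?_, ?_⟩
  · have a1 : ((N:ℝ)+1)^(-s.re+ε) ≤ V^(-1+2*ε) := by
      calc _ ≤ V^(-s.re+ε) := Real.rpow_le_rpow_of_nonpos (by linarith) hN1 (by linarith)
        _ ≤ _ := Real.rpow_le_rpow_of_exponent_le hV1 (by linarith)
    calc q * ‖s‖ * ((N:ℝ)+1)^(-s.re + ε) ≤ (2 * V) * V^(-1+2*ε) := by
          apply mul_le_mul _ a1 (by positivity) (by positivity)
          nlinarith
      _ = 2 * V^(2*ε) := by
          rw [Real.rpow_add (by linarith), Real.rpow_neg_one]; field_simp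
  · calc ((N:ℝ)+1)^(2*ε) ≤ (2*V)^(2*ε) := by gcongr
      _ = 2^(2*ε) * V^(2*ε) := Real.mul_rpow (by norm_num) (by linarith)
      _ ≤ _ := by
        gcongr
        calc (2:ℝ)^(2*ε) ≤ 2^(1:ℝ) := Real.rpow_le_rpow_of_exponent_le (by norm_num) (by linarith)
          _ = 2 := by norm_num
  · have a1 : ((N:ℝ)+1)^(-s.re) ≤ V^(-1+2*ε) := by
      calc _ ≤ V^(-s.re) := Real.rpow_le_rpow_of_nonpos (by linarith) hN1 (by linarith)
        _ ≤ _ := Real.rpow_le_rpow_of_exponent_le hV1 (by linarith)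
    calc _ ≤ V * V^(-1+2*ε) := by gcongr
      _ = V^(2*ε) := by
          rw [Real.rpow_add (by linarith), Real.rpow_neg_one]; field_simp

/-- upper bound for nonprincipal L-functions slightly to the left of 1 -/
theorem L_upper {ε : ℝ} (hε : 0 < ε) (hε2 : ε < 1/2) : ∃ C : ℝ, 1 ≤ C ∧ ∀ (q : ℕ) [NeZero q] (χ : DirichletCharacter ℂ q), χ ≠ 1 →
    ∀ s : ℂ, 1 - ε ≤ s.re → s.re ≤ 3 → ‖χ.LFunction s‖ ≤ C * ((q:ℝ) * (|s.im| + 2))^(2*ε) := by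
  set Z := ∑' n : ℕ, ((n:ℝ)+1) ^ (-(1 + ε)) with hZ
  have hZ0 : 0 ≤ Z := tsum_nonneg fun n => by positivity
  refine ⟨4 * Z + 1, by linarith, ?_⟩
  intro q _ χ hχ s h1 h2
  have hq : (1:ℝ) ≤ q := by exact_mod_cast NeZero.pos q
  obtain ⟨b1, b2, b3⟩ := V_aux hq hε hε2 h1 h2 rfl
  set N := ⌊(q:ℝ) * (|s.im| + 2)⌋₊
  have hs : 0 < s.re := by linarith
  have t := tail_bound hε (by linarith) (fun n => L_term_bound hχ s hs n) (L_hasSum hχ hs) N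
  rw [L_partial χ (chi_zero hχ)] at t
  have f := fin_sum_bound hε h1 N
  have f2 : ‖∑ n ∈ range N, χ ((n+1 : ℕ) : ZMod q) * (((n:ℝ)+1 : ℝ) : ℂ)^(-s)‖ ≤ ∑ n ∈ range N, ((n:ℝ)+1) ^ (-s.re) := by
    refine (norm_sum_le _ _).trans (sum_le_sum fun n _ => ?_)
    rw [norm_mul, norm_ncpow (by positivity)]
    exact mul_le_of_le_one_left (by positivity) (χ.norm_le_one _)
  have f3 : ‖(∑ m ∈ range (N+1), χ (m : ZMod q)) * (((N:ℝ)+1 : ℝ):ℂ)^(-s)‖ ≤ q * ((N:ℝ)+1)^(-s.re) := by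
    rw [norm_mul, norm_ncpow (by positivity)]
    gcongr
    exact char_sum_le hχ _
  set A := ∑ n ∈ range N, χ ((n+1 : ℕ) : ZMod q) * (((n:ℝ)+1 : ℝ) : ℂ)^(-s)
  set E := (∑ m ∈ range (N+1), χ (m : ZMod q)) * (((N:ℝ)+1 : ℝ):ℂ)^(-s)
  have key : ‖χ.LFunction s‖ ≤ ‖χ.LFunction s - (A - E)‖ + ‖A‖ + ‖E‖ := by
    calc ‖χ.LFunction s‖ = ‖(χ.LFunction s - (A - E)) + (A - E)‖ := by congr 1; ring
      _ ≤ _ := by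
        refine (norm_add_le _ _).trans ?_
        linarith [norm_sub_le A E]
  set W := ((q:ℝ) * (|s.im| + 2))^(2*ε)
  have g1 : ↑q * ‖s‖ * (↑N + 1) ^ (-s.re + ε) * Z ≤ 2 * W * Z := mul_le_mul_of_nonneg_right b1 hZ0
  have g2 : ((N:ℝ) + 1) ^ (2 * ε) * Z ≤ 2 * W * Z := mul_le_mul_of_nonneg_right b2 hZ0
  linarith

lemma zeta_partial (s : ℂ) (N : ℕ) :
    ∑ n ∈ range N, ((s - 1) * (((n:ℝ)+1 : ℝ):ℂ)^(-s) - ((((n:ℝ)+1:ℝ):ℂ)^(1-s) - (((n:ℝ)+1+1 : ℝ):ℂ)^(1-s))) =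
    (s-1) * ∑ n ∈ range N, (((n:ℝ)+1 : ℝ):ℂ)^(-s) + (((N:ℝ)+1 : ℝ):ℂ)^(1-s) - 1 := by
  induction N with
  | zero => simp
  | succ N ih =>
    rw [sum_range_succ, ih, sum_range_succ]
    push_cast
    ring

lemma zeta_term_bound (s : ℂ) (hs : 0 < s.re) (n : ℕ) :
    ‖(s - 1) * (((n:ℝ)+1 : ℝ):ℂ)^(-s) - ((((n:ℝ)+1:ℝ):ℂ)^(1-s) - (((n:ℝ)+1+1 : ℝ):ℂ)^(1-s))‖ ≤
      ‖1 - s‖ * ‖s‖ * ((n:ℝ)+1) ^ (-s.re - 1) := by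
  rw [mul_assoc]
  exact cpow_diff2_le hs (by linarith [(Nat.cast_nonneg n : (0:ℝ) ≤ n)])

lemma zeta_hasSum {s : ℂ} (hs : 0 < s.re) :
    HasSum (fun n : ℕ => (s - 1) * (((n:ℝ)+1 : ℝ):ℂ)^(-s) - ((((n:ℝ)+1:ℝ):ℂ)^(1-s) - (((n:ℝ)+1+1 : ℝ):ℂ)^(1-s)))
      (riemannZeta₁ s - 1) := by
  refine continue_series (K := 1) (G := fun s => riemannZeta₁ s - 1) (g := fun (n : ℕ) (s : ℂ) => (s - 1) * (((n:ℝ)+1 : ℝ):ℂ)^(-s) - ((((n:ℝ)+1:ℝ):ℂ)^(1-s) - (((n:ℝ)+1+1 : ℝ):ℂ)^(1-s)))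
    (differentiable_riemannZeta₁.sub_const 1) ?_ ?_ ?_ hs
  · intro n
    exact ((differentiable_id.sub_const 1).mul (differentiable_ncpow _ (by positivity))).sub ((differentiable_ncpow' _ (by positivity)).sub (differentiable_ncpow' _ (by positivity)))
  · intro n s hs
    refine (zeta_term_bound s hs n).trans ?_
    apply mul_le_mul_of_nonneg_right _ (by positivity)
    have : ‖1 - s‖ ≤ 1 + ‖s‖ := by simpa using norm_sub_le 1 s
    nlinarith [norm_nonneg s]
  · intro s hs
    have hsm : Summable (fun n : ℕ => (s - 1) * (((n:ℝ)+1 : ℝ):ℂ)^(-s) - ((((n:ℝ)+1:ℝ):ℂ)^(1-s) - (((n:ℝ)+1+1 : ℝ):ℂ)^(1-s))) := by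
      apply Summable.of_norm_bounded _ (fun n => zeta_term_bound s (by linarith) n)
      apply Summable.mul_left
      have := summable_shift (r := s.re + 1) (by linarith)
      refine this.congr fun n => ?_
      congr 1; ring
    have h1 := hsm.hasSum.tendsto_sum_nat
    simp_rw [zeta_partial s] at h1
    have hs1 : s ≠ 1 := by rintro rfl; simp at hs
    have e : riemannZeta₁ s = (s - 1) * riemannZeta s := by
      rw [riemannZeta_eq_inv_sub_mul hs1]
      have : s - 1 ≠ 0 := sub_ne_zero.2 hs1
      field_simp
    refine tendsto_nhds_unique ?_ h1
    change Filter.Tendsto _ _ (nhds (riemannZeta₁ s - 1))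
    rw [e]
    apply Filter.Tendsto.sub_const
    rw [← add_zero ((s-1) * riemannZeta s)]
    apply Filter.Tendsto.add
    · apply Filter.Tendsto.const_mul
      have h0 : LSeriesSummable 1 s := LSeriesSummable_one_iff.2 hs
      have h3 := h0.hasSum.tendsto_sum_nat
      have h4 : ∑' n, LSeries.term 1 s n = riemannZeta s := LSeries_one_eq_riemannZeta hs
      rw [h4] at h3
      have h2 := (Filter.tendsto_add_atTop_iff_nat 1).2 h3
      refine h2.congr fun N => ?_
      rw [sum_range_succ', LSeries.term_zero, add_zero]
      apply sum_congr rfl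
      intro n _
      rw [LSeries.term_of_ne_zero (by omega), Complex.cpow_neg, Pi.one_apply, one_div]
      push_cast; rfl
    · apply squeeze_zero_norm (a := fun N : ℕ => ((N:ℝ)+1)^(-(s.re-1)))
      · intro N
        rw [Complex.norm_cpow_eq_rpow_re_of_pos (by positivity)]
        apply le_of_eq; congr 1; simp
      · have := (tendsto_rpow_neg_atTop (show 0 < s.re - 1 by linarith)).comp (Filter.tendsto_atTop_add_const_right _ (1:ℝ) tendsto_natCast_atTop_atTop)
        exact this

/-- upper bound for zeta -/
theorem zeta_upper {ε : ℝ} (hε : 0 < ε) (hε2 : ε < 1/2) : ∃ C : ℝ, 1 ≤ C ∧ 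
    ∀ s : ℂ, s ≠ 1 → 1 - ε ≤ s.re → s.re ≤ 3 → ‖riemannZeta s‖ ≤ C * (|s.im| + 2)^(2*ε) * (1 + 1 / ‖s - 1‖) := by
  set Z := ∑' n : ℕ, ((n:ℝ)+1) ^ (-(1 + ε)) with hZ
  have hZ0 : 0 ≤ Z := tsum_nonneg fun n => by positivity
  refine ⟨4 * Z + 3, by linarith, ?_⟩
  intro s hs1 h1 h2
  obtain ⟨b1, b2, b3⟩ := V_aux (le_refl (1:ℝ)) hε hε2 h1 h2 rfl
  simp only [one_mul] at b1 b2 b3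
  set N := ⌊|s.im| + 2⌋₊
  have hs : 0 < s.re := by linarith
  have t := tail_bound hε (by linarith) (fun n => zeta_term_bound s hs n) (zeta_hasSum hs) N
  rw [zeta_partial] at t
  have f := fin_sum_bound hε h1 N
  have f2 : ‖∑ n ∈ range N, (((n:ℝ)+1 : ℝ) : ℂ)^(-s)‖ ≤ ∑ n ∈ range N, ((n:ℝ)+1) ^ (-s.re) := by
    refine (norm_sum_le _ _).trans (sum_le_sum fun n _ => ?_)
    rw [norm_ncpow (by positivity)]
  have f3 : ‖(((N:ℝ)+1 : ℝ):ℂ)^(1-s)‖ ≤ ((N:ℝ)+1)^(2*ε) := by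
    rw [Complex.norm_cpow_eq_rpow_re_of_pos (by positivity)]
    apply Real.rpow_le_rpow_of_exponent_le (by linarith [(Nat.cast_nonneg N : (0:ℝ) ≤ N)])
    simp; linarith
  set A := ∑ n ∈ range N, (((n:ℝ)+1 : ℝ) : ℂ)^(-s)
  set E := (((N:ℝ)+1 : ℝ):ℂ)^(1-s)
  have hd : s - 1 ≠ 0 := sub_ne_zero.2 hs1
  have hd' : 0 < ‖s - 1‖ := norm_pos_iff.2 hd
  rw [riemannZeta_eq_inv_sub_mul hs1, norm_mul, norm_inv]
  have key : ‖riemannZeta₁ s‖ ≤ ‖1 - s‖ * ‖s‖ * ((N:ℝ)+1)^(-s.re+ε) * Z + ‖s-1‖ * ‖A‖ + ‖E‖ := by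
    calc ‖riemannZeta₁ s‖ = ‖(riemannZeta₁ s - 1 - ((s-1) * A + E - 1)) + (s-1) * A + E‖ := by congr 1; ring
      _ ≤ _ := by
        refine (norm_add_le _ _).trans ?_
        gcongr
        refine (norm_add_le _ _).trans ?_
        rw [norm_mul]
        gcongr
  set W := (|s.im| + 2)^(2*ε)
  have hW : 0 ≤ W := by positivity
  have g1 : ‖s‖ * ((N:ℝ) + 1) ^ (-s.re + ε) * Z ≤ 2 * W * Z := mul_le_mul_of_nonneg_right b1 hZ0
  have g2 : ((N:ℝ) + 1) ^ (2 * ε) * Z ≤ 2 * W * Z := mul_le_mul_of_nonneg_right b2 hZ0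
  rw [norm_sub_rev 1 s] at key
  have k2 : ‖riemannZeta₁ s‖ ≤ ‖s-1‖ * (4 * Z * W) + 2 * W := by
    have : ‖s-1‖ * (‖s‖ * ((N:ℝ) + 1) ^ (-s.re + ε) * Z + ‖A‖) ≤ ‖s-1‖ * (4 * Z * W) := by
      gcongr; linarith
    nlinarith
  calc ‖s-1‖⁻¹ * ‖riemannZeta₁ s‖ ≤ ‖s-1‖⁻¹ * (‖s-1‖ * (4 * Z * W) + 2 * W) := by gcongr
    _ = 4 * Z * W + 2 * W * (1 / ‖s-1‖) := by field_simp
    _ ≤ _ := by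
      have : 0 ≤ 1 / ‖s-1‖ := by positivity
      nlinarith [mul_nonneg (mul_nonneg hZ0 hW) this, mul_nonneg hW this]

end Cay

namespace Cay
open Finset Metric

lemma deriv_bound {P : ℂ → ℂ} {s₀ : ℂ} {ρ M : ℝ} (hρ : 0 < ρ) (hd : DifferentiableOn ℂ P (ball s₀ ρ))
    (hM : ∀ z ∈ ball s₀ ρ, ‖P z‖ ≤ M) {z : ℂ} (hz : z ∈ closedBall s₀ (ρ/2)) : ‖deriv P z‖ ≤ 3 * M / ρ := by
  have hsub : closedBall z (ρ/3) ⊆ ball s₀ ρ := by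
    intro w hw
    rw [mem_closedBall] at hw hz
    rw [mem_ball]
    linarith [dist_triangle w z s₀]
  have := Complex.norm_deriv_le_of_forall_mem_sphere_norm_le (c := z) (R := ρ/3) (by linarith) (hd.diffContOnCl_ball hsub)
    (fun w hw => hM w (hsub (sphere_subset_closedBall hw)))
  refine this.trans (le_of_eq ?_)
  field_simp

/-- local bound for derivatives of the logarithmic derivative -/
lemma logderiv_bound {P : ℂ → ℂ} {s₀ : ℂ} {ρ M m : ℝ} (hρ : 0 < ρ) (hd : DifferentiableOn ℂ P (ball s₀ ρ))
    (hM : ∀ z ∈ ball s₀ ρ, ‖P z‖ ≤ M) (hm : 0 < m) (hm2 : m ≤ ‖P s₀‖) (k : ℕ) :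
    ‖iteratedDeriv k (fun z => deriv P z / P z) s₀‖ ≤ k.factorial * (8 * M / (ρ * m))^(k+1) := by
  have hmM : m ≤ M := hm2.trans (hM s₀ (mem_ball_self hρ))
  have hM0 : 0 < M := by linarith
  set r := ρ * m / (8 * M) with hr
  have hr0 : 0 < r := by positivity
  have hr8 : r ≤ ρ / 8 := by
    rw [hr, div_le_div_iff₀ (by positivity) (by norm_num)]
    nlinarith
  have hlow : ∀ z ∈ closedBall s₀ r, m / 2 ≤ ‖P z‖ := by
    intro z hz
    have h1 : ‖P z - P s₀‖ ≤ 3 * M / ρ * ‖z - s₀‖ := by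
      apply (convex_closedBall s₀ (ρ/2)).norm_image_sub_le_of_norm_deriv_le (𝕜 := ℂ) (f := P)
      · intro x hx
        apply hd.differentiableAt (isOpen_ball.mem_nhds _)
        exact closedBall_subset_ball (by linarith) hx
      · intro x hx; exact deriv_bound hρ hd hM hx
      · simp; linarith
      · exact closedBall_subset_closedBall (by linarith) hz
    have h2 : ‖z - s₀‖ ≤ r := by simpa [dist_eq_norm] using hz
    have h3 : 3 * M / ρ * ‖z - s₀‖ ≤ 3 * m / 8 := by
      calc _ ≤ 3 * M / ρ * r := by gcongr
        _ = _ := by rw [hr]; field_simp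
    have h4 : ‖P s₀‖ - ‖P z‖ ≤ ‖P z - P s₀‖ := by rw [norm_sub_rev]; exact norm_sub_norm_le _ _
    linarith
  have hsub : closedBall s₀ r ⊆ ball s₀ ρ := closedBall_subset_ball (by linarith)
  have hdc : DiffContOnCl ℂ (fun z => deriv P z / P z) (ball s₀ r) := by
    apply DifferentiableOn.diffContOnCl_ball (U := closedBall s₀ r) _ subset_rfl
    apply DifferentiableOn.div
    · exact (hd.deriv isOpen_ball).mono hsub
    · exact hd.mono hsub
    · intro z hz h0
      have := hlow z hz
      rw [h0, norm_zero] at this; linarith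
  have := Complex.norm_iteratedDeriv_le_of_forall_mem_sphere_norm_le k hr0 hdc (C := 8 * M / (ρ * m)) (by
    intro z hz
    have hz' := sphere_subset_closedBall hz
    have a1 := hlow z hz'
    have a2 := deriv_bound hρ hd hM (closedBall_subset_closedBall (by linarith : r ≤ ρ/2) hz')
    rw [norm_div]
    calc _ ≤ (3 * M / ρ) / (m / 2) := by gcongr
      _ = 6 * M / (ρ * m) := by field_simp; norm_num
      _ ≤ _ := by gcongr; norm_num)
  refine this.trans (le_of_eq ?_)
  rw [hr, pow_succ]
  field_simp
  rw [← mul_pow, show ρ*m/(8*M)*(8*M/(ρ*m)) = 1 by field_simp, one_pow]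

/-- from a 3-4-1 bound to a lower bound up to the line 1 -/
lemma low_bound {P : ℂ → ℂ} {t a M : ℝ} (ha : 0 < a) (ha1 : a ≤ 1) (hM : 1 ≤ M)
    (hd : ∀ x : ℝ, 1 ≤ x → x ≤ 2 → DifferentiableAt ℂ P (x + t * Complex.I))
    (hM' : ∀ x : ℝ, 1 ≤ x → x ≤ 2 → ‖deriv P (x + t * Complex.I)‖ ≤ M)
    (h341 : ∀ η : ℝ, 0 < η → η ≤ 1 → a^4 * η^3 ≤ ‖P ((1 + η : ℝ) + t * Complex.I)‖^4) (σ : ℝ) (h1 : 1 ≤ σ) (h2 : σ ≤ 2) :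
    a^4 / (16 * M^3) ≤ ‖P (σ + t * Complex.I)‖ := by
  set η := (a / (2 * M))^4 with hη
  have hη0 : 0 < η := by positivity
  have hq1 : a / (2 * M) ≤ 1 := by rw [div_le_one (by positivity)]; linarith
  have hη1 : η ≤ 1 := pow_le_one₀ (by positivity) hq1
  have h3 : ∀ η' : ℝ, η ≤ η' → η' ≤ 1 → a * (a / (2*M))^3 ≤ ‖P ((1 + η' : ℝ) + t * Complex.I)‖ := by
    intro η' h h'
    apply (pow_le_pow_iff_left₀ (by positivity) (norm_nonneg _) (show (4:ℕ) ≠ 0 by norm_num)).1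
    refine le_trans ?_ (h341 η' (by linarith) h')
    calc (a * (a / (2*M))^3)^4 = a^4 * η^3 := by rw [hη]; ring
      _ ≤ _ := by gcongr
  have e : a * (a / (2*M))^3 = 2 * (a^4 / (16 * M^3)) := by field_simp; ring
  have hp : 0 ≤ a^4 / (16 * M^3) := by positivity
  by_cases hc : 1 + η ≤ σ
  · have := h3 (σ - 1) (by linarith) (by linarith)
    rw [e] at this
    have e2 : ((1 + (σ - 1) : ℝ) : ℂ) = σ := by push_cast; ring
    rw [e2] at this; linarith
  · push Not at hc
    have h4 := h3 η le_rfl hη1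
    have h5 : ‖P ((1+η : ℝ) + t * Complex.I) - P (σ + t * Complex.I)‖ ≤ M * ‖(1+η) - σ‖ := by
      have := (convex_Icc (1:ℝ) 2).norm_image_sub_le_of_norm_hasDerivWithin_le (f := fun x : ℝ => P (x + t * Complex.I))
        (f' := fun x : ℝ => deriv P (x + t * Complex.I)) (C := M) (x := σ) (y := 1 + η) ?_ ?_ ⟨h1, h2⟩ ⟨by linarith, by linarith⟩
      · simpa using this
      · intro x hx
        have h := (hd x hx.1 hx.2).hasDerivAt
        have h' : HasDerivAt (fun x : ℝ => ((x:ℂ) + t * Complex.I)) 1 x := 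
          (Complex.ofRealCLM.hasDerivAt (x := x)).add_const _ |>.congr_deriv (by simp)
        have := HasDerivAt.comp x (h₂ := P) h h'
        rw [mul_one] at this
        exact this.hasDerivWithinAt
      · intro x hx; exact hM' x hx.1 hx.2
    have h6 : M * ‖(1+η) - σ‖ ≤ M * η := by
      gcongr
      rw [Real.norm_eq_abs, abs_of_pos (by linarith)]; linarith
    have h7 : M * η = (a^4 / (16 * M^3)) := by rw [hη]; field_simp; norm_num
    have h8 := norm_sub_norm_le (P ((1+η : ℝ) + t * Complex.I)) (P (σ + t * Complex.I))
    linarith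

lemma norm_L_le {q : ℕ} [NeZero q] (χ : DirichletCharacter ℂ q) {s : ℂ} (hs : 1 < s.re) :
    ‖χ.LFunction s‖ ≤ ‖riemannZeta (s.re : ℂ)‖ := by
  have hre : (1:ℝ) < (s.re : ℂ).re := by simpa using hs
  have h0 : LSeriesSummable 1 (s.re : ℂ) := LSeriesSummable_one_iff.2 hre
  have hn : ∀ n, ‖LSeries.term (fun n : ℕ => χ n) s n‖ ≤ ‖LSeries.term 1 (s.re:ℂ) n‖ := by
    intro n
    apply le_trans (LSeries.norm_term_le (g := 1) s (by simpa using χ.norm_le_one _))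
    apply LSeries.norm_term_le_of_re_le_re
    simp
  have e : ∑' n, ‖LSeries.term 1 (s.re:ℂ) n‖ = ‖riemannZeta (s.re : ℂ)‖ := by
    rw [← LSeries_one_eq_riemannZeta hre, LSeries]
    have hc : ∀ n, LSeries.term 1 (s.re : ℂ) n = ((‖LSeries.term 1 (s.re:ℂ) n‖ : ℝ) : ℂ) := by
      intro n
      rcases eq_or_ne n 0 with rfl | h
      · simp
      · rw [LSeries.norm_term_eq, if_neg h, LSeries.term_of_ne_zero h]
        push_cast
        simp
        rw [Complex.ofReal_cpow (Nat.cast_nonneg n)]; simp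
    rw [tsum_congr hc, ← Complex.ofReal_tsum, Complex.norm_real, Real.norm_eq_abs, abs_of_nonneg]
    exact tsum_nonneg fun _ => norm_nonneg _
  rw [← e, χ.LFunction_eq_LSeries hs]
  refine tsum_of_norm_bounded (Summable.hasSum ?_) hn
  exact h0.norm

lemma zeta_real_bound : ∃ C : ℝ, 1 ≤ C ∧ ∀ η : ℝ, 0 < η → η ≤ 1 → ‖riemannZeta ((1 + η : ℝ) : ℂ)‖ ≤ C / η := by
  obtain ⟨C, hC, h⟩ := zeta_upper (ε := 1/4) (by norm_num) (by norm_num)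
  refine ⟨C * 2^(2*(1/4):ℝ) * 2, ?_, ?_⟩
  · have : (1:ℝ) ≤ 2^(2*(1/4):ℝ) := Real.one_le_rpow (by norm_num) (by norm_num)
    nlinarith
  intro η h0 h1
  have := h ((1 + η : ℝ) : ℂ) (by norm_cast; linarith) (by rw [Complex.ofReal_re]; linarith) (by rw [Complex.ofReal_re]; linarith)
  refine this.trans ?_
  rw [Complex.ofReal_im]
  have e : ‖((1 + η : ℝ) : ℂ) - 1‖ = η := by push_cast; simp [abs_of_pos h0]
  rw [e]; simp only [abs_zero, zero_add]
  rw [mul_div_assoc]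
  gcongr
  rw [le_div_iff₀ h0]; field_simp; linarith

lemma prod_gen {ε : ℝ} (hε : 0 < ε) : ∃ C : ℝ, 1 ≤ C ∧ ∀ (q : ℕ), q ≠ 0 → ∀ f : ℕ → ℂ, (∀ p : ℕ, p.Prime → ‖f p‖ ≤ 2) →
    ‖∏ p ∈ q.primeFactors, f p‖ ≤ C * (q:ℝ)^ε := by
  set P := ⌈(2:ℝ)^(1/ε)⌉₊ with hP
  refine ⟨2^P, one_le_pow₀ (by norm_num), ?_⟩
  intro q hq f hf
  rw [norm_prod]
  have h1 : ∀ p ∈ q.primeFactors, ‖f p‖ ≤ (if p < P then 2 else 1) * (p:ℝ)^ε := by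
    intro p hp
    have hp' := Nat.prime_of_mem_primeFactors hp
    have hp1 : (1:ℝ) ≤ p := by exact_mod_cast hp'.one_lt.le
    have a : ‖f p‖ ≤ 2 := hf p hp'
    have b : 1 ≤ (p:ℝ)^ε := Real.one_le_rpow hp1 hε.le
    split_ifs with h
    · linarith
    · rw [one_mul]
      refine a.trans ?_
      have : (2:ℝ)^(1/ε) ≤ p := (Nat.le_ceil _).trans (by exact_mod_cast not_lt.1 h)
      calc (2:ℝ) = ((2:ℝ)^(1/ε))^ε := by rw [← Real.rpow_mul (by norm_num)]; field_simp; norm_num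
        _ ≤ _ := by gcongr
  refine (prod_le_prod (fun _ _ => norm_nonneg _) h1).trans ?_
  rw [prod_mul_distrib]
  gcongr
  · rw [prod_ite, prod_const_one, mul_one, prod_const]
    apply pow_le_pow_right₀ (by norm_num)
    calc _ ≤ (range P).card := by
          apply card_le_card
          intro p hp
          simpa using (mem_filter.1 hp).2
      _ = P := card_range P
  · rw [Real.finsetProd_rpow _ _ (fun _ _ => by positivity)]
    gcongr
    have := Nat.le_of_dvd (Nat.pos_of_ne_zero hq) (Nat.prod_primeFactors_dvd q)
    rw [← Nat.cast_prod]; exact_mod_cast this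

lemma prod_bound {ε : ℝ} (hε : 0 < ε) : ∃ C : ℝ, 1 ≤ C ∧ ∀ (q : ℕ), q ≠ 0 → ∀ s : ℂ, 0 ≤ s.re →
    ‖∏ p ∈ q.primeFactors, (1 - (p : ℂ) ^ (-s))‖ ≤ C * (q:ℝ)^ε := by
  obtain ⟨C, hC, H⟩ := prod_gen hε
  refine ⟨C, hC, fun q hq s hs => H q hq _ fun p hp' => ?_⟩
  have hp1 : (1:ℝ) ≤ p := by exact_mod_cast hp'.one_lt.le
  refine (norm_sub_le _ _).trans ?_
  have : ‖(p : ℂ) ^ (-s)‖ = (p:ℝ)^(-s.re) := by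
    rw [Complex.norm_natCast_cpow_of_pos hp'.pos]; simp
  rw [this, norm_one]
  have := Real.rpow_le_one_of_one_le_of_nonpos hp1 (show -s.re ≤ 0 by linarith)
  linarith

end Cay

namespace Cay
open Finset Metric

lemma two_mul_rpow_le {V ε : ℝ} (hV : 0 ≤ V) (_h1 : 0 ≤ ε) (h2 : ε ≤ 1) : (2 * V)^ε ≤ 2 * V^ε := by
  rw [Real.mul_rpow (by norm_num) hV]
  gcongr
  calc (2:ℝ)^ε ≤ 2^(1:ℝ) := by gcongr; norm_num
    _ = 2 := by norm_num

/-- local upper bounds, for nontrivial characters or zeta away from the pole -/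
lemma loc_bound {ε : ℝ} (h0 : 0 < ε) (h1 : ε < 1/2) : ∃ C : ℝ, 1 ≤ C ∧ ∀ (q : ℕ) [NeZero q] (χ : DirichletCharacter ℂ q) (s : ℂ),
    (χ ≠ 1 ∨ (q = 1 ∧ 1 ≤ |s.im|)) → 1 ≤ s.re → s.re ≤ 2 → DifferentiableOn ℂ χ.LFunction (ball s ε) ∧
      ∀ z ∈ ball s ε, ‖χ.LFunction z‖ ≤ C * ((q:ℝ) * (|s.im| + 2))^(2*ε) := by
  obtain ⟨C1, hC1, H1⟩ := L_upper h0 h1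
  obtain ⟨C2, hC2, H2⟩ := zeta_upper h0 h1
  refine ⟨2 * C1 + 6 * C2, by linarith, ?_⟩
  intro q _ χ s hs hs1 hs2
  have hq : (1:ℝ) ≤ q := by exact_mod_cast NeZero.one_le
  have hz0 : ∀ z ∈ ball s ε, 1 - ε ≤ z.re ∧ z.re ≤ 3 ∧ |z.im| ≤ |s.im| + ε ∧ |s.im| - ε ≤ |z.im| := by
    intro z hz
    rw [mem_ball, dist_eq_norm] at hz
    have a := (Complex.abs_re_le_norm (z - s)).trans hz.le
    have b := (Complex.abs_im_le_norm (z - s)).trans hz.le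
    rw [Complex.sub_re, abs_le] at a
    rw [Complex.sub_im] at b
    have b1 := abs_sub_abs_le_abs_sub z.im s.im
    have b2 := abs_sub_abs_le_abs_sub s.im z.im
    rw [abs_sub_comm] at b2
    exact ⟨by linarith, by linarith, by linarith, by linarith⟩
  have hV : 0 ≤ (q:ℝ) * (|s.im| + 2) := by positivity
  have hpow : ∀ z ∈ ball s ε, ((q:ℝ) * (|z.im| + 2))^(2*ε) ≤ 2 * ((q:ℝ) * (|s.im| + 2))^(2*ε) := by
    intro z hz
    refine le_trans ?_ (two_mul_rpow_le hV (by linarith) (by linarith))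
    apply Real.rpow_le_rpow (by positivity) _ (by linarith)
    have := hz0 z hz
    have h : |z.im| + 2 ≤ 2 * (|s.im| + 2) := by linarith [abs_nonneg s.im]
    nlinarith
  have hVp : 0 ≤ ((q:ℝ) * (|s.im| + 2))^(2*ε) := by positivity
  by_cases hχ : χ = 1
  · rcases hs with h | ⟨h, him⟩
    · exact absurd hχ h
    · subst h
      have e : χ.LFunction = riemannZeta := DirichletCharacter.LFunction_modOne_eq
      have hne : ∀ z ∈ ball s ε, 1/2 ≤ ‖z - 1‖ := by
        intro z hz
        have h3 := hz0 z hz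
        have := Complex.abs_im_le_norm (z - 1)
        simp at this
        linarith
      have hne' : ∀ z ∈ ball s ε, z ≠ 1 := by
        intro z hz h
        have := hne z hz
        rw [h] at this; norm_num at this
      rw [e]
      constructor
      · intro z hz
        exact (differentiableAt_riemannZeta (hne' z hz)).differentiableWithinAt
      · intro z hz
        have h3 := hz0 z hz
        refine (H2 z (hne' z hz) h3.1 h3.2.1).trans ?_
        have h5 := hpow z hz
        simp only [Nat.cast_one, one_mul] at h5 hVp ⊢
        have h4 : 1 + 1/‖z-1‖ ≤ 3 := by
          have : 1/‖z-1‖ ≤ 1/(1/2) := by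
            apply one_div_le_one_div_of_le (by norm_num) (hne z hz)
          norm_num at this ⊢
          linarith
        calc _ ≤ C2 * (2 * (|s.im| + 2)^(2*ε)) * 3 := by gcongr
          _ ≤ _ := by nlinarith
  · constructor
    · exact (DirichletCharacter.differentiable_LFunction hχ).differentiableOn
    · intro z hz
      have h3 := hz0 z hz
      refine (H1 q χ hχ z h3.1 h3.2.1).trans ?_
      calc _ ≤ C1 * (2 * ((q:ℝ) * (|s.im| + 2))^(2*ε)) := by gcongr; exact hpow z hz
        _ ≤ _ := by nlinarith

lemma loc_deriv {ε : ℝ} (h0 : 0 < ε) (h1 : ε < 1/2) : ∃ C : ℝ, 1 ≤ C ∧ ∀ (q : ℕ) [NeZero q] (χ : DirichletCharacter ℂ q) (s : ℂ),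
    (χ ≠ 1 ∨ (q = 1 ∧ 1 ≤ |s.im|)) → 1 ≤ s.re → s.re ≤ 2 → DifferentiableAt ℂ χ.LFunction s ∧
      ‖deriv χ.LFunction s‖ ≤ C * ((q:ℝ) * (|s.im| + 2))^(2*ε) := by
  obtain ⟨C, hC, H⟩ := loc_bound h0 h1
  refine ⟨3 * C / ε, ?_, ?_⟩
  · rw [le_div_iff₀ h0]; linarith
  intro q _ χ s hs hs1 hs2
  obtain ⟨a, b⟩ := H q χ s hs hs1 hs2
  refine ⟨a.differentiableAt (isOpen_ball.mem_nhds (mem_ball_self h0)), ?_⟩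
  refine (deriv_bound h0 a b (mem_closedBall_self (by linarith))).trans (le_of_eq ?_)
  ring

lemma prod341 : ∃ C0 : ℝ, 1 ≤ C0 ∧ ∀ (q : ℕ) [NeZero q] (χ : DirichletCharacter ℂ q) (η t M2 : ℝ), 0 < η → η ≤ 1 → 1 ≤ M2 →
    ‖(χ^2).LFunction ((1 + η : ℝ) + (2*t : ℝ) * Complex.I)‖ ≤ M2 →
    (1/(C0*M2))^4 * η^3 ≤ ‖χ.LFunction ((1 + η : ℝ) + t * Complex.I)‖^4 ∧
    η/C0 ≤ ‖χ.LFunction ((1 + η : ℝ) + t * Complex.I)‖ := by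
  obtain ⟨C0, hC0, H0⟩ := zeta_real_bound
  refine ⟨C0, hC0, ?_⟩
  intro q _ χ η t M2 h0 h1 hM2 h2
  have key := DirichletCharacter.norm_LFunction_product_ge_one χ h0 t
  rw [norm_mul, norm_mul, norm_pow, norm_pow] at key
  have e1 : (1 + (η:ℂ) + Complex.I * t) = ((1 + η : ℝ) + t * Complex.I) := by push_cast; ring
  have e2 : (1 + (η:ℂ) + 2 * Complex.I * t) = ((1 + η : ℝ) + (2*t:ℝ) * Complex.I) := by push_cast; ring
  rw [e1, e2] at key
  have b1 : ‖DirichletCharacter.LFunctionTrivChar q (1 + (η:ℂ))‖ ≤ C0/η := by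
    have := norm_L_le (1 : DirichletCharacter ℂ q) (s := 1 + (η:ℂ)) (by simpa using h0)
    rw [show (1 + (η:ℂ)).re = 1 + η by simp] at this
    exact this.trans (H0 η h0 h1)
  have b2 : ‖(χ^2).LFunction ((1 + η : ℝ) + (2*t : ℝ) * Complex.I)‖ ≤ C0/η := by
    have := norm_L_le (χ^2) (s := (1 + η : ℝ) + (2*t : ℝ) * Complex.I) (by simpa using h0)
    rw [show (((1 + η : ℝ):ℂ) + (2*t : ℝ) * Complex.I).re = 1 + η by simp] at this
    exact this.trans (H0 η h0 h1)
  set T := ‖DirichletCharacter.LFunctionTrivChar q (1 + (η:ℂ))‖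
  set L := ‖χ.LFunction ((1 + η : ℝ) + t * Complex.I)‖
  set L2 := ‖(χ^2).LFunction ((1 + η : ℝ) + (2*t : ℝ) * Complex.I)‖
  have hT : 0 ≤ T := norm_nonneg _
  have hL : 0 ≤ L := norm_nonneg _
  have hL2 : 0 ≤ L2 := norm_nonneg _
  clear_value T L L2
  have hmul : ∀ R, L2 ≤ R → 1 ≤ (C0/η)^3 * L^4 * R := by
    intro R hR
    refine key.le.trans ?_
    gcongr
  constructor
  · have := hmul M2 h2
    have h5 : (C0/η)^3 * L^4 * M2 * η^3 = C0^3 * M2 * L^4 := by field_simp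
    have h6 : η^3 ≤ C0^3 * M2 * L^4 := by
      rw [← h5]; nlinarith [pow_pos h0 3]
    have h7 : C0^3 * M2 * L^4 ≤ (C0*M2)^4 * L^4 := by
      gcongr
      rw [mul_pow]
      gcongr
      · norm_num
      · exact le_self_pow₀ hM2 (by norm_num)
    rw [one_div, inv_pow, inv_mul_le_iff₀ (by positivity)]
    linarith
  · have := hmul (C0/η) b2
    have h5 : 1 ≤ (C0/η*L)^4 := by calc (1:ℝ) ≤ _ := this
                                   _ = _ := by ring
    have h6 : 1 ≤ C0/η*L := by
      by_contra hc
      push Not at hc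
      have := pow_lt_one₀ (by positivity) hc (show (4:ℕ) ≠ 0 by norm_num)
      linarith
    rw [div_le_iff₀ (by positivity)]
    have h8 : C0/η*L = C0 * L/η := by ring
    rw [h8, le_div_iff₀ h0] at h6
    linarith

lemma M2_bound {ε : ℝ} (h0 : 0 < ε) (h1 : ε < 1/2) : ∃ C : ℝ, 1 ≤ C ∧ ∀ (q : ℕ) [NeZero q] (χ : DirichletCharacter ℂ q) (t η R : ℝ), 0 < η → η ≤ 1 →
    1 ≤ R → (χ ^ 2 ≠ 1 ∨ 1 ≤ |t| * R) →
    ‖(χ^2).LFunction ((1 + η : ℝ) + (2*t : ℝ) * Complex.I)‖ ≤ C * ((q:ℝ) * (|t| + 2))^(3*ε) * R := by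
  obtain ⟨C1, hC1, H1⟩ := L_upper h0 h1
  obtain ⟨C2, hC2, H2⟩ := zeta_upper h0 h1
  obtain ⟨C3, hC3, H3⟩ := prod_bound h0
  refine ⟨2 * C1 + C3 * C2 * 4, by nlinarith, ?_⟩
  intro q _ χ t η R hη hη1 hR hs
  have hq : (1:ℝ) ≤ q := by exact_mod_cast NeZero.one_le
  set V := (q:ℝ) * (|t| + 2) with hV
  have hV1 : 1 ≤ V := by nlinarith [abs_nonneg t]
  have hqV : (q:ℝ) ≤ V := by nlinarith [abs_nonneg t]
  have hVp : 0 < V^(3*ε) := by positivity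
  set s : ℂ := (1 + η : ℝ) + (2*t : ℝ) * Complex.I with hs'
  have sre : s.re = 1 + η := by simp [hs']
  have sim : s.im = 2*t := by simp [hs']
  have habs : |s.im| = 2*|t| := by rw [sim, abs_mul]; norm_num
  have h23 : V^(2*ε) ≤ V^(3*ε) := Real.rpow_le_rpow_of_exponent_le hV1 (by linarith)
  by_cases hχ : χ^2 = 1
  · have ht := hs.resolve_left (by simpa using hχ)
    have sne : s ≠ 1 := by
      intro h
      have := congrArg Complex.re h
      rw [sre] at this
      simp at this
      linarith
    have e : (χ^2).LFunction s = (∏ p ∈ q.primeFactors, (1 - (p:ℂ)^(-s))) * riemannZeta s := by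
      rw [hχ]; exact DirichletCharacter.LFunctionTrivChar_eq_mul_riemannZeta sne
    rw [e, norm_mul]
    have a1 := H3 q (NeZero.ne q) s (by rw [sre]; linarith)
    have a2 := H2 s sne (by rw [sre]; linarith) (by rw [sre]; linarith)
    have a3 : (|s.im| + 2)^(2*ε) ≤ 2 * V^(2*ε) := by
      refine le_trans ?_ (two_mul_rpow_le (by linarith) (by linarith) (by linarith))
      apply Real.rpow_le_rpow (by positivity) _ (by linarith)
      rw [habs, hV]; nlinarith [abs_nonneg t]
    have tpos : 0 < |t| := by
      by_contra hc
      have : |t| = 0 := le_antisymm (not_lt.1 hc) (abs_nonneg _)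
      rw [this] at ht; norm_num at ht
    have a4 : 1 + 1/‖s-1‖ ≤ 2 * R := by
      have b := Complex.abs_im_le_norm (s-1)
      simp only [Complex.sub_im, Complex.one_im, sub_zero, habs] at b
      have : 1/‖s-1‖ ≤ R := by
        rw [div_le_iff₀ (by linarith)]
        nlinarith
      linarith
    have a5 : (q:ℝ)^ε ≤ V^ε := by gcongr
    calc _ ≤ (C3 * V^ε) * (C2 * (2 * V^(2*ε)) * (2*R)) := by
          gcongr
          · exact a1.trans (by gcongr)
          · exact a2.trans (by gcongr)
      _ = C3 * C2 * 4 * (V^ε * V^(2*ε)) * R := by ring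
      _ = C3 * C2 * 4 * V^(3*ε) * R := by rw [← Real.rpow_add (by linarith)]; ring_nf
      _ ≤ _ := by gcongr; linarith
  · refine (H1 q _ hχ s (by rw [sre]; linarith) (by rw [sre]; linarith)).trans ?_
    have a3 : ((q:ℝ) * (|s.im| + 2))^(2*ε) ≤ 2 * V^(2*ε) := by
      refine le_trans ?_ (two_mul_rpow_le (by linarith) (by linarith) (by linarith))
      apply Real.rpow_le_rpow (by positivity) _ (by linarith)
      rw [habs, hV]; nlinarith [abs_nonneg t]
    calc _ ≤ C1 * (2 * V^(3*ε)) * 1 := by rw [mul_one]; exact mul_le_mul_of_nonneg_left (a3.trans (by linarith)) (by linarith)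
      _ ≤ (2 * C1 + C3 * C2 * 4) * V^(3*ε) * R := by
        have : 0 ≤ C3 * C2 * 4 * V^(3*ε) := by positivity
        exact mul_le_mul (by nlinarith) hR (by norm_num) (by positivity)

/-- lower bound away from the real axis, or for complex characters -/
lemma L_low_core {ε : ℝ} (h0 : 0 < ε) (h1 : ε < 1/2) : ∃ C : ℝ, 1 ≤ C ∧ ∀ (q : ℕ) [NeZero q] (χ : DirichletCharacter ℂ q) (t R : ℝ),
    1 ≤ R → (χ ^ 2 ≠ 1 ∨ 1 ≤ |t| * R) → (χ ≠ 1 ∨ (q = 1 ∧ 1 ≤ |t|)) → ∀ σ : ℝ, 1 ≤ σ → σ ≤ 2 →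
    1 / (C * ((q:ℝ) * (|t| + 2))^(18*ε) * R^4) ≤ ‖χ.LFunction (σ + t * Complex.I)‖ := by
  obtain ⟨C1, hC1, H1⟩ := loc_deriv h0 h1
  obtain ⟨C2, hC2, H2⟩ := M2_bound h0 h1
  obtain ⟨C0, hC0, H0⟩ := prod341
  refine ⟨16 * C0^4 * C2^4 * C1^3, ?_, ?_⟩
  · have := one_le_pow₀ hC0 (n := 4)
    have := one_le_pow₀ hC2 (n := 4)
    have := one_le_pow₀ hC1 (n := 3)
    have : 1 ≤ C0^4 * C2^4 * C1^3 := one_le_mul_of_one_le_of_one_le (one_le_mul_of_one_le_of_one_le ‹_› ‹_›) ‹_›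
    nlinarith
  intro q _ χ t R hR hs hp σ hσ1 hσ2
  have hq : (1:ℝ) ≤ q := by exact_mod_cast NeZero.one_le
  set V := (q:ℝ) * (|t| + 2) with hV
  have hV1 : 1 ≤ V := by nlinarith [abs_nonneg t]
  set M2 := C2 * V^(3*ε) * R with hM2
  have hM21 : 1 ≤ M2 := by
    have : 1 ≤ V^(3*ε) := Real.one_le_rpow hV1 (by linarith)
    exact one_le_mul_of_one_le_of_one_le (one_le_mul_of_one_le_of_one_le hC2 this) hR
  set M := C1 * V^(2*ε) with hM
  have hM1 : 1 ≤ M := one_le_mul_of_one_le_of_one_le hC1 (Real.one_le_rpow hV1 (by linarith))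
  have hder : ∀ x : ℝ, 1 ≤ x → x ≤ 2 → DifferentiableAt ℂ χ.LFunction (x + t * Complex.I) ∧ 
      ‖deriv χ.LFunction (x + t * Complex.I)‖ ≤ M := by
    intro x hx hx2
    have := H1 q χ (x + t * Complex.I) (by simpa using hp) (by simpa using hx) (by simpa using hx2)
    simpa using this
  have hCM : 1 ≤ C0 * M2 := one_le_mul_of_one_le_of_one_le hC0 hM21
  have := low_bound (P := χ.LFunction) (t := t) (a := 1/(C0*M2)) (M := M) (by positivity) 
    (by rw [div_le_one (by positivity)]; exact hCM) hM1 (fun x h h' => (hder x h h').1) (fun x h h' => (hder x h h').2) 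
    (fun η hη hη1 => (H0 q χ η t M2 hη hη1 hM21 (H2 q χ t η R hη hη1 hR hs)).1) σ hσ1 hσ2
  refine le_trans (le_of_eq ?_) this
  have e : V^(18*ε) = (V^(3*ε))^4 * (V^(2*ε))^3 := by
    rw [← Real.rpow_mul_natCast (by linarith), ← Real.rpow_mul_natCast (by linarith), ← Real.rpow_add (by linarith)]
    congr 1; push_cast; ring
  rw [e, hM2, hM]
  field_simp

/-- the zeta function away from its pole -/
lemma zeta_lower {ε : ℝ} (h0 : 0 < ε) : ∃ c : ℝ, 0 < c ∧ ∀ s : ℂ, 1 ≤ s.re → s.re ≤ 2 → 1 ≤ |s.im| →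
    c * (|s.im| + 2)^(-ε) ≤ ‖riemannZeta s‖ := by
  set δ := min (ε/18) (1/4) with hδ
  have d0 : 0 < δ := by positivity
  obtain ⟨C, hC, H⟩ := L_low_core d0 ((min_le_right _ _).trans_lt (by norm_num))
  refine ⟨1/C, by positivity, ?_⟩
  intro s h1 h2 h3
  have := H 1 1 s.im 1 le_rfl (Or.inr (by simpa using h3)) (Or.inr ⟨rfl, h3⟩) s.re h1 h2
  rw [Complex.re_add_im, DirichletCharacter.LFunction_modOne_eq] at this
  refine le_trans ?_ this
  rw [one_pow, mul_one, Real.rpow_neg (by positivity), Nat.cast_one, one_mul, one_div, one_div, mul_inv]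
  gcongr
  · linarith [abs_nonneg s.im]
  · have := min_le_left (ε/18) (1/4 : ℝ); linarith

/-- Siegel's hypothesis -/
def SiegelHyp : Prop := ∀ ε : ℝ, 0 < ε → ∃ c : ℝ, 0 < c ∧ ∀ (q : ℕ) [NeZero q] (χ : DirichletCharacter ℂ q), χ ≠ 1 → χ^2 = 1 →
  c * (q:ℝ)^(-ε) ≤ ‖χ.LFunction 1‖

lemma L_lower (hS : SiegelHyp) {ε' : ℝ} (h0' : 0 < ε') : ∃ c : ℝ, 0 < c ∧ ∀ (q : ℕ) [NeZero q] (χ : DirichletCharacter ℂ q) (s : ℂ), χ ≠ 1 →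
    1 ≤ s.re → s.re ≤ 2 → c * ((q:ℝ) * (|s.im| + 2))^(-ε') ≤ ‖χ.LFunction s‖ := by
  set ε := min (ε'/30) (1/4) with hδ
  have h0 : 0 < ε := by positivity
  have h1 : ε < 1/2 := (min_le_right _ _).trans_lt (by norm_num)
  have hεε : 30 * ε ≤ ε' := by have := min_le_left (ε'/30) (1/4 : ℝ); linarith
  obtain ⟨c, hc, hS'⟩ := hS ε h0
  obtain ⟨C1, hC1, H1⟩ := loc_deriv h0 h1
  obtain ⟨C, hC, H⟩ := L_low_core h0 h1
  obtain ⟨C0, hC0, H0⟩ := prod341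
  -- κ = k0 q^{-3ε}
  set k0 := min 1 (c / (12 * C1)) with hk0
  have k0p : 0 < k0 := by positivity
  have k01 : k0 ≤ 1 := min_le_left _ _
  have k02 : k0 * (12 * C1) ≤ c := by
    have := min_le_right 1 (c / (12 * C1))
    rw [← hk0, le_div_iff₀ (by positivity)] at this; exact this
  set c' := min (k0^4/C) (min (c/2) (k0/C0)) with hc'
  have c'p : 0 < c' := by positivity
  refine ⟨c', c'p, ?_⟩
  intro q _ χ s hχ hs1 hs2
  have hq : (1:ℝ) ≤ q := by exact_mod_cast NeZero.one_le
  set V := (q:ℝ) * (|s.im| + 2) with hV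
  have hV1 : 1 ≤ V := by nlinarith [abs_nonneg s.im]
  have hqV : (q:ℝ) ≤ V := by nlinarith [abs_nonneg s.im]
  set κ := k0 * (q:ℝ)^(-(3*ε)) with hκ
  have hqe1 : (q:ℝ)^(-(3*ε)) ≤ 1 := Real.rpow_le_one_of_one_le_of_nonpos hq (by linarith)
  have κp : 0 < κ := by positivity
  have κ1 : κ ≤ 1 := mul_le_one₀ k01 (by positivity) hqe1
  have hVκ : V^(-ε') ≤ (q:ℝ)^(-(3*ε)) := by
    calc V^(-ε') ≤ V^(-(3*ε)) := Real.rpow_le_rpow_of_exponent_le hV1 (by linarith)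
      _ ≤ _ := Real.rpow_le_rpow_of_nonpos (by linarith) hqV (by linarith)
  have hVe : V^(-ε') ≤ (q:ℝ)^(-ε) := by
    calc V^(-ε') ≤ V^(-ε) := Real.rpow_le_rpow_of_exponent_le hV1 (by linarith)
      _ ≤ _ := Real.rpow_le_rpow_of_nonpos (by linarith) hqV (by linarith)
  by_cases hcase : χ^2 ≠ 1 ∨ κ ≤ |s.im|
  · have h2 : χ ^ 2 ≠ 1 ∨ 1 ≤ |s.im| * (1/κ) := by
      refine hcase.imp id (fun h => ?_)
      rw [mul_one_div, le_div_iff₀ κp]; linarith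
    have := H q χ s.im (1/κ) (by rw [le_div_iff₀ κp]; linarith) h2 (Or.inl hχ) s.re hs1 hs2
    rw [Complex.re_add_im] at this
    refine le_trans ?_ this
    have e1 : 1 / (C * V^(18*ε) * (1/κ)^4) = k0^4/C * (V^(-(18*ε)) * ((q:ℝ)^(-(3*ε)))^4) := by
      rw [Real.rpow_neg (by linarith), hκ]; field_simp
    rw [e1]
    have e2 : V^(-ε') ≤ V^(-(18*ε)) * ((q:ℝ)^(-(3*ε)))^4 := by
      calc V^(-ε') ≤ V^(-(18*ε) + -(3*ε)*4) := Real.rpow_le_rpow_of_exponent_le hV1 (by linarith)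
        _ = V^(-(18*ε)) * (V^(-(3*ε)))^4 := by
          rw [Real.rpow_add (by linarith), Real.rpow_mul (show 0 ≤ V by linarith) (-(3*ε))]; norm_cast
        _ ≤ _ := by
          have : V^(-(3*ε)) ≤ (q:ℝ)^(-(3*ε)) := Real.rpow_le_rpow_of_nonpos (by linarith) hqV (by linarith)
          gcongr
    gcongr
    exact min_le_left _ _
  · push Not at hcase
    obtain ⟨hχ2, him⟩ := hcase
    by_cases hre : κ ≤ s.re - 1
    · have := (H0 q χ (s.re-1) s.im (max 1 ‖(χ^2).LFunction ((1 + (s.re-1) : ℝ) + (2*s.im : ℝ) * Complex.I)‖) 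
        (by linarith) (by linarith) (le_max_left _ _) (le_max_right _ _)).2
      have e : (((1 + (s.re - 1) : ℝ) : ℂ) + s.im * Complex.I) = s := by
        rw [show 1 + (s.re - 1) = s.re by ring, Complex.re_add_im]
      rw [e] at this
      refine le_trans ?_ this
      calc c' * V^(-ε') ≤ k0/C0 * (q:ℝ)^(-(3*ε)) := by
            gcongr
            exact (min_le_right _ _).trans (min_le_right _ _)
        _ = κ/C0 := by rw [hκ]; ring
        _ ≤ _ := by gcongr
    · push Not at hre
      have hsieg := hS' q χ hχ hχ2
      have hdiff : ‖χ.LFunction s - χ.LFunction 1‖ ≤ C1 * (3 * (q:ℝ)^(2*ε)) * ‖s - 1‖ := by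
        have hconv : Convex ℝ (Set.Icc (1:ℝ) 2 ×ℂ Set.Icc (-1:ℝ) 1) := ((convex_Icc (1:ℝ) 2).linear_preimage Complex.reLm).inter ((convex_Icc (-1:ℝ) 1).linear_preimage Complex.imLm)
        refine hconv.norm_image_sub_le_of_norm_deriv_le (𝕜 := ℂ) (f := χ.LFunction) ?_ ?_ ?_ ?_
        · intro z hz; exact DirichletCharacter.differentiable_LFunction hχ z
        · intro z hz
          rw [Complex.mem_reProdIm] at hz
          refine (H1 q χ z (Or.inl hχ) hz.1.1 hz.1.2).2.trans ?_
          gcongr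
          have him' : |z.im| ≤ 1 := abs_le.2 ⟨hz.2.1, hz.2.2⟩
          calc ((q:ℝ) * (|z.im| + 2))^(2*ε) ≤ (q * 3)^(2*ε) := by gcongr; linarith
            _ = 3^(2*ε) * (q:ℝ)^(2*ε) := by rw [mul_comm, Real.mul_rpow (by norm_num) (by positivity)]
            _ ≤ 3 * (q:ℝ)^(2*ε) := by
              gcongr
              calc (3:ℝ)^(2*ε) ≤ 3^(1:ℝ) := Real.rpow_le_rpow_of_exponent_le (by norm_num) (by linarith)
                _ = 3 := by norm_num
        · rw [Complex.mem_reProdIm]; simp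
        · rw [Complex.mem_reProdIm]
          exact ⟨⟨hs1, hs2⟩, abs_le.1 (by linarith)⟩
      have hsn : ‖s - 1‖ ≤ 2 * κ := by
        refine (Complex.norm_le_abs_re_add_abs_im _).trans ?_
        simp only [Complex.sub_re, Complex.one_re, Complex.sub_im, Complex.one_im, sub_zero]
        rw [abs_of_nonneg (by linarith : 0 ≤ s.re - 1)]
        linarith
      have h5 : C1 * (3 * (q:ℝ)^(2*ε)) * ‖s - 1‖ ≤ c/2 * (q:ℝ)^(-ε) := by
        calc _ ≤ C1 * (3 * (q:ℝ)^(2*ε)) * (2 * κ) := by gcongr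
          _ = (k0 * (12 * C1))/2 * ((q:ℝ)^(2*ε) * (q:ℝ)^(-(3*ε))) := by rw [hκ]; ring
          _ = (k0 * (12 * C1))/2 * (q:ℝ)^(-ε) := by rw [← Real.rpow_add (by linarith)]; ring_nf
          _ ≤ _ := by gcongr
      have h6 := norm_sub_norm_le (χ.LFunction 1) (χ.LFunction s)
      rw [norm_sub_rev] at h6
      calc c' * V^(-ε') ≤ c/2 * (q:ℝ)^(-ε) := by
            gcongr
            exact (min_le_right _ _).trans (min_le_left _ _)
        _ ≤ _ := by linarith

end Cay

namespace Cay
open Finset Metric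
open scoped ComplexOrder

lemma alternating_of_logderiv {F D : ℂ → ℂ} {U : Set ℂ} (hU : IsOpen U) {x : ℂ} (hx : x ∈ U)
    (hF : DifferentiableOn ℂ F U) (hD : DifferentiableOn ℂ D U) (hFD : ∀ z ∈ U, deriv F z = - (F z * D z))
    (h0 : 0 ≤ F x) (hpos : ∀ m : ℕ, 0 ≤ (-1)^m * iteratedDeriv m D x) (m : ℕ) :
    0 ≤ (-1)^m * iteratedDeriv m F x := by
  induction m using Nat.strong_induction_on with
  | _ m ih =>
    rcases m with _ | m
    · simpa using h0
    · have hFc : ContDiffAt ℂ m F x := (hF.analyticAt (hU.mem_nhds hx)).contDiffAt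
      have hDc : ContDiffAt ℂ m D x := (hD.analyticAt (hU.mem_nhds hx)).contDiffAt
      have e : iteratedDeriv (m+1) F x = - iteratedDeriv m (F * D) x := by
        rw [iteratedDeriv_succ']
        have : deriv F =ᶠ[nhds x] - (F * D) := by
          filter_upwards [hU.mem_nhds hx] with z hz
          rw [hFD z hz]; rfl
        rw [this.iteratedDeriv_eq, iteratedDeriv_neg]
      rw [e, iteratedDeriv_mul hFc hDc, pow_succ, mul_neg_one, neg_mul_neg, mul_sum]
      apply sum_nonneg
      intro i hi
      have hi' : i ≤ m := by simpa [Nat.lt_succ_iff] using hi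
      have e2 : (-1:ℂ)^m * ((m.choose i : ℂ) * iteratedDeriv i F x * iteratedDeriv (m-i) D x) = 
          (m.choose i : ℂ) * (((-1)^i * iteratedDeriv i F x) * ((-1)^(m-i) * iteratedDeriv (m-i) D x)) := by
        have : (-1:ℂ)^m = (-1)^i * (-1)^(m-i) := by rw [← pow_add]; congr 1; omega
        rw [this]; ring
      rw [e2]
      apply mul_nonneg
      · exact_mod_cast Nat.zero_le _
      · exact mul_nonneg (ih i (by omega)) (hpos _)

/-- Estermann's argument -/
lemma estermann {G : ℂ → ℂ} (hG : Differentiable ℂ G) {lam : ℂ} {K b0 : ℝ} (hK : ∀ s ∈ sphere (2:ℂ) (3/2), ‖G s‖ ≤ K)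
    (hb : ∀ m : ℕ, 0 ≤ ((-1)^m * iteratedDeriv m G 2).re + m.factorial * lam.re)
    (hb0 : b0 ≤ (G 2).re + lam.re) {s : ℝ} (hs : 7/8 ≤ s) (hs1 : s < 1)
    (hF : (G s).re - lam.re / (1 - s) ≤ 0) (M : ℕ) (hM0 : 1 ≤ M) (hM : 4 * K * (3/4)^M ≤ b0/2) :
    b0/2 * (1-s) ≤ lam.re * (2-s)^M := by
  set u := 2 - s with hu
  have hu1 : 1 < u := by linarith
  have hu2 : u ≤ 9/8 := by linarith
  have hK0 : 0 ≤ K := (norm_nonneg _).trans (hK (2 + 3/2) (by simp))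
  have hsum := Complex.hasSum_taylorSeries_of_entire hG 2 s
  have hre := Complex.hasSum_re hsum
  set g : ℕ → ℝ := fun n => ((-1)^n * iteratedDeriv n G 2).re / n.factorial * u^n with hg
  have e : (fun n : ℕ => (((n.factorial : ℂ)⁻¹ • ((s:ℂ) - 2)^n • iteratedDeriv n G 2)).re) = g := by
    funext n
    have : ((n.factorial : ℂ)⁻¹ • ((s:ℂ) - 2)^n • iteratedDeriv n G 2) = 
      (((n.factorial : ℝ)⁻¹ * u^n : ℝ) : ℂ) * ((-1)^n * iteratedDeriv n G 2) := by
      rw [show ((s:ℂ) - 2) = (-1) * (u:ℂ) by rw [hu]; push_cast; ring, mul_pow]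
      simp only [smul_eq_mul]
      push_cast
      ring
    rw [this, Complex.re_ofReal_mul, hg]
    simp only
    ring
  rw [e] at hre
  have hbd : ∀ n, |g n| ≤ K * (3/4)^n := by
    intro n
    have h1 := Complex.norm_iteratedDeriv_le_of_forall_mem_sphere_norm_le n (by norm_num : (0:ℝ) < 3/2) (hG.diffContOnCl) hK
    have h2 : |((-1)^n * iteratedDeriv n G 2).re| ≤ n.factorial * K / (3/2)^n := by
      refine (Complex.abs_re_le_norm _).trans ?_
      rw [norm_mul, norm_pow, norm_neg, norm_one, one_pow, one_mul]
      exact h1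
    rw [hg]
    simp only
    rw [abs_mul, abs_div, abs_of_pos (by positivity : (0:ℝ) < u^n), abs_of_pos (by positivity : (0:ℝ) < n.factorial)]
    calc _ ≤ (n.factorial * K / (3/2)^n) / n.factorial * (9/8)^n := by gcongr
      _ = K * ((9/8)^n / (3/2)^n) := by field_simp
      _ = _ := by rw [← div_pow]; norm_num
  have hsplit := hre.summable.sum_add_tsum_nat_add M
  rw [hre.tsum_eq] at hsplit
  have htail : |∑' n, g (n + M)| ≤ 4 * K * (3/4)^M := by
    have hgeo : HasSum (fun n : ℕ => K * (3/4)^M * (3/4:ℝ)^n) (K * (3/4)^M * (1 - 3/4)⁻¹) := 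
      (hasSum_geometric_of_lt_one (by norm_num) (by norm_num)).mul_left _
    have := tsum_of_norm_bounded hgeo (f := fun n => g (n+M)) (fun n => by
      rw [Real.norm_eq_abs]
      refine (hbd _).trans (le_of_eq ?_)
      rw [pow_add]; ring)
    rw [Real.norm_eq_abs] at this
    refine this.trans (le_of_eq ?_)
    norm_num; ring
  have hfin : b0 - lam.re * ((u^M - 1)/(u-1)) ≤ ∑ n ∈ range M, g n := by
    rw [← geom_sum_eq hu1.ne', mul_sum]
    have h1 : ∀ n ∈ range M, (if n = 0 then b0 else 0) - lam.re * u^n ≤ g n := by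
      intro n _
      rw [hg]
      simp only
      split_ifs with h
      · subst h; simp; linarith
      · have h3 := hb n
        have h4 : 0 ≤ (((-1)^n * iteratedDeriv n G 2).re + n.factorial * lam.re)/n.factorial * u^n := by positivity
        have h5 : (((-1)^n * iteratedDeriv n G 2).re + n.factorial * lam.re)/n.factorial * u^n = ((-1)^n * iteratedDeriv n G 2).re/n.factorial * u^n + lam.re * u^n := by
          field_simp
        linarith
    have := sum_le_sum h1
    rw [sum_sub_distrib, sum_ite_eq' (range M) 0 (fun _ => b0), if_pos (by simp; omega)] at this
    exact this
  have hu1' : u - 1 = 1 - s := by rw [hu]; ring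
  rw [hu1'] at hfin
  have := abs_le.1 htail
  have h7 : b0/2 ≤ lam.re * u^M/(1-s) := by
    have : lam.re * ((u^M - 1)/(1-s)) = lam.re * u^M/(1-s) - lam.re/(1-s) := by ring
    linarith
  rw [le_div_iff₀ (by linarith)] at h7
  exact h7

lemma quad_val {q : ℕ} {χ : DirichletCharacter ℂ q} (h : χ^2 = 1) (a : ZMod q) : χ a = 0 ∨ χ a = 1 ∨ χ a = -1 :=
  MulChar.isQuadratic_iff_sq_eq_one.mpr h a

lemma L_real {q : ℕ} [NeZero q] {χ : DirichletCharacter ℂ q} (hχ : χ ≠ 1) (h2 : χ^2 = 1) {x : ℝ} (hx : 0 < x) :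
    χ.LFunction x = ((χ.LFunction x).re : ℝ) := by
  have h := L_hasSum hχ (s := x) (by simpa using hx)
  have h' : HasSum (fun n : ℕ => (((starRingEnd ℂ) ((∑ m ∈ range (n+2), χ (m : ZMod q)) * ((((n:ℝ)+1 : ℝ) : ℂ)^(-(x:ℂ)) - (((n:ℝ)+1+1 : ℝ):ℂ)^(-(x:ℂ))))))) 
    ((starRingEnd ℂ) (χ.LFunction x)) := Complex.hasSum_conj.2 (by simpa using h)
  have e : ∀ n : ℕ, (starRingEnd ℂ) ((∑ m ∈ range (n+2), χ (m : ZMod q)) * ((((n:ℝ)+1 : ℝ) : ℂ)^(-(x:ℂ)) - (((n:ℝ)+1+1 : ℝ):ℂ)^(-(x:ℂ)))) = 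
    (∑ m ∈ range (n+2), χ (m : ZMod q)) * ((((n:ℝ)+1 : ℝ) : ℂ)^(-(x:ℂ)) - (((n:ℝ)+1+1 : ℝ):ℂ)^(-(x:ℂ))) := by
    intro n
    rw [map_mul, map_sum, map_sub]
    congr 1
    · apply sum_congr rfl
      intro m _
      rcases quad_val h2 (m : ZMod q) with h | h | h <;> simp [h]
    · rw [← Complex.ofReal_neg, ← Complex.ofReal_cpow (by positivity), ← Complex.ofReal_cpow (by positivity), Complex.conj_ofReal, Complex.conj_ofReal]
  simp only [e] at h'
  exact (Complex.conj_eq_iff_re.1 (h'.unique h)).symm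

lemma L_two {q : ℕ} [NeZero q] (χ : DirichletCharacter ℂ q) : 1/3 ≤ (χ.LFunction 2).re := by
  have hs : (1:ℝ) < (2:ℂ).re := by norm_num
  have h1 := (χ.LSeriesSummable_of_one_lt_re hs).LSeriesHasSum
  rw [← χ.LFunction_eq_LSeries hs] at h1
  have hre := (Complex.hasSum_re h1).add hasSum_zeta_two
  have hnorm : ∀ n : ℕ, ‖LSeries.term (fun n : ℕ => χ n) 2 n‖ ≤ 1/(n:ℝ)^2 := by
    intro n
    rw [LSeries.norm_term_eq]
    split_ifs with h
    · positivity
    · have : (n:ℝ)^((2:ℂ).re) = (n:ℝ)^2 := by norm_num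
      rw [this]
      gcongr
      exact χ.norm_le_one _
  have h11 : (LSeries.term (fun n : ℕ => χ n) 2 1).re = 1 := by
    rw [LSeries.term_of_ne_zero one_ne_zero]; simp
  have hle := sum_le_hasSum {1} (fun n _ => ?_) hre
  · rw [sum_singleton, h11] at hle
    have hpi : Real.pi^2 < 3.15^2 := by
      have := Real.pi_lt_d2
      have := Real.pi_pos
      nlinarith
    norm_num at hle
    linarith
  · have := (Complex.abs_re_le_norm _).trans (hnorm n)
    have := abs_le.1 this
    linarith

end Cay

namespace Cay
open Finset Metric
open scoped ComplexOrder

lemma pos_F {q : ℕ} [NeZero q] (S : Finset (DirichletCharacter ℂ q)) (h1 : ∀ χ ∈ S, χ ≠ 1) (h2 : ∀ χ ∈ S, χ^2 = 1)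
    (hn : ∀ n : ℕ, 0 ≤ 1 + ∑ χ ∈ S, χ (n : ZMod q)) (m : ℕ) :
    0 ≤ (-1)^m * iteratedDeriv m (fun s => riemannZeta s * ∏ χ ∈ S, χ.LFunction s) 2 := by
  set d : ℕ → ℂ := fun n => (1 + ∑ χ ∈ S, χ (n : ZMod q)) * (ArithmeticFunction.vonMangoldt n : ℂ) with hd
  have hd0 : 0 ≤ d := by
    intro n
    exact mul_nonneg (hn n) (Complex.zero_le_real.2 ArithmeticFunction.vonMangoldt_nonneg)
  set LΛ : ℕ → ℂ := fun n => (ArithmeticFunction.vonMangoldt n : ℂ) with hΛ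
  have dsum : d = LΛ + ∑ χ ∈ S, (fun n : ℕ => χ (n : ZMod q)) * LΛ := by
    funext n
    simp only [hd, Pi.add_apply, Finset.sum_apply, Pi.mul_apply, add_mul, one_mul, sum_mul, hΛ]
  have hsm : ∀ s : ℂ, 1 < s.re → LSeriesSummable LΛ s := fun s hs => ArithmeticFunction.LSeriesSummable_vonMangoldt hs
  have hsmχ : ∀ s : ℂ, 1 < s.re → ∀ χ ∈ S, LSeriesSummable ((fun n : ℕ => χ (n : ZMod q)) * LΛ) s := 
    fun s hs χ _ => DirichletCharacter.LSeriesSummable_twist_vonMangoldt χ hs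
  have hsmd : ∀ s : ℂ, 1 < s.re → LSeriesSummable d s := by
    intro s hs
    rw [dsum]
    exact (hsm s hs).add (LSeriesSummable.sum (hsmχ s hs))
  have habs : LSeries.abscissaOfAbsConv d ≤ (1:ℝ) := 
    LSeries.abscissaOfAbsConv_le_of_forall_lt_LSeriesSummable (fun y hy => hsmd y (by simpa using hy))
  have hU : IsOpen {s : ℂ | 1 < s.re} := isOpen_lt continuous_const Complex.continuous_re
  have zne : ∀ z : ℂ, 1 < z.re → z ≠ 1 := by
    rintro z hz rfl
    norm_num at hz
  have hLd : ∀ χ ∈ S, Differentiable ℂ χ.LFunction := fun χ h => DirichletCharacter.differentiable_LFunction (h1 χ h)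
  have hPd : Differentiable ℂ (fun s => ∏ χ ∈ S, χ.LFunction s) := by
    apply Differentiable.fun_finsetProd
    exact hLd
  refine alternating_of_logderiv (U := {s : ℂ | 1 < s.re}) (D := LSeries d) hU (by simp) ?_ ?_ ?_ ?_ ?_ m
  · intro z hz
    exact ((differentiableAt_riemannZeta (zne z hz)).mul (hPd z)).differentiableWithinAt
  · intro z hz
    have : LSeries.abscissaOfAbsConv d < z.re := habs.trans_lt (by exact_mod_cast hz)
    exact (LSeries_hasDerivAt this).differentiableAt.differentiableWithinAt
  · intro z hz
    have hz' : 1 < z.re := hz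
    have zz : riemannZeta z ≠ 0 := riemannZeta_ne_zero_of_one_le_re hz'.le
    have zL : ∀ χ ∈ S, χ.LFunction z ≠ 0 := fun χ h => χ.LFunction_ne_zero_of_one_le_re (Or.inl (h1 χ h)) hz'.le
    have zP : ∏ χ ∈ S, χ.LFunction z ≠ 0 := prod_ne_zero_iff.2 zL
    have e1 := logDeriv_mul z zz zP (differentiableAt_riemannZeta (zne z hz')) (hPd z)
    have e2 := logDeriv_prod (s := S) (f := fun χ : DirichletCharacter ℂ q => χ.LFunction) (x := z) zL (fun χ h => hLd χ h z)
    have e3 : LSeries d z = - logDeriv (fun s => riemannZeta s * ∏ χ ∈ S, χ.LFunction s) z := by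
      rw [e1, e2, dsum, LSeries_add (hsm z hz') (LSeriesSummable.sum (hsmχ z hz')), LSeries_sum (hsmχ z hz'), neg_add, ← sum_neg_distrib]
      congr 1
      · rw [hΛ, ArithmeticFunction.LSeries_vonMangoldt_eq_deriv_riemannZeta_div hz', logDeriv_apply, neg_div]
      · apply sum_congr rfl
        intro χ _
        have := DirichletCharacter.LSeries_twist_vonMangoldt_eq χ hz'
        rw [logDeriv_apply, χ.deriv_LFunction_eq_deriv_LSeries hz', χ.LFunction_eq_LSeries hz', ← neg_div]
        exact this
    rw [e3, logDeriv_apply]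
    have : riemannZeta z * ∏ χ ∈ S, χ.LFunction z ≠ 0 := mul_ne_zero zz zP
    field_simp
  · have hL : ∀ χ ∈ S, 0 ≤ χ.LFunction 2 := by
      intro χ h
      have e := L_real (h1 χ h) (h2 χ h) (x := 2) (by norm_num)
      have := L_two χ
      norm_num at e
      rw [e]
      exact_mod_cast (by linarith : 0 ≤ (χ.LFunction 2).re)
    refine mul_nonneg ?_ (prod_nonneg hL)
    rw [riemannZeta_two]
    norm_cast
    positivity
  · intro m
    have := LSeries.iteratedDeriv_alternating hd0 (x := 2) (habs.trans_lt (by norm_cast)) m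
    simpa using this

lemma L_half_bound : ∃ C : ℝ, 1 ≤ C ∧ ∀ (q : ℕ) [NeZero q] (χ : DirichletCharacter ℂ q), χ ≠ 1 → ∀ s : ℂ, 1/2 ≤ s.re → ‖s‖ ≤ 4 →
    ‖χ.LFunction s‖ ≤ C * q := by
  have hs := summable_shift (r := 3/2) (by norm_num)
  set T := ∑' n : ℕ, ((n:ℝ)+1)^(-(3/2:ℝ)) with hT
  have hT0 : 0 ≤ T := tsum_nonneg fun n => by positivity
  refine ⟨4 * T + 1, by linarith, ?_⟩
  intro q _ χ hχ s h1 h2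
  have h := L_hasSum hχ (s := s) (by linarith)
  have hb := (hs.hasSum.mul_left ((q:ℝ) * 4))
  have := tsum_of_norm_bounded hb (f := fun n : ℕ => (∑ m ∈ range (n+2), χ (m : ZMod q)) * ((((n:ℝ)+1 : ℝ) : ℂ)^(-s) - (((n:ℝ)+1+1 : ℝ):ℂ)^(-s))) (fun n => by
    refine (L_term_bound hχ s (by linarith) n).trans ?_
    gcongr
    · linarith [(Nat.cast_nonneg n : (0:ℝ) ≤ n)]
    · linarith)
  rw [h.tsum_eq] at this
  refine this.trans ?_
  have : (0:ℝ) ≤ q := Nat.cast_nonneg q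
  nlinarith

lemma iter_inv (m : ℕ) (lam : ℂ) : (-1)^m * iteratedDeriv m (fun s : ℂ => lam * (s - 1)⁻¹) 2 = m.factorial * lam := by
  rw [iteratedDeriv_const_mul_field, iteratedDeriv_eq_iterate]
  have := iter_deriv_inv_linear_sub m (1:ℂ) 1
  simp only [one_mul, one_pow, mul_one] at this
  rw [this]
  norm_num
  rw [← mul_assoc, mul_comm _ lam, ← mul_assoc, mul_comm _ lam, mul_assoc, mul_assoc, ← mul_assoc ((-1:ℂ)^m), ← pow_add, Even.neg_one_pow ⟨m, rfl⟩]
  ring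

end Cay

namespace Cay
open Finset Metric
open scoped ComplexOrder

lemma est_main : ∃ c : ℝ, 0 < c ∧ ∀ (q : ℕ) [NeZero q] (S : Finset (DirichletCharacter ℂ q)), S.card ≤ 3 →
    (∀ χ ∈ S, χ ≠ 1) → (∀ χ ∈ S, χ^2 = 1) → (∀ n : ℕ, 0 ≤ 1 + ∑ χ ∈ S, χ (n : ZMod q)) → ∀ s : ℝ, 7/8 ≤ s → s < 1 →
    (riemannZeta s * ∏ χ ∈ S, χ.LFunction s).re ≤ 0 → c * (1 - s) * (q:ℝ)^(-(12*(1-s))) ≤ ‖∏ χ ∈ S, χ.LFunction 1‖ := by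
  obtain ⟨C, hC, HC⟩ := L_half_bound
  obtain ⟨Z, hZ⟩ := (isCompact_sphere (2:ℂ) (3/2)).exists_bound_of_continuousOn (f := riemannZeta₀) differentiable_riemannZeta₀.continuous.continuousOn
  have hZ0 : 0 ≤ Z := (norm_nonneg _).trans (hZ (2 + 3/2) (by simp))
  set A := (4 + Z) * C^3 with hA
  have hC3 : 1 ≤ C^3 := one_le_pow₀ hC
  have hA1 : 1 ≤ A := by nlinarith
  refine ⟨1/54/(Real.exp 1 * (216 * A)), by positivity, ?_⟩
  intro q _ S hcard h1 h2 hn s hs hs1 hF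
  have hq : (1:ℝ) ≤ q := by exact_mod_cast NeZero.one_le
  set Q : ℂ → ℂ := fun s => ∏ χ ∈ S, χ.LFunction s with hQ
  have hQd : Differentiable ℂ Q := by
    apply Differentiable.fun_finsetProd
    exact fun χ h => DirichletCharacter.differentiable_LFunction (h1 χ h)
  set G : ℂ → ℂ := fun s => dslope Q 1 s + riemannZeta₀ s * Q s with hG
  have hGd : Differentiable ℂ G := by
    apply Differentiable.add
    · rw [← differentiableOn_univ]
      exact (Complex.differentiableOn_dslope Filter.univ_mem).2 hQd.differentiableOn
    · exact differentiable_riemannZeta₀.mul hQd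
  have hGF : ∀ z : ℂ, z ≠ 1 → riemannZeta z * Q z = G z + Q 1 * (z - 1)⁻¹ := by
    intro z hz
    rw [hG]
    simp only
    rw [dslope_of_ne _ hz, slope_def_field, riemannZeta_eq_inv_sub_add hz]
    have : z - 1 ≠ 0 := sub_ne_zero.2 hz
    field_simp
    ring
  have hQb : ∀ z : ℂ, 1/2 ≤ z.re → ‖z‖ ≤ 4 → ‖Q z‖ ≤ C^3 * (q:ℝ)^3 := by
    intro z hz hz'
    have hCq : 1 ≤ C * q := one_le_mul_of_one_le_of_one_le hC hq
    rw [hQ]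
    simp only
    rw [norm_prod]
    calc _ ≤ ∏ χ ∈ S, (C * q) := prod_le_prod (fun _ _ => norm_nonneg _) (fun χ h => HC q χ (h1 χ h) z hz hz')
      _ = (C * q)^S.card := by rw [prod_const]
      _ ≤ (C * q)^3 := pow_le_pow_right₀ hCq hcard
      _ = _ := by ring
  set K := A * (q:ℝ)^3 with hKdef
  have hK : ∀ z ∈ sphere (2:ℂ) (3/2), ‖G z‖ ≤ K := by
    intro z hz
    have hz' : ‖z - 2‖ = 3/2 := by simpa [dist_eq_norm] using hz
    have hre := (Complex.abs_re_le_norm (z - 2))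
    rw [hz', Complex.sub_re, abs_le] at hre
    norm_num at hre
    have hzr : 1/2 ≤ z.re := by linarith
    have hzn : ‖z‖ ≤ 4 := by
      calc ‖z‖ = ‖(z - 2) + 2‖ := by ring_nf
        _ ≤ ‖z - 2‖ + ‖(2:ℂ)‖ := norm_add_le _ _
        _ ≤ _ := by rw [hz']; norm_num
    have hz1 : 1/2 ≤ ‖z - 1‖ := by
      have := norm_sub_norm_le (z - 2) (-1)
      rw [hz'] at this
      rw [show z - 1 = z - 2 - (-1) by ring]
      norm_num at this ⊢
      linarith
    have hzne : z ≠ 1 := by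
      rintro rfl; norm_num at hz1
    have q1 := hQb z hzr hzn
    have q2 := hQb 1 (by norm_num) (by norm_num)
    rw [hG]
    simp only
    refine (norm_add_le _ _).trans ?_
    rw [dslope_of_ne _ hzne, slope_def_field, norm_mul, norm_div]
    have q3 : ‖Q z - Q 1‖ ≤ 2 * (C^3 * (q:ℝ)^3) := (norm_sub_le _ _).trans (by linarith)
    calc _ ≤ (2 * (C^3 * (q:ℝ)^3)) / (1/2) + Z * (C^3 * (q:ℝ)^3) := by
          gcongr
          exact hZ z hz
      _ = K := by rw [hKdef, hA]; ring
  have hK1 : 1 ≤ K := one_le_mul_of_one_le_of_one_le hA1 (one_le_pow₀ hq)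
  have hb : ∀ m : ℕ, 0 ≤ ((-1)^m * iteratedDeriv m G 2).re + m.factorial * (Q 1).re := by
    intro m
    have := pos_F S h1 h2 hn m
    have e : (fun s => riemannZeta s * ∏ χ ∈ S, χ.LFunction s) =ᶠ[nhds 2] (fun z => G z + Q 1 * (z - 1)⁻¹) := by
      filter_upwards [isOpen_ne.mem_nhds (show (2:ℂ) ≠ 1 by norm_num)] with z hz
      exact hGF z hz
    rw [e.iteratedDeriv_eq, iteratedDeriv_fun_add, mul_add, iter_inv] at this
    · have := (Complex.nonneg_iff.1 this).1
      rw [Complex.add_re] at this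
      have e3 : ((m.factorial : ℂ) * Q 1).re = m.factorial * (Q 1).re := by
        rw [← Complex.ofReal_natCast, Complex.re_ofReal_mul]
      rwa [e3] at this
    · exact (hGd.analyticAt 2).contDiffAt
    · have : AnalyticAt ℂ (fun z : ℂ => Q 1 * (z - 1)⁻¹) 2 := by
        apply AnalyticAt.mul analyticAt_const
        apply AnalyticAt.inv (by fun_prop)
        norm_num
      exact this.contDiffAt
  have hb0 : (1/27 : ℝ) ≤ (G 2).re + (Q 1).re := by
    have := hGF 2 (by norm_num)
    norm_num at this
    rw [← Complex.add_re, ← this]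
    have hQ2 : ∃ r : ℝ, 1/27 ≤ r ∧ Q 2 = r := by
      have hL : ∀ χ ∈ S, χ.LFunction 2 = ((χ.LFunction 2).re : ℝ) := by
        intro χ h
        simpa using L_real (h1 χ h) (h2 χ h) (x := 2) (by norm_num)
      refine ⟨∏ χ ∈ S, (χ.LFunction 2).re, ?_, ?_⟩
      · calc (1/27:ℝ) = (1/3)^3 := by norm_num
          _ ≤ (1/3)^S.card := pow_le_pow_of_le_one (by norm_num) (by norm_num) hcard
          _ = ∏ χ ∈ S, (1/3:ℝ) := by rw [prod_const]
          _ ≤ _ := prod_le_prod (fun _ _ => by norm_num) (fun χ _ => L_two χ)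
      · rw [hQ]; push_cast
        exact prod_congr rfl hL
    obtain ⟨r, hr, e⟩ := hQ2
    rw [e, riemannZeta_two]
    have : ((Real.pi:ℂ)^2/6 * (r:ℂ)).re = Real.pi^2/6 * r := by norm_cast
    rw [this]
    have := Real.pi_gt_three
    nlinarith
  have hFs : (G s).re - (Q 1).re / (1 - s) ≤ 0 := by
    have := hGF s (by norm_cast; linarith)
    rw [hQ] at this
    simp only at this
    rw [this] at hF
    rw [Complex.add_re] at hF
    have e : (Q 1 * ((s:ℂ) - 1)⁻¹).re = - ((Q 1).re/(1-s)) := by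
      rw [show ((s:ℂ) - 1)⁻¹ = (((s-1)⁻¹ : ℝ) : ℂ) by push_cast; rfl, Complex.re_mul_ofReal]
      rw [div_eq_mul_inv, ← mul_neg, ← inv_neg]
      congr 2; ring
    have hF' : (G s).re + (Q 1 * ((s:ℂ) - 1)⁻¹).re ≤ 0 := hF
    rw [e] at hF'
    linarith
  set M := ⌈4 * Real.log (216 * K)⌉₊ with hM
  have hlog : 1 < Real.log (216 * K) := by
    rw [Real.lt_log_iff_exp_lt (by positivity)]
    have := Real.exp_one_lt_d9
    nlinarith
  have hM1 : 4 * Real.log (216 * K) ≤ M := Nat.le_ceil _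
  have hM2 : (M:ℝ) ≤ 4 * Real.log (216 * K) + 1 := (Nat.ceil_lt_add_one (by linarith)).le
  have hMK : 4 * K * (3/4)^M ≤ (1/27)/2 := by
    have : (3/4:ℝ)^M ≤ 1/(216*K) := by
      calc (3/4:ℝ)^M ≤ (Real.exp (-(1/4)))^M := by
            gcongr
            have := Real.add_one_le_exp (-(1/4):ℝ)
            norm_num at this ⊢
            linarith
        _ = Real.exp (-(M/4)) := by rw [← Real.exp_nat_mul]; ring_nf
        _ ≤ Real.exp (- Real.log (216*K)) := by
            rw [Real.exp_le_exp]; linarith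
        _ = _ := by rw [Real.exp_neg, Real.exp_log (by positivity), one_div]
    calc _ ≤ 4 * K * (1/(216*K)) := by gcongr
      _ = _ := by field_simp; norm_num
  have main := estermann hGd hK hb hb0 hs hs1 hFs M (by
    have : (1:ℝ) ≤ M := by linarith
    exact_mod_cast this) hMK
  have hu : (2-s)^M ≤ Real.exp 1 * (216 * A) * (q:ℝ)^(12*(1-s)) := by
    calc (2-s)^M ≤ (Real.exp (1-s))^M := by
          have := Real.add_one_le_exp (1-s)
          exact pow_le_pow_left₀ (by linarith) (by linarith) _
      _ = Real.exp ((1-s)*M) := by rw [← Real.exp_nat_mul]; ring_nf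
      _ ≤ Real.exp (1 + Real.log (216*K) * (4*(1-s))) := by
          rw [Real.exp_le_exp]
          nlinarith
      _ = Real.exp 1 * (216*K)^(4*(1-s)) := by
          rw [Real.exp_add, Real.rpow_def_of_pos (by positivity)]
      _ = Real.exp 1 * ((216*A)^(4*(1-s)) * (q:ℝ)^(12*(1-s))) := by
          rw [hKdef, ← mul_assoc, Real.mul_rpow (by positivity) (by positivity)]
          congr 2
          rw [← Real.rpow_natCast_mul (by positivity)]
          congr 1; push_cast; ring
      _ ≤ Real.exp 1 * ((216*A)^(1:ℝ) * (q:ℝ)^(12*(1-s))) := by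
          gcongr
          · linarith
          · linarith
      _ = _ := by rw [Real.rpow_one]; ring
  have hre : 0 ≤ (Q 1).re := by
    by_contra hc
    push Not at hc
    have : 0 < (2-s)^M := pow_pos (by linarith) _
    nlinarith
  have hnorm : (Q 1).re ≤ ‖Q 1‖ := Complex.re_le_norm _
  have fin : (1/27)/2 * (1-s) ≤ ‖Q 1‖ * (Real.exp 1 * (216 * A) * (q:ℝ)^(12*(1-s))) := by
    refine main.trans ?_
    have : 0 ≤ (2-s)^M := pow_nonneg (by linarith) _
    gcongr
  rw [Real.rpow_neg (by positivity)]
  have hqp : 0 < (q:ℝ)^(12*(1-s)) := by positivity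
  rw [← div_eq_mul_inv, div_le_iff₀ hqp, div_mul_eq_mul_div, div_le_iff₀ (by positivity)]
  calc _ = (1/27)/2 * (1-s) := by ring
    _ ≤ _ := fin
    _ = _ := by ring

end Cay

namespace Cay
open Finset Metric
open scoped ComplexOrder

lemma L_pos {q : ℕ} [NeZero q] {χ : DirichletCharacter ℂ q} (hχ : χ ≠ 1) (h2 : χ^2 = 1) {x : ℝ} (hx : 0 < x) (hx1 : x < 1)
    (hz : ∀ β : ℝ, x ≤ β → β < 1 → χ.LFunction β ≠ 0) : 0 < (χ.LFunction x).re := by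
  by_contra hc
  push Not at hc
  have hcont : Continuous fun y : ℝ => (χ.LFunction y).re := 
    Complex.continuous_re.comp ((DirichletCharacter.differentiable_LFunction hχ).continuous.comp Complex.continuous_ofReal)
  have h3 := L_two χ
  have := intermediate_value_Icc (show x ≤ 2 by linarith) hcont.continuousOn (show (0:ℝ) ∈ Set.Icc (χ.LFunction x).re (χ.LFunction (2:ℝ)).re from ⟨hc, by
    norm_num; linarith⟩)
  obtain ⟨y, hy, hy0⟩ := this
  have e := L_real hχ h2 (show 0 < y by linarith [hy.1])
  simp only at hy0
  rw [hy0] at e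
  rcases lt_or_ge y 1 with h | h
  · exact hz y hy.1 h (by simpa using e)
  · exact χ.LFunction_ne_zero_of_one_le_re (s := y) (Or.inl hχ) (by simpa using h) (by simpa using e)

theorem siegel : SiegelHyp := by
  classical
  intro ε hε
  obtain ⟨c, hc, HE⟩ := est_main
  -- choose ε2
  have hcont : ContinuousAt (fun x : ℝ => (riemannZeta₁ ((1 - x : ℝ) : ℂ)).re) 0 := by
    apply Continuous.continuousAt
    exact Complex.continuous_re.comp (differentiable_riemannZeta₁.continuous.comp (Complex.continuous_ofReal.comp (by fun_prop)))
  have hev : ∀ᶠ x : ℝ in nhds 0, 0 < (riemannZeta₁ ((1 - x : ℝ) : ℂ)).re := by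
    apply hcont.eventually (lt_mem_nhds _)
    simp
  obtain ⟨d, hd, Hd⟩ := Metric.eventually_nhds_iff.1 hev
  set e2 := min (d/2) (min (1/8) (ε/48)) with he2
  have e2p : 0 < e2 := by positivity
  have e2d : e2 < d := (min_le_left _ _).trans_lt (by linarith)
  have e28 : e2 ≤ 1/8 := (min_le_right _ _).trans (min_le_left _ _)
  have e2ε : 48 * e2 ≤ ε := by
    have : e2 ≤ ε/48 := (min_le_right _ _).trans (min_le_right _ _)
    linarith
  by_cases hcase : ∃ (q₁ : ℕ) (_ : NeZero q₁) (χ : DirichletCharacter ℂ q₁) (β : ℝ), χ ≠ 1 ∧ χ^2 = 1 ∧ 1 - e2 ≤ β ∧ β < 1 ∧ χ.LFunction β = 0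
  · obtain ⟨q₁, hq₁, χ₁, β, hχ₁, hχ₁2, hβ, hβ1, hzero⟩ := hcase
    set δ := min (ε/16) (1/4) with hδ
    have δp : 0 < δ := by positivity
    have δε : 16 * δ ≤ ε := by have := min_le_left (ε/16) (1/4:ℝ); linarith
    have δ4 : δ ≤ 1/4 := min_le_right _ _
    obtain ⟨C, hC, HC⟩ := L_upper δp (by linarith)
    obtain ⟨C3, hC3, H3⟩ := prod_gen δp
    refine ⟨c * (1-β) / (4 * C^2 * C3) * (q₁:ℝ)^(-ε), ?_, ?_⟩
    · have : (0:ℝ) < q₁ := by exact_mod_cast NeZero.pos q₁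
      have : 0 < 1 - β := by linarith
      positivity
    intro q₂ _ χ₂ hχ₂ hχ₂2
    obtain ⟨q, hqdef⟩ : ∃ q, q = q₁ * q₂ := ⟨_, rfl⟩
    have : NeZero q := ⟨by rw [hqdef]; exact mul_ne_zero (NeZero.ne _) (NeZero.ne _)⟩
    have d1 : q₁ ∣ q := hqdef ▸ Dvd.intro _ rfl
    have d2 : q₂ ∣ q := hqdef ▸ Dvd.intro_left _ rfl
    set ψ₁ := DirichletCharacter.changeLevel d1 χ₁ with hψ₁
    set ψ₂ := DirichletCharacter.changeLevel d2 χ₂ with hψ₂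
    have ψ₁n : ψ₁ ≠ 1 := by rwa [hψ₁, Ne, DirichletCharacter.changeLevel_eq_one_iff]
    have ψ₂n : ψ₂ ≠ 1 := by rwa [hψ₂, Ne, DirichletCharacter.changeLevel_eq_one_iff]
    have ψ₁2 : ψ₁^2 = 1 := by rw [hψ₁, ← map_pow, hχ₁2, map_one]
    have ψ₂2 : ψ₂^2 = 1 := by rw [hψ₂, ← map_pow, hχ₂2, map_one]
    have ψ₁z : ψ₁.LFunction β = 0 := by
      rw [hψ₁, DirichletCharacter.LFunction_changeLevel d1 χ₁ (Or.inl hχ₁), hzero, zero_mul]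
    have hq : (1:ℝ) ≤ q := by exact_mod_cast NeZero.one_le
    set T := 2 * C * (q:ℝ)^(2*δ) with hT
    have hq2 : 1 ≤ (q:ℝ)^(2*δ) := Real.one_le_rpow hq (by linarith)
    have hT1 : 1 ≤ T := by nlinarith
    have hup : ∀ ψ : DirichletCharacter ℂ q, ψ ≠ 1 → ‖ψ.LFunction 1‖ ≤ T := by
      intro ψ hψ
      refine (HC q ψ hψ 1 (by simpa using δp.le) (by norm_num)).trans ?_
      have := two_mul_rpow_le (V := (q:ℝ)) (ε := 2*δ) (by linarith) (by linarith) (by linarith)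
      simp only [Complex.one_im, abs_zero, zero_add]
      rw [mul_comm (q:ℝ) 2, hT]
      nlinarith
    have hlow : ‖ψ₂.LFunction 1‖ ≤ ‖χ₂.LFunction 1‖ * (C3 * (q:ℝ)^δ) := by
      rw [hψ₂, DirichletCharacter.LFunction_changeLevel d2 χ₂ (Or.inl hχ₂), norm_mul]
      gcongr
      apply H3 q (NeZero.ne _) 
      intro p hp
      refine (norm_sub_le _ _).trans ?_
      rw [norm_one, norm_mul]
      have a1 : ‖χ₂ p‖ ≤ 1 := χ₂.norm_le_one _
      have a2 : ‖(p:ℂ)^(-(1:ℂ))‖ ≤ 1 := by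
        rw [Complex.cpow_neg_one, norm_inv, Complex.norm_natCast]
        apply inv_le_one_of_one_le₀
        exact_mod_cast hp.one_lt.le
      nlinarith [norm_nonneg (χ₂ p), norm_nonneg ((p:ℂ)^(-(1:ℂ)))]
    have hmain : c * (1-β) * (q:ℝ)^(-(12*(1-β))) ≤ T^2 * ‖ψ₂.LFunction 1‖ := by
      by_cases hprod : ψ₁ * ψ₂ = 1
      · have e : ψ₂ = ψ₁ := by
          have : ψ₁ * ψ₁ = 1 := by rw [← sq, ψ₁2]
          exact mul_left_cancel (hprod.trans this.symm)
        have := HE q {ψ₂} (by simp) (by simpa using ψ₂n) (by simpa using ψ₂2) (by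
          intro n
          rw [sum_singleton]
          rcases quad_val ψ₂2 (n : ZMod q) with h | h | h <;> rw [h] <;> norm_num) β (by linarith) hβ1 (by
            rw [prod_singleton, e, ψ₁z]; simp)
        rw [prod_singleton] at this
        refine this.trans ?_
        have : 1 ≤ T^2 := one_le_pow₀ hT1
        nlinarith [norm_nonneg (ψ₂.LFunction 1)]
      · have n1 : ψ₁ ≠ ψ₂ := by
          intro h
          apply hprod
          rw [← h, ← sq, ψ₁2]
        have n2 : ψ₁ ≠ ψ₁ * ψ₂ := by
          intro h
          exact ψ₂n (by simpa using h)
        have n3 : ψ₂ ≠ ψ₁ * ψ₂ := by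
          intro h
          exact ψ₁n (by simpa using h)
        have hS : ∀ f : DirichletCharacter ℂ q → ℂ, ∏ χ ∈ ({ψ₁, ψ₂, ψ₁ * ψ₂} : Finset (DirichletCharacter ℂ q)), f χ = f ψ₁ * (f ψ₂ * f (ψ₁ * ψ₂)) := by
          intro f
          rw [prod_insert (by simp [n1, ψ₂n]), prod_insert (by simp [ψ₁n]), prod_singleton]
        have hS' : ∀ f : DirichletCharacter ℂ q → ℂ, ∑ χ ∈ ({ψ₁, ψ₂, ψ₁ * ψ₂} : Finset (DirichletCharacter ℂ q)), f χ = f ψ₁ + (f ψ₂ + f (ψ₁ * ψ₂)) := by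
          intro f
          rw [sum_insert (by simp [n1, ψ₂n]), sum_insert (by simp [ψ₁n]), sum_singleton]
        have := HE q {ψ₁, ψ₂, ψ₁ * ψ₂} card_le_three (by simp [ψ₁n, ψ₂n, hprod]) (by simp [ψ₁2, ψ₂2, mul_pow]) (by
          intro n
          rw [hS']
          rw [MulChar.mul_apply]
          rcases quad_val ψ₁2 (n : ZMod q) with h | h | h <;> rcases quad_val ψ₂2 (n : ZMod q) with h' | h' | h' <;> rw [h, h'] <;> norm_num) β (by linarith) hβ1 (by
            rw [hS, ψ₁z]; simp)
        rw [hS, norm_mul, norm_mul] at this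
        refine this.trans ?_
        have u1 := hup ψ₁ ψ₁n
        have u2 := hup _ hprod
        calc _ ≤ T * (‖ψ₂.LFunction 1‖ * T) := by gcongr
          _ = _ := by ring
    have hβp : 0 < 1 - β := by linarith
    have f1 : c * (1-β) * (q:ℝ)^(-(12*(1-β))) ≤ 4 * C^2 * C3 * (q:ℝ)^(5*δ) * ‖χ₂.LFunction 1‖ := by
      calc _ ≤ T^2 * ‖ψ₂.LFunction 1‖ := hmain
        _ ≤ T^2 * (‖χ₂.LFunction 1‖ * (C3 * (q:ℝ)^δ)) := by gcongr
        _ = 4 * C^2 * C3 * (((q:ℝ)^(2*δ))^2 * (q:ℝ)^δ) * ‖χ₂.LFunction 1‖ := by rw [hT]; ring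
        _ = _ := by
          congr 2
          rw [← Real.rpow_mul_natCast (by linarith), ← Real.rpow_add (by linarith)]
          congr 1; push_cast; ring
    have f2 : c * (1-β) * (q:ℝ)^(-(12*(1-β))) * (q:ℝ)^(-(5*δ)) ≤ 4 * C^2 * C3 * ‖χ₂.LFunction 1‖ := by
      calc _ ≤ 4 * C^2 * C3 * (q:ℝ)^(5*δ) * ‖χ₂.LFunction 1‖ * (q:ℝ)^(-(5*δ)) := by gcongr
        _ = 4 * C^2 * C3 * ‖χ₂.LFunction 1‖ := by
          rw [Real.rpow_neg (by linarith)]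
          have : (q:ℝ)^(5*δ) ≠ 0 := by positivity
          field_simp
    have f3 : (q₁:ℝ)^(-ε) * (q₂:ℝ)^(-ε) ≤ (q:ℝ)^(-(12*(1-β))) * (q:ℝ)^(-(5*δ)) := by
      rw [← Real.mul_rpow (by positivity) (by positivity), ← Real.rpow_add (by linarith), hqdef]
      push_cast
      apply Real.rpow_le_rpow_of_exponent_le
      · rw [hqdef] at hq; exact_mod_cast hq
      · linarith
    calc _ = c * (1-β) * ((q₁:ℝ)^(-ε) * (q₂:ℝ)^(-ε)) / (4 * C^2 * C3) := by ring
      _ ≤ c * (1-β) * ((q:ℝ)^(-(12*(1-β))) * (q:ℝ)^(-(5*δ))) / (4 * C^2 * C3) := by gcongr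
      _ ≤ _ := by
        rw [div_le_iff₀ (by positivity)]
        linarith
  · push Not at hcase
    refine ⟨c * e2, by positivity, ?_⟩
    intro q _ χ hχ hχ2
    have hq : (1:ℝ) ≤ q := by exact_mod_cast NeZero.one_le
    have hpos := L_pos hχ hχ2 (x := 1 - e2) (by linarith) (by linarith) (fun β h h' => hcase q inferInstance χ β hχ hχ2 h h')
    have := HE q {χ} (by simp) (by simpa using hχ) (by simpa using hχ2) (by
      intro n
      rw [sum_singleton]
      rcases quad_val hχ2 (n : ZMod q) with h | h | h <;> rw [h] <;> norm_num) (1 - e2) (by linarith) (by linarith) (by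
        rw [prod_singleton, L_real hχ hχ2 (by linarith), Complex.re_mul_ofReal]
        apply mul_nonpos_of_nonpos_of_nonneg _ hpos.le
        rw [riemannZeta_eq_inv_sub_mul (by norm_cast; linarith)]
        have h4 := Hd (y := e2) (by simpa [abs_of_pos e2p] using e2d)
        rw [show (((1 - e2 : ℝ) : ℂ) - 1)⁻¹ = (((-e2)⁻¹ : ℝ) : ℂ) by push_cast; congr 1; ring, Complex.re_ofReal_mul]
        apply mul_nonpos_of_nonpos_of_nonneg _ h4.le
        rw [inv_nonpos]; linarith)
    rw [prod_singleton] at this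
    refine le_trans ?_ this
    rw [show 1 - (1 - e2) = e2 by ring]
    gcongr
    linarith

end Cay

namespace Cay
open Finset Metric

lemma ev_re {s : ℂ} (h : 1 < s.re) : ∀ᶠ z in nhds s, 1 < z.re :=
  Complex.continuous_re.continuousAt.eventually (lt_mem_nhds h)

lemma Dk_eq {a : ℕ → ℂ} {F : ℂ → ℂ} (hs : ∀ s : ℂ, 1 < s.re → LSeriesSummable a s)
    (hF : ∀ s : ℂ, 1 < s.re → LSeries a s = F s) (k : ℕ) {s : ℂ} (h : 1 < s.re) :
    ‖LSeries (LSeries.logMul^[k] a) s‖ = ‖iteratedDeriv k F s‖ := by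
  have h1 : LSeries.abscissaOfAbsConv a < s.re := by
    refine lt_of_le_of_lt (LSeries.abscissaOfAbsConv_le_of_forall_lt_LSeriesSummable (x := 1) ?_) (by exact_mod_cast h)
    intro y hy
    exact hs y (by simpa using hy)
  have h2 : iteratedDeriv k F s = iteratedDeriv k (LSeries a) s := by
    apply Filter.EventuallyEq.iteratedDeriv_eq
    filter_upwards [ev_re h] with z hz using (hF z hz).symm
  rw [h2, LSeries_iteratedDeriv k h1, norm_mul, norm_pow, norm_neg, norm_one, one_pow, one_mul]

lemma rat_pow {V C c ε ρ : ℝ} (hV : 0 < V) (hc : 0 < c) (k : ℕ) :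
    (8 * (C * V^(2*ε)) / (ρ * (c * V^(-ε))))^(k+1) = (8 * C/(ρ * c))^(k+1) * V^(3*ε*(k+1)) := by
  have : 8 * (C * V^(2*ε)) / (ρ * (c * V^(-ε))) = (8 * C/(ρ * c)) * V^(3*ε) := by
    rw [Real.rpow_neg hV.le, show 3*ε = 2*ε+ε by ring, Real.rpow_add hV]
    field_simp
  rw [this, mul_pow, ← Real.rpow_mul_natCast hV.le]
  push_cast
  rfl

lemma Dk_chi {δ : ℝ} (hδ : 0 < δ) (hδ1 : δ ≤ 1/2) (k : ℕ) : ∃ C : ℝ, 1 ≤ C ∧ ∀ (q : ℕ) [NeZero q] (χ : DirichletCharacter ℂ q) (s : ℂ),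
    χ ≠ 1 → 1 < s.re → s.re ≤ 2 →
    ‖LSeries (LSeries.logMul^[k] ((fun n : ℕ => χ n) * (fun n => ((ArithmeticFunction.vonMangoldt n : ℝ) : ℂ)))) s‖ ≤ C * ((q:ℝ)*(|s.im|+2))^δ := by
  set ε := δ / (3 * (k+1)) with hε
  have εp : 0 < ε := by positivity
  have εl : ε < 1/2 := by
    have : ε ≤ δ / 3 := by rw [hε]; gcongr; nlinarith [(Nat.cast_nonneg k : (0:ℝ) ≤ k)]
    linarith
  have εδ : 3 * ε * (k+1) = δ := by rw [hε]; field_simp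
  obtain ⟨C, hC, HC⟩ := loc_bound εp εl
  obtain ⟨c, hc, Hc⟩ := L_lower siegel εp
  refine ⟨max 1 (k.factorial * (8 * C/(ε*c))^(k+1)), le_max_left _ _, ?_⟩
  intro q _ χ s hχ hs hs2
  have hV : 0 < (q:ℝ)*(|s.im|+2) := by
    have : (0:ℝ) < q := by exact_mod_cast NeZero.pos q
    positivity
  rw [Dk_eq (F := fun z => -(deriv χ.LFunction z / χ.LFunction z)) (fun s h => χ.LSeriesSummable_twist_vonMangoldt h) (fun s h => by
    rw [χ.LSeries_twist_vonMangoldt_eq h, χ.LFunction_eq_LSeries h, χ.deriv_LFunction_eq_deriv_LSeries h, neg_div]) k hs,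
    iteratedDeriv_fun_neg, norm_neg]
  obtain ⟨h1, h2⟩ := HC q χ s (Or.inl hχ) hs.le hs2
  have h3 := Hc q χ s hχ hs.le hs2
  refine (logderiv_bound εp h1 h2 (by positivity) h3 k).trans ?_
  rw [rat_pow hV hc, εδ, ← mul_assoc]
  gcongr
  exact le_max_right _ _

lemma zeta1_ne {s : ℂ} (h : 1 ≤ s.re) : riemannZeta₁ s ≠ 0 := by
  by_cases h1 : s = 1
  · rw [h1, riemannZeta₁_one]; exact one_ne_zero
  · have := riemannZeta_ne_zero_of_one_le_re h
    rw [riemannZeta_eq_inv_sub_mul h1] at this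
    exact right_ne_zero_of_mul this

lemma Dk_zeta {δ : ℝ} (hδ : 0 < δ) (hδ1 : δ ≤ 1/2) (k : ℕ) : ∃ C : ℝ, 1 ≤ C ∧ ∀ (s : ℂ),
    1 < s.re → s.re ≤ 2 →
    ‖LSeries (LSeries.logMul^[k] ((fun n => ((ArithmeticFunction.vonMangoldt n : ℝ) : ℂ)) - 1)) s‖ ≤ C * (|s.im|+2)^δ := by
  set ε := δ / (3 * (k+1)) with hε
  have εp : 0 < ε := by positivity
  have εl : ε < 1/2 := by
    have : ε ≤ δ / 3 := by rw [hε]; gcongr; nlinarith [(Nat.cast_nonneg k : (0:ℝ) ≤ k)]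
    linarith
  have εδ : 3 * ε * (k+1) = δ := by rw [hε]; field_simp
  have ε2δ : 2 * ε ≤ δ := by rw [← εδ]; nlinarith [(Nat.cast_nonneg k : (0:ℝ) ≤ k)]
  obtain ⟨C, hC, HC⟩ := loc_bound εp εl
  obtain ⟨c, hc, Hc⟩ := zeta_lower εp
  set G : ℂ → ℂ := fun z => -(deriv riemannZeta₁ z / riemannZeta₁ z) - riemannZeta₀ z with hG
  have hGa : ∀ s : ℂ, 1 ≤ s.re → AnalyticAt ℂ G s := by
    intro s hs
    have a1 : AnalyticAt ℂ riemannZeta₁ s := differentiable_riemannZeta₁.analyticAt s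
    have a0 : AnalyticAt ℂ riemannZeta₀ s := differentiable_riemannZeta₀.analyticAt s
    exact ((a1.deriv.div a1 (zeta1_ne hs)).neg).sub a0
  have hcomp : IsCompact (Set.Icc (1:ℝ) 2 ×ℂ Set.Icc (-1:ℝ) 1) := isCompact_Icc.reProdIm isCompact_Icc
  obtain ⟨K, hK⟩ := hcomp.exists_bound_of_continuousOn (f := iteratedDeriv k G) (by
    intro s hs
    apply ContinuousAt.continuousWithinAt
    rw [iteratedDeriv_eq_iterate]
    exact ((hGa s hs.1.1).iterated_deriv k).continuousAt)
  refine ⟨1 + |K| + k.factorial * (8 * C/(ε*c))^(k+1) + k.factorial * C / (ε/2)^k, ?_, ?_⟩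
  · have : 0 ≤ k.factorial * (8 * C/(ε*c))^(k+1) := by positivity
    have : 0 ≤ k.factorial * C / (ε/2)^k := by positivity
    linarith [abs_nonneg K]
  intro s hs hs2
  have hV1 : 1 ≤ |s.im| + 2 := by linarith [abs_nonneg s.im]
  have hV : 0 < |s.im|+2 := by linarith
  have hVδ : 1 ≤ (|s.im|+2)^δ := Real.one_le_rpow hV1 hδ.le
  have hsum : ∀ s : ℂ, 1 < s.re → LSeriesSummable ((fun n => ((ArithmeticFunction.vonMangoldt n : ℝ) : ℂ)) - 1) s :=
    fun s h => (ArithmeticFunction.LSeriesSummable_vonMangoldt h).sub (LSeriesSummable_one_iff.2 h)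
  have hLS : ∀ s : ℂ, 1 < s.re → LSeries ((fun n => ((ArithmeticFunction.vonMangoldt n : ℝ) : ℂ)) - 1) s = -(deriv riemannZeta s / riemannZeta s) - riemannZeta s := by
    intro s h
    rw [LSeries_sub (ArithmeticFunction.LSeriesSummable_vonMangoldt h) (LSeriesSummable_one_iff.2 h), LSeries_one_eq_riemannZeta h,
      ArithmeticFunction.LSeries_vonMangoldt_eq_deriv_riemannZeta_div h, neg_div]
  have p1 : 0 ≤ k.factorial * (8 * C/(ε*c))^(k+1) := by positivity
  have p2 : 0 ≤ k.factorial * C / (ε/2)^k := by positivity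
  rcases le_total |s.im| 1 with hi | hi
  · rw [Dk_eq (F := G) hsum (fun s h => by
      have hne : s ≠ 1 := by rintro rfl; simp at h
      rw [hLS s h]
      have e1 : deriv riemannZeta s / riemannZeta s = -(s-1)⁻¹ + deriv riemannZeta₁ s / riemannZeta₁ s := by
        have e : riemannZeta =ᶠ[nhds s] fun z => (z-1)⁻¹ * riemannZeta₁ z := by
          filter_upwards [isOpen_ne.mem_nhds hne] with z hz using riemannZeta_eq_inv_sub_mul hz
        have hne' : s - 1 ≠ 0 := sub_ne_zero.2 hne
        have hd : HasDerivAt (fun z : ℂ => (z-1)⁻¹ * riemannZeta₁ z) (-1/(s-1)^2 * riemannZeta₁ s + (s-1)⁻¹ * deriv riemannZeta₁ s) s :=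
          (((hasDerivAt_id s).sub_const 1).fun_inv hne').mul (differentiable_riemannZeta₁ s).hasDerivAt
        rw [e.deriv_eq, hd.deriv, riemannZeta_eq_inv_sub_mul hne]
        have := zeta1_ne h.le
        field_simp
      rw [e1, riemannZeta_eq_inv_sub_add hne, hG]
      ring) k hs]
    have := hK s ⟨⟨hs.le, hs2⟩, abs_le.1 hi⟩
    calc _ ≤ |K| := this.trans (le_abs_self _)
      _ ≤ |K| * (|s.im|+2)^δ := le_mul_of_one_le_right (abs_nonneg _) hVδ
      _ ≤ _ := by
        gcongr; linarith
  · have hne : s ≠ 1 := by rintro rfl; simp at hs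
    rw [Dk_eq (F := fun z => -(deriv riemannZeta z / riemannZeta z) - riemannZeta z) hsum hLS k hs]
    have az : AnalyticAt ℂ riemannZeta s := by
      refine DifferentiableOn.analyticAt (s := {z : ℂ | z ≠ 1}) (fun z hz => (differentiableAt_riemannZeta hz).differentiableWithinAt) (isOpen_ne.mem_nhds hne)
    have hz0 := riemannZeta_ne_zero_of_one_le_re hs.le
    have ad : AnalyticAt ℂ (fun z => deriv riemannZeta z / riemannZeta z) s := az.deriv.div az hz0
    rw [iteratedDeriv_fun_sub (f := fun z => -(deriv riemannZeta z / riemannZeta z)) ad.neg.contDiffAt az.contDiffAt, iteratedDeriv_fun_neg]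
    obtain ⟨h1, h2⟩ := HC 1 1 s (Or.inr ⟨rfl, hi⟩) hs.le hs2
    rw [DirichletCharacter.LFunction_modOne_eq] at h1 h2
    simp only [Nat.cast_one, one_mul] at h2
    have h3 := Hc s hs.le hs2 hi
    have b1 := logderiv_bound εp h1 h2 (by positivity) h3 k
    rw [rat_pow hV hc, εδ, ← mul_assoc] at b1
    have b2 : ‖iteratedDeriv k riemannZeta s‖ ≤ k.factorial * (C * (|s.im|+2)^(2*ε)) / (ε/2)^k := by
      apply Complex.norm_iteratedDeriv_le_of_forall_mem_sphere_norm_le k (by positivity)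
      · apply DifferentiableOn.diffContOnCl_ball (U := ball s ε) h1
        exact closedBall_subset_ball (by linarith)
      · intro z hz
        apply h2
        rw [mem_sphere] at hz
        rw [mem_ball, hz]; linarith
    have b3 : (|s.im|+2)^(2*ε) ≤ (|s.im|+2)^δ := Real.rpow_le_rpow_of_exponent_le hV1 ε2δ
    have b4 : k.factorial * (C * (|s.im|+2)^(2*ε)) / (ε/2)^k ≤ k.factorial * C / (ε/2)^k * (|s.im|+2)^δ := by
      calc _ = k.factorial * C / (ε/2)^k * (|s.im|+2)^(2*ε) := by ring
        _ ≤ _ := by gcongr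
    refine (norm_sub_le _ _).trans ?_
    rw [norm_neg]
    nlinarith [abs_nonneg K]

end Cay

namespace Cay
open Finset MeasureTheory FourierTransform

noncomputable def pf (σ : ℝ) (u : ℝ) : ℂ := ((max u 0 * Real.exp (-σ*u) : ℝ) : ℂ)

lemma pf_eq_ind (σ : ℝ) : pf σ = Set.indicator (Set.Ioi 0) (fun u : ℝ => (u:ℂ)^((2:ℂ)-1) * Complex.exp (-((σ:ℂ)*u))) := by
  funext u
  by_cases h : 0 < u
  · rw [Set.indicator_of_mem (by exact h), pf, max_eq_left h.le]
    push_cast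
    norm_num
  · rw [Set.indicator_of_notMem (by exact h), pf, max_eq_right (not_lt.1 h)]
    simp

lemma pf_integrable {σ : ℝ} (hσ : 0 < σ) : Integrable (pf σ) := by
  have h := integrableOn_rpow_mul_exp_neg_mul_rpow (p := 1) (s := 1) (b := σ) (by norm_num) (by norm_num) hσ
  have h2 : pf σ = Set.indicator (Set.Ioi 0) (fun u : ℝ => ((u^(1:ℝ) * Real.exp (-σ * u^(1:ℝ)) : ℝ) : ℂ)) := by
    funext u
    by_cases h : 0 < u
    · rw [Set.indicator_of_mem (by exact h), pf, max_eq_left h.le]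
      simp
    · rw [Set.indicator_of_notMem (by exact h), pf, max_eq_right (not_lt.1 h)]
      simp
  rw [h2, integrable_indicator_iff measurableSet_Ioi]
  exact h.ofReal

lemma pf_cont (σ : ℝ) : Continuous (pf σ) := by
  unfold pf
  fun_prop

lemma int_exp {r : ℂ} (hr : 0 < r.re) : ∫ u : ℝ in Set.Ioi 0, (u:ℂ)^((2:ℂ)-1) * Complex.exp (-(r*u)) = 1 / r^2 := by
  have r0 : r ≠ 0 := by rintro rfl; simp at hr
  have e : ∀ u : ℝ, (u:ℂ)^((2:ℂ)-1) * Complex.exp (-(r*u)) = u * Complex.exp (-(r*u)) := by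
    intro u; norm_num
  simp_rw [e]
  have hd : ∀ x ∈ Set.Ici (0:ℝ), HasDerivAt (fun u : ℝ => -((u:ℂ)/r + 1/r^2) * Complex.exp (-(r*u))) ((x:ℂ) * Complex.exp (-(r*x))) x := by
    intro x _
    have h1 : HasDerivAt (fun u : ℝ => (u:ℂ)) 1 x := Complex.ofRealCLM.hasDerivAt
    have h2 := (((h1.div_const r).add_const (1/r^2)).neg).mul ((h1.const_mul r).neg.cexp)
    refine h2.congr_deriv ?_
    simp only [Pi.neg_apply]
    field_simp
    ring
  have hb : ∀ u : ℝ, ‖Complex.exp (-(r*u))‖ = Real.exp (-r.re*u) := by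
    intro u; rw [Complex.norm_exp]; simp
  have hi : IntegrableOn (fun u : ℝ => (u:ℂ) * Complex.exp (-(r*u))) (Set.Ioi 0) := by
    have h := integrableOn_rpow_mul_exp_neg_mul_rpow (p := 1) (s := 1) (b := r.re) (by norm_num) (by norm_num) hr
    refine h.mono' (by apply Continuous.aestronglyMeasurable; fun_prop) ?_
    refine (ae_restrict_iff' measurableSet_Ioi).2 (Filter.Eventually.of_forall fun u hu => ?_)
    rw [norm_mul, hb, Complex.norm_real, Real.norm_eq_abs, abs_of_pos hu]
    simp
  have ht : Filter.Tendsto (fun u : ℝ => -((u:ℂ)/r + 1/r^2) * Complex.exp (-(r*u))) Filter.atTop (nhds 0) := by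
    rw [tendsto_zero_iff_norm_tendsto_zero]
    have t1 := (tendsto_rpow_mul_exp_neg_mul_atTop_nhds_zero 1 r.re hr).const_mul (1/‖r‖)
    have t2 := (tendsto_rpow_mul_exp_neg_mul_atTop_nhds_zero 0 r.re hr).const_mul (1/‖r‖^2)
    have t3 := t1.add t2
    rw [mul_zero, mul_zero, add_zero] at t3
    refine squeeze_zero' (Filter.Eventually.of_forall fun u => norm_nonneg _) ?_ t3
    filter_upwards [Filter.eventually_ge_atTop 0] with u hu
    rw [norm_mul, hb, norm_neg, Real.rpow_one, Real.rpow_zero, one_mul, ← mul_assoc, ← add_mul]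
    gcongr
    refine (norm_add_le _ _).trans ?_
    rw [norm_div, norm_div, norm_pow, norm_one, Complex.norm_real, Real.norm_eq_abs, abs_of_nonneg hu]
    apply le_of_eq; ring
  rw [integral_Ioi_of_hasDerivAt_of_tendsto' hd hi ht]
  simp

lemma pf_fourier {σ : ℝ} (hσ : 0 < σ) (v : ℝ) : 𝓕 (pf σ) v = 1 / ((σ:ℂ) + 2*Real.pi*v*Complex.I)^2 := by
  rw [Real.fourier_real_eq_integral_exp_smul, pf_eq_ind]
  have : ∀ u : ℝ, Complex.exp (↑(-2 * Real.pi * u * v) * Complex.I) • Set.indicator (Set.Ioi 0) (fun u : ℝ => (u:ℂ)^((2:ℂ)-1) * Complex.exp (-((σ:ℂ)*u))) u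
      = Set.indicator (Set.Ioi 0) (fun u : ℝ => (u:ℂ)^((2:ℂ)-1) * Complex.exp (-(((σ:ℂ) + 2*Real.pi*v*Complex.I)*u))) u := by
    intro u
    by_cases h : 0 < u
    · rw [Set.indicator_of_mem (by exact h), Set.indicator_of_mem (by exact h), smul_eq_mul, mul_left_comm, ← Complex.exp_add]
      congr 2
      push_cast; ring
    · rw [Set.indicator_of_notMem (by exact h), Set.indicator_of_notMem (by exact h), smul_zero]
  rw [integral_congr_ae (Filter.Eventually.of_forall this), integral_indicator measurableSet_Ioi,
    int_exp (by simpa using hσ)]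

lemma den_norm {σ v : ℝ} : ‖1 / ((σ:ℂ) + 2*Real.pi*v*Complex.I)^2‖ = 1 / (σ^2 + (2*Real.pi*v)^2) := by
  rw [norm_div, norm_one, norm_pow, ← Complex.normSq_eq_norm_sq]
  congr 1
  simp [Complex.normSq_apply]
  ring

lemma den_le {σ v : ℝ} (hσ : 1 ≤ σ) : 1 / (σ^2 + (2*Real.pi*v)^2) ≤ 2 * (1+|v|)^(-(2:ℝ)) := by
  rw [Real.rpow_neg (by positivity), ← div_eq_mul_inv, div_le_div_iff₀ (by positivity) (by positivity)]
  have h3 := Real.pi_gt_three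
  have e : (1+|v|)^(2:ℝ) = (1+|v|)^2 := by norm_num
  have e2 : v^2 = |v|^2 := (sq_abs v).symm
  rw [e, mul_pow, e2]
  have : 1 ≤ σ^2 := by nlinarith
  have : 1 ≤ (2*Real.pi)^2 := by nlinarith
  nlinarith [sq_nonneg (|v|-1), sq_nonneg |v|]

lemma pfF_integrable {σ : ℝ} (hσ : 1 ≤ σ) : Integrable (fun v : ℝ => 1 / ((σ:ℂ) + 2*Real.pi*v*Complex.I)^2) := by
  have h := (integrable_one_add_norm (E := ℝ) (μ := volume) (r := 2) (by simp)).const_mul 2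
  refine h.mono' ?_ ?_
  · apply Measurable.aestronglyMeasurable
    fun_prop
  · refine Filter.Eventually.of_forall fun v => ?_
    rw [den_norm]
    exact den_le hσ

lemma pf_inv {σ : ℝ} (hσ : 1 ≤ σ) (u : ℝ) :
    ∫ v : ℝ, Complex.exp ((2*Real.pi*(v*u) : ℝ) * Complex.I) * (1 / ((σ:ℂ) + 2*Real.pi*v*Complex.I)^2) = pf σ u := by
  have e : 𝓕 (pf σ) = fun v : ℝ => 1 / ((σ:ℂ) + 2*Real.pi*v*Complex.I)^2 := by
    funext v; exact pf_fourier (by linarith) v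
  have := congrFun ((pf_cont σ).fourierInv_fourier_eq (pf_integrable (by linarith)) (by rw [e]; exact pfF_integrable hσ)) u
  rw [← this, e, Real.fourierInv_eq']
  apply integral_congr_ae
  refine Filter.Eventually.of_forall fun v => ?_
  simp only [smul_eq_mul, RCLike.inner_apply, conj_trivial]
  rw [mul_comm u v]

/-- Smoothed Perron formula bound. -/
lemma perron : ∃ C0 : ℝ, 1 ≤ C0 ∧ ∀ (b : ℕ → ℂ) (M : ℝ), 0 ≤ M → (∀ s : ℂ, 1 < s.re → LSeriesSummable b s) →
    (∀ s : ℂ, 1 < s.re → s.re ≤ 2 → ‖LSeries b s‖ ≤ M * (|s.im|+2)^(1/2:ℝ)) → ∀ y : ℝ, 3 ≤ y →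
    ‖∑ n ∈ Ioc 0 ⌊y⌋₊, b n * (Real.log (y/n) : ℝ)‖ ≤ C0 * M * y := by
  set I : ℝ := ∫ v : ℝ, 8 * (1+‖v‖)^(-(3/2:ℝ)) with hI
  have hInt : Integrable (fun v : ℝ => 8 * (1+‖v‖)^(-(3/2:ℝ))) := (integrable_one_add_norm (E := ℝ) (μ := volume) (r := 3/2) (by norm_num)).const_mul 8
  refine ⟨max 1 (3 * I), le_max_left _ _, ?_⟩
  intro b M hM hsum hb y hy
  have hy0 : 0 < y := by linarith
  have hly : 1 ≤ Real.log y := by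
    rw [Real.le_log_iff_exp_le hy0]
    linarith [Real.exp_one_lt_d9]
  set σ := 1 + 1/Real.log y with hσ
  have σ1 : 1 < σ := by rw [hσ]; have : 0 < 1/Real.log y := by positivity
                        linarith
  have σ2 : σ ≤ 2 := by rw [hσ]; have : 1/Real.log y ≤ 1 := by rw [div_le_one (by linarith)]; exact hly
                        linarith
  have hyσ : y^σ ≤ 3 * y := by
    rw [hσ, Real.rpow_add hy0, Real.rpow_one, Real.rpow_def_of_pos hy0, mul_one_div_cancel (by linarith)]
    nlinarith [Real.exp_one_lt_d9]
  set W : ℝ → ℂ := fun v => 1 / ((σ:ℂ) + 2*Real.pi*v*Complex.I)^2 with hW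
  set s : ℝ → ℂ := fun v => (σ:ℂ) + 2*Real.pi*v*Complex.I with hs
  have hsre : ∀ v, (s v).re = σ := by intro v; simp [hs]
  have hsim : ∀ v, (s v).im = 2*Real.pi*v := by intro v; simp [hs]
  set F : ℕ → ℝ → ℂ := fun n v => LSeries.term b (s v) n * ((y:ℂ)^(s v) * W v) with hF
  have hterm : ∀ n v, ‖LSeries.term b (s v) n‖ = ‖LSeries.term b σ n‖ := by
    intro n v
    rw [LSeries.norm_term_eq, LSeries.norm_term_eq, hsre, Complex.ofReal_re]
  have hycpow : ∀ v, ‖(y:ℂ)^(s v)‖ = y^σ := by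
    intro v; rw [Complex.norm_cpow_eq_rpow_re_of_pos hy0, hsre]
  have hFe : ∀ n, n ≠ 0 → ∀ v, F n v = b n * ((y/n)^σ : ℝ) * (Complex.exp ((2*Real.pi*(v*Real.log (y/n)) : ℝ) * Complex.I) * W v) := by
    intro n hn v
    have hn0 : (0:ℝ) < n := by positivity
    simp only [hF]
    rw [LSeries.term_of_ne_zero hn]
    have e1 : (y:ℂ)^(s v) / (n:ℂ)^(s v) = ((y/n)^σ : ℝ) * Complex.exp ((2*Real.pi*(v*Real.log (y/n)) : ℝ) * Complex.I) := by
      have hn1 : (n:ℂ) ≠ 0 := by exact_mod_cast hn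
      have hy1 : (y:ℂ) ≠ 0 := by exact_mod_cast hy0.ne'
      rw [Complex.cpow_def_of_ne_zero hn1, Complex.cpow_def_of_ne_zero hy1, ← Complex.exp_sub, Real.rpow_def_of_pos (by positivity),
        Complex.ofReal_exp, ← Complex.exp_add]
      congr 1
      rw [← Complex.natCast_log, ← Complex.ofReal_log hy0.le, Real.log_div hy0.ne' hn0.ne']
      simp only [hs]
      push_cast
      ring
    calc _ = b n * ((y:ℂ)^(s v) / (n:ℂ)^(s v)) * W v := by ring
      _ = _ := by rw [e1]; ring
  have hWi : Integrable W := pfF_integrable σ1.le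
  have hmeas : ∀ c : ℝ, Integrable (fun v : ℝ => Complex.exp ((2*Real.pi*(v*c) : ℝ) * Complex.I) * W v) := by
    intro c
    refine hWi.bdd_mul (c := 1) (by apply Continuous.aestronglyMeasurable; fun_prop) ?_
    refine Filter.Eventually.of_forall fun v => ?_
    rw [Complex.norm_exp_ofReal_mul_I]
  have hFint : ∀ n, Integrable (F n) := by
    intro n
    by_cases hn : n = 0
    · have : F n = fun _ => 0 := by funext v; simp [hF, hn]
      rw [this]; exact integrable_zero _ _ _
    · have : F n = fun v => b n * ((y/n)^σ : ℝ) * (Complex.exp ((2*Real.pi*(v*Real.log (y/n)) : ℝ) * Complex.I) * W v) := by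
        funext v; exact hFe n hn v
      rw [this]
      exact (hmeas _).const_mul _
  have hFnorm : ∀ n, ∫ v, ‖F n v‖ = ‖LSeries.term b σ n‖ * (y^σ * ∫ v, ‖W v‖) := by
    intro n
    rw [← integral_const_mul, ← integral_const_mul]
    congr 1
    funext v
    simp only [hF]
    rw [norm_mul, norm_mul, hterm, hycpow]
  have hS := hasSum_integral_of_summable_integral_norm hFint (by
    simp_rw [hFnorm]
    exact ((hsum σ (by simpa using σ1)).norm).mul_right _)
  -- identify the left side
  have hval : ∀ n, ∫ v, F n v = if n ∈ Ioc 0 ⌊y⌋₊ then b n * (Real.log (y/n) : ℝ) else 0 := by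
    intro n
    by_cases hn : n = 0
    · have : F n = fun _ => 0 := by funext v; simp [hF, hn]
      rw [this, hn]; simp
    · have hn0 : (0:ℝ) < n := by positivity
      have : F n = fun v => b n * ((y/n)^σ : ℝ) * (Complex.exp ((2*Real.pi*(v*Real.log (y/n)) : ℝ) * Complex.I) * W v) := by
        funext v; exact hFe n hn v
      rw [this, integral_const_mul, pf_inv σ1.le, pf]
      have hyn : 0 < y/n := by positivity
      by_cases h : n ∈ Ioc 0 ⌊y⌋₊
      · rw [if_pos h]
        rw [mem_Ioc, Nat.le_floor_iff hy0.le] at h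
        have hl : 0 ≤ Real.log (y/n) := Real.log_nonneg (by rw [le_div_iff₀ hn0]; linarith [h.2])
        rw [max_eq_left hl, Real.rpow_def_of_pos hyn, mul_assoc, ← Complex.ofReal_mul]
        congr 2
        rw [mul_left_comm, ← Real.exp_add]
        ring_nf
        simp
      · rw [if_neg h]
        rw [mem_Ioc, Nat.le_floor_iff hy0.le] at h
        have h' : y < n := by
          by_contra hc
          exact h ⟨Nat.pos_of_ne_zero hn, not_lt.1 hc⟩
        have hl : Real.log (y/n) ≤ 0 := Real.log_nonpos hyn.le (by rw [div_le_one hn0]; exact h'.le)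
        rw [max_eq_right hl]; simp
  have hts : ∑' n, ∫ v, F n v = ∑ n ∈ Ioc 0 ⌊y⌋₊, b n * (Real.log (y/n) : ℝ) := by
    rw [tsum_eq_sum (s := Ioc 0 ⌊y⌋₊)]
    · apply sum_congr rfl
      intro n hn
      rw [hval, if_pos hn]
    · intro n hn
      rw [hval, if_neg hn]
  rw [← hts, hS.tsum_eq]
  have hbd : ‖∫ v, ∑' n, F n v‖ ≤ ∫ v : ℝ, (M * (3*y)) * (8 * (1+‖v‖)^(-(3/2:ℝ))) := by
    apply norm_integral_le_of_norm_le (hInt.const_mul _)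
    refine Filter.Eventually.of_forall fun v => ?_
    have e : ∑' n, F n v = LSeries b (s v) * ((y:ℂ)^(s v) * W v) := by
      simp only [hF]
      rw [tsum_mul_right]; rfl
    rw [e, norm_mul, norm_mul, hycpow]
    have b1 := hb (s v) (by rw [hsre]; exact σ1) (by rw [hsre]; exact σ2)
    rw [hsim] at b1
    have b2 : ‖W v‖ ≤ 2 * (1+|v|)^(-(2:ℝ)) := by
      simp only [hW]; rw [den_norm]; exact den_le σ1.le
    have b3 : (|2*Real.pi*v|+2)^(1/2:ℝ) ≤ 4 * (1+|v|)^(1/2:ℝ) := by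
      have : (4:ℝ) = (16:ℝ)^(1/2:ℝ) := by
        rw [show (16:ℝ) = 4^(2:ℝ) by norm_num, ← Real.rpow_mul (by norm_num)]; norm_num
      rw [this, ← Real.mul_rpow (by norm_num) (by positivity)]
      apply Real.rpow_le_rpow (by positivity) _ (by norm_num)
      rw [abs_mul, abs_of_pos (by positivity)]
      nlinarith [Real.pi_lt_d2, abs_nonneg v]
    have e4 : (1+|v|)^(1/2:ℝ) * (1+|v|)^(-(2:ℝ)) = (1+|v|)^(-(3/2:ℝ)) := by
      rw [← Real.rpow_add (by positivity)]; norm_num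
    calc _ ≤ (M * (4 * (1+|v|)^(1/2:ℝ))) * ((3*y) * (2 * (1+|v|)^(-(2:ℝ)))) := by
          gcongr
          exact b1.trans (by gcongr)
      _ = (M * (3*y)) * (8 * ((1+|v|)^(1/2:ℝ) * (1+|v|)^(-(2:ℝ)))) := by ring
      _ = _ := by rw [e4, Real.norm_eq_abs]
  refine hbd.trans ?_
  rw [integral_const_mul, ← hI]
  have : 3 * I ≤ max 1 (3*I) := le_max_right _ _
  calc _ = 3 * I * (M * y) := by ring
    _ ≤ max 1 (3*I) * (M*y) := by gcongr
    _ = _ := by ring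

end Cay

namespace Cay
open Finset

lemma abel_anti (g : ℕ → ℝ) (z : ℕ → ℂ) (a b : ℕ) (K : ℝ) (hK : 0 ≤ K) (hab : a ≤ b)
    (hg0 : 0 ≤ g (b+1)) (hg : ∀ n, a < n → n ≤ b → g (n+1) ≤ g n)
    (hz : ∀ n, a < n → n ≤ b → ‖∑ m ∈ Ioc a n, z m‖ ≤ K) :
    ‖∑ n ∈ Ioc a b, (g n : ℂ) * z n‖ ≤ K * g (a+1) := by
  refine (abel_bound (fun n => (g n : ℂ)) z a b K hK hz).trans ?_
  have h1 : ∑ n ∈ Ioc a b, ‖((g (n+1) : ℝ):ℂ) - (g n : ℂ)‖ = g (a+1) - g (b+1) := by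
    have := sum_tele (fun n => - g n) a hab
    rw [show g (a+1) - g (b+1) = -g (b+1) - -g (a+1) by ring, ← this]
    apply sum_congr rfl
    intro n hn
    rw [mem_Ioc] at hn
    rw [← Complex.ofReal_sub, Complex.norm_real, Real.norm_eq_abs, abs_of_nonpos (by linarith [hg n hn.1 hn.2])]
    ring
  rw [h1, Complex.norm_real, Real.norm_eq_abs, abs_of_nonneg hg0]
  apply le_of_eq; ring

lemma one_le_log {N : ℕ} (h : 3 ≤ N) : 1 ≤ Real.log N := by
  have h' : (3:ℝ) ≤ N := by exact_mod_cast h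
  rw [Real.le_log_iff_exp_le (by linarith)]
  linarith [Real.exp_one_lt_d9]

lemma desmooth (m : ℕ) (hm : 1 ≤ m) (a b : ℕ → ℂ) (ha : ∀ n, 1 ≤ n → ‖a n‖ ≤ 1 + Real.log n)
    (hb : ∀ n, 1 ≤ n → b n = ((Real.log n)^(2*m-1) : ℝ) * a n) (K : ℝ) (hK : 1 ≤ K)
    (hZ : ∀ y : ℝ, 3 ≤ y → ‖∑ n ∈ Ioc 0 ⌊y⌋₊, b n * (Real.log (y/n) : ℝ)‖ ≤ K * y) (N : ℕ) (hN : 3 ≤ N) :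
    ‖∑ n ∈ Ioc 0 N, b n‖ ≤ (4 + 2*16^m) * K * N * (Real.log N)^m := by
  have hN' : (3:ℝ) ≤ N := by exact_mod_cast hN
  have hL := one_le_log hN
  set L := Real.log N with hLd
  have hLm : 1 ≤ L^m := one_le_pow₀ hL
  set h := 1 / L^m with hh
  have h0 : 0 < h := by positivity
  have h1 : h ≤ 1 := by rw [hh, div_le_one (by positivity)]; exact hLm
  have he := Real.abs_exp_sub_one_le (x := h) (by rw [abs_of_pos h0]; exact h1)
  rw [abs_of_pos h0] at he
  have he1 : Real.exp h - 1 ≤ 2 * h := (le_abs_self _).trans he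
  have he2 : 1 ≤ Real.exp h := Real.one_le_exp h0.le
  set y := N * Real.exp h with hy
  have hyN : (N:ℝ) ≤ y := by rw [hy]; nlinarith
  have hy3 : y ≤ 3 * N := by rw [hy]; nlinarith
  have hy0 : 0 < y := by linarith
  set N' := ⌊y⌋₊ with hN'd
  have hNN : N ≤ N' := Nat.le_floor hyN
  have z1 := hZ N hN'
  have z2 := hZ y (by linarith)
  rw [Nat.floor_natCast] at z1
  rw [← hN'd, ← sum_Ioc_consecutive _ (Nat.zero_le N) hNN] at z2
  have hdiff : ∑ n ∈ Ioc 0 N, b n * (Real.log (y/n) : ℝ) = ∑ n ∈ Ioc 0 N, b n * (Real.log (N/n) : ℝ) + (h:ℂ) * ∑ n ∈ Ioc 0 N, b n := by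
    rw [mul_sum, ← sum_add_distrib]
    apply sum_congr rfl
    intro n hn
    rw [mem_Ioc] at hn
    have hn0 : (0:ℝ) < n := by exact_mod_cast hn.1
    rw [hy, mul_div_right_comm, Real.log_mul (by positivity) (by positivity), Real.log_exp]
    push_cast; ring
  have htail : ‖∑ n ∈ Ioc N N', b n * (Real.log (y/n) : ℝ)‖ ≤ (2 * h * N) * ((16^m * L^(2*m)) * h) := by
    have hterm : ∀ n ∈ Ioc N N', ‖b n * (Real.log (y/n) : ℝ)‖ ≤ (16^m * L^(2*m)) * h := by
      intro n hn
      rw [mem_Ioc] at hn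
      have hn1 : 1 ≤ n := by omega
      have hn0 : (0:ℝ) < n := by exact_mod_cast hn1
      have hny : (n:ℝ) ≤ y := (Nat.le_floor_iff hy0.le).1 hn.2
      have hln0 : 0 ≤ Real.log n := Real.log_natCast_nonneg n
      have hln : Real.log n ≤ 3 * L := by
        have : Real.log n ≤ Real.log (3 * N) := Real.log_le_log hn0 (by linarith)
        rw [Real.log_mul (by norm_num) (by positivity)] at this
        have l3 : Real.log 3 ≤ 2 := by
          have := Real.log_le_sub_one_of_pos (show (0:ℝ) < 3 by norm_num)
          linarith
        linarith
      have hlog0 : 0 ≤ Real.log (y/n) := Real.log_nonneg (by rw [le_div_iff₀ hn0]; linarith)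
      have hlogh : Real.log (y/n) ≤ h := by
        have : y/n ≤ Real.exp h := by
          rw [div_le_iff₀ hn0, hy, mul_comm]
          have : (N:ℝ) ≤ n := by exact_mod_cast hn.1.le
          gcongr
        calc _ ≤ Real.log (Real.exp h) := Real.log_le_log (by positivity) this
          _ = h := Real.log_exp h
      have hbn : ‖b n‖ ≤ 16^m * L^(2*m) := by
        rw [hb n hn1, norm_mul, Complex.norm_real, Real.norm_eq_abs, abs_of_nonneg (by positivity)]
        calc _ ≤ (4 * L)^(2*m-1) * (4*L) := by
              apply mul_le_mul _ ((ha n hn1).trans (by linarith)) (norm_nonneg _) (by positivity)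
              apply pow_le_pow_left₀ hln0; linarith
          _ = (4*L)^(2*m) := by rw [← pow_succ]; congr 1; omega
          _ = _ := by rw [mul_pow, pow_mul]; norm_num
      rw [norm_mul, Complex.norm_real, Real.norm_eq_abs, abs_of_nonneg hlog0]
      exact mul_le_mul hbn hlogh hlog0 (by positivity)
    refine (norm_sum_le_of_le _ hterm).trans ?_
    rw [sum_const, Nat.card_Ioc, nsmul_eq_mul, Nat.cast_sub hNN]
    have : (N':ℝ) ≤ y := Nat.floor_le hy0.le
    apply mul_le_mul_of_nonneg_right _ (by positivity)
    have : y - N = N * (Real.exp h - 1) := by rw [hy]; ring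
    nlinarith
  rw [hdiff] at z2
  have hmain : h * ‖∑ n ∈ Ioc 0 N, b n‖ ≤ K * (3*N) + K * N + (2 * h * N) * ((16^m * L^(2*m)) * h) := by
    have e : (h:ℂ) * ∑ n ∈ Ioc 0 N, b n = (∑ n ∈ Ioc 0 N, b n * (Real.log (N/n) : ℝ) + (h:ℂ) * ∑ n ∈ Ioc 0 N, b n + ∑ n ∈ Ioc N N', b n * (Real.log (y/n) : ℝ)) - ∑ n ∈ Ioc 0 N, b n * (Real.log (N/n) : ℝ) - ∑ n ∈ Ioc N N', b n * (Real.log (y/n) : ℝ) := by ring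
    have e2 : ‖(h:ℂ) * ∑ n ∈ Ioc 0 N, b n‖ = h * ‖∑ n ∈ Ioc 0 N, b n‖ := by
      rw [norm_mul, Complex.norm_real, Real.norm_eq_abs, abs_of_pos h0]
    rw [← e2, e]
    refine (norm_sub_le _ _).trans (add_le_add ((norm_sub_le _ _).trans (add_le_add (z2.trans ?_) z1)) htail)
    gcongr
  have hLh : L^m * h = 1 := by rw [hh]; field_simp
  have hL2 : L^(2*m) * h^2 = 1 := by rw [mul_comm 2 m, pow_mul, ← mul_pow, hLh, one_pow]
  have e3 : ‖∑ n ∈ Ioc 0 N, b n‖ = L^m * (h * ‖∑ n ∈ Ioc 0 N, b n‖) := by rw [← mul_assoc, hLh, one_mul]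
  rw [e3]
  have hN0 : (0:ℝ) ≤ N := by linarith
  calc _ ≤ L^m * (K * (3*N) + K * N + (2 * h * N) * ((16^m * L^(2*m)) * h)) := by gcongr
    _ = L^m * (4 * K * N + 2 * 16^m * N * (L^(2*m) * h^2)) := by ring
    _ = L^m * N * (4 * K + 2 * 16^m * 1) := by rw [hL2]; ring
    _ ≤ L^m * N * (4 * K + 2 * 16^m * K) := by gcongr
    _ = _ := by ring

lemma log_pow_le_sqrt (m : ℕ) (hm : 1 ≤ m) (N : ℕ) (hN : 1 ≤ N) : (Real.log N)^m ≤ (2*m)^m * √N := by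
  have hm0 : (0:ℝ) < m := by exact_mod_cast hm
  have h := Real.log_le_rpow_div (x := N) (ε := 1/(2*m)) (by positivity) (by positivity)
  have h0 := Real.log_natCast_nonneg N
  calc _ ≤ ((N:ℝ)^(1/(2*m):ℝ) / (1/(2*m)))^m := by gcongr
    _ = (2*m)^m * ((N:ℝ)^(1/(2*m):ℝ))^m := by rw [← mul_pow]; congr 1; field_simp
    _ = _ := by
      rw [← Real.rpow_mul_natCast (by positivity), Real.sqrt_eq_rpow]
      congr 2; field_simp

lemma strip (m : ℕ) (hm : 1 ≤ m) : ∃ C : ℝ, 1 ≤ C ∧ ∀ (a b : ℕ → ℂ), (∀ n, 1 ≤ n → ‖a n‖ ≤ 1 + Real.log n) →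
    (∀ n, 1 ≤ n → b n = ((Real.log n)^(2*m-1) : ℝ) * a n) → ∀ K : ℝ, 1 ≤ K →
    (∀ y : ℝ, 3 ≤ y → ‖∑ n ∈ Ioc 0 ⌊y⌋₊, b n * (Real.log (y/n) : ℝ)‖ ≤ K * y) → ∀ N : ℕ, 9 ≤ N →
    ‖∑ n ∈ Ioc 0 N, a n‖ * (Real.log N)^(m-1) ≤ C * K * N := by
  refine ⟨4*(2*m)^m + 4^m * (2 * (4+2*16^m)), ?_, ?_⟩
  · have : 0 ≤ 4*(2*(m:ℝ))^m := by positivity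
    have : (1:ℝ) ≤ 4^m := one_le_pow₀ (by norm_num)
    have : (1:ℝ) ≤ 16^m := one_le_pow₀ (by norm_num)
    nlinarith
  intro a b ha hb K hK hZ N hN
  have hD := desmooth m hm a b ha hb K hK hZ
  have hN' : (9:ℝ) ≤ N := by exact_mod_cast hN
  have hL := one_le_log (show 3 ≤ N by omega)
  set L := Real.log N with hLd
  set M := ⌈√(N:ℝ)⌉₊ with hM
  have hs3 : 3 ≤ √(N:ℝ) := by
    apply Real.le_sqrt_of_sq_le; linarith
  have hsq : √(N:ℝ) * √(N:ℝ) = N := Real.mul_self_sqrt (by linarith)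
  have hM1 : √(N:ℝ) ≤ M := Nat.le_ceil _
  have hM2 : (M:ℝ) < √(N:ℝ) + 1 := Nat.ceil_lt_add_one (by positivity)
  have hM3 : 3 ≤ M := by
    have : (3:ℝ) ≤ M := hs3.trans hM1
    exact_mod_cast this
  have hMN : M ≤ N := by
    have : (M:ℝ) ≤ N := by nlinarith
    exact_mod_cast this
  have hlogM : L/2 ≤ Real.log M := by
    have : Real.log (√N) = L/2 := Real.log_sqrt (by linarith)
    rw [← this]
    exact Real.log_le_log (by linarith) hM1
  set K1 := (4+2*16^m) * K * N * L^m with hK1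
  have hK0 : 0 ≤ K1 := by positivity
  have hp : ∀ n, M ≤ n → n ≤ N → ‖∑ j ∈ Ioc 0 n, b j‖ ≤ K1 := by
    intro n h1 h2
    refine (hD n (by omega)).trans ?_
    have : (n:ℝ) ≤ N := by exact_mod_cast h2
    have h5 : Real.log n ≤ L := log_nat_mono h2
    have h6 := Real.log_natCast_nonneg n
    rw [hK1]
    gcongr
  rw [← sum_Ioc_consecutive _ (Nat.zero_le M) hMN]
  have hfirst : ‖∑ n ∈ Ioc 0 M, a n‖ ≤ 4 * √N * L := by
    have : ∀ n ∈ Ioc 0 M, ‖a n‖ ≤ 2 * L := by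
      intro n hn
      rw [mem_Ioc] at hn
      refine (ha n hn.1).trans ?_
      have := log_nat_mono (hn.2.trans hMN)
      linarith
    refine (norm_sum_le_of_le _ this).trans ?_
    rw [sum_const, Nat.card_Ioc, nsmul_eq_mul, Nat.sub_zero]
    nlinarith
  have hsecond : ‖∑ n ∈ Ioc M N, a n‖ ≤ (2*K1) * (2/L)^(2*m-1) := by
    have e : ∑ n ∈ Ioc M N, a n = ∑ n ∈ Ioc M N, (((1 / (Real.log n)^(2*m-1) : ℝ)) : ℂ) * b n := by
      apply sum_congr rfl
      intro n hn
      rw [mem_Ioc] at hn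
      rw [hb n (by omega), ← mul_assoc, ← Complex.ofReal_mul, one_div_mul_cancel, Complex.ofReal_one, one_mul]
      have : 1 ≤ Real.log n := one_le_log (by omega)
      positivity
    rw [e]
    refine (abel_anti (fun n => 1 / (Real.log n)^(2*m-1)) b M N (2*K1) (by positivity) hMN (by
      have := Real.log_natCast_nonneg (N+1)
      positivity) ?_ ?_).trans ?_
    · intro n h1 h2
      have : 1 ≤ Real.log n := one_le_log (by omega)
      have := log_nat_mono (Nat.le_succ n)
      apply one_div_le_one_div_of_le (by positivity)
      gcongr
    · intro n h1 h2
      have : ∑ j ∈ Ioc M n, b j = ∑ j ∈ Ioc 0 n, b j - ∑ j ∈ Ioc 0 M, b j := by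
        rw [← sum_Ioc_consecutive _ (Nat.zero_le M) h1.le]; ring
      rw [this]
      refine (norm_sub_le _ _).trans ?_
      linarith [hp n h1.le h2, hp M le_rfl hMN]
    · have h5 : L/2 ≤ Real.log ((M+1:ℕ):ℝ) := hlogM.trans (log_nat_mono (Nat.le_succ M))
      rw [← one_div_pow]
      have h6 : 1 / Real.log ((M+1:ℕ):ℝ) ≤ 2 / L := by
        rw [div_le_div_iff₀ (by linarith) (by linarith)]
        linarith
      have h7 : 0 ≤ 1 / Real.log ((M+1:ℕ):ℝ) := by
        have := Real.log_natCast_nonneg (M+1)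
        positivity
      exact mul_le_mul_of_nonneg_left (pow_le_pow_left₀ h7 h6 _) (by positivity)
  have hLp : L * L^(m-1) = L^m := by rw [← pow_succ']; congr 1; omega
  have hlp := log_pow_le_sqrt m hm N (by omega)
  rw [← hLd] at hlp
  have b1 : (4 * √N * L) * L^(m-1) ≤ 4*(2*m)^m * N := by
    rw [mul_assoc, hLp]
    calc _ ≤ 4 * √N * ((2*m)^m * √N) := by gcongr
      _ = 4*(2*m)^m * (√(N:ℝ) * √N) := by ring
      _ = _ := by rw [hsq]
  have b2 : (2*K1) * (2/L)^(2*m-1) * L^(m-1) ≤ 4^m * (2 * (4+2*16^m)) * K * N := by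
    have e : (2/L)^(2*m-1) * (L^m * L^(m-1)) = 2^(2*m-1) := by
      rw [← pow_add, show m + (m-1) = 2*m-1 by omega, ← mul_pow, div_mul_cancel₀ _ (by linarith)]
    have e2 : (2:ℝ)^(2*m-1) ≤ 4^m := by
      rw [show (4:ℝ) = 2^2 by norm_num, ← pow_mul]
      exact pow_le_pow_right₀ (by norm_num) (by omega)
    calc _ = (2 * (4+2*16^m)) * K * N * ((2/L)^(2*m-1) * (L^m * L^(m-1))) := by rw [hK1]; ring
      _ = (2 * (4+2*16^m)) * K * N * 2^(2*m-1) := by rw [e]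
      _ ≤ (2 * (4+2*16^m)) * K * N * 4^m := by gcongr
      _ = _ := by ring
  calc _ ≤ (4 * √N * L + (2*K1) * (2/L)^(2*m-1)) * L^(m-1) := by
        gcongr
        exact (norm_add_le _ _).trans (add_le_add hfirst hsecond)
    _ = (4 * √N * L) * L^(m-1) + (2*K1) * (2/L)^(2*m-1) * L^(m-1) := by ring
    _ ≤ 4*(2*m)^m * N + 4^m * (2 * (4+2*16^m)) * K * N := add_le_add b1 b2
    _ ≤ 4*(2*m)^m * K * N + 4^m * (2 * (4+2*16^m)) * K * N := by
        have : 4*(2*(m:ℝ))^m ≤ 4*(2*m)^m * K := le_mul_of_one_le_right (by positivity) hK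
        have := mul_le_mul_of_nonneg_right this (by linarith : (0:ℝ) ≤ N)
        linarith
    _ = _ := by ring

end Cay

namespace Cay
open Finset ArithmeticFunction

lemma sum_nthRoots (q : ℕ) (hq : 0 < q) : ∑ ζ ∈ Polynomial.nthRootsFinset q (1:ℂ), ζ = if q = 1 then 1 else 0 := by
  have hp := Complex.isPrimitiveRoot_exp q hq.ne'
  have e : ∑ ζ ∈ Polynomial.nthRootsFinset q (1:ℂ), ζ = ∑ i ∈ range q, (Complex.exp (2 * Real.pi * Complex.I / q))^i := by
    symm
    refine sum_bij (fun i _ => (Complex.exp (2 * Real.pi * Complex.I / q))^i) ?_ ?_ ?_ ?_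
    · intro i _
      rw [Polynomial.mem_nthRootsFinset hq, ← pow_mul, mul_comm i q, pow_mul, hp.pow_eq_one, one_pow]
    · intro i hi j hj h
      exact hp.pow_inj (mem_range.1 hi) (mem_range.1 hj) h
    · intro z hz
      rw [Polynomial.mem_nthRootsFinset hq] at hz
      have : NeZero q := ⟨hq.ne'⟩
      obtain ⟨i, hi, h⟩ := hp.eq_pow_of_pow_eq_one hz
      exact ⟨i, mem_range.2 hi, h⟩
    · intro i _; rfl
  rw [e]
  split_ifs with h
  · subst h; simp
  · exact hp.geom_sum_eq_zero (by omega)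

lemma sum_primRoots (q : ℕ) (hq : 0 < q) : ∑ ζ ∈ primitiveRoots q ℂ, ζ = ((moebius q : ℤ) : ℂ) := by
  classical
  have h := (sum_eq_iff_sum_mul_moebius_eq (R := ℂ) (f := fun q => ∑ ζ ∈ primitiveRoots q ℂ, ζ) (g := fun q => if q = 1 then 1 else 0)).1 (by
    intro n hn
    rw [← sum_nthRoots n hn, IsPrimitiveRoot.nthRoots_one_eq_biUnion_primitiveRoots, sum_biUnion]
    intro i _ j _ hij
    exact IsPrimitiveRoot.disjoint hij) q hq
  rw [← h, Nat.sum_divisorsAntidiagonal (f := fun i j => ((moebius i : ℤ) : ℂ) * (if j = 1 then 1 else 0))]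
  rw [sum_eq_single q]
  · simp [Nat.div_self hq]
  · intro b hb hne
    have hb' := Nat.dvd_of_mem_divisors hb
    rw [if_neg, mul_zero]
    intro h1
    apply hne
    have := Nat.div_mul_cancel hb'
    rw [h1, one_mul] at this
    exact this
  · intro h
    simp at h
    omega

/-- reduced residues -/
def cop (q : ℕ) : Finset ℕ := (range q).filter (fun b => b.Coprime q)

lemma mem_cop {q b : ℕ} : b ∈ cop q ↔ b < q ∧ b.Coprime q := by simp [cop]

lemma card_cop (q : ℕ) : (cop q).card = q.totient := by
  rw [cop, Nat.totient_eq_card_coprime]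
  congr 1
  ext b
  simp [Nat.coprime_comm]

lemma ee_prim {a : ℤ} {q : ℕ} (hq : 0 < q) (hc : IsCoprime a (q:ℤ)) : IsPrimitiveRoot (ee ((a:ℝ)/q)) q := by
  have := Complex.isPrimitiveRoot_exp_of_isCoprime a q hq.ne' hc
  have e : ee ((a:ℝ)/q) = Complex.exp (2 * Real.pi * Complex.I * (a / q)) := by
    unfold ee
    congr 1
    push_cast; ring
  rw [e]; exact this

lemma ramanujan {a : ℤ} {q : ℕ} (hq : 0 < q) (hc : IsCoprime a (q:ℤ)) :
    ∑ b ∈ cop q, ee (b * ((a:ℝ)/q)) = ((moebius q : ℤ) : ℂ) := by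
  have hp := ee_prim hq hc
  rw [← sum_primRoots q hq]
  have : NeZero q := ⟨hq.ne'⟩
  refine sum_bij (fun b _ => ee (b * ((a:ℝ)/q))) ?_ ?_ ?_ ?_
  · intro b hb
    rw [mem_cop] at hb
    rw [ee_mul_nat, mem_primitiveRoots hq]
    exact hp.pow_of_coprime b hb.2
  · intro i hi j hj h
    rw [mem_cop] at hi hj
    rw [ee_mul_nat, ee_mul_nat] at h
    exact hp.pow_inj hi.1 hj.1 h
  · intro z hz
    rw [mem_primitiveRoots hq, hp.isPrimitiveRoot_iff] at hz
    obtain ⟨i, hi, hi2, h⟩ := hz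
    exact ⟨i, mem_cop.2 ⟨hi, hi2⟩, by rw [ee_mul_nat, h]⟩
  · intro b _; rfl

lemma ee_mod (a : ℤ) {q : ℕ} (hq : 0 < q) (n : ℕ) : ee (((n % q : ℕ):ℝ) * ((a:ℝ)/q)) = ee (n * ((a:ℝ)/q)) := by
  have hq' : (q:ℝ) ≠ 0 := by positivity
  have h : (n:ℝ) = q * (n/q : ℕ) + (n % q : ℕ) := by exact_mod_cast (Nat.div_add_mod n q).symm
  generalize n / q = k at h
  have : (n:ℝ) * ((a:ℝ)/q) = ((n % q : ℕ):ℝ) * ((a:ℝ)/q) + ((a * (k:ℤ) : ℤ) : ℝ) := by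
    conv_lhs => rw [h]
    push_cast
    field_simp
    ring
  rw [this, ee_add_int]

lemma noncop_sum (N q : ℕ) (hq : 0 < q) (hN : 0 < N) : ∑ n ∈ (Ioc 0 N).filter (fun n => ¬ n.Coprime q), vonMangoldt n ≤ q * Real.log N := by
  classical
  set M := ∏ p ∈ q.primeFactors, p^(Nat.log p N) with hM
  have hM0 : M ≠ 0 := by
    rw [hM, prod_ne_zero_iff]
    intro p hp
    exact pow_ne_zero _ (Nat.prime_of_mem_primeFactors hp).ne_zero
  have h1 : ∑ n ∈ (Ioc 0 N).filter (fun n => ¬ n.Coprime q), vonMangoldt n ≤ ∑ n ∈ M.divisors, vonMangoldt n := by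
    rw [← sum_filter_ne_zero]
    apply sum_le_sum_of_subset_of_nonneg
    · intro n hn
      rw [mem_filter, mem_filter, mem_Ioc, vonMangoldt_ne_zero_iff] at hn
      obtain ⟨⟨⟨hn0, hnN⟩, hnc⟩, hpp⟩ := hn
      rw [isPrimePow_nat_iff] at hpp
      obtain ⟨p, k, hp, hk, rfl⟩ := hpp
      have hpq : p ∣ q := by
        by_contra h
        exact hnc (Nat.Coprime.pow_left k ((Nat.Prime.coprime_iff_not_dvd hp).2 h))
      rw [Nat.mem_divisors]
      refine ⟨?_, hM0⟩
      refine dvd_trans (pow_dvd_pow p (Nat.le_log_of_pow_le hp.one_lt hnN)) ?_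
      exact dvd_prod_of_mem (fun p => p^(Nat.log p N)) (Nat.mem_primeFactors.2 ⟨hp, hpq, hq.ne'⟩)
    · intro n _ _; exact vonMangoldt_nonneg
  refine h1.trans ?_
  rw [vonMangoldt_sum, hM]
  push_cast
  rw [Real.log_prod (fun p hp => by
    have := (Nat.prime_of_mem_primeFactors hp).ne_zero
    positivity)]
  calc _ ≤ ∑ p ∈ q.primeFactors, Real.log N := by
        apply sum_le_sum
        intro p hp
        have hpp := Nat.prime_of_mem_primeFactors hp
        apply Real.log_le_log (by have := hpp.pos; positivity)
        exact_mod_cast Nat.pow_log_le_self p hN.ne'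
    _ = (q.primeFactors.card : ℝ) * Real.log N := by rw [sum_const, nsmul_eq_mul]
    _ ≤ _ := by
      apply mul_le_mul_of_nonneg_right _ (Real.log_natCast_nonneg N)
      have : q.primeFactors.card ≤ q := by
        calc _ ≤ (Ioc 0 q).card := card_le_card (fun p hp => mem_Ioc.2 ⟨(Nat.prime_of_mem_primeFactors hp).pos, Nat.le_of_mem_primeFactors hp⟩)
          _ = q := by simp
      exact_mod_cast this

lemma logMul_iter (a : ℕ → ℂ) (k n : ℕ) : LSeries.logMul^[k] a n = ((Real.log n)^k : ℝ) * a n := by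
  induction k with
  | zero => simp
  | succ k ih =>
    rw [Function.iterate_succ_apply', LSeries.logMul, ih, ← Complex.natCast_log]
    push_cast; ring

lemma logMul_summable {a : ℕ → ℂ} (hs : ∀ s : ℂ, 1 < s.re → LSeriesSummable a s) (k : ℕ) (s : ℂ) (h : 1 < s.re) :
    LSeriesSummable (LSeries.logMul^[k] a) s := by
  apply LSeriesSummable_of_abscissaOfAbsConv_lt_re
  rw [LSeries.absicssaOfAbsConv_logPowMul]
  refine lt_of_le_of_lt (LSeries.abscissaOfAbsConv_le_of_forall_lt_LSeriesSummable (x := 1) ?_) (by exact_mod_cast h)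
  intro y hy
  exact hs y (by simpa using hy)

lemma psi_chi (A : ℕ) : ∃ C : ℝ, 1 ≤ C ∧ ∀ (q : ℕ) [NeZero q] (χ : DirichletCharacter ℂ q), χ ≠ 1 → ∀ N : ℕ, 9 ≤ N →
    ‖∑ n ∈ Ioc 0 N, χ n * (vonMangoldt n : ℂ)‖ * (Real.log N)^A ≤ C * q * N := by
  obtain ⟨C1, hC1, H1⟩ := strip (A+1) (by omega)
  obtain ⟨C0, hC0, H0⟩ := perron
  obtain ⟨C2, hC2, H2⟩ := Dk_chi (δ := 1/2) (by norm_num) le_rfl (2*(A+1)-1)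
  refine ⟨C1 * (C0 * C2), by nlinarith [mul_le_mul hC0 hC2 (by norm_num) (by linarith)], ?_⟩
  intro q _ χ hχ N hN
  have hq : (1:ℝ) ≤ q := by exact_mod_cast NeZero.one_le
  set a : ℕ → ℂ := (fun n : ℕ => χ n) * (fun n => ((vonMangoldt n : ℝ) : ℂ)) with ha
  have hq2 : (q:ℝ)^(1/2:ℝ) ≤ q := by
    calc _ ≤ (q:ℝ)^(1:ℝ) := Real.rpow_le_rpow_of_exponent_le hq (by norm_num)
      _ = q := Real.rpow_one _
  have hK : 1 ≤ C0 * (C2 * q) := by nlinarith [mul_le_mul hC2 hq (by norm_num) (by linarith)]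
  have := H1 a (LSeries.logMul^[2*(A+1)-1] a) (by
    intro n hn
    simp only [ha, Pi.mul_apply]
    rw [norm_mul, Complex.norm_real, Real.norm_eq_abs, abs_of_nonneg vonMangoldt_nonneg]
    have h1 := χ.norm_le_one (n : ZMod q)
    have h2 := vonMangoldt_le_log (n := n)
    have h3 := vonMangoldt_nonneg (n := n)
    nlinarith) (fun n _ => logMul_iter a _ n) (C0 * (C2 * q)) hK (by
      intro y hy
      refine H0 _ (C2 * q) (by positivity) (logMul_summable (fun s h => χ.LSeriesSummable_twist_vonMangoldt h) _) ?_ y hy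
      intro s hs hs2
      refine (H2 q χ s hχ hs hs2).trans ?_
      rw [Real.mul_rpow (by positivity) (by positivity), ← mul_assoc]
      gcongr) N hN
  rw [Nat.add_sub_cancel] at this
  refine this.trans (le_of_eq (by ring))

lemma psi_one (A : ℕ) : ∃ C : ℝ, 1 ≤ C ∧ ∀ N : ℕ, 9 ≤ N →
    ‖∑ n ∈ Ioc 0 N, (vonMangoldt n : ℂ) - N‖ * (Real.log N)^A ≤ C * N := by
  obtain ⟨C1, hC1, H1⟩ := strip (A+1) (by omega)
  obtain ⟨C0, hC0, H0⟩ := perron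
  obtain ⟨C2, hC2, H2⟩ := Dk_zeta (δ := 1/2) (by norm_num) le_rfl (2*(A+1)-1)
  refine ⟨C1 * (C0 * C2), by nlinarith [mul_le_mul hC0 hC2 (by norm_num) (by linarith)], ?_⟩
  intro N hN
  set a : ℕ → ℂ := (fun n => ((vonMangoldt n : ℝ) : ℂ)) - 1 with ha
  have hK : 1 ≤ C0 * C2 := by nlinarith
  have := H1 a (LSeries.logMul^[2*(A+1)-1] a) (by
    intro n hn
    simp only [ha, Pi.sub_apply, Pi.one_apply]
    refine (norm_sub_le _ _).trans ?_
    rw [Complex.norm_real, Real.norm_eq_abs, abs_of_nonneg vonMangoldt_nonneg, norm_one]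
    have h2 := vonMangoldt_le_log (n := n)
    linarith) (fun n _ => logMul_iter a _ n) (C0 * C2) hK (by
      intro y hy
      refine H0 _ C2 (by positivity) (logMul_summable (fun s h => (ArithmeticFunction.LSeriesSummable_vonMangoldt h).sub (LSeriesSummable_one_iff.2 h)) _) ?_ y hy
      intro s hs hs2
      exact H2 s hs hs2) N hN
  rw [Nat.add_sub_cancel] at this
  have e : ∑ n ∈ Ioc 0 N, a n = ∑ n ∈ Ioc 0 N, (vonMangoldt n : ℂ) - N := by
    simp only [ha, Pi.sub_apply, Pi.one_apply]
    rw [sum_sub_distrib]; simp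
  rw [e] at this
  refine this.trans (le_of_eq (by ring))

end Cay

namespace Cay
open Finset ArithmeticFunction

/-- Gauss type sum -/
noncomputable def gs {q : ℕ} (χ : DirichletCharacter ℂ q) (a : ℤ) : ℂ :=
  ∑ b ∈ cop q, χ ((b : ZMod q)⁻¹) * ee (b * ((a:ℝ)/q))

lemma gs_id {q : ℕ} [NeZero q] (a : ℤ) (n : ℕ) :
    ∑ χ : DirichletCharacter ℂ q, gs χ a * χ n = if n.Coprime q then (q.totient : ℂ) * ee (n * ((a:ℝ)/q)) else 0 := by
  have hq : 0 < q := Nat.pos_of_ne_zero (NeZero.ne q)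
  simp only [gs, sum_mul]
  rw [sum_comm]
  have h1 : ∀ b ∈ cop q, ∑ χ : DirichletCharacter ℂ q, χ ((b : ZMod q)⁻¹) * ee (b * ((a:ℝ)/q)) * χ n
      = if b = n % q then (q.totient : ℂ) * ee (n * ((a:ℝ)/q)) else 0 := by
    intro b hb
    rw [mem_cop] at hb
    have hu : IsUnit (b : ZMod q) := (ZMod.isUnit_iff_coprime b q).2 hb.2
    have h2 := DirichletCharacter.sum_char_inv_mul_char_eq ℂ hu (n : ZMod q)
    have h3 : ∑ χ : DirichletCharacter ℂ q, χ ((b : ZMod q)⁻¹) * ee (b * ((a:ℝ)/q)) * χ n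
      = (∑ χ : DirichletCharacter ℂ q, χ ((b : ZMod q)⁻¹) * χ n) * ee (b * ((a:ℝ)/q)) := by
      rw [sum_mul]; apply sum_congr rfl; intro χ _; ring
    rw [h3, h2]
    have h4 : ((b : ZMod q) = (n : ZMod q)) ↔ b = n % q := by
      rw [ZMod.natCast_eq_natCast_iff', Nat.mod_eq_of_lt hb.1]
    by_cases h : b = n % q
    · rw [if_pos (h4.2 h), if_pos h, h, ee_mod a hq]
    · rw [if_neg (fun h' => h (h4.1 h')), if_neg h, zero_mul]
  rw [sum_congr rfl h1, sum_ite_eq']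
  have h5 : n % q ∈ cop q ↔ n.Coprime q := by
    rw [mem_cop]
    constructor
    · intro h
      have := h.2
      rw [Nat.Coprime, ← Nat.gcd_rec, Nat.gcd_comm] at this
      exact this
    · intro h
      refine ⟨Nat.mod_lt _ hq, ?_⟩
      rw [Nat.Coprime, ← Nat.gcd_rec, Nat.gcd_comm]
      exact h
  by_cases h : n.Coprime q
  · rw [if_pos (h5.2 h), if_pos h]
  · rw [if_neg (fun h' => h (h5.1 h')), if_neg h]

lemma gs_one {q : ℕ} [NeZero q] {a : ℤ} (hc : IsCoprime a (q:ℤ)) : gs (1 : DirichletCharacter ℂ q) a = ((moebius q : ℤ) : ℂ) := by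
  have hq : 0 < q := Nat.pos_of_ne_zero (NeZero.ne q)
  rw [← ramanujan hq hc, gs]
  apply sum_congr rfl
  intro b hb
  rw [mem_cop] at hb
  have hu : IsUnit (b : ZMod q) := (ZMod.isUnit_iff_coprime b q).2 hb.2
  have hu' : IsUnit ((b : ZMod q)⁻¹) := by
    obtain ⟨u, hu⟩ := hu
    rw [← hu, ZMod.inv_coe_unit]
    exact Units.isUnit _
  rw [MulChar.one_apply hu', one_mul]

lemma gs_norm {q : ℕ} (χ : DirichletCharacter ℂ q) (a : ℤ) : ‖gs χ a‖ ≤ q := by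
  unfold gs
  refine (norm_sum_le_of_le _ (fun b _ => ?_) : _ ≤ ∑ b ∈ cop q, (1:ℝ)).trans ?_
  · rw [norm_mul, norm_ee, mul_one]; exact DirichletCharacter.norm_le_one χ _
  · rw [sum_const, nsmul_eq_mul, mul_one, card_cop]
    exact_mod_cast Nat.totient_le q

theorem SWe (A : ℕ) : ∃ C : ℝ, 1 ≤ C ∧ ∀ (q : ℕ) (a : ℤ), 0 < q → IsCoprime a (q:ℤ) → ∀ N : ℕ, 9 ≤ N →
    ‖∑ n ∈ Ioc 0 N, ((vonMangoldt n : ℝ) : ℂ) * ee (n * ((a:ℝ)/q)) - (((moebius q : ℤ) : ℂ) / (q.totient:ℂ)) * N‖ * (Real.log N)^A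
      ≤ C * (q:ℝ)^2 * N := by
  obtain ⟨C1, hC1, H1⟩ := psi_chi A
  obtain ⟨C2, hC2, H2⟩ := psi_one A
  set D : ℝ := (2 * ((A+1:ℕ):ℝ))^(A+1) with hD
  have hD0 : 0 ≤ D := by positivity
  refine ⟨C1 + C2 + 2 * D, by linarith, ?_⟩
  intro q a hq hc N hN
  have : NeZero q := ⟨hq.ne'⟩
  classical
  have hphi : (0:ℝ) < q.totient := by exact_mod_cast Nat.totient_pos.2 hq
  have hphiC : (q.totient:ℂ) ≠ 0 := by exact_mod_cast hphi.ne'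
  have hphi1 : (1:ℝ) ≤ q.totient := by exact_mod_cast Nat.totient_pos.2 hq
  have hq1 : (1:ℝ) ≤ q := by exact_mod_cast hq
  have hL : 0 ≤ Real.log N := Real.log_natCast_nonneg N
  have hN1 : (1:ℝ) ≤ N := by exact_mod_cast (by omega : 1 ≤ N)
  set S : ℂ := ∑ n ∈ Ioc 0 N, ((vonMangoldt n : ℝ) : ℂ) * ee (n * ((a:ℝ)/q)) with hS
  set NC : ℂ := ∑ n ∈ (Ioc 0 N).filter (fun n => ¬ n.Coprime q), ((vonMangoldt n : ℝ) : ℂ) * ee (n * ((a:ℝ)/q)) with hNC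
  set N1 : ℂ := ∑ n ∈ (Ioc 0 N).filter (fun n => ¬ n.Coprime q), ((vonMangoldt n : ℝ) : ℂ) with hN1d
  set P : ℂ := ∑ n ∈ Ioc 0 N, ((vonMangoldt n : ℝ) : ℂ) with hP
  set R : ℂ := ∑ χ ∈ (univ : Finset (DirichletCharacter ℂ q)).erase 1, gs χ a * ∑ n ∈ Ioc 0 N, χ n * ((vonMangoldt n : ℝ) : ℂ) with hR
  -- noncoprime bounds
  have hnc : ∑ n ∈ (Ioc 0 N).filter (fun n => ¬ n.Coprime q), vonMangoldt n ≤ q * Real.log N := noncop_sum N q hq (by omega)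
  have hncL : q * Real.log N * (Real.log N)^A ≤ D * (q:ℝ)^2 * N := by
    have h1 := log_pow_le_sqrt (A+1) (by omega) N (by omega)
    have h2 : √(N:ℝ) ≤ N := by
      rw [Real.sqrt_le_left (by linarith)]; nlinarith
    calc q * Real.log N * (Real.log N)^A = q * (Real.log N)^(A+1) := by ring
      _ ≤ q * (D * N) := by
        apply mul_le_mul_of_nonneg_left _ (by linarith)
        exact h1.trans (mul_le_mul_of_nonneg_left h2 hD0)
      _ = D * q * N := by ring
      _ ≤ _ := by
        apply mul_le_mul_of_nonneg_right _ (by linarith)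
        apply mul_le_mul_of_nonneg_left _ hD0
        nlinarith
  have bNC : ‖NC‖ ≤ q * Real.log N := by
    refine le_trans (norm_sum_le_of_le _ (fun n _ => ?_)) hnc
    rw [norm_mul, norm_ee, mul_one, Complex.norm_real, Real.norm_of_nonneg vonMangoldt_nonneg]
  have bN1 : ‖N1‖ ≤ q * Real.log N := by
    refine le_trans (norm_sum_le_of_le _ (fun n _ => ?_)) hnc
    rw [Complex.norm_real, Real.norm_of_nonneg vonMangoldt_nonneg]
  -- identity
  have id1 : (q.totient:ℂ) * (S - NC) = ((moebius q : ℤ) : ℂ) * (P - N1) + R := by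
    have e1 : S - NC = ∑ n ∈ (Ioc 0 N).filter (fun n => n.Coprime q), ((vonMangoldt n : ℝ) : ℂ) * ee (n * ((a:ℝ)/q)) := by
      rw [hS, hNC, ← sum_filter_add_sum_filter_not (Ioc 0 N) (fun n => n.Coprime q)]; ring
    have e2 : P - N1 = ∑ n ∈ Ioc 0 N, (1 : DirichletCharacter ℂ q) n * ((vonMangoldt n : ℝ) : ℂ) := by
      rw [hP, hN1d, ← sum_filter_add_sum_filter_not (Ioc 0 N) (fun n => n.Coprime q), add_sub_cancel_right, sum_filter]
      apply sum_congr rfl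
      intro n _
      split_ifs with h
      · rw [MulChar.one_apply ((ZMod.isUnit_iff_coprime n q).2 h), one_mul]
      · rw [MulChar.map_nonunit _ (fun h' => h ((ZMod.isUnit_iff_coprime n q).1 h')), zero_mul]
    have e3 : (q.totient:ℂ) * (S - NC) = ∑ χ : DirichletCharacter ℂ q, gs χ a * ∑ n ∈ Ioc 0 N, χ n * ((vonMangoldt n : ℝ) : ℂ) := by
      simp only [mul_sum]
      rw [sum_comm, e1, mul_sum, sum_filter]
      apply sum_congr rfl
      intro n _
      have := gs_id (q := q) a n
      have h2 : ∑ χ : DirichletCharacter ℂ q, gs χ a * (χ n * ((vonMangoldt n : ℝ) : ℂ)) = (∑ χ : DirichletCharacter ℂ q, gs χ a * χ n) * ((vonMangoldt n : ℝ) : ℂ) := by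
        rw [sum_mul]; apply sum_congr rfl; intro χ _; ring
      rw [h2, this]
      split_ifs
      · ring
      · ring
    rw [e3, e2, hR, ← add_sum_erase univ _ (mem_univ (1 : DirichletCharacter ℂ q)), gs_one hc]
  have bR : ‖R‖ * (Real.log N)^A ≤ q.totient * (C1 * (q:ℝ)^2 * N) := by
    have h1 : ‖R‖ ≤ ∑ χ ∈ (univ : Finset (DirichletCharacter ℂ q)).erase 1, (q:ℝ) * ‖∑ n ∈ Ioc 0 N, χ n * ((vonMangoldt n : ℝ) : ℂ)‖ := by
      refine norm_sum_le_of_le _ (fun χ _ => ?_)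
      rw [norm_mul]
      exact mul_le_mul_of_nonneg_right (gs_norm χ a) (norm_nonneg _)
    have hcard : (((univ : Finset (DirichletCharacter ℂ q)).erase 1).card : ℝ) ≤ q.totient := by
      have h2 := DirichletCharacter.card_eq_totient_of_hasEnoughRootsOfUnity ℂ q
      rw [Nat.card_eq_fintype_card] at h2
      have h3 := card_erase_le (s := (univ : Finset (DirichletCharacter ℂ q))) (a := 1)
      rw [card_univ, h2] at h3
      exact_mod_cast h3
    calc ‖R‖ * (Real.log N)^A ≤ (∑ χ ∈ (univ : Finset (DirichletCharacter ℂ q)).erase 1, (q:ℝ) * ‖∑ n ∈ Ioc 0 N, χ n * ((vonMangoldt n : ℝ) : ℂ)‖) * (Real.log N)^A :=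
          mul_le_mul_of_nonneg_right h1 (by positivity)
      _ = ∑ χ ∈ (univ : Finset (DirichletCharacter ℂ q)).erase 1, (q:ℝ) * (‖∑ n ∈ Ioc 0 N, χ n * ((vonMangoldt n : ℝ) : ℂ)‖ * (Real.log N)^A) := by
          rw [sum_mul]; apply sum_congr rfl; intro χ _; ring
      _ ≤ ∑ χ ∈ (univ : Finset (DirichletCharacter ℂ q)).erase 1, (q:ℝ) * (C1 * q * N) := by
          apply sum_le_sum
          intro χ hχ
          exact mul_le_mul_of_nonneg_left (H1 q χ (ne_of_mem_erase hχ) N hN) (by linarith)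
      _ = (((univ : Finset (DirichletCharacter ℂ q)).erase 1).card : ℝ) * (C1 * (q:ℝ)^2 * N) := by
          rw [sum_const, nsmul_eq_mul]; ring
      _ ≤ _ := mul_le_mul_of_nonneg_right hcard (by positivity)
  have hmu : ‖((moebius q : ℤ) : ℂ) / (q.totient:ℂ)‖ ≤ 1 := by
    rw [norm_div, div_le_one (by simpa using hphi)]
    have h1 : ‖((moebius q : ℤ) : ℂ)‖ ≤ 1 := by
      rw [Complex.norm_intCast]; exact_mod_cast abs_moebius_le_one
    refine h1.trans ?_
    simpa using hphi1
  have id2 : S - (((moebius q : ℤ) : ℂ) / (q.totient:ℂ)) * N = NC + R / (q.totient:ℂ) + (((moebius q : ℤ) : ℂ) / (q.totient:ℂ)) * ((P - N) - N1) := by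
    have : S = NC + (((moebius q : ℤ) : ℂ) * (P - N1) + R) / (q.totient:ℂ) := by
      rw [← id1]; field_simp; ring
    rw [this]; field_simp; ring
  rw [id2]
  have hLA : 0 ≤ (Real.log N)^A := by positivity
  have t1 : ‖R / (q.totient:ℂ)‖ * (Real.log N)^A ≤ C1 * (q:ℝ)^2 * N := by
    rw [norm_div, Complex.norm_natCast, div_mul_eq_mul_div, div_le_iff₀ hphi]
    linarith
  have t2 : ‖(((moebius q : ℤ) : ℂ) / (q.totient:ℂ)) * ((P - N) - N1)‖ ≤ ‖P - N‖ + ‖N1‖ := by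
    rw [norm_mul]
    calc _ ≤ 1 * ‖(P - N) - N1‖ := mul_le_mul_of_nonneg_right hmu (norm_nonneg _)
      _ ≤ _ := by rw [one_mul]; exact norm_sub_le _ _
  have t3 : ‖P - N‖ * (Real.log N)^A ≤ C2 * (q:ℝ)^2 * N := by
    refine (H2 N hN).trans ?_
    apply mul_le_mul_of_nonneg_right _ (by linarith)
    have : 1 ≤ (q:ℝ)^2 := one_le_pow₀ hq1
    nlinarith
  have t4 : ‖NC‖ * (Real.log N)^A ≤ D * (q:ℝ)^2 * N := (mul_le_mul_of_nonneg_right bNC hLA).trans hncL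
  have t5 : ‖N1‖ * (Real.log N)^A ≤ D * (q:ℝ)^2 * N := (mul_le_mul_of_nonneg_right bN1 hLA).trans hncL
  calc _ ≤ (‖NC‖ + ‖R / (q.totient:ℂ)‖ + (‖P - N‖ + ‖N1‖)) * (Real.log N)^A := by
        apply mul_le_mul_of_nonneg_right _ hLA
        exact (norm_add_le _ _).trans (add_le_add (norm_add_le _ _) t2)
    _ = ‖NC‖ * (Real.log N)^A + ‖R / (q.totient:ℂ)‖ * (Real.log N)^A + (‖P - N‖ * (Real.log N)^A + ‖N1‖ * (Real.log N)^A) := by ring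
    _ ≤ D * (q:ℝ)^2 * N + C1 * (q:ℝ)^2 * N + (C2 * (q:ℝ)^2 * N + D * (q:ℝ)^2 * N) := by linarith
    _ = _ := by ring

end Cay

namespace Cay
open Finset ArithmeticFunction

/-- Dirichlet kernel of a window -/
noncomputable def DD (a b : ℕ) (x : ℝ) : ℂ := ∑ n ∈ Ioc a b, ee (n * x)
/-- weighted prime exponential sum of a window -/
noncomputable def FF (a b : ℕ) (x : ℝ) : ℂ := ∑ n ∈ Ioc a b, ((vonMangoldt n : ℝ) : ℂ) * ee (n * x)
/-- Farey pairs -/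
def Th (Q : ℕ) : Finset (Σ _ : ℕ, ℕ) := (Ioc 0 Q).sigma cop
/-- Farey fraction -/
noncomputable def th (p : Σ _ : ℕ, ℕ) : ℝ := (p.2 : ℝ) / p.1
/-- model coefficient -/
noncomputable def cc (p : Σ _ : ℕ, ℕ) : ℝ := ((moebius p.1 : ℤ) : ℝ) / (p.1.totient : ℝ)
/-- model exponential sum -/
noncomputable def GG (Q a b : ℕ) (x : ℝ) : ℂ := ∑ p ∈ Th Q, (cc p : ℂ) * DD a b (x - th p)

lemma mem_Th {Q : ℕ} {p : Σ _ : ℕ, ℕ} : p ∈ Th Q ↔ (0 < p.1 ∧ p.1 ≤ Q) ∧ p.2 < p.1 ∧ p.2.Coprime p.1 := by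
  rw [Th, mem_sigma, mem_Ioc, mem_cop]

lemma nn_tri (x y : ℝ) : nn x ≤ nn y + |x - y| := by
  refine (nn_le x (round y)).trans ?_
  have : x - round y = (y - round y) + (x - y) := by ring
  rw [this]
  exact abs_add_le _ _

lemma nn_add_int (x : ℝ) (m : ℤ) : nn (x + m) = nn x := by
  unfold nn
  rw [round_add_intCast]; push_cast; congr 1; ring

lemma DD_far {a b : ℕ} {x δ : ℝ} (hδ : 0 < δ) (h : δ ≤ nn x) : ‖DD a b x‖ ≤ 2 / δ := by
  refine (geom_bound a b x).trans ?_
  have hY : (0:ℝ) ≤ ((b - a : ℕ) : ℝ) := Nat.cast_nonneg _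
  have hx : 0 < nn x := lt_of_lt_of_le hδ h
  have : mn ((b - a : ℕ) : ℝ) x ≤ 1 / δ := by
    unfold mn
    rw [div_le_div_iff₀ (by positivity) hδ]
    nlinarith
  calc 3/2 * mn ((b - a : ℕ) : ℝ) x ≤ 3/2 * (1/δ) := by linarith
    _ ≤ 2 / δ := by
      rw [mul_one_div]
      apply div_le_div_of_nonneg_right _ hδ.le
      norm_num

lemma DD_le (a b : ℕ) (x : ℝ) : ‖DD a b x‖ ≤ ((b - a : ℕ) : ℝ) := by
  unfold DD
  refine (norm_sum_le_of_le _ (fun n _ => (norm_ee _).le)).trans ?_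
  simp

lemma DD_add_int (a b : ℕ) (x : ℝ) (m : ℤ) : DD a b (x + m) = DD a b x := by
  unfold DD
  apply sum_congr rfl
  intro n _
  have : (n:ℝ) * (x + m) = n * x + ((n * m : ℤ) : ℝ) := by push_cast; ring
  rw [this, ee_add_int]

lemma FF_add_int (a b : ℕ) (x : ℝ) (m : ℤ) : FF a b (x + m) = FF a b x := by
  unfold FF
  apply sum_congr rfl
  intro n _
  have : (n:ℝ) * (x + m) = n * x + ((n * m : ℤ) : ℝ) := by push_cast; ring
  rw [this, ee_add_int]

lemma far {a : ℤ} {q Q : ℕ} (hq : 0 < q) (hc : IsCoprime a (q:ℤ)) {p : Σ _ : ℕ, ℕ} (hp : p ∈ Th Q) :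
    (p.1 = q ∧ ∃ m : ℤ, (a:ℝ)/q = th p + m) ∨ 1 / ((q:ℝ) * p.1) ≤ nn ((a:ℝ)/q - th p) := by
  rw [mem_Th] at hp
  obtain ⟨⟨hp0, hpQ⟩, hlt, hcp⟩ := hp
  have hq' : (0:ℝ) < q := by exact_mod_cast hq
  have hp' : (0:ℝ) < p.1 := by exact_mod_cast hp0
  set m := round ((a:ℝ)/q - th p) with hm
  have e : (a:ℝ)/q - th p - m = ((a * p.1 - p.2 * q - m * (q * p.1) : ℤ) : ℝ) / ((q:ℝ) * p.1) := by
    unfold th; push_cast; field_simp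
  by_cases h0 : a * p.1 - p.2 * q - m * (q * p.1) = 0
  · left
    have hqp : (q:ℤ) ∣ p.1 := by
      have : (q:ℤ) ∣ a * p.1 := ⟨p.2 + m * p.1, by linarith⟩
      exact hc.symm.dvd_of_dvd_mul_left this
    have hpq : (p.1:ℤ) ∣ q := by
      have : (p.1:ℤ) ∣ p.2 * q := ⟨a - m * q, by linarith⟩
      have h2 : IsCoprime (p.1:ℤ) (p.2:ℤ) := (Nat.isCoprime_iff_coprime.2 hcp).symm
      exact h2.dvd_of_dvd_mul_left this
    refine ⟨Nat.dvd_antisymm (by exact_mod_cast hpq) (by exact_mod_cast hqp), m, ?_⟩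
    rw [h0] at e
    simp at e
    linarith
  · right
    rw [nn, ← hm, e, abs_div, abs_of_pos (by positivity : (0:ℝ) < (q:ℝ) * p.1)]
    apply div_le_div_of_nonneg_right _ (by positivity)
    rw [← Int.cast_abs]
    exact_mod_cast Int.one_le_abs h0

lemma th_sep {Q : ℕ} {p p' : Σ _ : ℕ, ℕ} (hp : p ∈ Th Q) (hp' : p' ∈ Th Q) (hne : p ≠ p') :
    1 / (Q:ℝ)^2 ≤ nn (th p - th p') := by
  have h1 := mem_Th.1 hp
  have h2 := mem_Th.1 hp'
  have a1 : (0:ℝ) < p.1 := by exact_mod_cast h1.1.1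
  have a2 : (0:ℝ) < p'.1 := by exact_mod_cast h2.1.1
  have a3 : (p.1:ℝ) ≤ Q := by exact_mod_cast h1.1.2
  have a4 : (p'.1:ℝ) ≤ Q := by exact_mod_cast h2.1.2
  rcases far (a := (p.2:ℤ)) h1.1.1 (Nat.isCoprime_iff_coprime.2 h1.2.2) hp' with ⟨e, m, hm⟩ | h
  · exfalso
    have b1 : (p.2:ℝ) < p.1 := by exact_mod_cast h1.2.1
    have b2 : (p'.2:ℝ) < p'.1 := by exact_mod_cast h2.2.1
    have c1 : (p.2:ℝ) / p.1 < 1 := (div_lt_one a1).2 b1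
    have c2 : (p'.2:ℝ) / p'.1 < 1 := (div_lt_one a2).2 b2
    have c3 : 0 ≤ (p.2:ℝ) / p.1 := by positivity
    have c4 : 0 ≤ (p'.2:ℝ) / p'.1 := by positivity
    unfold th at hm
    rw [Int.cast_natCast] at hm
    have m1 : (m:ℝ) < 1 := by linarith
    have m2 : (-1:ℝ) < m := by linarith
    have m0 : m = 0 := by
      have := (by exact_mod_cast m1 : m < 1)
      have := (by exact_mod_cast m2 : -1 < m)
      omega
    rw [m0] at hm
    simp at hm
    rw [e] at hm
    have := (div_left_inj' a1.ne').1 hm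
    apply hne
    apply Sigma.ext e.symm
    simp
    exact_mod_cast this
  · refine le_trans ?_ h
    apply one_div_le_one_div_of_le (by positivity)
    nlinarith

lemma exists_th {a : ℤ} {q Q : ℕ} (hq : 0 < q) (hqQ : q ≤ Q) (hc : IsCoprime a (q:ℤ)) :
    ∃ p ∈ Th Q, p.1 = q ∧ ∃ m : ℤ, (a:ℝ)/q = th p + m := by
  have hq' : (q:ℤ) ≠ 0 := by exact_mod_cast hq.ne'
  have h0 := Int.emod_nonneg a hq'
  have hl := Int.emod_lt_of_pos a (by exact_mod_cast hq : (0:ℤ) < q)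
  obtain ⟨r, hr⟩ := Int.eq_ofNat_of_zero_le h0
  have hd := Int.emod_add_mul_ediv a q
  rw [hr] at hd hl
  refine ⟨⟨q, r⟩, ?_, rfl, a / q, ?_⟩
  · rw [mem_Th]
    refine ⟨⟨hq, hqQ⟩, by exact_mod_cast hl, ?_⟩
    rw [← Nat.isCoprime_iff_coprime]
    rw [← hd] at hc
    exact (IsCoprime.add_mul_left_left_iff).1 hc
  · generalize a / (q:ℤ) = k at hd
    have : (a:ℝ) = r + q * k := by exact_mod_cast hd.symm
    have hq'' : (q:ℝ) ≠ 0 := by exact_mod_cast hq.ne'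
    rw [this]
    simp only [th]
    field_simp

lemma cc_abs {Q : ℕ} {p : Σ _ : ℕ, ℕ} (hp : p ∈ Th Q) : |cc p| ≤ 1 := by
  have h1 := mem_Th.1 hp
  have : (1:ℝ) ≤ p.1.totient := by exact_mod_cast Nat.totient_pos.2 h1.1.1
  unfold cc
  rw [abs_div, abs_of_nonneg (by positivity : (0:ℝ) ≤ (p.1.totient:ℝ)), div_le_one (by linarith)]
  refine le_trans ?_ this
  rw [← Int.cast_abs]
  exact_mod_cast abs_moebius_le_one

lemma card_Th (Q : ℕ) : ((Th Q).card : ℝ) ≤ (Q:ℝ)^2 := by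
  have : (Th Q).card ≤ Q^2 := by
    rw [Th, card_sigma]
    calc _ ≤ ∑ q ∈ Ioc 0 Q, Q := by
          apply sum_le_sum
          intro q hq
          rw [card_cop]
          exact (Nat.totient_le q).trans (mem_Ioc.1 hq).2
      _ = Q^2 := by simp [sq]
  exact_mod_cast this

lemma cc_sq (Q : ℕ) : ∑ p ∈ Th Q, (cc p)^2 ≤ (1 + Real.log Q)^2 := by
  refine le_trans ?_ (sum_tau_div_le Q)
  rw [Th, sum_sigma]
  apply sum_le_sum
  intro q hq
  have hq0 := (mem_Ioc.1 hq).1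
  have hqR : (0:ℝ) < q := by exact_mod_cast hq0
  have hphi : (0:ℝ) < q.totient := by exact_mod_cast Nat.totient_pos.2 hq0
  simp only [cc]
  rw [sum_const, nsmul_eq_mul, card_cop, div_pow]
  have hmu : ((moebius q : ℤ) : ℝ)^2 ≤ 1 := by
    rw [sq_le_one_iff_abs_le_one, ← Int.cast_abs]
    exact_mod_cast abs_moebius_le_one
  have hqt : (q:ℝ) ≤ tau q * q.totient := by
    have h : q ≤ q.divisors.card * q.totient := by
      calc q = ∑ d ∈ q.divisors, d.totient := (Nat.sum_totient q).symm
        _ ≤ ∑ d ∈ q.divisors, q.totient := sum_le_sum (fun d hd =>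
            Nat.le_of_dvd (Nat.totient_pos.2 hq0) (Nat.totient_dvd_of_dvd (Nat.dvd_of_mem_divisors hd)))
        _ = _ := by simp
    unfold tau
    exact_mod_cast h
  calc (q.totient:ℝ) * (((moebius q : ℤ) : ℝ)^2 / (q.totient:ℝ)^2) = ((moebius q : ℤ) : ℝ)^2 / (q.totient:ℝ) := by
        field_simp
    _ ≤ 1 / (q.totient:ℝ) := div_le_div_of_nonneg_right hmu hphi.le
    _ ≤ tau q * (1/(q:ℝ)) := by
        rw [mul_one_div, div_le_div_iff₀ hphi hqR]; linarith

lemma ee_lip (x : ℝ) : ‖ee x - 1‖ ≤ 7 * |x| := by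
  have : ee x = Complex.exp (Complex.I * ((2 * Real.pi * x : ℝ) : ℂ)) := by
    unfold ee; congr 1; push_cast; ring
  rw [this]
  refine (Real.norm_exp_I_mul_ofReal_sub_one_le).trans ?_
  rw [Real.norm_eq_abs, abs_mul, abs_mul, abs_of_pos Real.pi_pos, abs_of_pos (by norm_num : (0:ℝ) < 2)]
  apply mul_le_mul_of_nonneg_right _ (abs_nonneg _)
  linarith [Real.pi_lt_d2]

end Cay

namespace Cay
open Finset ArithmeticFunction

lemma ev_log_pow (m : ℕ) {s : ℝ} (hs : 0 < s) : ∀ᶠ Y : ℝ in Filter.atTop, (Real.log Y)^m ≤ Y^s := by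
  have h := (isLittleO_log_rpow_rpow_atTop (m:ℝ) hs).bound (by norm_num : (0:ℝ) < 1)
  filter_upwards [h, Filter.eventually_ge_atTop 1] with Y h1 hY
  rw [one_mul, Real.norm_eq_abs, Real.norm_eq_abs, Real.rpow_natCast] at h1
  rw [abs_of_nonneg (Real.rpow_nonneg (by linarith) s)] at h1
  exact (le_abs_self _).trans h1

lemma ev_log_ge (c : ℝ) : ∀ᶠ Y : ℝ in Filter.atTop, c ≤ Real.log Y :=
  Real.tendsto_log_atTop.eventually_ge_atTop c

lemma SWu (A : ℕ) : ∃ C : ℝ, 1 ≤ C ∧ ∀ᶠ Y : ℝ in Filter.atTop, ∀ (q : ℕ) (a : ℤ), 0 < q → IsCoprime a (q:ℤ) →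
    ∀ N : ℕ, (N:ℝ) ≤ Y →
    ‖∑ n ∈ Ioc 0 N, (((vonMangoldt n : ℝ) : ℂ) * ee (n * ((a:ℝ)/q)) - ((moebius q : ℤ) : ℂ) / (q.totient:ℂ))‖
      ≤ C * (q:ℝ)^2 * Y / (Real.log Y)^A := by
  obtain ⟨C, hC, H⟩ := SWe A
  refine ⟨C * 2^A, one_le_mul_of_one_le_of_one_le hC (one_le_pow₀ (by norm_num)), ?_⟩
  filter_upwards [ev_log_pow (A+2) (by norm_num : (0:ℝ) < 1/2), ev_log_ge 10, Filter.eventually_ge_atTop 100] with Y h1 hL hY q a hq hc N hN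
  have hq1 : (1:ℝ) ≤ (q:ℝ)^2 := one_le_pow₀ (by exact_mod_cast hq)
  set L := Real.log Y with hLd
  have hL0 : 0 < L := by linarith
  rw [← Real.sqrt_eq_rpow] at h1
  have hss : √Y * √Y = Y := Real.mul_self_sqrt (by linarith)
  have hphi1 : (1:ℝ) ≤ q.totient := by exact_mod_cast Nat.totient_pos.2 hq
  have hmu : ‖((moebius q : ℤ) : ℂ) / (q.totient:ℂ)‖ ≤ 1 := by
    rw [norm_div, Complex.norm_natCast, div_le_one (by linarith)]
    have h1 : ‖((moebius q : ℤ) : ℂ)‖ ≤ 1 := by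
      rw [Complex.norm_intCast]; exact_mod_cast abs_moebius_le_one
    exact h1.trans hphi1
  by_cases hNs : (N:ℝ) < √Y
  · have hb : ‖∑ n ∈ Ioc 0 N, (((vonMangoldt n : ℝ) : ℂ) * ee (n * ((a:ℝ)/q)) - ((moebius q : ℤ) : ℂ) / (q.totient:ℂ))‖ ≤ N * (L + 1) := by
      refine (norm_sum_le_of_le (n := fun _ => L + 1) _ (fun n hn => ?_)).trans ?_
      · refine (norm_sub_le _ _).trans (add_le_add ?_ hmu)
        rw [norm_mul, norm_ee, mul_one, Complex.norm_real, Real.norm_of_nonneg vonMangoldt_nonneg]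
        refine vonMangoldt_le_log.trans ?_
        rw [mem_Ioc] at hn
        apply Real.log_le_log (by exact_mod_cast hn.1)
        exact le_trans (by exact_mod_cast hn.2) hN
      · rw [sum_const, nsmul_eq_mul, Nat.card_Ioc, Nat.sub_zero]
    refine hb.trans ?_
    rw [le_div_iff₀ (by positivity)]
    have h2 : (N:ℝ) * (L+1) * L^A ≤ √Y * L^(A+2) := by
      calc (N:ℝ) * (L+1) * L^A = N * ((L+1) * L^A) := by ring
        _ ≤ √Y * (L^2 * L^A) := by
            apply mul_le_mul hNs.le _ (by positivity) (by positivity)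
            apply mul_le_mul_of_nonneg_right _ (by positivity)
            nlinarith
        _ = _ := by ring
    have h3 : √Y * L^(A+2) ≤ Y := by
      calc √Y * L^(A+2) ≤ √Y * √Y := mul_le_mul_of_nonneg_left h1 (by positivity)
        _ = Y := hss
    have h4 : 1 ≤ C * 2^A * (q:ℝ)^2 :=
      one_le_mul_of_one_le_of_one_le (one_le_mul_of_one_le_of_one_le hC (one_le_pow₀ (by norm_num))) hq1
    nlinarith
  · push Not at hNs
    have hs10 : (10:ℝ) ≤ √Y := by
      apply Real.le_sqrt_of_sq_le; linarith
    have hN9 : 9 ≤ N := by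
      have : (9:ℝ) ≤ N := by linarith
      exact_mod_cast this
    have h2 := H q a hq hc N hN9
    rw [sum_sub_distrib, sum_const, nsmul_eq_mul, Nat.card_Ioc, Nat.sub_zero, mul_comm (N:ℂ)]
    have hlogN : L / 2 ≤ Real.log N := by
      have : Real.log (√Y) = L / 2 := by rw [Real.log_sqrt (by linarith)]
      rw [← this]
      exact Real.log_le_log (by positivity) hNs
    have hp : L^A ≤ 2^A * (Real.log N)^A := by
      rw [← mul_pow]
      apply pow_le_pow_left₀ hL0.le
      linarith
    rw [le_div_iff₀ (by positivity)]
    calc _ ≤ ‖∑ n ∈ Ioc 0 N, ((vonMangoldt n : ℝ) : ℂ) * ee (n * ((a:ℝ)/q)) - (((moebius q : ℤ) : ℂ) / (q.totient:ℂ)) * N‖ * (2^A * (Real.log N)^A) :=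
          mul_le_mul_of_nonneg_left hp (norm_nonneg _)
      _ = 2^A * (‖∑ n ∈ Ioc 0 N, ((vonMangoldt n : ℝ) : ℂ) * ee (n * ((a:ℝ)/q)) - (((moebius q : ℤ) : ℂ) / (q.totient:ℂ)) * N‖ * (Real.log N)^A) := by ring
      _ ≤ 2^A * (C * (q:ℝ)^2 * N) := mul_le_mul_of_nonneg_left h2 (by positivity)
      _ = C * 2^A * (q:ℝ)^2 * N := by ring
      _ ≤ _ := mul_le_mul_of_nonneg_left hN (by positivity)

lemma Ioc_diff (f : ℕ → ℂ) {a b : ℕ} (hab : a ≤ b) : ∑ n ∈ Ioc a b, f n = ∑ n ∈ Ioc 0 b, f n - ∑ n ∈ Ioc 0 a, f n := by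
  rw [← sum_Ioc_consecutive f (Nat.zero_le a) hab]; ring

/-- major arc approximation -/
lemma major_FF {c : ℂ} {a b : ℕ} (hab : a ≤ b) {θ β Y K : ℝ} (hb : (b:ℝ) ≤ Y)
    (hK : ∀ N : ℕ, (N:ℝ) ≤ Y → ‖∑ n ∈ Ioc 0 N, (((vonMangoldt n : ℝ) : ℂ) * ee (n * θ) - c)‖ ≤ K) :
    ‖FF a b (θ + β) - c * DD a b β‖ ≤ 2 * K * (1 + 7 * |β| * Y) := by
  have hK0 : 0 ≤ K := (norm_nonneg _).trans (hK b hb)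
  have haY : (a:ℝ) ≤ Y := le_trans (by exact_mod_cast hab) hb
  have e : FF a b (θ + β) - c * DD a b β = ∑ n ∈ Ioc a b, ee (n * β) * (((vonMangoldt n : ℝ) : ℂ) * ee (n * θ) - c) := by
    rw [FF, DD, mul_sum, ← sum_sub_distrib]
    apply sum_congr rfl
    intro n _
    rw [mul_add, ee_add]; ring
  rw [e]
  refine (abel_bound (fun n => ee (n * β)) _ a b (2*K) (by linarith) ?_).trans ?_
  · intro n hn hnb
    rw [Ioc_diff _ hn.le]
    refine (norm_sub_le _ _).trans ?_
    have h1 := hK n (le_trans (by exact_mod_cast hnb) hb)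
    have h2 := hK a haY
    linarith
  · apply mul_le_mul_of_nonneg_left _ (by linarith)
    rw [norm_ee]
    apply add_le_add le_rfl
    refine (sum_le_sum (g := fun _ => 7 * |β|) (fun n _ => ?_)).trans ?_
    · have : ee (((n+1:ℕ):ℝ) * β) - ee (n * β) = ee (n * β) * (ee β - 1) := by
        push_cast
        rw [add_mul, one_mul, ee_add]; ring
      rw [this, norm_mul, norm_ee, one_mul]
      exact ee_lip β
    · rw [sum_const, nsmul_eq_mul, Nat.card_Ioc, mul_comm]
      apply mul_le_mul_of_nonneg_left _ (by positivity)
      refine le_trans ?_ hb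
      exact_mod_cast Nat.sub_le b a

lemma GG_near {Q a b : ℕ} {p0 : Σ _ : ℕ, ℕ} (hp0 : p0 ∈ Th Q) {α β : ℝ} {m : ℤ} (hα : α = th p0 + m + β)
    (hβ : |β| ≤ 1 / (2 * (Q:ℝ)^2)) : ‖GG Q a b α - (cc p0 : ℂ) * DD a b β‖ ≤ 4 * (Q:ℝ)^4 := by
  classical
  have hQ : (0:ℝ) < Q := by
    have h1 := mem_Th.1 hp0
    exact_mod_cast lt_of_lt_of_le h1.1.1 h1.1.2
  have e1 : DD a b (α - th p0) = DD a b β := by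
    rw [← DD_add_int a b β m]; congr 1; rw [hα]; ring
  rw [GG, ← add_sum_erase _ _ hp0, e1, add_sub_cancel_left]
  refine (norm_sum_le_of_le (n := fun _ => 4 * (Q:ℝ)^2) _ (fun p hp => ?_)).trans ?_
  · rw [norm_mul, Complex.norm_real, Real.norm_eq_abs]
    have hpT := mem_of_mem_erase hp
    have h1 := th_sep hp0 hpT (ne_of_mem_erase hp).symm
    have h2 : nn (th p0 - th p) ≤ nn (α - th p) + |β| := by
      have := nn_tri (th p0 - th p) (α - th p - m)
      have h3 : nn (α - th p - m) = nn (α - th p) := by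
        have := nn_add_int (α - th p) (-m)
        rw [← this]; push_cast; rfl
      have h4 : th p0 - th p - (α - th p - m) = -β := by rw [hα]; ring
      rw [h3, h4, abs_neg] at this
      exact this
    have h5 : 1 / (2 * (Q:ℝ)^2) ≤ nn (α - th p) := by
      have : 1 / (Q:ℝ)^2 = 1 / (2 * (Q:ℝ)^2) + 1 / (2 * (Q:ℝ)^2) := by field_simp; norm_num
      linarith
    have h6 := DD_far (a := a) (b := b) (by positivity) h5
    calc |cc p| * ‖DD a b (α - th p)‖ ≤ 1 * (2 / (1 / (2 * (Q:ℝ)^2))) :=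
          mul_le_mul (cc_abs hpT) h6 (norm_nonneg _) zero_le_one
      _ = 4 * (Q:ℝ)^2 := by field_simp; norm_num
  · rw [sum_const, nsmul_eq_mul]
    have : (((Th Q).erase p0).card : ℝ) ≤ (Q:ℝ)^2 := le_trans (by exact_mod_cast card_erase_le) (card_Th Q)
    calc _ ≤ (Q:ℝ)^2 * (4 * (Q:ℝ)^2) := mul_le_mul_of_nonneg_right this (by positivity)
      _ = _ := by ring

lemma GG_far {Q a b : ℕ} {α δ : ℝ} (hδ : 0 < δ) (h : ∀ p ∈ Th Q, δ ≤ nn (α - th p)) : ‖GG Q a b α‖ ≤ (Q:ℝ)^2 * (2/δ) := by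
  unfold GG
  refine (norm_sum_le_of_le (n := fun _ => 2/δ) _ (fun p hp => ?_)).trans ?_
  · rw [norm_mul, Complex.norm_real, Real.norm_eq_abs]
    calc |cc p| * ‖DD a b (α - th p)‖ ≤ 1 * (2 / δ) :=
          mul_le_mul (cc_abs hp) (DD_far hδ (h p hp)) (norm_nonneg _) zero_le_one
      _ = _ := one_mul _
  · rw [sum_const, nsmul_eq_mul]
    exact mul_le_mul_of_nonneg_right (card_Th Q) (by positivity)

end Cay

namespace Cay
open Finset ArithmeticFunction

lemma minor_vin {α : ℝ} {r : ℤ} {q : ℕ} (hq : 0 < q) (hc : IsCoprime r (q:ℤ)) (h : |α - r / q| ≤ 1 / (q:ℝ)^2)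
    {a b : ℕ} (hab : a ≤ b) {Y L : ℝ} (hL : Real.log Y = L) (hL1 : 192000 ≤ L) (hb : (b:ℝ) ≤ Y) (hY : 1 ≤ Y)
    (hq1 : L^20 ≤ q) (hq2 : q ≤ Y / L^66) (h6 : L^200 ≤ Y^((1:ℝ)/6)) :
    ‖FF a b α‖ ≤ Y / (2 * L^5) := by
  have hL0 : 0 < L := by linarith
  have hqR : (0:ℝ) < q := by exact_mod_cast hq
  have v1 := vinogradov hq hc h b Y hb hY
  have v2 := vinogradov hq hc h a Y (le_trans (by exact_mod_cast hab) hb) hY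
  rw [hL] at v1 v2
  have t1 : Y / √q ≤ Y / L^10 := by
    apply div_le_div_of_nonneg_left (by linarith) (by positivity)
    apply Real.le_sqrt_of_sq_le
    calc (L^10)^2 = L^20 := by ring
      _ ≤ (q:ℝ) := hq1
  have t2 : Y^((5:ℝ)/6) ≤ Y / L^10 := by
    rw [le_div_iff₀ (by positivity)]
    have e : Y = Y^((5:ℝ)/6) * Y^((1:ℝ)/6) := by
      rw [← Real.rpow_add (by linarith)]; norm_num
    conv_rhs => rw [e]
    apply mul_le_mul_of_nonneg_left _ (by positivity)
    exact le_trans (pow_le_pow_right₀ (by linarith) (by norm_num)) h6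
  have t3 : √(Y * q) ≤ Y / L^10 := by
    rw [Real.sqrt_le_left (by positivity)]
    calc Y * q ≤ Y * (Y / L^66) := mul_le_mul_of_nonneg_left hq2 (by linarith)
      _ = Y^2 / L^66 := by ring
      _ ≤ Y^2 / L^20 := by
        apply div_le_div_of_nonneg_left (by positivity) (by positivity)
        exact pow_le_pow_right₀ (by linarith) (by norm_num)
      _ = (Y / L^10)^2 := by rw [div_pow]; ring
  have t0 : (1 + L)^4 ≤ 16 * L^4 := by
    calc (1+L)^4 ≤ (2*L)^4 := pow_le_pow_left₀ (by linarith) (by linarith) 4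
      _ = _ := by ring
  have t4 : 1000 * (1 + L)^4 * (Y / √q + Y^((5:ℝ)/6) + √(Y * q)) ≤ 1000 * (16 * L^4) * (3 * (Y / L^10)) := by
    apply mul_le_mul (by linarith) (by linarith) (by positivity) (by positivity)
  have t5 : FF a b α = ∑ n ∈ Ioc 0 b, ((vonMangoldt n : ℝ) : ℂ) * ee (n * α) - ∑ n ∈ Ioc 0 a, ((vonMangoldt n : ℝ) : ℂ) * ee (n * α) := by
    rw [FF, Ioc_diff _ hab]
  rw [t5]
  refine (norm_sub_le _ _).trans ?_
  have t6 : 2 * (1000 * (16 * L^4) * (3 * (Y / L^10))) ≤ Y / (2 * L^5) := by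
    have : 2 * (1000 * (16 * L^4) * (3 * (Y / L^10))) = 192000 * (Y / (2 * L^6)) := by
      field_simp; norm_num
    rw [this]
    have e2 : Y / (2 * L^5) = L * (Y / (2 * L^6)) := by field_simp
    rw [e2]
    exact mul_le_mul_of_nonneg_right hL1 (by positivity)
  linarith

theorem minor : ∀ᶠ Y : ℝ in Filter.atTop, ∀ (a b : ℕ), a ≤ b → (b:ℝ) ≤ Y → ∀ α : ℝ,
    ‖FF a b α - GG ⌊(Real.log Y)^20⌋₊ a b α‖ ≤ Y / (Real.log Y)^5 := by
  obtain ⟨C, hC, H⟩ := SWu 112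
  filter_upwards [H, ev_log_ge (192000 + 32 * C), ev_log_pow 200 (by norm_num : (0:ℝ) < 1/6), Filter.eventually_ge_atTop 1] with Y H hLL h6 hY a b hab hb α
  obtain ⟨L, hLd⟩ : ∃ L, Real.log Y = L := ⟨_, rfl⟩
  rw [hLd] at H hLL h6 ⊢
  have hL : 192000 ≤ L := by linarith
  have hL0 : 0 < L := by linarith
  have hY0 : 0 < Y := by linarith
  have hL1 : 1 ≤ L := by linarith
  have h200 : L^200 ≤ Y := by
    refine h6.trans ?_
    calc Y^((1:ℝ)/6) ≤ Y^(1:ℝ) := Real.rpow_le_rpow_of_exponent_le hY (by norm_num)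
      _ = Y := Real.rpow_one Y
  have big : ∀ k, k ≤ 198 → 8 * L^k ≤ Y := by
    intro k hk
    calc 8 * L^k ≤ L^2 * L^k := mul_le_mul_of_nonneg_right (by nlinarith) (by positivity)
      _ = L^(k+2) := by ring
      _ ≤ L^200 := pow_le_pow_right₀ hL1 (by omega)
      _ ≤ Y := h200
  set Q := ⌊L^20⌋₊ with hQ
  set R := ⌊Y / L^66⌋₊ with hR
  have hQ1 : (Q:ℝ) ≤ L^20 := Nat.floor_le (by positivity)
  have hQ2 : L^20 < Q + 1 := Nat.lt_floor_add_one _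
  have hR1 : (R:ℝ) ≤ Y / L^66 := Nat.floor_le (by positivity)
  have hR2 : Y / L^66 < R + 1 := Nat.lt_floor_add_one _
  have hR0 : 0 < R := by
    rw [hR, Nat.floor_pos, le_div_iff₀ (by positivity)]
    have := big 66 (by norm_num)
    linarith [pow_pos hL0 66]
  have hQ0 : 0 < Q := by
    rw [hQ, Nat.floor_pos]; exact one_le_pow₀ hL1
  have hQR : (0:ℝ) < Q := by exact_mod_cast hQ0
  obtain ⟨r, hr1, hr2⟩ := Real.exists_rat_abs_sub_le_and_den_le α hR0
  obtain ⟨q, hqd⟩ : ∃ q, r.den = q := ⟨_, rfl⟩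
  obtain ⟨s, hsd⟩ : ∃ s, r.num = s := ⟨_, rfl⟩
  have hq : 0 < q := by rw [← hqd]; exact r.pos
  have hqR : (0:ℝ) < q := by exact_mod_cast hq
  have hq1R : (1:ℝ) ≤ q := by exact_mod_cast hq
  have hc : IsCoprime s (q:ℤ) := by
    rw [← hqd, ← hsd, Int.isCoprime_iff_gcd_eq_one]
    exact r.reduced
  have hrc : (r:ℝ) = (s:ℝ)/q := by rw [← hqd, ← hsd]; exact Rat.cast_def r
  rw [hrc, hqd] at hr1
  rw [hqd] at hr2
  have hqR2 : (q:ℝ) ≤ R := by exact_mod_cast hr2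
  by_cases hqQ : q ≤ Q
  · obtain ⟨p0, hp0, hpq, m, hm⟩ := exists_th hq hqQ hc
    obtain ⟨β, hβd⟩ : ∃ β, β = α - (s:ℝ)/q := ⟨_, rfl⟩
    rw [← hβd] at hr1
    have hα : α = th p0 + m + β := by rw [hβd, hm]; ring
    have hβ : |β| * Y ≤ L^66 := by
      have h1 : |β| ≤ 1 / (Y / L^66) := by
        refine hr1.trans (one_div_le_one_div_of_le (by positivity) ?_)
        nlinarith
      calc |β| * Y ≤ 1 / (Y / L^66) * Y := mul_le_mul_of_nonneg_right h1 hY0.le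
        _ = L^66 := by field_simp
    have hβ2 : |β| ≤ 1 / (2 * (Q:ℝ)^2) := by
      rw [le_div_iff₀ (by positivity)]
      have hQsq : (Q:ℝ)^2 ≤ L^40 := by
        calc (Q:ℝ)^2 ≤ (L^20)^2 := pow_le_pow_left₀ hQR.le hQ1 2
          _ = L^40 := by ring
      have h2 := big 106 (by norm_num)
      have h3 : |β| * (2 * (Q:ℝ)^2) * Y ≤ 1 * Y := by
        calc |β| * (2 * (Q:ℝ)^2) * Y = 2 * ((|β| * Y) * (Q:ℝ)^2) := by ring
          _ ≤ 2 * (L^66 * L^40) := by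
            apply mul_le_mul_of_nonneg_left _ (by norm_num)
            exact mul_le_mul hβ hQsq (by positivity) (by positivity)
          _ = 2 * L^106 := by ring
          _ ≤ 1 * Y := by linarith [pow_pos hL0 106]
      exact le_of_mul_le_mul_right h3 hY0
    have g1 := GG_near (a := a) (b := b) hp0 hα hβ2
    have f1 := major_FF (c := ((moebius q : ℤ) : ℂ) / (q.totient:ℂ)) (θ := (s:ℝ)/q) (β := β) hab hb (H q s hq hc)
    have e1 : (s:ℝ)/q + β = α := by rw [hβd]; ring
    have e2 : ((cc p0 : ℝ) : ℂ) = ((moebius q : ℤ) : ℂ) / (q.totient:ℂ) := by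
      rw [cc, hpq]; push_cast; rfl
    rw [e1] at f1
    rw [e2] at g1
    have k1 : 2 * (C * (q:ℝ)^2 * Y / L^112) * (1 + 7 * |β| * Y) ≤ Y / (2 * L^5) := by
      have hqsq : (q:ℝ)^2 ≤ L^40 := by
        calc (q:ℝ)^2 ≤ (L^20)^2 := pow_le_pow_left₀ hqR.le (le_trans (by exact_mod_cast hqQ) hQ1) 2
          _ = L^40 := by ring
      have h66 : 1 ≤ L^66 := one_le_pow₀ hL1
      calc 2 * (C * (q:ℝ)^2 * Y / L^112) * (1 + 7 * |β| * Y) ≤ 2 * (C * L^40 * Y / L^112) * (8 * L^66) := by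
            apply mul_le_mul _ (by linarith) (by positivity) (by positivity)
            apply mul_le_mul_of_nonneg_left _ (by norm_num)
            apply div_le_div_of_nonneg_right _ (by positivity)
            apply mul_le_mul_of_nonneg_right _ hY0.le
            exact mul_le_mul_of_nonneg_left hqsq (by linarith)
        _ = (32 * C) * (Y / (2 * L^6)) := by field_simp; norm_num
        _ ≤ L * (Y / (2 * L^6)) := mul_le_mul_of_nonneg_right (by linarith) (by positivity)
        _ = Y / (2 * L^5) := by field_simp
    have k2 : 4 * (Q:ℝ)^4 ≤ Y / (2 * L^5) := by
      rw [le_div_iff₀ (by positivity)]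
      have := big 85 (by norm_num)
      calc 4 * (Q:ℝ)^4 * (2 * L^5) ≤ 4 * (L^20)^4 * (2 * L^5) := by
            apply mul_le_mul_of_nonneg_right _ (by positivity)
            apply mul_le_mul_of_nonneg_left _ (by norm_num)
            exact pow_le_pow_left₀ hQR.le hQ1 4
        _ = 8 * L^85 := by ring
        _ ≤ Y := this
    have e3 : FF a b α - GG Q a b α = (FF a b α - ((moebius q : ℤ) : ℂ) / (q.totient:ℂ) * DD a b β) - (GG Q a b α - ((moebius q : ℤ) : ℂ) / (q.totient:ℂ) * DD a b β) := by ring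
    rw [e3]
    have k3 : Y / L^5 = Y / (2 * L^5) + Y / (2 * L^5) := by field_simp; norm_num
    refine (norm_sub_le _ _).trans ?_
    linarith
  · push Not at hqQ
    have hq20 : L^20 ≤ q := by
      have : ((Q + 1 : ℕ):ℝ) ≤ q := by exact_mod_cast hqQ
      push_cast at this
      linarith
    have f1 : ‖FF a b α‖ ≤ Y / (2 * L^5) := by
      refine minor_vin hq hc ?_ hab hLd hL hb hY hq20 (hqR2.trans hR1) h6
      refine hr1.trans (one_div_le_one_div_of_le (by positivity) ?_)
      nlinarith
    have hRQ : 2 * (Q:ℝ) ≤ R + 1 := by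
      have : 2 * L^20 ≤ Y / L^66 := by
        rw [le_div_iff₀ (by positivity)]
        have := big 86 (by norm_num)
        calc 2 * L^20 * L^66 = 2 * L^86 := by ring
          _ ≤ Y := by linarith [pow_pos hL0 86]
      linarith
    have g1 : ‖GG Q a b α‖ ≤ (Q:ℝ)^2 * (2 / (1 / (2 * q * Q))) := by
      apply GG_far (by positivity)
      intro p hp
      have hpT := mem_Th.1 hp
      rcases far hq hc hp with ⟨h1, _⟩ | h1
      · omega
      have h2 := nn_tri ((s:ℝ)/q - th p) (α - th p)
      have h3 : (s:ℝ)/q - th p - (α - th p) = -(α - (s:ℝ)/q) := by ring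
      rw [h3, abs_neg] at h2
      have hp1 : (0:ℝ) < p.1 := by exact_mod_cast hpT.1.1
      have hp2 : (p.1:ℝ) ≤ Q := by exact_mod_cast hpT.1.2
      have h4 : 1 / ((q:ℝ) * Q) ≤ 1 / ((q:ℝ) * p.1) := by
        apply one_div_le_one_div_of_le (by positivity)
        exact mul_le_mul_of_nonneg_left hp2 hqR.le
      have h5 : 1 / (((R:ℝ) + 1) * q) ≤ 1 / (2 * q * Q) := by
        apply one_div_le_one_div_of_le (by positivity)
        nlinarith
      have h6 : 1 / ((q:ℝ) * Q) = 1 / (2 * q * Q) + 1 / (2 * q * Q) := by field_simp; norm_num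
      linarith
    have g2 : (Q:ℝ)^2 * (2 / (1 / (2 * q * Q))) ≤ Y / (2 * L^5) := by
      have e : (Q:ℝ)^2 * (2 / (1 / (2 * q * Q))) = 4 * (Q:ℝ)^3 * q := by field_simp; ring
      rw [e]
      calc 4 * (Q:ℝ)^3 * q ≤ 4 * (L^20)^3 * (Y / L^66) := by
            apply mul_le_mul _ (hqR2.trans hR1) hqR.le (by positivity)
            apply mul_le_mul_of_nonneg_left _ (by norm_num)
            exact pow_le_pow_left₀ hQR.le hQ1 3
        _ = 8 * (Y / (2 * L^6)) := by field_simp; norm_num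
        _ ≤ L * (Y / (2 * L^6)) := mul_le_mul_of_nonneg_right (by linarith) (by positivity)
        _ = Y / (2 * L^5) := by field_simp
    have k3 : Y / L^5 = Y / (2 * L^5) + Y / (2 * L^5) := by field_simp; norm_num
    refine (norm_sub_le _ _).trans ?_
    linarith

end Cay

namespace Cay
open Finset ArithmeticFunction

lemma orth {M : ℕ} (hM : 0 < M) (m : ℤ) : ∑ k ∈ range M, ee (m * ((k:ℝ)/M)) = if (M:ℤ) ∣ m then (M:ℂ) else 0 := by
  have hMR : (M:ℝ) ≠ 0 := by exact_mod_cast hM.ne'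
  have e : ∀ k ∈ range M, ee (m * ((k:ℝ)/M)) = (ee ((m:ℝ)/M))^k := by
    intro k _
    rw [← ee_mul_nat]; congr 1; ring
  rw [sum_congr rfl e]
  split_ifs with h
  · obtain ⟨c, rfl⟩ := h
    have : (((M:ℤ) * c : ℤ):ℝ) / M = c := by push_cast; field_simp
    rw [this, ee_int]; simp
  · have hz : (ee ((m:ℝ)/M))^M = 1 := by
      rw [← ee_mul_nat, mul_div_cancel₀ _ hMR, ee_int]
    have hne : ee ((m:ℝ)/M) ≠ 1 := by
      intro h1
      have h2 := norm_ee_sub_one ((m:ℝ)/M)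
      rw [h1, sub_self, norm_zero] at h2
      have h3 : nn ((m:ℝ)/M) = 0 := le_antisymm (by linarith) (nn_nonneg _)
      rw [nn, abs_eq_zero, sub_eq_zero, div_eq_iff hMR] at h3
      apply h
      refine ⟨round ((m:ℝ)/M), ?_⟩
      generalize round ((m:ℝ)/M) = t at h3
      have : m = t * M := by exact_mod_cast h3
      rw [this]; ring
    rw [geom_sum_eq hne, hz, sub_self, zero_div]

/-- solution set of the signed linear equation -/
noncomputable def sol (s : Fin 4 → ℤ) (W : Fin 4 → Finset ℕ) : Finset (Fin 4 → ℕ) :=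
  (Fintype.piFinset W).filter (fun n => ∑ i, s i * (n i : ℤ) = 0)

lemma ee_sum {ι : Type*} (t : Finset ι) (x : ι → ℝ) : ee (∑ i ∈ t, x i) = ∏ i ∈ t, ee (x i) := by
  classical
  induction t using Finset.induction_on with
  | empty => simp [ee_zero]
  | insert i t hi ih => rw [sum_insert hi, prod_insert hi, ee_add, ih]

lemma orth4 (s : Fin 4 → ℤ) (W : Fin 4 → Finset ℕ) (f : Fin 4 → ℕ → ℂ) {M : ℕ} (hM : 0 < M)
    (h : ∀ n ∈ Fintype.piFinset W, |∑ i, s i * (n i : ℤ)| < M) :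
    ∑ k ∈ range M, ∏ i, ∑ n ∈ W i, f i n * ee (n * (s i * ((k:ℝ)/M))) = M * ∑ n ∈ sol s W, ∏ i, f i (n i) := by
  have e : ∀ k ∈ range M, ∏ i, ∑ n ∈ W i, f i n * ee (n * (s i * ((k:ℝ)/M)))
      = ∑ n ∈ Fintype.piFinset W, (∏ i, f i (n i)) * ee (((∑ i, s i * (n i : ℤ) : ℤ) : ℝ) * ((k:ℝ)/M)) := by
    intro k _
    rw [prod_univ_sum]
    apply sum_congr rfl
    intro n _
    rw [prod_mul_distrib, ← ee_sum]
    congr 2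
    push_cast
    rw [sum_mul]
    apply sum_congr rfl
    intro i _; ring
  rw [sum_congr rfl e, sum_comm, sol, sum_filter, mul_sum]
  apply sum_congr rfl
  intro n hn
  rw [← mul_sum, orth hM]
  have : ((M:ℤ) ∣ ∑ i, s i * (n i : ℤ)) ↔ ∑ i, s i * (n i : ℤ) = 0 := by
    constructor
    · intro hd
      exact Int.eq_zero_of_abs_lt_dvd hd (h n hn)
    · intro h0; rw [h0]; exact dvd_zero _
  by_cases h0 : ∑ i, s i * (n i : ℤ) = 0
  · rw [if_pos (this.2 h0), if_pos h0]; ring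
  · rw [if_neg (fun h' => h0 (this.1 h')), if_neg h0]; ring

lemma pars {s : ℤ} (hs : s = 1 ∨ s = -1) (W : Finset ℕ) (f : ℕ → ℂ) {M : ℕ} (hM : 0 < M) (hW : ∀ n ∈ W, n < M) :
    ∑ k ∈ range M, ‖∑ n ∈ W, f n * ee (n * (s * ((k:ℝ)/M)))‖^2 = M * ∑ n ∈ W, ‖f n‖^2 := by
  have key : ∑ k ∈ range M, (((‖∑ n ∈ W, f n * ee (n * (s * ((k:ℝ)/M)))‖^2 : ℝ)) : ℂ) = ((M * ∑ n ∈ W, ‖f n‖^2 : ℝ) : ℂ) := by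
    have e : ∀ k ∈ range M, (((‖∑ n ∈ W, f n * ee (n * (s * ((k:ℝ)/M)))‖^2 : ℝ)) : ℂ) =
        ∑ n ∈ W, ∑ m ∈ W, f n * (starRingEnd ℂ) (f m) * ee (((s * ((n:ℤ) - m) : ℤ) : ℝ) * ((k:ℝ)/M)) := by
      intro k _
      push_cast
      rw [← Complex.mul_conj', map_sum, sum_mul_sum]
      apply sum_congr rfl
      intro n _
      apply sum_congr rfl
      intro m _
      rw [map_mul, ← ee_neg]
      have : ee ((s:ℝ) * ((n:ℝ) - m) * ((k:ℝ)/M)) = ee (n * (s * ((k:ℝ)/M))) * ee (-(m * (s * ((k:ℝ)/M)))) := by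
        rw [← ee_add]; congr 1; ring
      rw [this]; ring
    have er : ((M * ∑ n ∈ W, ‖f n‖^2 : ℝ) : ℂ) = (M:ℂ) * ∑ n ∈ W, (‖f n‖:ℂ)^2 := by push_cast; rfl
    rw [sum_congr rfl e, sum_comm, er, mul_sum]
    apply sum_congr rfl
    intro n hn
    rw [sum_comm, sum_eq_single n]
    · rw [← mul_sum, orth hM, if_pos (by simp), Complex.mul_conj']; ring
    · intro m hm hne
      rw [← mul_sum, orth hM, if_neg, mul_zero]
      intro hd
      have hd' : (M:ℤ) ∣ (n:ℤ) - m := by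
        rcases hs with rfl | rfl
        · simpa using hd
        · rw [neg_one_mul, dvd_neg] at hd; exact hd
      have hn' := hW n hn
      have hm' := hW m hm
      have := Int.eq_zero_of_abs_lt_dvd hd' (by rw [abs_lt]; constructor <;> omega)
      omega
    · intro h; exact absurd hn h
  exact_mod_cast key

lemma tele4 (F G : Fin 4 → ℂ) {η S : ℝ} (hη : ∀ i, ‖F i - G i‖ ≤ η) (hF : ∀ i, ‖F i‖ ≤ S) (hG : ∀ i, ‖G i‖ ≤ S) :
    ‖∏ i, F i - ∏ i, G i‖ ≤ 4 * η * S * ∑ i, (‖F i‖^2 + ‖G i‖^2) := by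
  have hη0 : 0 ≤ η := (norm_nonneg _).trans (hη 0)
  have hS0 : 0 ≤ S := (norm_nonneg _).trans (hF 0)
  have gen : ∀ (x y u v : ℂ) (T : ℝ), ‖x‖ ≤ η → ‖y‖ ≤ S → ‖u‖^2 + ‖v‖^2 ≤ T → ‖x * y * u * v‖ ≤ η * S * T := by
    intro x y u v T hx hy hT
    rw [norm_mul, norm_mul, norm_mul, mul_assoc (‖x‖ * ‖y‖)]
    apply mul_le_mul (mul_le_mul hx hy (norm_nonneg _) hη0) _ (by positivity) (by positivity)
    nlinarith [sq_nonneg (‖u‖ - ‖v‖), norm_nonneg u, norm_nonneg v]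
  rw [Fin.prod_univ_four, Fin.prod_univ_four, Fin.sum_univ_four]
  set T := ‖F 0‖^2 + ‖G 0‖^2 + (‖F 1‖^2 + ‖G 1‖^2) + (‖F 2‖^2 + ‖G 2‖^2) + (‖F 3‖^2 + ‖G 3‖^2) with hT
  have e : F 0 * F 1 * F 2 * F 3 - G 0 * G 1 * G 2 * G 3 = (F 0 - G 0) * F 1 * F 2 * F 3
      + (F 1 - G 1) * F 2 * G 0 * F 3 + (F 2 - G 2) * F 3 * G 0 * G 1 + (F 3 - G 3) * G 0 * G 1 * G 2 := by ring
  rw [e]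
  have g1 := gen (F 0 - G 0) (F 1) (F 2) (F 3) T (hη 0) (hF 1) (by rw [hT]; nlinarith [sq_nonneg ‖F 0‖, sq_nonneg ‖F 1‖, sq_nonneg ‖G 0‖, sq_nonneg ‖G 1‖, sq_nonneg ‖G 2‖, sq_nonneg ‖G 3‖])
  have g2 := gen (F 1 - G 1) (F 2) (G 0) (F 3) T (hη 1) (hF 2) (by rw [hT]; nlinarith [sq_nonneg ‖F 0‖, sq_nonneg ‖F 1‖, sq_nonneg ‖F 2‖, sq_nonneg ‖G 1‖, sq_nonneg ‖G 2‖, sq_nonneg ‖G 3‖])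
  have g3 := gen (F 2 - G 2) (F 3) (G 0) (G 1) T (hη 2) (hF 3) (by rw [hT]; nlinarith [sq_nonneg ‖F 0‖, sq_nonneg ‖F 1‖, sq_nonneg ‖F 2‖, sq_nonneg ‖F 3‖, sq_nonneg ‖G 2‖, sq_nonneg ‖G 3‖])
  have g4 := gen (F 3 - G 3) (G 0) (G 1) (G 2) T (hη 3) (hG 0) (by rw [hT]; nlinarith [sq_nonneg ‖F 0‖, sq_nonneg ‖F 1‖, sq_nonneg ‖F 2‖, sq_nonneg ‖F 3‖, sq_nonneg ‖G 0‖, sq_nonneg ‖G 3‖])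
  calc _ ≤ η * S * T + η * S * T + η * S * T + η * S * T := by
        refine (norm_add_le _ _).trans (add_le_add ?_ g4)
        refine (norm_add_le _ _).trans (add_le_add ?_ g3)
        exact (norm_add_le _ _).trans (add_le_add g1 g2)
    _ = _ := by ring

lemma prod4_small (D : Fin 4 → ℂ) {δ S : ℝ} (hD : ∀ i, ‖D i‖ ≤ S) (i : Fin 4) (hi : ‖D i‖ ≤ δ) :
    ‖∏ i, D i‖ ≤ δ * S * ∑ i, ‖D i‖^2 := by
  have hδ : 0 ≤ δ := (norm_nonneg _).trans hi
  have hS0 : 0 ≤ S := (norm_nonneg _).trans (hD 0)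
  have gen : ∀ (x y u v T : ℝ), 0 ≤ x → 0 ≤ y → 0 ≤ u → 0 ≤ v → x ≤ δ → y ≤ S → u^2 + v^2 ≤ T → (x * y) * (u * v) ≤ δ * S * T := by
    intro x y u v T hx0 hy0 hu hv hx hy hT
    apply mul_le_mul (mul_le_mul hx hy hy0 hδ) _ (by positivity) (by positivity)
    nlinarith [sq_nonneg (u - v)]
  rw [norm_prod, Fin.prod_univ_four, Fin.sum_univ_four]
  have n0 := norm_nonneg (D 0)
  have n1 := norm_nonneg (D 1)
  have n2 := norm_nonneg (D 2)
  have n3 := norm_nonneg (D 3)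
  have h0 := hD 0
  have h1 := hD 1
  have h2 := hD 2
  have h3 := hD 3
  fin_cases i
  · have := gen _ _ _ _ (‖D 0‖^2 + ‖D 1‖^2 + ‖D 2‖^2 + ‖D 3‖^2) n0 n1 n2 n3 hi h1 (by nlinarith)
    calc _ = _ := by ring
      _ ≤ _ := this
  · have := gen _ _ _ _ (‖D 0‖^2 + ‖D 1‖^2 + ‖D 2‖^2 + ‖D 3‖^2) n1 n0 n2 n3 hi h0 (by nlinarith)
    refine le_trans (le_of_eq ?_) this
    ring
  · have := gen _ _ _ _ (‖D 0‖^2 + ‖D 1‖^2 + ‖D 2‖^2 + ‖D 3‖^2) n2 n0 n1 n3 hi h0 (by nlinarith)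
    refine le_trans (le_of_eq ?_) this
    ring
  · have := gen _ _ _ _ (‖D 0‖^2 + ‖D 1‖^2 + ‖D 2‖^2 + ‖D 3‖^2) n3 n0 n1 n2 hi h0 (by nlinarith)
    refine le_trans (le_of_eq ?_) this
    ring

end Cay

namespace Cay
open Finset ArithmeticFunction

/-- signed model exponential sum -/
noncomputable def GS (s : ℤ) (Q a b : ℕ) (x : ℝ) : ℂ := ∑ p ∈ Th Q, (cc p : ℂ) * DD a b (s * (x - th p))

lemma DD_neg (a b : ℕ) (x : ℝ) : DD a b (-x) = (starRingEnd ℂ) (DD a b x) := by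
  unfold DD
  rw [_root_.map_sum]
  apply sum_congr rfl
  intro n _
  rw [← ee_neg]; congr 1; ring

lemma FF_neg (a b : ℕ) (x : ℝ) : FF a b (-x) = (starRingEnd ℂ) (FF a b x) := by
  unfold FF
  rw [_root_.map_sum]
  apply sum_congr rfl
  intro n _
  rw [_root_.map_mul, Complex.conj_ofReal, ← ee_neg]; congr 2; ring

lemma FG_sign {s : ℤ} (hs : s = 1 ∨ s = -1) (Q a b : ℕ) (x : ℝ) :
    ‖FF a b (s * x) - GS s Q a b x‖ = ‖FF a b x - GG Q a b x‖ := by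
  rcases hs with rfl | rfl
  · simp only [GS, GG, Int.cast_one, one_mul]
  · have : FF a b (((-1:ℤ):ℝ) * x) - GS (-1) Q a b x = (starRingEnd ℂ) (FF a b x - GG Q a b x) := by
      have e1 : ((-1:ℤ):ℝ) * x = -x := by push_cast; ring
      rw [e1, FF_neg, _root_.map_sub, GS, GG, _root_.map_sum]
      congr 1
      apply sum_congr rfl
      intro p _
      have e2 : ((-1:ℤ):ℝ) * (x - th p) = -(x - th p) := by push_cast; ring
      rw [e2, DD_neg, _root_.map_mul, Complex.conj_ofReal]
    rw [this, RCLike.norm_conj]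

/-- physical side of the model -/
noncomputable def gm (s : ℤ) (Q : ℕ) (n : ℕ) : ℂ := ∑ p ∈ Th Q, (cc p : ℂ) * ee (-(n * (s * th p)))

lemma GS_wave (s : ℤ) (Q a b : ℕ) (x : ℝ) : GS s Q a b x = ∑ n ∈ Ioc a b, gm s Q n * ee (n * (s * x)) := by
  simp only [GS, DD, gm, mul_sum, sum_mul]
  rw [sum_comm]
  apply sum_congr rfl
  intro n _
  apply sum_congr rfl
  intro p _
  rw [mul_assoc, ← ee_add]; congr 2; ring

lemma nn_sgn {s : ℤ} (hs : s = 1 ∨ s = -1) (x : ℝ) : nn (s * x) = nn x := by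
  rcases hs with rfl | rfl
  · simp
  · rw [← nn_neg x]; congr 1; push_cast; ring

lemma gm_sq {s : ℤ} (hs : s = 1 ∨ s = -1) {Q : ℕ} (hQ : 0 < Q) (a b : ℕ) :
    ∑ n ∈ Ioc a b, ‖gm s Q n‖^2 ≤ ((b - a : ℕ):ℝ) * (1 + Real.log Q)^2 + 2 * (Q:ℝ)^6 := by
  classical
  have hQR : (0:ℝ) < Q := by exact_mod_cast hQ
  have key : ((∑ n ∈ Ioc a b, ‖gm s Q n‖^2 : ℝ) : ℂ) = ∑ p ∈ Th Q, ∑ p' ∈ Th Q, ((cc p * cc p' : ℝ) : ℂ) * DD a b (s * (th p' - th p)) := by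
    push_cast
    have e : ∀ n ∈ Ioc a b, ((‖gm s Q n‖ : ℝ) : ℂ)^2 = ∑ p ∈ Th Q, ∑ p' ∈ Th Q, ((cc p * cc p' : ℝ) : ℂ) * ee (n * (s * (th p' - th p))) := by
      intro n _
      rw [← Complex.mul_conj', gm, _root_.map_sum, sum_mul_sum]
      apply sum_congr rfl
      intro p _
      apply sum_congr rfl
      intro p' _
      rw [_root_.map_mul, Complex.conj_ofReal, ← ee_neg]
      have : ee (n * (s * (th p' - th p))) = ee (-(n * (s * th p))) * ee (-(-(n * (s * th p')))) := by
        rw [← ee_add]; congr 1; ring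
      rw [this]; push_cast; ring
    rw [sum_congr rfl e, sum_comm]
    apply sum_congr rfl
    intro p _
    rw [sum_comm]
    apply sum_congr rfl
    intro p' _
    rw [DD, mul_sum]
    push_cast; rfl
  have h0 : 0 ≤ ∑ n ∈ Ioc a b, ‖gm s Q n‖^2 := sum_nonneg (fun _ _ => by positivity)
  have h1 : ∑ n ∈ Ioc a b, ‖gm s Q n‖^2 = ‖∑ p ∈ Th Q, ∑ p' ∈ Th Q, ((cc p * cc p' : ℝ) : ℂ) * DD a b (s * (th p' - th p))‖ := by
    rw [← key, Complex.norm_real, Real.norm_of_nonneg h0]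
  rw [h1]
  have hterm : ∀ p ∈ Th Q, ∀ p' ∈ Th Q, ‖((cc p * cc p' : ℝ) : ℂ) * DD a b (s * (th p' - th p))‖ ≤ (if p = p' then (cc p)^2 * ((b - a : ℕ):ℝ) else 0) + 2 * (Q:ℝ)^2 := by
    intro p hp p' hp'
    rw [norm_mul, Complex.norm_real, Real.norm_eq_abs]
    split_ifs with h
    · rw [← h, abs_mul_self, ← sq]
      have := mul_le_mul_of_nonneg_left (DD_le a b (s * (th p - th p))) (sq_nonneg (cc p))
      have : 0 ≤ 2 * (Q:ℝ)^2 := by positivity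
      linarith
    · rw [zero_add, abs_mul]
      have h2 := th_sep hp' hp (fun h' => h h'.symm)
      have h3 := DD_far (a := a) (b := b) (by positivity) ((nn_sgn hs (th p' - th p)).symm ▸ h2)
      calc |cc p| * |cc p'| * ‖DD a b (s * (th p' - th p))‖ ≤ (1 * 1) * (2 / (1 / (Q:ℝ)^2)) := by
            apply mul_le_mul _ h3 (norm_nonneg _) (by norm_num)
            exact mul_le_mul (cc_abs hp) (cc_abs hp') (abs_nonneg _) zero_le_one
        _ = _ := by field_simp
  calc _ ≤ ∑ p ∈ Th Q, ∑ p' ∈ Th Q, ((if p = p' then (cc p)^2 * ((b - a : ℕ):ℝ) else 0) + 2 * (Q:ℝ)^2) := by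
        refine norm_sum_le_of_le _ (fun p hp => ?_)
        exact norm_sum_le_of_le _ (fun p' hp' => hterm p hp p' hp')
    _ = ∑ p ∈ Th Q, ((cc p)^2 * ((b - a : ℕ):ℝ) + ((Th Q).card : ℝ) * (2 * (Q:ℝ)^2)) := by
        apply sum_congr rfl
        intro p hp
        rw [sum_add_distrib, sum_ite_eq, if_pos hp, sum_const, nsmul_eq_mul]
    _ = (∑ p ∈ Th Q, (cc p)^2) * ((b - a : ℕ):ℝ) + ((Th Q).card : ℝ) * (((Th Q).card : ℝ) * (2 * (Q:ℝ)^2)) := by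
        rw [sum_add_distrib, sum_mul, sum_const, nsmul_eq_mul]
    _ ≤ (1 + Real.log Q)^2 * ((b - a : ℕ):ℝ) + (Q:ℝ)^2 * ((Q:ℝ)^2 * (2 * (Q:ℝ)^2)) := by
        apply add_le_add
        · exact mul_le_mul_of_nonneg_right (cc_sq Q) (by positivity)
        · apply mul_le_mul (card_Th Q) _ (by positivity) (by positivity)
          exact mul_le_mul_of_nonneg_right (card_Th Q) (by positivity)
    _ = _ := by ring

lemma nn_sub_le (u v : ℝ) : nn (u - v) ≤ nn u + nn v := by
  refine (nn_le (u - v) (round u - round v)).trans ?_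
  have : u - v - ((round u - round v : ℤ) : ℝ) = (u - round u) - (v - round v) := by push_cast; ring
  rw [this]
  exact abs_sub _ _

lemma offdiag {s : Fin 4 → ℤ} (hs : ∀ i, s i = 1 ∨ s i = -1) {Q : ℕ} (hQ : 0 < Q) (a b : Fin 4 → ℕ) {H : ℝ}
    (hH : ∀ i, ((b i - a i : ℕ):ℝ) ≤ H) {p : Fin 4 → Σ _ : ℕ, ℕ} (hp : ∀ i, p i ∈ Th Q) {i j : Fin 4} (hij : p i ≠ p j) (x : ℝ) :
    ‖∏ i, DD (a i) (b i) (s i * (x - th (p i)))‖ ≤ 4 * (Q:ℝ)^2 * H * ∑ i, ‖DD (a i) (b i) (s i * (x - th (p i)))‖^2 := by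
  have hQR : (0:ℝ) < Q := by exact_mod_cast hQ
  have small : ∀ i, 1 / (2 * (Q:ℝ)^2) ≤ nn (x - th (p i)) → ‖DD (a i) (b i) (s i * (x - th (p i)))‖ ≤ 4 * (Q:ℝ)^2 := by
    intro i h
    have := DD_far (a := a i) (b := b i) (by positivity) ((nn_sgn (hs i) (x - th (p i))).symm ▸ h)
    refine this.trans (le_of_eq ?_)
    field_simp; norm_num
  have hS : ∀ i, ‖DD (a i) (b i) (s i * (x - th (p i)))‖ ≤ H := fun i => (DD_le _ _ _).trans (hH i)
  have h1 := th_sep (hp i) (hp j) hij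
  have h2 := nn_sub_le (x - th (p j)) (x - th (p i))
  have e : x - th (p j) - (x - th (p i)) = th (p i) - th (p j) := by ring
  rw [e] at h2
  have e2 : 1 / (Q:ℝ)^2 = 1 / (2 * (Q:ℝ)^2) + 1 / (2 * (Q:ℝ)^2) := by field_simp; norm_num
  by_cases h : 1 / (2 * (Q:ℝ)^2) ≤ nn (x - th (p i))
  · exact prod4_small _ hS i (small i h)
  · push Not at h
    exact prod4_small _ hS j (small j (by linarith))

lemma DD_pars {s : ℤ} (hs : s = 1 ∨ s = -1) (a b : ℕ) {M : ℕ} (hM : b < M) (θ : ℝ) :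
    ∑ k ∈ range M, ‖DD a b (s * ((k:ℝ)/M - θ))‖^2 = M * ((b - a : ℕ):ℝ) := by
  have e : ∀ k ∈ range M, ‖DD a b (s * ((k:ℝ)/M - θ))‖^2 = ‖∑ n ∈ Ioc a b, ee (-(n * (s * θ))) * ee (n * (s * ((k:ℝ)/M)))‖^2 := by
    intro k _
    congr 2
    rw [DD]
    apply sum_congr rfl
    intro n _
    rw [← ee_add]; congr 1; ring
  rw [sum_congr rfl e, pars hs (Ioc a b) _ (by omega) (fun n hn => by have := mem_Ioc.1 hn; omega)]
  congr 1
  simp [norm_ee]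

lemma diag_sum {s : Fin 4 → ℤ} (a b : Fin 4 → ℕ) {M : ℕ} (hM : 0 < M)
    (h : ∀ n ∈ Fintype.piFinset (fun i => Ioc (a i) (b i)), |∑ i, s i * (n i : ℤ)| < M) (θ : ℝ) :
    ∑ k ∈ range M, ∏ i, DD (a i) (b i) (s i * ((k:ℝ)/M - θ)) = M * ((sol s (fun i => Ioc (a i) (b i))).card : ℂ) := by
  have := orth4 s (fun i => Ioc (a i) (b i)) (fun i n => ee (-(n * (s i * θ)))) hM h
  rw [card_eq_sum_ones]
  push_cast
  have e1 : ∀ n ∈ sol s (fun i => Ioc (a i) (b i)), ∏ i, ee (-((n i : ℝ) * (s i * θ))) = (1:ℂ) := by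
    intro n hn
    rw [sol, mem_filter] at hn
    rw [← ee_sum]
    have : ∑ i, -((n i : ℝ) * (s i * θ)) = -θ * ((∑ i, s i * (n i : ℤ) : ℤ) : ℝ) := by
      push_cast; rw [mul_sum]; apply sum_congr rfl; intro i _; ring
    rw [this, hn.2]; simp [ee_zero]
  rw [sum_congr rfl e1] at this
  rw [← this]
  apply sum_congr rfl
  intro k _
  apply prod_congr rfl
  intro i _
  rw [DD]
  apply sum_congr rfl
  intro n _
  rw [← ee_add]; congr 1; ring

end Cay

namespace Cay
open Finset ArithmeticFunction

lemma main_GS {s : Fin 4 → ℤ} (hs : ∀ i, s i = 1 ∨ s i = -1) {Q : ℕ} (hQ : 0 < Q) (a b : Fin 4 → ℕ) {H : ℝ}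
    (hH : ∀ i, ((b i - a i : ℕ):ℝ) ≤ H) {M : ℕ} (hM : ∀ i, b i < M)
    (h : ∀ n ∈ Fintype.piFinset (fun i => Ioc (a i) (b i)), |∑ i, s i * (n i : ℤ)| < M) :
    M * (((sol s (fun i => Ioc (a i) (b i))).card : ℝ) - 16 * (Q:ℝ)^10 * H^2) ≤
      (∑ k ∈ range M, ∏ i, GS (s i) Q (a i) (b i) ((k:ℝ)/M)).re := by
  classical
  have hM0 : 0 < M := lt_of_le_of_lt (Nat.zero_le _) (hM 0)
  have hMR : (0:ℝ) < M := by exact_mod_cast hM0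
  have hH0 : 0 ≤ H := le_trans (Nat.cast_nonneg _) (hH 0)
  set N : ℝ := ((sol s (fun i => Ioc (a i) (b i))).card : ℝ) with hN
  set P := Fintype.piFinset (fun _ : Fin 4 => Th Q) with hP
  set T : (Fin 4 → Σ _ : ℕ, ℕ) → ℂ := fun p => ∑ k ∈ range M, ∏ i, DD (a i) (b i) (s i * ((k:ℝ)/M - th (p i))) with hT
  have e1 : ∑ k ∈ range M, ∏ i, GS (s i) Q (a i) (b i) ((k:ℝ)/M) = ∑ p ∈ P, ((∏ i, cc (p i) : ℝ) : ℂ) * T p := by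
    have : ∀ k ∈ range M, ∏ i, GS (s i) Q (a i) (b i) ((k:ℝ)/M) = ∑ p ∈ P, ((∏ i, cc (p i) : ℝ) : ℂ) * ∏ i, DD (a i) (b i) (s i * ((k:ℝ)/M - th (p i))) := by
      intro k _
      simp only [GS]
      rw [prod_univ_sum]
      apply sum_congr rfl
      intro p _
      rw [prod_mul_distrib]; push_cast; rfl
    rw [sum_congr rfl this, sum_comm]
    apply sum_congr rfl
    intro p _
    rw [hT, mul_sum]
  have hcp : ∀ p ∈ P, |∏ i, cc (p i)| ≤ 1 := by
    intro p hp
    rw [abs_prod]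
    exact prod_le_one (fun _ _ => abs_nonneg _) (fun i _ => cc_abs (Fintype.mem_piFinset.1 hp i))
  rw [e1, ← sum_filter_add_sum_filter_not P (fun p => ∀ i, p i = p 0), Complex.add_re]
  have d1 : M * N ≤ (∑ p ∈ P.filter (fun p => ∀ i, p i = p 0), ((∏ i, cc (p i) : ℝ) : ℂ) * T p).re := by
    have e2 : ∀ p ∈ P.filter (fun p => ∀ i, p i = p 0), ((∏ i, cc (p i) : ℝ) : ℂ) * T p = (((cc (p 0))^4 * (M * N) : ℝ) : ℂ) := by
      intro p hp
      have hc := (mem_filter.1 hp).2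
      have e3 : T p = ((M * N : ℝ) : ℂ) := by
        have := diag_sum (s := s) a b hM0 h (th (p 0))
        rw [hT, hN]
        push_cast
        rw [← this]
        apply sum_congr rfl
        intro k _
        apply prod_congr rfl
        intro i _
        rw [hc i]
      have e4 : ∏ i, cc (p i) = (cc (p 0))^4 := by
        rw [prod_congr rfl (fun i _ => by rw [hc i] : ∀ i ∈ (univ : Finset (Fin 4)), cc (p i) = cc (p 0))]
        simp
      rw [e3, e4]; push_cast; ring
    rw [sum_congr rfl e2, ← Complex.ofReal_sum, Complex.ofReal_re]
    have hmem : (fun _ => ⟨1, 0⟩ : Fin 4 → Σ _ : ℕ, ℕ) ∈ P.filter (fun p => ∀ i, p i = p 0) := by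
      rw [mem_filter, hP, Fintype.mem_piFinset]
      refine ⟨fun i => ?_, fun i => rfl⟩
      rw [mem_Th]
      exact ⟨⟨one_pos, hQ⟩, one_pos, by simp⟩
    have hN0 : 0 ≤ N := by rw [hN]; positivity
    have := single_le_sum (f := fun p : Fin 4 → Σ _ : ℕ, ℕ => (cc (p 0))^4 * (M * N)) (fun p _ => by positivity) hmem
    refine le_trans (le_of_eq ?_) this
    simp [cc]
  have d2 : ‖∑ p ∈ P.filter (fun p => ¬ ∀ i, p i = p 0), ((∏ i, cc (p i) : ℝ) : ℂ) * T p‖ ≤ M * (16 * (Q:ℝ)^10 * H^2) := by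
    have hb : ∀ p ∈ P.filter (fun p => ¬ ∀ i, p i = p 0), ‖((∏ i, cc (p i) : ℝ) : ℂ) * T p‖ ≤ 16 * (Q:ℝ)^2 * H^2 * M := by
      intro p hp
      rw [mem_filter] at hp
      obtain ⟨hpP, hne⟩ := hp
      push Not at hne
      obtain ⟨i, hi⟩ := hne
      rw [norm_mul, Complex.norm_real, Real.norm_eq_abs]
      have t1 : ‖T p‖ ≤ 16 * (Q:ℝ)^2 * H^2 * M := by
        calc ‖T p‖ ≤ ∑ k ∈ range M, 4 * (Q:ℝ)^2 * H * ∑ i, ‖DD (a i) (b i) (s i * ((k:ℝ)/M - th (p i)))‖^2 :=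
              norm_sum_le_of_le _ (fun k _ => offdiag hs hQ a b hH (Fintype.mem_piFinset.1 hpP) hi _)
          _ = 4 * (Q:ℝ)^2 * H * ∑ i, ∑ k ∈ range M, ‖DD (a i) (b i) (s i * ((k:ℝ)/M - th (p i)))‖^2 := by
              rw [← mul_sum, sum_comm]
          _ = 4 * (Q:ℝ)^2 * H * ∑ i, (M:ℝ) * ((b i - a i : ℕ):ℝ) := by
              congr 1
              apply sum_congr rfl
              intro i _
              exact DD_pars (hs i) _ _ (hM i) _
          _ ≤ 4 * (Q:ℝ)^2 * H * ∑ i : Fin 4, (M:ℝ) * H := by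
              apply mul_le_mul_of_nonneg_left _ (by positivity)
              apply sum_le_sum
              intro i _
              exact mul_le_mul_of_nonneg_left (hH i) hMR.le
          _ = _ := by rw [sum_const, card_univ, Fintype.card_fin, nsmul_eq_mul]; push_cast; ring
      calc _ ≤ 1 * (16 * (Q:ℝ)^2 * H^2 * M) := mul_le_mul (hcp p hpP) t1 (norm_nonneg _) zero_le_one
        _ = _ := one_mul _
    refine (norm_sum_le_of_le _ hb).trans ?_
    rw [sum_const, nsmul_eq_mul]
    have hcard : ((P.filter (fun p => ¬ ∀ i, p i = p 0)).card : ℝ) ≤ (Q:ℝ)^8 := by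
      have c1 : ((P.filter (fun p => ¬ ∀ i, p i = p 0)).card : ℝ) ≤ (P.card : ℝ) := by
        exact_mod_cast card_filter_le _ _
      have c2 : (P.card : ℝ) = ((Th Q).card : ℝ)^4 := by
        rw [hP, Fintype.card_piFinset]; simp
      rw [c2] at c1
      calc _ ≤ ((Th Q).card : ℝ)^4 := c1
        _ ≤ ((Q:ℝ)^2)^4 := pow_le_pow_left₀ (by positivity) (card_Th Q) 4
        _ = _ := by ring
    calc _ ≤ (Q:ℝ)^8 * (16 * (Q:ℝ)^2 * H^2 * M) := mul_le_mul_of_nonneg_right hcard (by positivity)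
      _ = _ := by ring
  have d3 := (abs_le.1 ((Complex.abs_re_le_norm _).trans d2)).1
  linarith

theorem circle {s : Fin 4 → ℤ} (hs : ∀ i, s i = 1 ∨ s i = -1) {Q : ℕ} (hQ : 0 < Q) (a b : Fin 4 → ℕ) {H Y L η : ℝ}
    (hH : ∀ i, ((b i - a i : ℕ):ℝ) ≤ H) (hY : ∀ i, (b i : ℝ) ≤ Y) (hL : Real.log Y = L) (hη1 : η ≤ H * L)
    (hη : ∀ i x, ‖FF (a i) (b i) x - GG Q (a i) (b i) x‖ ≤ η) :
    ((sol s (fun i => Ioc (a i) (b i))).card : ℝ) - 16 * (Q:ℝ)^10 * H^2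
      - 32 * η * H * L * (H * L^2 + H * (1 + Real.log Q)^2 + 2 * (Q:ℝ)^6)
      ≤ ∑ n ∈ sol s (fun i => Ioc (a i) (b i)), ∏ i, vonMangoldt (n i) := by
  have hη0 : 0 ≤ η := (norm_nonneg _).trans (hη 0 0)
  have hH0 : 0 ≤ H := le_trans (Nat.cast_nonneg _) (hH 0)
  set M : ℕ := ∑ i, b i + 1 with hMd
  have hM : ∀ i, b i < M := fun i => Nat.lt_succ_of_le (single_le_sum (f := b) (fun _ _ => Nat.zero_le _) (mem_univ i))
  have hM0 : 0 < M := Nat.succ_pos _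
  have hMR : (0:ℝ) < M := by exact_mod_cast hM0
  have h : ∀ n ∈ Fintype.piFinset (fun i => Ioc (a i) (b i)), |∑ i, s i * (n i : ℤ)| < M := by
    intro n hn
    rw [Fintype.mem_piFinset] at hn
    calc |∑ i, s i * (n i : ℤ)| ≤ ∑ i, |s i * (n i : ℤ)| := abs_sum_le_sum_abs _ _
      _ ≤ ∑ i, (b i : ℤ) := by
        apply sum_le_sum
        intro i _
        have h1 := (mem_Ioc.1 (hn i)).2
        have h2 : |s i| = 1 := by rcases hs i with h | h <;> rw [h] <;> rfl
        rw [abs_mul, h2, one_mul, Nat.abs_cast]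
        exact_mod_cast h1
      _ < M := by rw [hMd]; push_cast; linarith
  have hΛ : ∀ i, ∀ n ∈ Ioc (a i) (b i), vonMangoldt n ≤ L := by
    intro i n hn
    rw [mem_Ioc] at hn
    refine vonMangoldt_le_log.trans ?_
    rw [← hL]
    apply Real.log_le_log (by exact_mod_cast (by omega : 0 < n))
    exact le_trans (by exact_mod_cast hn.2) (hY i)
  have hFG : ∀ i x, ‖FF (a i) (b i) (s i * x) - GS (s i) Q (a i) (b i) x‖ ≤ η := by
    intro i x
    rw [FG_sign (hs i)]; exact hη i x
  by_cases hLn : L < 0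
  · -- degenerate
    have hH' : H = 0 := by
      rcases hH0.lt_or_eq with h1 | h1
      · nlinarith
      · exact h1.symm
    have hcard : ((sol s (fun i => Ioc (a i) (b i))).card : ℝ) = 0 := by
      have : sol s (fun i => Ioc (a i) (b i)) = ∅ := by
        rw [sol, filter_eq_empty_iff]
        intro n hn
        exfalso
        have h1 := Fintype.mem_piFinset.1 hn 0
        have h2 := hH 0
        rw [hH'] at h2
        have h3 : b 0 - a 0 = 0 := by
          have : ((b 0 - a 0 : ℕ):ℝ) = 0 := le_antisymm h2 (Nat.cast_nonneg _)
          exact_mod_cast this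
        rw [mem_Ioc] at h1
        omega
      rw [this]; simp
    rw [hcard, hH']
    have : 0 ≤ ∑ n ∈ sol s (fun i => Ioc (a i) (b i)), ∏ i, vonMangoldt (n i) :=
      sum_nonneg (fun n _ => prod_nonneg (fun i _ => vonMangoldt_nonneg))
    simpa using this
  push Not at hLn
  have hFS : ∀ i x, ‖FF (a i) (b i) x‖ ≤ H * L := by
    intro i x
    rw [FF]
    refine (norm_sum_le_of_le (n := fun _ => L) _ (fun n hn => ?_)).trans ?_
    · rw [norm_mul, norm_ee, mul_one, Complex.norm_real, Real.norm_of_nonneg vonMangoldt_nonneg]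
      exact hΛ i n hn
    · rw [sum_const, nsmul_eq_mul, Nat.card_Ioc]
      exact mul_le_mul_of_nonneg_right (hH i) hLn
  have hGS : ∀ i x, ‖GS (s i) Q (a i) (b i) x‖ ≤ 2 * H * L := by
    intro i x
    have h1 := hFG i x
    have h2 := hFS i (s i * x)
    have h3 : ‖GS (s i) Q (a i) (b i) x‖ ≤ ‖FF (a i) (b i) (s i * x)‖ + ‖FF (a i) (b i) (s i * x) - GS (s i) Q (a i) (b i) x‖ := by
      have e : GS (s i) Q (a i) (b i) x = FF (a i) (b i) (s i * x) - (FF (a i) (b i) (s i * x) - GS (s i) Q (a i) (b i) x) := by ring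
      conv_lhs => rw [e]
      exact norm_sub_le _ _
    linarith
  -- exact formula
  have id1 : ∑ k ∈ range M, ∏ i, FF (a i) (b i) (s i * ((k:ℝ)/M)) =
      ((M * ∑ n ∈ sol s (fun i => Ioc (a i) (b i)), ∏ i, vonMangoldt (n i) : ℝ) : ℂ) := by
    have := orth4 s (fun i => Ioc (a i) (b i)) (fun _ n => ((vonMangoldt n : ℝ) : ℂ)) hM0 h
    simp only [FF]
    rw [this]
    push_cast; rfl
  set E : ℝ := H * L^2 + (H * (1 + Real.log Q)^2 + 2 * (Q:ℝ)^6) with hE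
  have sq1 : ∀ i, ∑ k ∈ range M, (‖FF (a i) (b i) (s i * ((k:ℝ)/M))‖^2 + ‖GS (s i) Q (a i) (b i) ((k:ℝ)/M)‖^2) ≤ M * E := by
    intro i
    have hW : ∀ n ∈ Ioc (a i) (b i), n < M := fun n hn => lt_of_le_of_lt (mem_Ioc.1 hn).2 (hM i)
    have p1 := pars (hs i) (Ioc (a i) (b i)) (fun n => ((vonMangoldt n : ℝ) : ℂ)) hM0 hW
    have p2 := pars (hs i) (Ioc (a i) (b i)) (gm (s i) Q) hM0 hW
    rw [sum_add_distrib]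
    simp only [FF]
    rw [p1, sum_congr rfl (fun k _ => by rw [GS_wave] : ∀ k ∈ range M, ‖GS (s i) Q (a i) (b i) ((k:ℝ)/M)‖^2 = ‖∑ n ∈ Ioc (a i) (b i), gm (s i) Q n * ee (n * (s i * ((k:ℝ)/M)))‖^2), p2, ← mul_add]
    apply mul_le_mul_of_nonneg_left _ hMR.le
    rw [hE]
    apply add_le_add
    · refine (sum_le_sum (g := fun _ => L^2) (fun n hn => ?_)).trans ?_
      · rw [Complex.norm_real, Real.norm_of_nonneg vonMangoldt_nonneg]
        exact pow_le_pow_left₀ vonMangoldt_nonneg (hΛ i n hn) 2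
      · rw [sum_const, nsmul_eq_mul, Nat.card_Ioc]
        exact mul_le_mul_of_nonneg_right (hH i) (by positivity)
    · refine (gm_sq (hs i) hQ (a i) (b i)).trans ?_
      have := mul_le_mul_of_nonneg_right (hH i) (sq_nonneg (1 + Real.log Q))
      linarith
  have tele : ‖∑ k ∈ range M, ∏ i, FF (a i) (b i) (s i * ((k:ℝ)/M)) - ∑ k ∈ range M, ∏ i, GS (s i) Q (a i) (b i) ((k:ℝ)/M)‖
      ≤ M * (32 * η * H * L * E) := by
    rw [← sum_sub_distrib]
    have hHL : 0 ≤ H * L := mul_nonneg hH0 hLn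
    calc _ ≤ ∑ k ∈ range M, 4 * η * (2 * H * L) * ∑ i, (‖FF (a i) (b i) (s i * ((k:ℝ)/M))‖^2 + ‖GS (s i) Q (a i) (b i) ((k:ℝ)/M)‖^2) := by
          refine norm_sum_le_of_le _ (fun k _ => ?_)
          exact tele4 _ _ (fun i => hFG i _) (fun i => by have := hFS i (s i * ((k:ℝ)/M)); linarith) (fun i => hGS i _)
      _ = 4 * η * (2 * H * L) * ∑ i, ∑ k ∈ range M, (‖FF (a i) (b i) (s i * ((k:ℝ)/M))‖^2 + ‖GS (s i) Q (a i) (b i) ((k:ℝ)/M)‖^2) := by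
          rw [← mul_sum, sum_comm]
      _ ≤ 4 * η * (2 * H * L) * ∑ i : Fin 4, M * E := by
          apply mul_le_mul_of_nonneg_left _ (by positivity)
          exact sum_le_sum (fun i _ => sq1 i)
      _ = _ := by rw [sum_const, card_univ, Fintype.card_fin, nsmul_eq_mul]; push_cast; ring
  have m1 := main_GS hs hQ a b hH hM h
  have m2 := (abs_le.1 ((Complex.abs_re_le_norm _).trans tele)).1
  rw [Complex.sub_re, id1, Complex.ofReal_re] at m2
  have m3 : M * (((sol s (fun i => Ioc (a i) (b i))).card : ℝ) - 16 * (Q:ℝ)^10 * H^2 - 32 * η * H * L * E)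
      ≤ M * ∑ n ∈ sol s (fun i => Ioc (a i) (b i)), ∏ i, vonMangoldt (n i) := by
    rw [mul_sub]; linarith
  have m4 := le_of_mul_le_mul_left m3 hMR
  rw [hE, ← add_assoc] at m4
  exact m4

end Cay

namespace Cay
open Finset ArithmeticFunction

theorem asym : ∀ᶠ Y : ℝ in Filter.atTop, ∀ (s : Fin 4 → ℤ), (∀ i, s i = 1 ∨ s i = -1) →
    ∀ (a b : Fin 4 → ℕ), (∀ i, a i ≤ b i) → (∀ i, (b i : ℝ) ≤ Y) → (∀ i, ((b i - a i : ℕ):ℝ) ≤ Y / Real.log Y) →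
    ((sol s (fun i => Ioc (a i) (b i))).card : ℝ) - 97 * ((Y / Real.log Y)^3 / Real.log Y) ≤
      ∑ n ∈ sol s (fun i => Ioc (a i) (b i)), ∏ i, vonMangoldt (n i) := by
  filter_upwards [minor, ev_log_pow 203 (by norm_num : (0:ℝ) < 1), ev_log_ge 1000, Filter.eventually_ge_atTop 1,
    Real.tendsto_log_atTop.eventually (ev_log_pow 1 (by norm_num : (0:ℝ) < 1/2))] with Y hm hp hL hY hll s hs a b hab hbY hba
  set L := Real.log Y with hLd
  have hL0 : 0 < L := by linarith
  have hY0 : 0 < Y := by linarith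
  rw [Real.rpow_one] at hp
  rw [← Real.sqrt_eq_rpow, pow_one] at hll
  set Q := ⌊L^20⌋₊ with hQd
  have hQle : (Q:ℝ) ≤ L^20 := Nat.floor_le (by positivity)
  have hL20 : (1:ℝ) ≤ L^20 := one_le_pow₀ (by linarith)
  have hQ : 0 < Q := Nat.floor_pos.2 hL20
  have hQR : (0:ℝ) < Q := by exact_mod_cast hQ
  have hlQ : 1 + Real.log Q ≤ L := by
    have h1 : Real.log Q ≤ 20 * Real.log L := by
      refine (Real.log_le_log hQR hQle).trans ?_
      rw [Real.log_pow]; norm_num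
    have h2 : √L * √L = L := Real.mul_self_sqrt hL0.le
    have h3 : 30 ≤ √L := by
      apply Real.le_sqrt_of_sq_le; linarith
    nlinarith
  have hlQ0 : 0 ≤ 1 + Real.log Q := by
    have : 0 ≤ Real.log Q := Real.log_nonneg (by exact_mod_cast hQ)
    linarith
  set H := Y / L with hHd
  have hH0 : 0 < H := by positivity
  have hYH : Y = H * L := by rw [hHd]; field_simp
  have key := circle hs hQ a b (H := H) (Y := Y) (L := L) (η := Y / L^5) hba hbY rfl (by
    rw [← hYH]
    exact div_le_self hY0.le (one_le_pow₀ (by linarith))) (fun i x => hm _ _ (hab i) (hbY i) x)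
  have hHL : L^202 ≤ H := by
    rw [hHd, le_div_iff₀ hL0]
    calc L^202 * L = L^203 := by ring
      _ ≤ Y := hp
  have e1 : 16 * (Q:ℝ)^10 * H^2 ≤ H^3 / L := by
    rw [le_div_iff₀ hL0]
    have h1 : (Q:ℝ)^10 ≤ L^200 := by
      calc (Q:ℝ)^10 ≤ (L^20)^10 := pow_le_pow_left₀ hQR.le hQle 10
        _ = L^200 := by ring
    have h2 : 16 * L^200 * L ≤ H := by
      calc 16 * L^200 * L = 16 * L^201 := by ring
        _ ≤ L * L^201 := mul_le_mul_of_nonneg_right (by linarith) (by positivity)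
        _ = L^202 := by ring
        _ ≤ H := hHL
    calc 16 * (Q:ℝ)^10 * H^2 * L = (16 * (Q:ℝ)^10 * L) * H^2 := by ring
      _ ≤ (16 * L^200 * L) * H^2 := by gcongr
      _ ≤ H * H^2 := by gcongr
      _ = H^3 := by ring
  have e2 : 32 * (Y / L^5) * H * L * (H * L^2 + H * (1 + Real.log Q)^2 + 2 * (Q:ℝ)^6) ≤ 96 * (H^3 / L) := by
    have h1 : (1 + Real.log Q)^2 ≤ L^2 := pow_le_pow_left₀ hlQ0 hlQ 2
    have h2 : 2 * (Q:ℝ)^6 ≤ H * L^2 := by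
      have h3 : (Q:ℝ)^6 ≤ L^120 := by
        calc (Q:ℝ)^6 ≤ (L^20)^6 := pow_le_pow_left₀ hQR.le hQle 6
          _ = L^120 := by ring
      have h4 : L^120 ≤ L^202 := pow_le_pow_right₀ (by linarith) (by norm_num)
      have h5 : 2 ≤ L^2 := by nlinarith
      nlinarith
    have h3 : 32 * (Y / L^5) * H * L * (3 * (H * L^2)) = 96 * (H^3 / L) := by
      rw [hYH]; field_simp; norm_num
    rw [← h3]
    apply mul_le_mul_of_nonneg_left _ (by positivity)
    have := mul_le_mul_of_nonneg_left h1 hH0.le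
    linarith
  linarith

end Cay

namespace Cay
open Finset ArithmeticFunction

lemma card_sol_le (s : Fin 4 → ℤ) (hs : ∀ i, s i = 1 ∨ s i = -1) (W : Fin 4 → Finset ℕ) (l : Fin 4) :
    (sol s W).card ≤ ∏ j ∈ univ.erase l, (W j).card := by
  classical
  have h1 : (sol s W).card ≤ (Fintype.piFinset (Function.update W l {0})).card := by
    apply card_le_card_of_injOn (fun n => Function.update n l 0)
    · intro n hn
      rw [mem_coe, sol, mem_filter, Fintype.mem_piFinset] at hn
      rw [mem_coe, Fintype.mem_piFinset]
      intro j
      by_cases hj : j = l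
      · subst hj; simp
      · simp [Function.update_of_ne hj, hn.1 j]
    · intro n hn m hm h
      rw [mem_coe, sol, mem_filter] at hn hm
      have hj : ∀ j, j ≠ l → n j = m j := by
        intro j hj
        have := congrFun h j
        simpa [Function.update_of_ne hj] using this
      have e1 := hn.2
      have e2 := hm.2
      rw [← add_sum_erase _ _ (mem_univ l)] at e1 e2
      have e3 : ∑ x ∈ univ.erase l, s x * (n x : ℤ) = ∑ x ∈ univ.erase l, s x * (m x : ℤ) :=
        sum_congr rfl (fun x hx => by rw [hj x (ne_of_mem_erase hx)])
      have hl : n l = m l := by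
        rcases hs l with h | h <;> rw [h] at e1 e2 <;> omega
      funext j
      by_cases hjl : j = l
      · rw [hjl, hl]
      · exact hj j hjl
  refine h1.trans (le_of_eq ?_)
  rw [Fintype.card_piFinset, ← mul_prod_erase _ _ (mem_univ l), Function.update_self, card_singleton, one_mul]
  exact prod_congr rfl (fun x hx => by rw [Function.update_of_ne (ne_of_mem_erase hx)])

noncomputable def PP (Y : ℝ) : Finset ℕ := (Ioc 0 ⌊Y⌋₊).filter (fun n => ¬ n.Prime ∧ IsPrimePow n)

lemma card_PP {Y : ℝ} (hY : 1 ≤ Y) : ((PP Y).card : ℝ) ≤ 4 * √Y * Real.log Y := by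
  have h1 := Chebyshev.psi_sub_theta_le hY
  rw [Chebyshev.psi_sub_theta_eq_sum_not_prime] at h1
  have h2 : ∑ n ∈ PP Y, (1/2:ℝ) ≤ ∑ n ∈ (Ioc 0 ⌊Y⌋₊).filter (fun n => ¬ n.Prime), vonMangoldt n := by
    refine (sum_le_sum (g := fun n => vonMangoldt n) (fun n hn => ?_)).trans (sum_le_sum_of_subset_of_nonneg ?_ (fun _ _ _ => vonMangoldt_nonneg))
    · rw [PP, mem_filter] at hn
      rw [vonMangoldt_apply, if_pos hn.2.2]
      have h3 : 2 ≤ n.minFac := (Nat.minFac_prime hn.2.2.one_lt.ne').two_le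
      have h4 : Real.log 2 ≤ Real.log n.minFac := Real.log_le_log (by norm_num) (by exact_mod_cast h3)
      linarith [Real.log_two_gt_d9]
    · intro n hn
      rw [PP, mem_filter] at hn
      exact mem_filter.2 ⟨hn.1, hn.2.1⟩
  rw [sum_const, nsmul_eq_mul] at h2
  linarith

lemma prod_ite (P H : ℝ) (i : Fin 4) : ∏ j ∈ univ.erase (i+1), (if j = i then P else H) = P * H^2 := by
  have hi : i ∈ univ.erase (i+1) := by
    rw [mem_erase]; exact ⟨by revert i; decide, mem_univ _⟩
  rw [← mul_prod_erase _ _ hi, if_pos rfl, prod_congr rfl (g := fun _ => H) (fun j hj => if_neg (ne_of_mem_erase hj)),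
    prod_const, card_erase_of_mem hi, card_erase_of_mem (mem_univ _), card_univ, Fintype.card_fin]

theorem primes_sol : ∀ᶠ Y : ℝ in Filter.atTop, ∀ (s : Fin 4 → ℤ), (∀ i, s i = 1 ∨ s i = -1) →
    ∀ (a b : Fin 4 → ℕ), (∀ i, a i ≤ b i) → (∀ i, (b i : ℝ) ≤ Y) → (∀ i, ((b i - a i : ℕ):ℝ) ≤ Y / Real.log Y) →
    ((sol s (fun i => Ioc (a i) (b i))).card : ℝ) - 98 * ((Y / Real.log Y)^3 / Real.log Y) ≤
      (Real.log Y)^4 * (((sol s (fun i => Ioc (a i) (b i))).filter (fun n => ∀ i, (n i).Prime)).card : ℝ) := by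
  filter_upwards [asym, ev_log_pow 8 (by norm_num : (0:ℝ) < 1/2), ev_log_ge 1000, Filter.eventually_ge_atTop 1] with Y hm hp hL hY s hs a b hab hbY hba
  have key := hm s hs a b hab hbY hba
  set L := Real.log Y with hLd
  have hL0 : 0 < L := by linarith
  have hY0 : 0 < Y := by linarith
  rw [← Real.sqrt_eq_rpow] at hp
  set H := Y / L with hHd
  have hH0 : 0 < H := by positivity
  have hYH : Y = H * L := by rw [hHd]; field_simp
  set W := fun i => Ioc (a i) (b i) with hW
  have hbound : ∀ n ∈ sol s W, ∏ i, vonMangoldt (n i) ≤ L^4 := by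
    intro n hn
    have h1 : ∏ i, vonMangoldt (n i) ≤ ∏ _i : Fin 4, L := by
      apply prod_le_prod (fun i _ => vonMangoldt_nonneg)
      intro i _
      rw [sol, mem_filter, Fintype.mem_piFinset] at hn
      have h2 := mem_Ioc.1 (hn.1 i)
      refine vonMangoldt_le_log.trans ?_
      apply Real.log_le_log (by exact_mod_cast lt_of_le_of_lt (Nat.zero_le _) h2.1)
      exact le_trans (by exact_mod_cast h2.2) (hbY i)
    rwa [prod_const, card_univ, Fintype.card_fin] at h1
  set W' : Fin 4 → Fin 4 → Finset ℕ := fun i => Function.update W i (PP Y) with hW'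
  have hsplit : ∑ n ∈ sol s W, ∏ i, vonMangoldt (n i) ≤
      L^4 * (((sol s W).filter (fun n => ∀ i, (n i).Prime)).card : ℝ) + ∑ i : Fin 4, L^4 * ((sol s (W' i)).card : ℝ) := by
    rw [← sum_filter_add_sum_filter_not _ (fun n : Fin 4 → ℕ => ∀ i, (n i).Prime)]
    apply add_le_add
    · refine (sum_le_sum (g := fun _ => L^4) (fun n hn => hbound n (mem_filter.1 hn).1)).trans ?_
      rw [sum_const, nsmul_eq_mul, mul_comm]
    · have h1 : ∀ n ∈ (sol s W).filter (fun n => ¬ ∀ i, (n i).Prime), ∏ i, vonMangoldt (n i) ≤ ∑ i : Fin 4, if n ∈ sol s (W' i) then L^4 else 0 := by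
        intro n hn
        rw [mem_filter] at hn
        have hnn : ∀ i ∈ (univ : Finset (Fin 4)), (0:ℝ) ≤ if n ∈ sol s (W' i) then L^4 else 0 := by
          intro i _
          split_ifs <;> positivity
        by_cases hz : ∏ i, vonMangoldt (n i) = 0
        · rw [hz]; exact sum_nonneg hnn
        · rw [← ne_eq, prod_ne_zero_iff] at hz
          obtain ⟨i, hi⟩ := not_forall.1 hn.2
          have hpp := vonMangoldt_ne_zero_iff.1 (hz i (mem_univ i))
          have hin : n ∈ sol s (W' i) := by
            have h0 := hn.1
            rw [sol, mem_filter, Fintype.mem_piFinset] at h0 ⊢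
            refine ⟨fun j => ?_, h0.2⟩
            by_cases hj : j = i
            · subst hj
              rw [hW']; simp only [Function.update_self]
              have h2 := mem_Ioc.1 (h0.1 j)
              rw [PP, mem_filter, mem_Ioc]
              refine ⟨⟨by omega, ?_⟩, hi, hpp⟩
              apply Nat.le_floor
              exact le_trans (by exact_mod_cast h2.2) (hbY j)
            · rw [hW']; simp only [Function.update_of_ne hj]
              exact h0.1 j
          refine le_trans ?_ (single_le_sum hnn (mem_univ i))
          rw [if_pos hin]
          exact hbound n hn.1
      refine (sum_le_sum h1).trans ?_
      rw [sum_comm]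
      apply sum_le_sum
      intro i _
      rw [← sum_filter, sum_const, nsmul_eq_mul, mul_comm]
      apply mul_le_mul_of_nonneg_left _ (by positivity)
      norm_cast
      apply card_le_card
      intro n hn
      exact (mem_filter.1 hn).2
  have hcard : ∀ i, ((sol s (W' i)).card : ℝ) ≤ (4 * √Y * L) * H^2 := by
    intro i
    have h1 := card_sol_le s hs (W' i) (i+1)
    have h2 : ((sol s (W' i)).card : ℝ) ≤ ∏ j ∈ univ.erase (i+1), ((W' i j).card : ℝ) := by exact_mod_cast h1
    refine h2.trans ?_
    rw [← prod_ite]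
    apply prod_le_prod (fun _ _ => Nat.cast_nonneg _)
    intro j _
    rw [hW']
    split_ifs with hj
    · subst hj
      simp only [Function.update_self]
      exact card_PP hY
    · simp only [Function.update_of_ne hj, hW, Nat.card_Ioc]
      exact hba j
  have e1 : ∑ i : Fin 4, L^4 * ((sol s (W' i)).card : ℝ) ≤ H^3 / L := by
    have h1 : ∑ i : Fin 4, L^4 * ((sol s (W' i)).card : ℝ) ≤ ∑ _i : Fin 4, L^4 * ((4 * √Y * L) * H^2) :=
      sum_le_sum (fun i _ => mul_le_mul_of_nonneg_left (hcard i) (by positivity))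
    refine h1.trans ?_
    rw [sum_const, card_univ, Fintype.card_fin, nsmul_eq_mul, le_div_iff₀ hL0]
    have hss : √Y * √Y = Y := Real.mul_self_sqrt hY0.le
    have h3 : 16 * √Y * L^7 ≤ Y := by
      calc 16 * √Y * L^7 ≤ L * √Y * L^7 := by gcongr; linarith
        _ = √Y * L^8 := by ring
        _ ≤ √Y * √Y := by gcongr
        _ = Y := hss
    have h2 : 16 * √Y * L^6 ≤ H := by
      rw [hHd, le_div_iff₀ hL0]
      linarith [h3]
    calc ((4:ℕ):ℝ) * (L^4 * ((4 * √Y * L) * H^2)) * L = (16 * √Y * L^6) * H^2 := by push_cast; ring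
      _ ≤ H * H^2 := by gcongr
      _ = H^3 := by ring
  linarith

end Cay

namespace Cay
open Finset ArithmeticFunction

lemma mem_win {c H : ℝ} (h : 0 ≤ c - H) (hH : 0 ≤ H) (n : ℕ) :
    n ∈ Ioc ⌊c - H⌋₊ ⌊c + H⌋₊ ↔ c - H < n ∧ (n:ℝ) ≤ c + H := by
  rw [mem_Ioc, Nat.floor_lt h, Nat.le_floor_iff (by linarith)]

lemma card_quarter {c H : ℝ} (h : 0 ≤ c) (hH : 8 ≤ H) : H / 8 ≤ ((Ioc ⌊c⌋₊ ⌊c + H/4⌋₊).card : ℝ) := by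
  rw [Nat.card_Ioc]
  have h1 : ⌊c⌋₊ ≤ ⌊c + H/4⌋₊ := Nat.floor_mono (by linarith)
  rw [Nat.cast_sub h1]
  have h2 := Nat.floor_le h
  have h3 := Nat.lt_floor_add_one (c + H/4)
  linarith

lemma abs_sgn_mul {s : ℤ} (hs : s = 1 ∨ s = -1) (x : ℝ) : |(s:ℝ) * x| = |x| := by
  rcases hs with h | h <;> rw [h] <;> simp

lemma card_sol_ge {s : Fin 4 → ℤ} (hs : ∀ i, s i = 1 ∨ s i = -1) {c : Fin 4 → ℝ} {H : ℝ} (hH : 8 ≤ H)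
    (hc : ∀ i, H ≤ c i) (hsum : ∑ i, (s i : ℝ) * c i = 0) :
    (H / 8)^3 ≤ ((sol s (fun i => Ioc ⌊c i - H⌋₊ ⌊c i + H⌋₊)).card : ℝ) := by
  classical
  set I : Fin 4 → Finset ℕ := fun i => Ioc ⌊c i⌋₊ ⌊c i + H/4⌋₊ with hI
  set T := I 0 ×ˢ I 1 ×ˢ I 2 with hT
  have hmI : ∀ i n, n ∈ I i → c i < n ∧ (n:ℝ) ≤ c i + H/4 := by
    intro i n hn
    rw [hI] at hn
    simp only [mem_Ioc] at hn
    rw [Nat.floor_lt (by linarith [hc i]), Nat.le_floor_iff (by linarith [hc i])] at hn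
    exact hn
  have hle : T.card ≤ (sol s (fun i => Ioc ⌊c i - H⌋₊ ⌊c i + H⌋₊)).card := by
    apply card_le_card_of_injOn (fun p => ![p.1, p.2.1, p.2.2, (-(s 3) * (s 0 * p.1 + s 1 * p.2.1 + s 2 * p.2.2)).toNat])
    · intro p hp
      rw [mem_coe, hT, mem_product, mem_product] at hp
      have h0 := hmI _ _ hp.1
      have h1 := hmI _ _ hp.2.1
      have h2 := hmI _ _ hp.2.2
      obtain ⟨n0, n1, n2⟩ := p
      dsimp only at h0 h1 h2 ⊢
      set v : ℤ := -(s 3) * (s 0 * n0 + s 1 * n1 + s 2 * n2) with hv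
      have s33 : s 3 * s 3 = 1 := by rcases hs 3 with h | h <;> rw [h] <;> norm_num
      have s33R : (s 3:ℝ) * s 3 = 1 := by exact_mod_cast s33
      rw [Fin.sum_univ_four] at hsum
      have hd : (v:ℝ) - c 3 = -(s 3) * (s 0 * (n0 - c 0) + s 1 * (n1 - c 1) + s 2 * (n2 - c 2)) := by
        rw [hv]; push_cast
        have : (s 3:ℝ) * ((s 0:ℝ) * c 0 + s 1 * c 1 + s 2 * c 2 + s 3 * c 3) = 0 := by rw [hsum, mul_zero]
        linear_combination -this + c 3 * s33R
      have hb : |(v:ℝ) - c 3| ≤ 3 * H / 4 := by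
        rw [hd, neg_mul, abs_neg, abs_sgn_mul (hs 3)]
        refine (abs_add_three _ _ _).trans ?_
        rw [abs_sgn_mul (hs 0), abs_sgn_mul (hs 1), abs_sgn_mul (hs 2)]
        rw [abs_of_nonneg (by linarith), abs_of_nonneg (by linarith), abs_of_nonneg (by linarith)]
        linarith
      have hb' := abs_le.1 hb
      have hv0 : 0 ≤ v := by
        have : (0:ℝ) ≤ v := by linarith [hc 3]
        exact_mod_cast this
      have hvt : ((v.toNat : ℕ):ℤ) = v := Int.toNat_of_nonneg hv0
      have hvtR : ((v.toNat : ℕ):ℝ) = v := by exact_mod_cast congrArg (fun z : ℤ => (z:ℝ)) hvt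
      rw [mem_coe, sol, mem_filter, Fintype.mem_piFinset]
      have hH0 : 0 ≤ H := by linarith
      refine ⟨fun i => ?_, ?_⟩
      · rw [mem_win (by linarith [hc i]) hH0]
        fin_cases i
        · exact ⟨by simp; linarith, by simp; linarith⟩
        · exact ⟨by simp; linarith, by simp; linarith⟩
        · exact ⟨by simp; linarith, by simp; linarith⟩
        · change c 3 - H < ((v.toNat : ℕ):ℝ) ∧ ((v.toNat : ℕ):ℝ) ≤ c 3 + H
          rw [hvtR]; exact ⟨by linarith, by linarith⟩
      · rw [Fin.sum_univ_four]
        change s 0 * (n0:ℤ) + s 1 * n1 + s 2 * n2 + s 3 * ((v.toNat : ℕ):ℤ) = 0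
        rw [hvt, hv]
        linear_combination (-(s 0 * (n0:ℤ) + s 1 * n1 + s 2 * n2)) * s33
    · rintro ⟨x, y, z⟩ - ⟨x', y', z'⟩ - h
      have h0 := congrFun h 0
      have h1 := congrFun h 1
      have h2 := congrFun h 2
      simp at h0 h1 h2
      rw [h0, h1, h2]
  have hTc : (H/8)^3 ≤ (T.card : ℝ) := by
    rw [hT, card_product, card_product]
    push_cast
    have q : ∀ i, H/8 ≤ ((I i).card : ℝ) := fun i => card_quarter (by linarith [hc i]) hH
    have hp : 0 ≤ H/8 := by linarith
    calc (H/8)^3 = (H/8) * ((H/8) * (H/8)) := by ring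
      _ ≤ _ := by
        apply mul_le_mul (q 0) _ (by positivity) (by positivity)
        exact mul_le_mul (q 1) (q 2) hp (by positivity)
  exact hTc.trans (by exact_mod_cast hle)

theorem prime_count {s : Fin 4 → ℤ} (hs : ∀ i, s i = 1 ∨ s i = -1) {l m : Fin 4 → ℝ} (hl : ∀ i, 0 < l i)
    (hsl : ∑ i, (s i : ℝ) * l i = 0) (hsm : ∑ i, (s i : ℝ) * m i = 0) (hm : ∀ i, |m i| ≤ 18) :
    ∀ᶠ X : ℝ in Filter.atTop, X^3 / (2^14 * (Real.log X)^7) ≤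
      (((sol s (fun i => Ioc ⌊X * l i + m i * (X / Real.log X) - X / Real.log X⌋₊
        ⌊X * l i + m i * (X / Real.log X) + X / Real.log X⌋₊)).filter (fun n => ∀ i, (n i).Prime)).card : ℝ) := by
  obtain ⟨κ, hκ, hκl⟩ : ∃ κ : ℝ, 100 ≤ κ ∧ ∀ i, l i + 19 ≤ κ := by
    refine ⟨100 + ∑ i, l i, ?_, fun i => ?_⟩
    · have := sum_nonneg (fun i (_ : i ∈ univ) => (hl i).le); linarith
    · have := single_le_sum (fun i (_ : i ∈ univ) => (hl i).le) (mem_univ i); linarith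
  obtain ⟨ε, hε, hεl⟩ : ∃ ε : ℝ, 0 < ε ∧ ∀ i, ε ≤ l i := by
    obtain ⟨i, -, hi⟩ := exists_min_image univ l univ_nonempty
    exact ⟨l i, hl i, fun j => hi j (mem_univ j)⟩
  have hev := (Filter.tendsto_id.const_mul_atTop (show (0:ℝ) < κ by linarith)).eventually primes_sol
  filter_upwards [hev, ev_log_ge 1, ev_log_ge (19/ε), ev_log_ge (98 * 1024 * κ^3), Filter.eventually_ge_atTop κ,
    ev_log_pow 2 (by norm_num : (0:ℝ) < 1), Filter.eventually_ge_atTop 64] with X hp hL1 hLε hLκ hXκ hlp hX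
  simp only [id] at hp
  rw [Real.rpow_one] at hlp
  set L := Real.log X with hLd
  have hL0 : 0 < L := by linarith
  have hX0 : 0 < X := by linarith
  set H := X / L with hHd
  have hH0 : 0 < H := by positivity
  have hXH : X = H * L := by rw [hHd]; field_simp
  have hH8 : 8 ≤ H := by
    by_cases h8 : L ≤ 8
    · rw [hHd, le_div_iff₀ hL0]; linarith
    · rw [hHd, le_div_iff₀ hL0]; push Not at h8; nlinarith
  have hHX : H ≤ X := div_le_self hX0.le hL1
  have hHε : 19 * H ≤ X * ε := by
    rw [div_le_iff₀ hε] at hLε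
    rw [hXH]; nlinarith
  have hmH : ∀ i, |m i * H| ≤ 18 * H := by
    intro i; rw [abs_mul, abs_of_pos hH0]; exact mul_le_mul_of_nonneg_right (hm i) hH0.le
  set c : Fin 4 → ℝ := fun i => X * l i + m i * H with hc
  have hcH : ∀ i, H ≤ c i := by
    intro i
    have h1 := (abs_le.1 (hmH i)).1
    have h2 := mul_le_mul_of_nonneg_left (hεl i) hX0.le
    simp only [hc]; linarith
  have hcs : ∑ i, (s i : ℝ) * c i = 0 := by
    have : ∀ i, (s i : ℝ) * c i = X * (s i * l i) + H * (s i * m i) := by intro i; simp only [hc]; ring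
    simp only [this]
    rw [sum_add_distrib, ← mul_sum, ← mul_sum, hsl, hsm]; ring
  have k1 := card_sol_ge hs hH8 hcH hcs
  set Y := κ * X with hY
  have hlY : Real.log Y = Real.log κ + L := by rw [hY, Real.log_mul (by linarith) (by linarith)]
  have hlκ0 : 0 ≤ Real.log κ := Real.log_nonneg (by linarith)
  have hlκ1 : Real.log κ ≤ L := Real.log_le_log (by linarith) hXκ
  set M := Real.log Y with hM
  have hML : L ≤ M := by linarith
  have hM2 : M ≤ 2 * L := by linarith
  have hM0 : 0 < M := by linarith
  have hYM1 : 50 * H ≤ Y / M := by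
    rw [le_div_iff₀ hM0]
    calc 50 * H * M ≤ 50 * H * (2 * L) := by gcongr
      _ = 100 * X := by rw [hXH]; ring
      _ ≤ Y := mul_le_mul_of_nonneg_right hκ hX0.le
  have hYM2 : Y / M ≤ κ * H := by
    rw [hHd, ← mul_div_assoc]
    exact div_le_div_of_nonneg_left (by positivity) hL0 hML
  have k2 := hp s hs (fun i => ⌊c i - H⌋₊) (fun i => ⌊c i + H⌋₊) (fun i => Nat.floor_mono (by linarith)) (by
    intro i
    refine (Nat.floor_le (by linarith [hcH i])).trans ?_
    have h1 := (abs_le.1 (hmH i)).2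
    have h2 := mul_le_mul_of_nonneg_right (hκl i) hX0.le
    simp only [hc]; nlinarith) (by
    intro i
    rw [Nat.cast_sub (Nat.floor_mono (by linarith))]
    have h2 := Nat.floor_le (show 0 ≤ c i + H by linarith [hcH i])
    have h3 := Nat.lt_floor_add_one (c i - H)
    linarith)
  set N : ℝ := (((sol s (fun i => Ioc ⌊c i - H⌋₊ ⌊c i + H⌋₊)).filter (fun n => ∀ i, (n i).Prime)).card : ℝ) with hN
  change X^3 / (2^14 * L^7) ≤ N
  have hN0 : 0 ≤ N := Nat.cast_nonneg _
  have k3 : 98 * ((Y/M)^3 / M) ≤ H^3 / 1024 := by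
    have hYM0 : 0 ≤ Y / M := by linarith
    have h1 : (Y/M)^3 / M ≤ (κ * H)^3 / L := by
      apply div_le_div₀ (by positivity) (pow_le_pow_left₀ hYM0 hYM2 3) hL0 hML
    have h2 : 98 * ((κ * H)^3 / L) ≤ H^3 / 1024 := by
      rw [← mul_div_assoc, div_le_div_iff₀ hL0 (by norm_num)]
      have := mul_le_mul_of_nonneg_left hLκ (show 0 ≤ H^3 by positivity)
      linarith [this]
    linarith
  have k4 : M^4 * N ≤ (2 * L)^4 * N :=
    mul_le_mul_of_nonneg_right (pow_le_pow_left₀ hM0.le hM2 4) hN0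
  have k5 : H^3 / 1024 ≤ 16 * L^4 * N := by
    have e1 : (H/8)^3 = H^3/512 := by ring
    have e2 : (2 * L)^4 * N = 16 * L^4 * N := by ring
    rw [e1] at k1
    rw [e2] at k4
    linarith
  rw [div_le_iff₀ (by positivity)]
  calc X^3 = (H * L)^3 := by rw [← hXH]
    _ = H^3 / 1024 * (1024 * L^3) := by ring
    _ ≤ 16 * L^4 * N * (1024 * L^3) := mul_le_mul_of_nonneg_right k5 (by positivity)
    _ = _ := by ring

end Cay

namespace Cay
open Finset ArithmeticFunction

def xm (y : Fin 4 → ℤ) : Fin 4 → ℤ := ![y 1 * y 2 * y 3, y 0 * y 2 * y 3, y 0 * y 1 * y 3, y 0 * y 1 * y 2]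

lemma xm0 (y : Fin 4 → ℤ) : xm y 0 = y 1 * y 2 * y 3 := rfl
lemma xm1 (y : Fin 4 → ℤ) : xm y 1 = y 0 * y 2 * y 3 := rfl
lemma xm2 (y : Fin 4 → ℤ) : xm y 2 = y 0 * y 1 * y 3 := rfl
lemma xm3 (y : Fin 4 → ℤ) : xm y 3 = y 0 * y 1 * y 2 := rfl

lemma xm_mul (y : Fin 4 → ℤ) (i : Fin 4) : xm y i * y i = y 0 * y 1 * y 2 * y 3 := by
  fin_cases i
  · change xm y 0 * y 0 = _
    rw [xm0]; ring
  · change xm y 1 * y 1 = _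
    rw [xm1]; ring
  · change xm y 2 * y 2 = _
    rw [xm2]; ring
  · change xm y 3 * y 3 = _
    rw [xm3]

lemma xm_prod (y : Fin 4 → ℤ) : xm y 0 * xm y 1 * xm y 2 * xm y 3 = (y 0 * y 1 * y 2 * y 3)^3 := by
  rw [xm0, xm1, xm2, xm3]; ring

lemma xm_surf {y : Fin 4 → ℤ} (h : y 0 + y 1 + y 2 + y 3 = 0) :
    xm y 1 * xm y 2 * xm y 3 + xm y 0 * xm y 2 * xm y 3 + xm y 0 * xm y 1 * xm y 3 + xm y 0 * xm y 1 * xm y 2 = 0 := by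
  rw [xm0, xm1, xm2, xm3]
  linear_combination (y 0 * y 1 * y 2 * y 3)^2 * h

lemma xm_inj {y y' : Fin 4 → ℤ} (h0 : y 0 * y 1 * y 2 * y 3 ≠ 0) (h : xm y = xm y') : y = y' := by
  have e1 := xm_prod y
  have e2 := xm_prod y'
  rw [← h, e1] at e2
  have e3 : y 0 * y 1 * y 2 * y 3 = y' 0 * y' 1 * y' 2 * y' 3 :=
    (Odd.strictMono_pow (by decide : Odd 3)).injective e2
  funext i
  have f1 := xm_mul y i
  have f2 := xm_mul y' i
  rw [← h, ← e3, ← f1] at f2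
  have : xm y i ≠ 0 := by
    intro hz
    rw [hz, zero_mul] at f1
    exact h0 f1.symm
  exact (mul_left_cancel₀ this f2).symm

lemma xm_add {y : Fin 4 → ℤ} (h0 : y 0 * y 1 * y 2 * y 3 ≠ 0) {i j : Fin 4}
    (h : y i + y j ≠ 0) : xm y i + xm y j ≠ 0 := by
  intro hz
  have f1 := xm_mul y i
  have f2 := xm_mul y j
  set P := y 0 * y 1 * y 2 * y 3 with hP
  have e : P * (y i + y j) = 0 := by
    have : P * (y i + y j) = (xm y i + xm y j) * (y i * y j) := by
      rw [mul_add]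
      linear_combination (-(y j)) * f1 - y i * f2
    rw [this, hz, zero_mul]
  rcases mul_eq_zero.1 e with h1 | h1
  · exact h0 h1
  · exact h h1

lemma natAbs_sgn {s : ℤ} (hs : s = 1 ∨ s = -1) (n : ℕ) : (s * (n:ℤ)).natAbs = n := by
  rcases hs with h | h <;> rw [h] <;> simp

lemma gcd_four {n : Fin 4 → ℕ} (hp : ∀ i, (n i).Prime) (hn : Function.Injective n) :
    Nat.gcd (Nat.gcd (n 1 * n 2 * n 3) (n 0 * n 2 * n 3)) (Nat.gcd (n 0 * n 1 * n 3) (n 0 * n 1 * n 2)) = 1 := by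
  rw [Nat.eq_one_iff_not_exists_prime_dvd]
  intro q hq hd
  have d0 := hd.trans ((Nat.gcd_dvd_left _ _).trans (Nat.gcd_dvd_left _ _))
  have d1 := hd.trans ((Nat.gcd_dvd_left _ _).trans (Nat.gcd_dvd_right _ _))
  have d2 := hd.trans ((Nat.gcd_dvd_right _ _).trans (Nat.gcd_dvd_left _ _))
  have d3 := hd.trans ((Nat.gcd_dvd_right _ _).trans (Nat.gcd_dvd_right _ _))
  simp only [hq.dvd_mul, Nat.prime_dvd_prime_iff_eq hq (hp _)] at d0 d1 d2 d3
  have n01 : n 0 ≠ n 1 := fun h => absurd (hn h) (by decide)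
  have n02 : n 0 ≠ n 2 := fun h => absurd (hn h) (by decide)
  have n03 : n 0 ≠ n 3 := fun h => absurd (hn h) (by decide)
  have n12 : n 1 ≠ n 2 := fun h => absurd (hn h) (by decide)
  have n13 : n 1 ≠ n 3 := fun h => absurd (hn h) (by decide)
  have n23 : n 2 ≠ n 3 := fun h => absurd (hn h) (by decide)
  omega

lemma omega_twelve {n : Fin 4 → ℕ} (hp : ∀ i, (n i).Prime) :
    ((n 0 * n 1 * n 2 * n 3)^3).primeFactorsList.length = 12 := by
  have h : ∀ i, n i ≠ 0 := fun i => (hp i).ne_zero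
  rw [← cardFactors_apply, cardFactors_pow, cardFactors_mul (by simp [h]) (h 3), cardFactors_mul (by simp [h]) (h 2),
    cardFactors_mul (h 0) (h 1)]
  simp [cardFactors_apply_prime (hp _)]

lemma xm_good {s : Fin 4 → ℤ} (hs : ∀ i, s i = 1 ∨ s i = -1) {n : Fin 4 → ℕ} (hp : ∀ i, (n i).Prime)
    (hn : Function.Injective n) (hsum : ∑ i, s i * (n i : ℤ) = 0) {x : Fin 4 → ℤ} (hx : x = xm (fun i => s i * (n i : ℤ))) :
    Int.gcd (Int.gcd (x 0) (x 1)) (Int.gcd (x 2) (x 3)) = 1 ∧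
          x 1 * x 2 * x 3 + x 0 * x 2 * x 3 + x 0 * x 1 * x 3 + x 0 * x 1 * x 2 = 0 ∧
          x 0 * x 1 * x 2 * x 3 ≠ 0 ∧
          (∀ i j, i ≠ j → x i + x j ≠ 0) ∧
          (x 0 * x 1 * x 2 * x 3).natAbs.primeFactorsList.length ≤ 12 := by
  set y : Fin 4 → ℤ := fun i => s i * (n i : ℤ) with hy
  have hya : ∀ i, (y i).natAbs = n i := fun i => natAbs_sgn (hs i) _
  have hy0 : ∀ i, y i ≠ 0 := by
    intro i h
    have := hya i
    rw [h] at this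
    exact (hp i).ne_zero this.symm
  have hP : y 0 * y 1 * y 2 * y 3 ≠ 0 := mul_ne_zero (mul_ne_zero (mul_ne_zero (hy0 0) (hy0 1)) (hy0 2)) (hy0 3)
  rw [hx]
  refine ⟨?_, ?_, ?_, ?_, ?_⟩
  · rw [xm0, xm1, xm2, xm3]
    simp only [Int.gcd, Int.natAbs_mul, hya, Int.natAbs_natCast]
    exact gcd_four hp hn
  · apply xm_surf
    rw [Fin.sum_univ_four] at hsum
    exact hsum
  · rw [xm_prod]; exact pow_ne_zero 3 hP
  · intro i j hij
    apply xm_add hP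
    intro h
    have h1 : (y i).natAbs = (y j).natAbs := by
      rw [Int.natAbs_eq_natAbs_iff]; right; linarith
    rw [hya, hya] at h1
    exact hij (hn h1)
  · rw [xm_prod, Int.natAbs_pow]
    simp only [Int.natAbs_mul, hya]
    exact (omega_twelve hp).le

lemma prod3_close {K δ : ℝ} {u0 u1 u2 v0 v1 v2 : ℝ} (hu1 : |u1| ≤ K) (hu2 : |u2| ≤ K)
    (hv0 : |v0| ≤ K) (hv1 : |v1| ≤ K) (h0 : |u0 - v0| ≤ δ) (h1 : |u1 - v1| ≤ δ) (h2 : |u2 - v2| ≤ δ) :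
    |u0 * u1 * u2 - v0 * v1 * v2| ≤ 3 * K^2 * δ := by
  have hK : 0 ≤ K := (abs_nonneg _).trans hu1
  have hδ : 0 ≤ δ := (abs_nonneg _).trans h0
  have e : u0 * u1 * u2 - v0 * v1 * v2 = (u0 - v0) * u1 * u2 + v0 * (u1 - v1) * u2 + v0 * v1 * (u2 - v2) := by ring
  rw [e]
  refine (abs_add_three _ _ _).trans ?_
  simp only [abs_mul]
  have a1 : |u0 - v0| * |u1| * |u2| ≤ δ * K * K := by gcongr
  have a2 : |v0| * |u1 - v1| * |u2| ≤ K * δ * K := by gcongr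
  have a3 : |v0| * |v1| * |u2 - v2| ≤ K * K * δ := by gcongr
  linarith

lemma exists_cbrt (P : ℝ) : ∃ t : ℝ, t^3 = P := by
  rcases le_total 0 P with h | h
  · exact ⟨P^((1:ℝ)/3), by rw [← Real.rpow_natCast, ← Real.rpow_mul h]; norm_num⟩
  · refine ⟨-((-P)^((1:ℝ)/3)), ?_⟩
    have : ((-P)^((1:ℝ)/3))^3 = -P := by
      rw [← Real.rpow_natCast, ← Real.rpow_mul (by linarith)]; norm_num
    rw [neg_pow, this]; ring

end Cay

namespace Cay
open Finset ArithmeticFunction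

def mu : Fin 4 → ℝ := ![3, 6, 9, -18]

lemma mu_sum : ∑ i, mu i = 0 := by
  rw [Fin.sum_univ_four]; simp [mu]; norm_num

lemma mu_abs (i : Fin 4) : |mu i| ≤ 18 := by
  rw [abs_le]
  fin_cases i <;> simp [mu] <;> norm_num

lemma mu_sep {i j : Fin 4} (h : i ≠ j) : 3 ≤ |mu i - mu j| := by
  rw [le_abs]
  fin_cases i <;> fin_cases j <;> first | exact absurd rfl h | (simp [mu]; done) | (simp [mu]; norm_num)

lemma win_bound {c H : ℝ} {n : ℕ} (h : n ∈ Ioc ⌊c - H⌋₊ ⌊c + H⌋₊) (h0 : 0 ≤ c - H) (hH : 0 ≤ H) : |(n:ℝ) - c| ≤ H := by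
  rw [mem_win h0 hH] at h
  rw [abs_le]; constructor <;> linarith

lemma exists_sgn {x : ℝ} (h : x ≠ 0) : ∃ s : ℤ, (s = 1 ∨ s = -1) ∧ (s:ℝ) * |x| = x := by
  rcases lt_or_gt_of_ne h with h | h
  · exact ⟨-1, Or.inr rfl, by rw [abs_of_neg h]; push_cast; ring⟩
  · exact ⟨1, Or.inl rfl, by rw [abs_of_pos h]; push_cast; ring⟩

lemma sgn_sq {s : ℤ} (hs : s = 1 ∨ s = -1) : (s:ℝ) * s = 1 := by
  rcases hs with h | h <;> rw [h] <;> norm_num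

lemma div3 (a b c X : ℝ) : a * b * c / X^3 = a / X * (b / X) * (c / X) := by
  rw [div_mul_div_comm, div_mul_div_comm]; congr 1; ring

set_option maxHeartbeats 1000000 in
theorem final (ξ : Fin 4 → ℝ)
    (hsurf : ξ 1 * ξ 2 * ξ 3 + ξ 0 * ξ 2 * ξ 3 + ξ 0 * ξ 1 * ξ 3 + ξ 0 * ξ 1 * ξ 2 = 0)
    (hnz : ξ 0 * ξ 1 * ξ 2 * ξ 3 ≠ 0)
    (hln : ∀ i j, i ≠ j → ξ i + ξ j ≠ 0) :
    ∃ C : ℝ, 0 < C ∧ ∃ c : ℝ, 0 < c ∧ ∃ B₀ : ℝ, ∀ B : ℝ, B₀ ≤ B →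
      c * B / (Real.log B) ^ 7 ≤
        (Set.ncard {x : Fin 4 → ℤ |
          Int.gcd (Int.gcd (x 0) (x 1)) (Int.gcd (x 2) (x 3)) = 1 ∧
          x 1 * x 2 * x 3 + x 0 * x 2 * x 3 + x 0 * x 1 * x 3 + x 0 * x 1 * x 2 = 0 ∧
          x 0 * x 1 * x 2 * x 3 ≠ 0 ∧
          (∀ i j, i ≠ j → x i + x j ≠ 0) ∧
          (∀ i, |(x i : ℝ) / B - ξ i| ≤ C / Real.log B) ∧
          (x 0 * x 1 * x 2 * x 3).natAbs.primeFactorsList.length ≤ 12} : ℝ) := by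
  have hξ : ∀ i, ξ i ≠ 0 := by
    intro i h
    apply hnz
    fin_cases i <;> simp at h <;> simp [h]
  obtain ⟨t, ht⟩ := exists_cbrt (ξ 0 * ξ 1 * ξ 2 * ξ 3)
  have ht0 : t ≠ 0 := by
    rintro rfl
    apply hnz; rw [← ht]; norm_num
  set lam : Fin 4 → ℝ := fun i => t / ξ i with hlam
  have hlam0 : ∀ i, lam i ≠ 0 := fun i => div_ne_zero ht0 (hξ i)
  have h0 := hξ 0
  have h1 := hξ 1
  have h2 := hξ 2
  have h3 := hξ 3
  have hlsum : ∑ i, lam i = 0 := by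
    rw [Fin.sum_univ_four]
    simp only [hlam]
    have : t / ξ 0 + t / ξ 1 + t / ξ 2 + t / ξ 3 = t * (ξ 1 * ξ 2 * ξ 3 + ξ 0 * ξ 2 * ξ 3 + ξ 0 * ξ 1 * ξ 3 + ξ 0 * ξ 1 * ξ 2) / (ξ 0 * ξ 1 * ξ 2 * ξ 3) := by
      field_simp
    rw [this, hsurf]; simp
  have hladd : ∀ i j, i ≠ j → lam i + lam j ≠ 0 := by
    intro i j hij h
    simp only [hlam] at h
    have hi := hξ i
    have hj := hξ j
    field_simp at h
    rw [mul_zero] at h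
    rcases mul_eq_zero.1 h with h | h
    · exact ht0 h
    · exact hln i j hij (by linarith)
  have p0 : lam 1 * lam 2 * lam 3 = ξ 0 := by
    simp only [hlam]; field_simp; rw [ht]; ring
  have p1 : lam 0 * lam 2 * lam 3 = ξ 1 := by
    simp only [hlam]; field_simp; rw [ht]; ring
  have p2 : lam 0 * lam 1 * lam 3 = ξ 2 := by
    simp only [hlam]; field_simp; rw [ht]; ring
  have p3 : lam 0 * lam 1 * lam 2 = ξ 3 := by
    simp only [hlam]; field_simp; rw [ht]
  clear_value lam
  choose s hs hsl using fun i => exists_sgn (hlam0 i)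
  set l : Fin 4 → ℝ := fun i => |lam i| with hl
  set m : Fin 4 → ℝ := fun i => s i * mu i with hm
  have hl0 : ∀ i, 0 < l i := fun i => abs_pos.2 (hlam0 i)
  have hsm : ∀ i, (s i : ℝ) * m i = mu i := by
    intro i; simp only [hm]; rw [← mul_assoc, sgn_sq (hs i), one_mul]
  have hmabs : ∀ i, |m i| ≤ 18 := by
    intro i; simp only [hm]; rw [abs_sgn_mul (hs i)]; exact mu_abs i
  have hcount := prime_count hs hl0 (by simp only [hl, hsl]; exact hlsum) (by simp only [hsm]; exact mu_sum) hmabs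
  obtain ⟨K, hK19, hK⟩ : ∃ K : ℝ, 19 ≤ K ∧ ∀ i, |lam i| + 19 ≤ K := by
    refine ⟨19 + ∑ i, l i, ?_, fun i => ?_⟩
    · have := sum_nonneg (fun i (_ : i ∈ univ) => (hl0 i).le); linarith
    · have := single_le_sum (fun i (_ : i ∈ univ) => (hl0 i).le) (mem_univ i); linarith
  have hsep : ∀ᶠ X : ℝ in Filter.atTop, ∀ i j, 40 / |l i - l j| ≤ Real.log X :=
    Filter.eventually_all.2 fun i => Filter.eventually_all.2 fun j => ev_log_ge _
  have hbig : ∀ᶠ X : ℝ in Filter.atTop, ∀ i, 20 / l i ≤ Real.log X :=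
    Filter.eventually_all.2 fun i => ev_log_ge _
  set C : ℝ := 3 * K^2 * 57 with hC
  have hX := (tendsto_rpow_atTop (show (0:ℝ) < 1/3 by norm_num)).eventually
    (hcount.and (hsep.and (hbig.and ((ev_log_ge 1).and (Filter.eventually_ge_atTop 1)))))
  obtain ⟨B₁, hB₁⟩ := Filter.eventually_atTop.1 hX
  refine ⟨C, by positivity, 3^7 / 2^14, by positivity, max B₁ 1, fun B hB => ?_⟩
  obtain ⟨k1, k2, k3, hL1, hX1⟩ := hB₁ B (le_trans (le_max_left _ _) hB)
  have hB1 : 1 ≤ B := le_trans (le_max_right _ _) hB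
  have hB0 : 0 < B := by linarith
  have hX3 : (B^((1:ℝ)/3))^3 = B := by
    rw [← Real.rpow_natCast, ← Real.rpow_mul hB0.le]; norm_num
  have hlogX : Real.log (B^((1:ℝ)/3)) = Real.log B / 3 := by
    rw [Real.log_rpow hB0]; ring
  set X := B^((1:ℝ)/3) with hXd
  clear_value X
  set L := Real.log X with hL
  clear_value L
  have hlogB : Real.log B = 3 * L := by linarith
  rw [hlogB]
  have hL0 : 0 < L := by linarith
  have hX0 : 0 < X := by linarith
  set H := X / L with hH
  have hH0 : 0 < H := by positivity
  have hXH : X = H * L := by rw [hH]; field_simp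
  clear_value H
  have hwin0 : ∀ i, 0 ≤ X * l i + m i * H - H := by
    intro i
    have a1 := k3 i
    rw [div_le_iff₀ (hl0 i)] at a1
    have a2 := (abs_le.1 (hmabs i)).1
    have a3 : 20 * H ≤ X * l i := by
      rw [hXH]
      calc 20 * H ≤ (L * l i) * H := mul_le_mul_of_nonneg_right a1 hH0.le
        _ = _ := by ring
    nlinarith
  set S : Finset (Fin 4 → ℕ) := (sol s (fun i => Ioc ⌊X * l i + m i * H - H⌋₊
        ⌊X * l i + m i * H + H⌋₊)).filter (fun n => ∀ i, (n i).Prime) with hS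
  set F : (Fin 4 → ℕ) → (Fin 4 → ℤ) := fun n => xm (fun i => s i * (n i : ℤ)) with hF
  have hSmem : ∀ n ∈ S, (∀ i, |(n i:ℝ) - (X * l i + m i * H)| ≤ H) ∧ (∀ i, (n i).Prime) ∧ ∑ i, s i * (n i : ℤ) = 0 := by
    intro n hn
    rw [hS, mem_filter, sol, mem_filter, Fintype.mem_piFinset] at hn
    exact ⟨fun i => win_bound (hn.1.1 i) (hwin0 i) hH0.le, hn.2, hn.1.2⟩
  have hSinj : ∀ n ∈ S, Function.Injective n := by
    intro n hn i j hij
    by_contra hne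
    obtain ⟨hw, -, -⟩ := hSmem n hn
    have a1 := abs_le.1 (hw i)
    have a2 := abs_le.1 (hw j)
    rw [hij] at a1
    have a3 : |X * (l i - l j) + (m i - m j) * H| ≤ 2 * H := by
      rw [abs_le]; constructor <;> linarith
    by_cases hll : l i = l j
    · have e1 : lam i = lam j := by
        rcases abs_eq_abs.1 hll with h | h
        · exact h
        · exact absurd (by linarith) (hladd i j hne)
      have e2 : (s i : ℝ) = s j := by
        have b1 := hsl i
        have b2 := hsl j
        rw [← e1] at b2
        have b3 : (s i : ℝ) * |lam i| = s j * |lam i| := by linarith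
        exact mul_right_cancel₀ (hl0 i).ne' b3
      have e3 : X * (l i - l j) + (m i - m j) * H = s i * ((mu i - mu j) * H) := by
        rw [hll]; simp only [hm]; rw [e2]; ring
      rw [e3, abs_sgn_mul (hs i), abs_mul, abs_of_pos hH0] at a3
      have := mul_le_mul_of_nonneg_right (mu_sep hne) hH0.le
      linarith
    · have hd : 0 < |l i - l j| := abs_pos.2 (sub_ne_zero.2 hll)
      have b1 := k2 i j
      rw [div_le_iff₀ hd] at b1
      have b2 : 40 * H ≤ |X * (l i - l j)| := by
        rw [abs_mul, abs_of_pos hX0, hXH]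
        calc 40 * H ≤ (L * |l i - l j|) * H := mul_le_mul_of_nonneg_right b1 hH0.le
          _ = _ := by ring
      have b3 : |(m i - m j) * H| ≤ 36 * H := by
        rw [abs_mul, abs_of_pos hH0]
        apply mul_le_mul_of_nonneg_right _ hH0.le
        have c1 := abs_le.1 (hmabs i)
        have c2 := abs_le.1 (hmabs j)
        rw [abs_le]; constructor <;> linarith
      have b4 : |X * (l i - l j)| ≤ |X * (l i - l j) + (m i - m j) * H| + |(m i - m j) * H| := by
        have := abs_sub (X * (l i - l j) + (m i - m j) * H) ((m i - m j) * H)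
        rwa [add_sub_cancel_right] at this
      linarith
  have hclose : ∀ n ∈ S, ∀ i, |((F n i : ℤ) : ℝ) / B - ξ i| ≤ C / (3 * L) := by
    intro n hn
    obtain ⟨hw, -, -⟩ := hSmem n hn
    have hd : ∀ i, |((s i : ℝ) * n i) / X - lam i| ≤ 19 / L := by
      intro i
      have a1 : ((s i : ℝ) * n i) / X - lam i = (s i * ((n i - (X * l i + m i * H)) + m i * H)) / X := by
        have : (s i:ℝ) * l i = lam i := hsl i
        rw [← this]; field_simp; ring
      rw [a1, abs_div, abs_sgn_mul (hs i), abs_of_pos hX0, div_le_div_iff₀ hX0 hL0]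
      have a2 : |((n i:ℝ) - (X * l i + m i * H)) + m i * H| ≤ 19 * H := by
        refine (abs_add_le _ _).trans ?_
        have a3 : |m i * H| ≤ 18 * H := by
          rw [abs_mul, abs_of_pos hH0]; exact mul_le_mul_of_nonneg_right (hmabs i) hH0.le
        linarith [hw i]
      calc _ ≤ 19 * H * L := mul_le_mul_of_nonneg_right a2 hL0.le
        _ = 19 * X := by rw [hXH]; ring
    set u : Fin 4 → ℝ := fun i => ((s i : ℝ) * n i) / X with hu
    have hlK : ∀ i, |lam i| ≤ K := fun i => by linarith [hK i]
    have huK : ∀ i, |u i| ≤ K := by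
      intro i
      have b1 := abs_add_le (u i - lam i) (lam i)
      rw [sub_add_cancel] at b1
      have b2 : 19 / L ≤ 19 := div_le_self (by norm_num) hL1
      linarith [hd i, hK i]
    have hCL : C / (3 * L) = 3 * K^2 * (19 / L) := by rw [hC]; field_simp; norm_num
    have pc : ∀ i j k, |u i * u j * u k - lam i * lam j * lam k| ≤ C / (3 * L) := by
      intro i j k
      rw [hCL]
      exact prod3_close (huK j) (huK k) (hlK i) (hlK j) (hd i) (hd j) (hd k)
    intro i
    rw [← hX3]
    fin_cases i
    · change |((F n 0 : ℤ) : ℝ) / X^3 - ξ 0| ≤ _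
      have := pc 1 2 3
      rw [p0] at this
      convert this using 3
      simp only [hF, xm0, hu]; push_cast; exact div3 _ _ _ _
    · change |((F n 1 : ℤ) : ℝ) / X^3 - ξ 1| ≤ _
      have := pc 0 2 3
      rw [p1] at this
      convert this using 3
      simp only [hF, xm1, hu]; push_cast; exact div3 _ _ _ _
    · change |((F n 2 : ℤ) : ℝ) / X^3 - ξ 2| ≤ _
      have := pc 0 1 3
      rw [p2] at this
      convert this using 3
      simp only [hF, xm2, hu]; push_cast; exact div3 _ _ _ _
    · change |((F n 3 : ℤ) : ℝ) / X^3 - ξ 3| ≤ _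
      have := pc 0 1 2
      rw [p3] at this
      convert this using 3
      simp only [hF, xm3, hu]; push_cast; exact div3 _ _ _ _
  have hFinj : Set.InjOn F (S : Set (Fin 4 → ℕ)) := by
    intro n hn n' hn' h
    rw [mem_coe] at hn hn'
    obtain ⟨-, hp, -⟩ := hSmem n hn
    have hy0 : ∀ i, s i * (n i : ℤ) ≠ 0 := by
      intro i
      apply mul_ne_zero
      · rcases hs i with h | h <;> rw [h] <;> norm_num
      · exact_mod_cast (hp i).ne_zero
    have := xm_inj (mul_ne_zero (mul_ne_zero (mul_ne_zero (hy0 0) (hy0 1)) (hy0 2)) (hy0 3)) h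
    funext i
    have e := congrArg Int.natAbs (congrFun this i)
    rwa [natAbs_sgn (hs i), natAbs_sgn (hs i)] at e
  set A := {x : Fin 4 → ℤ |
          Int.gcd (Int.gcd (x 0) (x 1)) (Int.gcd (x 2) (x 3)) = 1 ∧
          x 1 * x 2 * x 3 + x 0 * x 2 * x 3 + x 0 * x 1 * x 3 + x 0 * x 1 * x 2 = 0 ∧
          x 0 * x 1 * x 2 * x 3 ≠ 0 ∧
          (∀ i j, i ≠ j → x i + x j ≠ 0) ∧
          (∀ i, |(x i : ℝ) / B - ξ i| ≤ C / (3 * L)) ∧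
          (x 0 * x 1 * x 2 * x 3).natAbs.primeFactorsList.length ≤ 12} with hA
  have hfin : A.Finite := by
    apply Set.Finite.subset (Set.finite_Icc (fun i : Fin 4 => ⌊B * (ξ i - C / (3 * L))⌋) (fun i : Fin 4 => ⌈B * (ξ i + C / (3 * L))⌉))
    intro x hx
    obtain ⟨-, -, -, -, hx, -⟩ := hx
    rw [Set.mem_Icc]
    refine ⟨fun i => ?_, fun i => ?_⟩
    · have a := (abs_le.1 (hx i)).1
      have b : ξ i - C / (3 * L) ≤ (x i : ℝ) / B := by linarith
      rw [le_div_iff₀ hB0] at b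
      have c : ((⌊B * (ξ i - C / (3 * L))⌋ : ℤ) : ℝ) ≤ x i := (Int.floor_le _).trans (by linarith)
      exact_mod_cast c
    · have a := (abs_le.1 (hx i)).2
      have b : (x i : ℝ) / B ≤ ξ i + C / (3 * L) := by linarith
      rw [div_le_iff₀ hB0] at b
      have c : (x i : ℝ) ≤ ((⌈B * (ξ i + C / (3 * L))⌉ : ℤ) : ℝ) := le_trans (by linarith) (Int.le_ceil _)
      exact_mod_cast c
  have hsub : F '' (S : Set (Fin 4 → ℕ)) ⊆ A := by
    rintro x ⟨n, hn, rfl⟩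
    rw [mem_coe] at hn
    obtain ⟨-, hp, hsum⟩ := hSmem n hn
    obtain ⟨g1, g2, g3, g4, g5⟩ := xm_good hs hp (hSinj n hn) hsum (x := F n) rfl
    exact ⟨g1, g2, g3, g4, hclose n hn, g5⟩
  have hcard : S.card ≤ A.ncard := by
    rw [← Set.ncard_coe_finset, ← hFinj.ncard_image]
    exact Set.ncard_le_ncard hsub hfin
  have hcardR : (S.card : ℝ) ≤ (A.ncard : ℝ) := by exact_mod_cast hcard
  refine le_trans (le_trans (le_of_eq ?_) k1) hcardR
  rw [hX3]; field_simp

end Cay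

/-- The main Theorem: saturation number of Cayley's cubic surface is at most 12.
Given a real point `ξ` on the open subset `U₀` of Cayley's cubic surface, the number of
primitive integral points on `U₀` close to `B • ξ` whose coordinate product has at most
12 prime factors (with multiplicity) is `≫ B (log B)⁻⁷`. -/
theorem cayley_saturation_twelve
    (ξ : Fin 4 → ℝ)
    (hsurf : ξ 1 * ξ 2 * ξ 3 + ξ 0 * ξ 2 * ξ 3 + ξ 0 * ξ 1 * ξ 3 + ξ 0 * ξ 1 * ξ 2 = 0)
    (hnz : ξ 0 * ξ 1 * ξ 2 * ξ 3 ≠ 0)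
    (hln : ∀ i j, i ≠ j → ξ i + ξ j ≠ 0) :
    ∃ C : ℝ, 0 < C ∧ ∃ c : ℝ, 0 < c ∧ ∃ B₀ : ℝ, ∀ B : ℝ, B₀ ≤ B →
      c * B / (Real.log B) ^ 7 ≤
        (Set.ncard {x : Fin 4 → ℤ |
          Int.gcd (Int.gcd (x 0) (x 1)) (Int.gcd (x 2) (x 3)) = 1 ∧
          x 1 * x 2 * x 3 + x 0 * x 2 * x 3 + x 0 * x 1 * x 3 + x 0 * x 1 * x 2 = 0 ∧
          x 0 * x 1 * x 2 * x 3 ≠ 0 ∧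
          (∀ i j, i ≠ j → x i + x j ≠ 0) ∧
          (∀ i, |(x i : ℝ) / B - ξ i| ≤ C / Real.log B) ∧
          (x 0 * x 1 * x 2 * x 3).natAbs.primeFactorsList.length ≤ 12} : ℝ) := by
  exact Cay.final ξ hsurf hnz hln
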